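/- Let k be a number field and let k_v be the completion of k at a nonarchimedean place v. For any k-definable subset A of k_v^n, the intersection A ∩ k^n is diophantine over k. -/

import Mathlib

/-- A subset `A ⊆ k^n` is diophantine over `k` if there exist `m ∈ ℕ` and finitely many
polynomials `f₁, …, f_r ∈ k[x₁, …, x_{n+m}]` such that
`A = {a ∈ k^n : ∃ b ∈ k^m, f_i(a,b) = 0 for all i}`. -/
def IsDiophantine (k : Type*) [Field k] {n : ℕ} (A : Set (Fin n → k)) : Prop :=
  ∃ (m r : ℕ) (f : Fin r → MvPolynomial (Fin (n + m)) k),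
    A = {a : Fin n → k | ∃ b : Fin m → k,
      ∀ i : Fin r, MvPolynomial.eval (Fin.append a b) (f i) = 0}

/-- A subset of `k` is diophantine if the corresponding subset of `k¹` is. -/
def IsDiophantineSet (k : Type*) [Field k] (A : Set k) : Prop :=
  IsDiophantine k {x : Fin 1 → k | x 0 ∈ A}

open FirstOrder IsDedekindDomain

section

open Polynomial

/-- A field with a valuation that behaves like a `p`-adic field with a dense subfield `k`. -/
structure PadicLike (k : Type*) {U Γ : Type*} [Field k] [Field U] [Algebra k U]
    [LinearOrderedCommGroupWithZero Γ] (V : Valuation U Γ) (π : k) : Prop where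
  charZero : CharZero k
  pi_ne : π ≠ 0
  pi_lt : V (algebraMap k U π) < 1
  hensel : ∀ φ : U[X], (∀ i, V (φ.coeff i) ≤ 1) → V (φ.coeff 1) = 1 → V (φ.coeff 0) < 1 →
    ∃ s, φ.eval s = 0 ∧ V s ≤ V (φ.coeff 0)
  power_reps : ∀ N : ℕ, 0 < N → ∃ S : Finset k, (∀ κ ∈ S, κ ≠ 0) ∧
    ∀ x : U, x ≠ 0 → ∃ κ ∈ S, ∃ y : U, x = algebraMap k U κ * y ^ N
  residue_reps : ∀ M : ℕ, ∃ S : Finset k, ∀ x : U, V x ≤ 1 →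
    ∃ κ ∈ S, V (x - algebraMap k U κ) ≤ V (algebraMap k U π) ^ M
  discrete : ∀ x : U, V x < 1 → V x ≤ V (algebraMap k U π)
  val_k : ∀ κ : k, κ ≠ 0 → ∃ n : ℤ, V (algebraMap k U κ) = V (algebraMap k U π) ^ n

lemma mul_max_of_zero_le {Γ : Type*} [LinearOrderedCommGroupWithZero Γ] (a b c : Γ) :
    a * max b c = max (a * b) (a * c) := by
  rcases le_total b c with h | h
  · rw [max_eq_right h, max_eq_right (by gcongr)]
  · rw [max_eq_left h, max_eq_left (by gcongr)]
/-- The idempotent semiring with addition `max`; it makes `ring` available for monomials. -/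
@[reducible] def maxSemiring (Γ : Type*) [LinearOrderedCommGroupWithZero Γ] : CommSemiring Γ :=
  { (inferInstance : CommMonoidWithZero Γ) with
    add := max
    add_assoc := max_assoc
    add_comm := max_comm
    zero_add := fun a => max_eq_right zero_le
    add_zero := fun a => max_eq_left zero_le
    nsmul := fun n x => if n = 0 then 0 else x
    left_distrib := fun a b c => mul_max_of_zero_le a b c
    right_distrib := fun a b c => by
      rw [mul_comm, mul_comm a, mul_comm b]; exact mul_max_of_zero_le c a b
    nsmul_zero := fun _ => if_pos rfl
    nsmul_succ := fun n x => by
      change (if n + 1 = 0 then 0 else x) = max (if n = 0 then 0 else x) x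
      rw [if_neg n.succ_ne_zero]
      split_ifs
      · exact (max_eq_right (zero_le (a := x))).symm
      · exact (max_self x).symm }

/-- Being an `N`-th power. -/
def IsPw {U : Type*} [Monoid U] (N : ℕ) (x : U) : Prop := ∃ y, y ^ N = x

section recenter

variable {U Γ : Type*} [Field U] [LinearOrderedCommGroupWithZero Γ] (V : Valuation U Γ)

lemma Valuation.map_natCast_le_one' (n : ℕ) : V (n : U) ≤ 1 := by
  induction n with
  | zero => simp
  | succ n ih =>
    push_cast
    exact (V.map_add _ _).trans (max_le ih (by simp))

lemma taylor_coeff_eq_sum (f : U[X]) (r : U) (n : ℕ) :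
    (taylor r f).coeff n = ∑ i ∈ f.support, (i.choose n : U) * f.coeff i * r ^ (i - n) := by
  rw [taylor_coeff, hasseDeriv_apply, Polynomial.sum_def, eval_finsetSum]
  simp

lemma recenter (g : U[X]) (a b y : U) (j₀ : ℕ) (B : Γ) (hab : V (b - a) ≤ V y)
    (h : ∀ i, j₀ ≤ i → V ((taylor a g).coeff i) * V y ^ i ≤ B) (j : ℕ) (hj : j₀ ≤ j) :
    V ((taylor b g).coeff j) * V y ^ j ≤ B := by
  have : taylor b g = taylor (b - a) (taylor a g) := by
    rw [taylor_taylor]; congr 1; ring_nf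
  rw [this, taylor_coeff_eq_sum]
  rw [← map_pow, ← map_mul, Finset.sum_mul]
  refine V.map_sum_le fun i _ => ?_
  rcases lt_or_ge i j with hij | hij
  · simp [Nat.choose_eq_zero_of_lt hij]
  refine le_trans ?_ (h i (hj.trans hij))
  rw [map_mul, map_mul, map_mul, map_pow, map_pow]
  calc _ ≤ 1 * V ((taylor a g).coeff i) * V y ^ (i - j) * V y ^ j := by
        gcongr
        exact V.map_natCast_le_one' _
    _ = _ := by rw [one_mul, mul_assoc, ← pow_add, Nat.sub_add_cancel hij]

lemma eval_eq_sum_taylor (g : U[X]) (c t : U) :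
    g.eval t = ∑ j ∈ (taylor c g).support, (taylor c g).coeff j * (t - c) ^ j := by
  conv_lhs => rw [← sub_add_cancel t c, ← taylor_eval]
  rw [eval_eq_sum, Polynomial.sum_def]

/-- A bound on all higher Taylor terms bounds `g(t) - g(c)`. -/
lemma eval_sub_le (g : U[X]) (c t : U) (B : Γ)
    (h : ∀ j, 1 ≤ j → V ((taylor c g).coeff j) * V (t - c) ^ j ≤ B) :
    V (g.eval t - g.eval c) ≤ B := by
  have h0 : g.eval t - g.eval c
      = ∑ j ∈ (taylor c g).support.erase 0, (taylor c g).coeff j * (t - c) ^ j := by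
    rw [eval_eq_sum_taylor g c t]
    by_cases h0 : 0 ∈ (taylor c g).support
    · rw [← Finset.add_sum_erase _ _ h0]; simp
    · rw [Finset.erase_eq_of_notMem h0]
      have : g.eval c = 0 := by simpa using h0
      simp [this]
  rw [h0]
  refine V.map_sum_le fun i hi => ?_
  rw [map_mul, map_pow]
  exact h i (Nat.one_le_iff_ne_zero.2 (Finset.ne_of_mem_erase hi))

lemma taylor_derivative_coeff (g : U[X]) (c : U) (j : ℕ) :
    (taylor c (derivative g)).coeff j = ((j + 1 : ℕ) : U) * (taylor c g).coeff (j + 1) := by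
  have : taylor c (derivative g) = derivative (taylor c g) := by
    simp [taylor_apply, derivative_comp]
  rw [this, coeff_derivative]; push_cast; ring

/-- Hensel's lemma after rescaling. -/
lemma hensel_scaled (hh : ∀ φ : U[X], (∀ i, V (φ.coeff i) ≤ 1) → V (φ.coeff 1) = 1 →
    V (φ.coeff 0) < 1 → ∃ s, φ.eval s = 0 ∧ V s ≤ V (φ.coeff 0))
    (g : U[X]) (t y : U) (hy : (taylor t g).coeff 1 * y ≠ 0)
    (h1 : ∀ j, 2 ≤ j → V ((taylor t g).coeff j) * V y ^ j ≤ V ((taylor t g).coeff 1) * V y)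
    (h0 : V (g.eval t) < V ((taylor t g).coeff 1) * V y) :
    ∃ θ, g.eval θ = 0 ∧ V (θ - t) * V ((taylor t g).coeff 1) ≤ V (g.eval t) := by
  set d := (taylor t g).coeff 1 * y with hd
  have hVd : 0 < V d := by rwa [Valuation.pos_iff]
  have hy0 : y ≠ 0 := right_ne_zero_of_mul hy
  have hc : ∀ i, ((C d⁻¹ * (taylor t g).comp (C y * X))).coeff i
      = d⁻¹ * ((taylor t g).coeff i * y ^ i) := by
    intro i; rw [coeff_C_mul, comp_C_mul_X_coeff]
  obtain ⟨s, hs, hs'⟩ := hh (C d⁻¹ * (taylor t g).comp (C y * X)) (by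
      intro i
      rw [hc, map_mul, map_inv₀, inv_mul_le_iff₀ hVd, mul_one, map_mul, map_pow, hd, map_mul]
      rcases i with _ | _ | i
      · simpa using h0.le
      · simp
      · exact h1 _ (by omega)) (by
      rw [hc, pow_one, ← hd, inv_mul_cancel₀ hy, map_one]) (by
      rw [hc, map_mul, map_inv₀, inv_mul_lt_iff₀ hVd, mul_one, hd, map_mul]
      simpa using h0)
  refine ⟨y * s + t, ?_, ?_⟩
  · have : d⁻¹ ≠ 0 := inv_ne_zero hy
    simpa [eval_comp, taylor_eval, this] using hs
  · rw [hc, map_mul, map_inv₀, le_inv_mul_iff₀ hVd, hd, map_mul] at hs'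
    rw [add_sub_cancel_right, map_mul]
    calc _ = V ((taylor t g).coeff 1) * V y * V s := by let := maxSemiring Γ; ring
      _ ≤ _ := by simpa using hs'

end recenter

namespace PadicLike

variable {k U Γ : Type*} [Field k] [Field U] [Algebra k U]
    [LinearOrderedCommGroupWithZero Γ] {V : Valuation U Γ} {π : k} (H : PadicLike k V π)

include H

lemma pi_ne' : algebraMap k U π ≠ 0 := by simpa using H.pi_ne

lemma pos : 0 < V (algebraMap k U π) := by
  rw [Valuation.pos_iff]; exact H.pi_ne'

lemma ppos (m : ℕ) : 0 < V (algebraMap k U π) ^ m := pow_pos H.pos m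

lemma pow_le_one (m : ℕ) : V (algebraMap k U π) ^ m ≤ 1 := pow_le_one₀ zero_le H.pi_lt.le

lemma pow_anti {m n : ℕ} (h : m ≤ n) :
    V (algebraMap k U π) ^ n ≤ V (algebraMap k U π) ^ m :=
  pow_le_pow_of_le_one zero_le H.pi_lt.le h

lemma nat_val (n : ℕ) (hn : n ≠ 0) : ∃ m : ℕ, V (algebraMap k U π) ^ m ≤ V (n : U) := by
  have := H.charZero
  obtain ⟨z, hz⟩ := H.val_k n (by exact_mod_cast hn)
  refine ⟨z.toNat, ?_⟩
  rw [map_natCast] at hz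
  rw [hz, ← zpow_natCast]
  exact zpow_le_zpow_right_of_le_one₀ H.pos H.pi_lt.le (Int.self_le_toNat z)

lemma nat_val_unif (d : ℕ) : ∃ m : ℕ, ∀ n, n ≠ 0 → n ≤ d →
    V (algebraMap k U π) ^ m ≤ V (n : U) := by
  induction d with
  | zero => exact ⟨0, fun n h h' => absurd (Nat.le_zero.1 h') h⟩
  | succ d ih =>
    obtain ⟨m, hm⟩ := ih
    obtain ⟨m', hm'⟩ := H.nat_val (d + 1) (by omega)
    refine ⟨max m m', fun n hn hnd => ?_⟩
    rcases Nat.lt_or_ge d n with h | h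
    · obtain rfl : n = d + 1 := by omega
      exact (H.pow_anti (le_max_right _ _)).trans hm'
    · exact (H.pow_anti (le_max_left _ _)).trans (hm n hn h)

/-- Discreteness, iterated. -/
lemma exists_pow_eq (x : U) (h : V x ≤ 1) (M : ℕ) (hM : V (algebraMap k U π) ^ M < V x) :
    ∃ s : ℕ, V x = V (algebraMap k U π) ^ s := by
  induction M generalizing x with
  | zero => exact absurd hM (by simpa using h)
  | succ M ih =>
    rcases h.eq_or_lt with h | h
    · exact ⟨0, by simpa using h⟩
    have h1 := H.discrete x h
    have h2 : V (x / algebraMap k U π) ≤ 1 := by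
      rw [map_div₀]; exact div_le_one_of_le₀ h1 zero_le
    obtain ⟨s, hs⟩ := ih _ h2 (by
      rw [map_div₀, lt_div_iff₀ H.pos, ← pow_succ]; exact hM)
    refine ⟨s + 1, ?_⟩
    rw [map_div₀, div_eq_iff H.pos.ne'] at hs
    rw [hs, pow_succ]

/-- Elements close to `1` are `N`-th powers. -/
lemma isPw_of_near (N : ℕ) (hN : 0 < N) : ∃ m : ℕ, 1 ≤ m ∧ ∀ x : U,
    V (x - 1) ≤ V (algebraMap k U π) ^ m → IsPw N x := by
  obtain ⟨n, hn⟩ := H.nat_val N hN.ne'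
  set p := V (algebraMap k U π) with hp
  refine ⟨2 * n + 1, by omega, fun x hx => ?_⟩
  have ht : taylor (1 : U) (X ^ N - C x) = (X + 1) ^ N - C x := by simp
  have hcoef : ∀ j, 1 ≤ j → (taylor (1 : U) (X ^ N - C x)).coeff j = (N.choose j : U) := by
    intro j hj
    rw [ht, coeff_sub, coeff_C, if_neg (by omega), sub_zero, coeff_X_add_one_pow]
  have h1 := hcoef 1 le_rfl
  rw [Nat.choose_one_right] at h1
  have hV : V (algebraMap k U π ^ n) = p ^ n := by rw [map_pow]
  have hN0 : (N : U) ≠ 0 := by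
    intro h; rw [h, map_zero] at hn; exact absurd hn (not_le.2 (H.ppos n))
  obtain ⟨θ, hθ, -⟩ := hensel_scaled V H.hensel (X ^ N - C x) 1 (algebraMap k U π ^ n)
    (by rw [h1]; exact mul_ne_zero hN0 (pow_ne_zero _ H.pi_ne')) (by
      intro j hj
      rw [hcoef j (by omega), h1, hV]
      obtain ⟨j, rfl⟩ := Nat.exists_eq_add_of_le' hj
      calc _ ≤ 1 * (p ^ n) ^ (j + 2) := by gcongr; exact V.map_natCast_le_one' _
        _ = (p ^ n) ^ j * p ^ n * p ^ n := by let := maxSemiring Γ; ring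
        _ ≤ 1 * p ^ n * p ^ n := by
          gcongr; exact pow_le_one₀ zero_le (H.pow_le_one n)
        _ ≤ _ := by rw [one_mul]; gcongr) (by
      rw [h1, hV]
      have : V (eval 1 (X ^ N - C x)) = V (x - 1) := by
        rw [← V.map_neg]; simp
      rw [this]
      calc _ ≤ p ^ (2 * n + 1) := hx
        _ = p ^ n * p ^ n * p := by let := maxSemiring Γ; ring
        _ < p ^ n * p ^ n * 1 := by
          have := H.ppos n
          gcongr
          exact H.pi_lt
        _ ≤ _ := by rw [mul_one]; gcongr)
  exact ⟨θ, by simpa [sub_eq_zero] using hθ⟩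

/-- Being an `N`-th power is insensitive to small relative changes. -/
lemma isPw_congr (N : ℕ) (hN : 0 < N) : ∃ m : ℕ, 1 ≤ m ∧ ∀ x y : U,
    V (x - y) ≤ V y * V (algebraMap k U π) ^ m → (IsPw N x ↔ IsPw N y) := by
  obtain ⟨m, hm1, hm⟩ := H.isPw_of_near N hN
  refine ⟨m, hm1, fun x y h => ?_⟩
  by_cases hy : y = 0
  · subst hy; simp at h; rw [h]
  have hVy : 0 < V y := by rwa [Valuation.pos_iff]
  have : V (x / y - 1) ≤ V (algebraMap k U π) ^ m := by
    rw [div_sub_one hy, map_div₀, div_le_iff₀ hVy, mul_comm]; exact h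
  obtain ⟨z, hz⟩ := hm _ this
  have hz0 : z ^ N ≠ 0 := by
    rw [hz]; intro h0
    rw [h0, zero_sub, V.map_neg, map_one] at this
    exact absurd this (not_le.2 (pow_lt_one₀ zero_le H.pi_lt (by omega)))
  have hx : x = z ^ N * y := by rw [hz]; field_simp
  constructor
  · rintro ⟨w, hw⟩; exact ⟨w / z, by rw [div_pow, hw, hx]; field_simp⟩
  · rintro ⟨w, hw⟩; exact ⟨z * w, by rw [mul_pow, hw, hx]⟩

omit H in
lemma val_eq_of_near {p : Γ} (hp : p < 1) {x y : U} (h : V (x - y) ≤ V y * p) : V x = V y := by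
  by_cases hy : y = 0
  · subst hy; simp at h; rw [h]
  have hVy : 0 < V y := by rwa [Valuation.pos_iff]
  have : V (x - y) < V y := h.trans_lt (by simpa using mul_lt_mul_of_pos_left hp hVy)
  have := V.map_add_eq_of_lt_left this
  rwa [add_sub_cancel] at this

/-- If every root in `U` of a polynomial over `L` of degree at most `D` lies in `L`, then
polynomials over `L` of degree at most `D` have centers in `L` for every point of `U`. -/
lemma exists_center {L : Type*} [Field L] (ι : L →+* U) (D : ℕ)
    (hL : ∀ f : L[X], f ≠ 0 → f.natDegree ≤ D → ∀ θ : U, eval₂ ι θ f = 0 → ∃ l, ι l = θ)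
    (g : L[X]) (hg : g.natDegree ≤ D) (t : U) :
    ∃ (c : L) (m : ℕ), ∀ j, V ((taylor (ι c) (g.map ι)).coeff j) * V (t - ι c) ^ j *
      V (algebraMap k U π) ^ m ≤ V ((g.map ι).eval t) := by
  set p := V (algebraMap k U π) with hp
  induction hd : g.natDegree generalizing g with
  | zero =>
    refine ⟨0, 0, fun j => ?_⟩
    rw [natDegree_eq_zero] at hd
    obtain ⟨x, rfl⟩ := hd
    rcases j with _ | j
    · simp
    · simp
  | succ d ih =>
    have := H.charZero
    have : CharZero U := charZero_of_injective_algebraMap (algebraMap k U).injective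
    have : CharZero L := (RingHom.charZero_iff ι.injective).2 inferInstance
    obtain ⟨c, m₀, hc⟩ := ih (derivative g) (by
      rw [natDegree_derivative]; omega) (by rw [natDegree_derivative]; omega)
    obtain ⟨m₁, hm₁⟩ := H.nat_val_unif (d + 1)
    set G := g.map ι with hG
    have hGd : G.natDegree = d + 1 := by rw [hG, natDegree_map, hd]
    set e := t - ι c with he
    have hb : ∀ j, 1 ≤ j → V ((taylor (ι c) G).coeff j) * V e ^ j * p ^ (m₀ + m₁) ≤
        V ((derivative G).eval t) * V e := by
      intro j hj
      obtain ⟨j, rfl⟩ := Nat.exists_eq_add_of_le' hj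
      rcases lt_or_ge (d + 1) (j + 1) with hjd | hjd
      · rw [coeff_eq_zero_of_natDegree_lt (by rw [natDegree_taylor, hGd]; exact hjd)]
        simp
      have := hc j
      rw [← derivative_map, taylor_derivative_coeff, map_mul] at this
      calc _ = p ^ m₁ * V ((taylor (ι c) G).coeff (j + 1)) * V e ^ j * p ^ m₀ * V e := by let := maxSemiring Γ; ring
        _ ≤ V ((j + 1 : ℕ) : U) * V ((taylor (ι c) G).coeff (j + 1)) * V e ^ j * p ^ m₀ * V e := by
          gcongr
          exact hm₁ _ (by omega) hjd
        _ ≤ _ := by gcongr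
    set m := m₀ + m₁ with hm
    rcases le_or_gt (V ((derivative G).eval t) * V e * p ^ m) (V (G.eval t)) with hcase | hcase
    · have hj1 : ∀ j, 1 ≤ j → V ((taylor (ι c) G).coeff j) * V e ^ j * p ^ (m + m) ≤
          V (G.eval t) := by
        intro j hj
        calc _ = V ((taylor (ι c) G).coeff j) * V e ^ j * p ^ m * p ^ m := by let := maxSemiring Γ; ring
          _ ≤ _ := le_trans (mul_le_mul' (hb j hj) le_rfl) hcase
      refine ⟨c, m + m, fun j => ?_⟩
      rcases j with _ | j
      · simp only [taylor_coeff_zero, pow_zero, mul_one]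
        have h1 : V (G.eval t - G.eval (ι c)) ≤ V (G.eval t) / p ^ (m + m) := by
          refine eval_sub_le V G (ι c) t _ fun j hj => ?_
          rw [le_div_iff₀ (H.ppos _)]
          exact hj1 j hj
        have h2 : V (G.eval (ι c)) ≤ V (G.eval t) / p ^ (m + m) := by
          have h3 : G.eval (ι c) = G.eval t - (G.eval t - G.eval (ι c)) := by ring
          rw [h3]
          refine (V.map_sub _ _).trans (max_le ?_ h1)
          rw [le_div_iff₀ (H.ppos _)]
          exact mul_le_of_le_one_right zero_le (H.pow_le_one _)
        rwa [le_div_iff₀ (H.ppos _)] at h2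
      · exact hj1 _ (by omega)
    · have hc1 : (taylor t G).coeff 1 = (derivative G).eval t := taylor_coeff_one _ _
      have hne : (derivative G).eval t * e ≠ 0 := by
        intro h
        rw [← map_mul, h, map_zero, zero_mul] at hcase
        exact absurd hcase not_lt_zero
      have hVw : V (algebraMap k U π ^ m) = p ^ m := by rw [map_pow]
      have hbt : ∀ j, 1 ≤ j → V ((taylor t G).coeff j) * V e ^ j ≤
          V ((derivative G).eval t) * V e / p ^ m :=
        fun j hj => recenter V G (ι c) t e 1 _ le_rfl (fun i hi => by
          rw [le_div_iff₀ (H.ppos _)]; exact hb i hi) j hj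
      obtain ⟨θ, hθ, hθ'⟩ := hensel_scaled V H.hensel G t (e * algebraMap k U π ^ m)
        (by rw [hc1, ← mul_assoc]; exact mul_ne_zero hne (pow_ne_zero _ H.pi_ne')) (by
          intro j hj
          rw [map_mul, hVw, hc1]
          obtain ⟨j, rfl⟩ := Nat.exists_eq_add_of_le' hj
          calc _ = V ((taylor t G).coeff (j + 2)) * V e ^ (j + 2) * p ^ m * p ^ m
                * (p ^ m) ^ j := by let := maxSemiring Γ; ring
            _ ≤ V ((derivative G).eval t) * V e / p ^ m * p ^ m * p ^ m * 1 := by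
              gcongr
              · exact hbt _ (by omega)
              · exact pow_le_one₀ zero_le (H.pow_le_one m)
            _ = _ := by rw [div_mul_cancel₀ _ (H.ppos m).ne', mul_one, mul_assoc])
        (by rw [hc1, map_mul, hVw, ← mul_assoc]; exact hcase)
      obtain ⟨c', rfl⟩ := hL g (by rintro rfl; simp at hd) hg θ (by rwa [hG, eval_map] at hθ)
      rw [hc1] at hθ'
      have hd0 : 0 < V ((derivative G).eval t) := by
        rw [Valuation.pos_iff]; exact left_ne_zero_of_mul hne
      have hdist : V (ι c' - t) ≤ V e * p ^ m := by
        have := hθ'.trans hcase.le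
        rw [mul_assoc, mul_comm] at this
        exact le_of_mul_le_mul_left this hd0
      refine ⟨c', m, fun j => ?_⟩
      rcases j with _ | j
      · simp only [taylor_coeff_zero, pow_zero, mul_one]
        rw [hθ]; simp
      rw [← le_div_iff₀ (H.ppos _), V.map_sub_swap]
      refine recenter V G t (ι c') (ι c' - t) 1 _ le_rfl (fun i hi => ?_) (j + 1) (by omega)
      obtain ⟨i, rfl⟩ := Nat.exists_eq_add_of_le' hi
      have he0 : 0 < V e := by rw [Valuation.pos_iff]; exact right_ne_zero_of_mul hne
      have hle : V (ι c' - t) ≤ V e :=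
        hdist.trans (mul_le_of_le_one_right zero_le (H.pow_le_one m))
      rw [le_div_iff₀ (H.ppos _)]
      have h5 : V ((taylor t G).coeff (i + 1)) * V e ^ (i + 1) * p ^ m ≤
          V ((derivative G).eval t) * V e := by
        rw [← le_div_iff₀ (H.ppos _)]; exact hbt _ (by omega)
      refine le_of_mul_le_mul_left ?_ he0
      calc _ = V ((taylor t G).coeff (i + 1)) * V e * V (ι c' - t) ^ i * p ^ m * V (ι c' - t) := by
            let := maxSemiring Γ; ring
        _ ≤ V ((taylor t G).coeff (i + 1)) * V e * V e ^ i * p ^ m * V (ι c' - t) := by gcongr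
        _ = V ((taylor t G).coeff (i + 1)) * V e ^ (i + 1) * p ^ m * V (ι c' - t) := by let := maxSemiring Γ; ring
        _ ≤ V ((derivative G).eval t) * V e * V (ι c' - t) := by gcongr
        _ = V e * (V (ι c' - t) * V ((derivative G).eval t)) := by let := maxSemiring Γ; ring
        _ ≤ _ := by gcongr

end PadicLike

end

section

open Polynomial

namespace PadicLike

variable {k U Γ : Type*} [Field k] [Field U] [Algebra k U]
    [LinearOrderedCommGroupWithZero Γ] {V : Valuation U Γ} {π : k} (H : PadicLike k V π)

include H

lemma pow_lt_one' {m : ℕ} (hm : 1 ≤ m) : V (algebraMap k U π) ^ m < 1 :=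
  pow_lt_one₀ zero_le H.pi_lt (by omega)

/-- Approximation of an element whose value is attained on `L`. -/
lemma exists_approx {L : Type*} [Field L] [Algebra k L] (ι : L →ₐ[k] U) (e : U) (l : L)
    (hl : l ≠ 0) (h : V e = V (ι l)) (M : ℕ) (hM : 1 ≤ M) :
    ∃ κ : k, V (e - ι (l * algebraMap k L κ)) ≤ V e * V (algebraMap k U π) ^ M ∧
      V (ι (l * algebraMap k L κ)) = V e := by
  have h0 : ι l ≠ 0 := by simpa using hl
  have h1 : 0 < V (ι l) := by rwa [Valuation.pos_iff]
  obtain ⟨S, hS⟩ := H.residue_reps M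
  obtain ⟨κ, -, hκ⟩ := hS (e / ι l) (by rw [map_div₀, h, div_self h1.ne'])
  have h2 : V (e - ι (l * algebraMap k L κ)) ≤ V e * V (algebraMap k U π) ^ M := by
    have : e - ι (l * algebraMap k L κ) = ι l * (e / ι l - algebraMap k U κ) := by
      rw [map_mul, AlgHom.commutes]; field_simp
    rw [this, map_mul, h]
    gcongr
  exact ⟨κ, h2, val_eq_of_near (H.pow_lt_one' hM) (by rwa [V.map_sub_swap])⟩

lemma exists_pow_root {L : Type*} [Field L] [Algebra k L] (ι : L →ₐ[k] U) (e : U) (l : L)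
    (n : ℕ) (hn : 0 < n) (hl : l ≠ 0) (h : V e ^ n = V (ι l)) :
    ∃ (y : U) (l' : L), l' ≠ 0 ∧ y ^ n = ι l' ∧ V y = V e := by
  obtain ⟨m, hm1, hm⟩ := H.isPw_congr n hn
  rw [← map_pow] at h
  obtain ⟨κ, hκ, hκ'⟩ := H.exists_approx ι (e ^ n) l hl h m hm1
  obtain ⟨y, hy⟩ := (hm (e ^ n) _ (by rwa [hκ'])).1 ⟨e, rfl⟩
  refine ⟨y, _, ?_, hy, ?_⟩
  · intro h0
    rw [h0, map_zero, map_zero, h] at hκ'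
    have h0 : ι l ≠ 0 := by simpa using hl
    exact h0 (by simpa using hκ'.symm)
  · have : V y ^ n = V e ^ n := by rw [← map_pow, ← map_pow, hy, hκ']
    exact (pow_left_inj₀ zero_le zero_le hn.ne').1 this

/-- If no small power of `V e` is a value of `L`, then evaluation at `e` of a polynomial over `L`
is dominated by one monomial. -/
lemma exists_dominant {L : Type*} [Field L] [Algebra k L] (ι : L →ₐ[k] U) (e : U) (he : e ≠ 0)
    (D : ℕ) (hD : ∀ n, 1 ≤ n → n ≤ D → ∀ l : L, l ≠ 0 → V e ^ n ≠ V (ι l))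
    (g : L[X]) (hg : g.natDegree ≤ D) (hg0 : g ≠ 0) :
    ∃ j ∈ g.support, ∀ i, i ≠ j → ∀ M, V (ι (g.coeff i)) * V e ^ i ≤
      V (ι (g.coeff j)) * V e ^ j * V (algebraMap k U π) ^ M := by
  obtain ⟨j, hj, hmax⟩ := g.support.exists_max_image (fun i => V (ι (g.coeff i)) * V e ^ i)
    (support_nonempty.2 hg0)
  refine ⟨j, hj, fun i hij M => ?_⟩
  by_cases hi : g.coeff i = 0
  · simp [hi]
  by_contra! hlt
  have hle := hmax i (mem_support_iff.2 hi)
  have hj' : g.coeff j ≠ 0 := mem_support_iff.1 hj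
  have hVe : 0 < V e := by rwa [Valuation.pos_iff]
  have hVi : 0 < V (ι (g.coeff i)) := by rw [Valuation.pos_iff]; simpa using hi
  have hVj : 0 < V (ι (g.coeff j)) := by rw [Valuation.pos_iff]; simpa using hj'
  have hx : V (ι (g.coeff i) * e ^ i / (ι (g.coeff j) * e ^ j)) =
      V (ι (g.coeff i)) * V e ^ i / (V (ι (g.coeff j)) * V e ^ j) := by simp
  have hpos : 0 < V (ι (g.coeff j)) * V e ^ j := mul_pos hVj (pow_pos hVe j)
  obtain ⟨s, hs⟩ := H.exists_pow_eq (ι (g.coeff i) * e ^ i / (ι (g.coeff j) * e ^ j))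
    (by rw [hx]; exact div_le_one_of_le₀ hle zero_le) M
    (by rw [hx, lt_div_iff₀ hpos, mul_comm]; exact hlt)
  rw [hx, div_eq_iff hpos.ne'] at hs
  have hpi : V (algebraMap k U π) ^ s = V (ι (algebraMap k L π ^ s)) := by simp
  have hp0 : algebraMap k L π ^ s ≠ 0 := pow_ne_zero _ (by simpa using H.pi_ne)
  rcases lt_or_gt_of_ne hij with hlt' | hlt'
  · refine hD (j - i) (by omega) (by have := le_natDegree_of_mem_supp j hj; omega)
      (g.coeff i / (g.coeff j * algebraMap k L π ^ s))
      (div_ne_zero hi (mul_ne_zero hj' hp0)) ?_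
    rw [map_div₀, map_mul, map_div₀, map_mul, ← hpi,
      eq_div_iff (mul_ne_zero hVj.ne' (H.ppos s).ne')]
    have hi0 : V e ^ i ≠ 0 := (pow_pos hVe i).ne'
    refine mul_right_cancel₀ hi0 ?_
    rw [hs]
    have : V e ^ j = V e ^ (j - i) * V e ^ i := by rw [← pow_add]; congr 1; omega
    rw [this]
    let := maxSemiring Γ; ring
  · refine hD (i - j) (by omega)
      (by have := le_natDegree_of_mem_supp i (mem_support_iff.2 hi); omega)
      (g.coeff j * algebraMap k L π ^ s / g.coeff i)
      (div_ne_zero (mul_ne_zero hj' hp0) hi) ?_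
    rw [map_div₀, map_mul, map_div₀, map_mul, ← hpi, eq_div_iff hVi.ne']
    have hj0 : V e ^ j ≠ 0 := (pow_pos hVe j).ne'
    refine mul_right_cancel₀ hj0 ?_
    have : V e ^ i = V e ^ (i - j) * V e ^ j := by rw [← pow_add]; congr 1; omega
    rw [this] at hs
    calc _ = V (ι (g.coeff i)) * (V e ^ (i - j) * V e ^ j) := by let := maxSemiring Γ; ring
      _ = _ := by rw [hs]; let := maxSemiring Γ; ring

omit H in
lemma eval_near_dominant {L : Type*} [Field L] (ι : L →+* U) (e : U) (g : L[X]) (j : ℕ) (B : Γ)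
    (h : ∀ i ∈ g.support, i ≠ j → V (ι (g.coeff i)) * V e ^ i ≤ B) :
    V ((g.map ι).eval e - ι (g.coeff j) * e ^ j) ≤ B := by
  have h0 : (g.map ι).eval e - ι (g.coeff j) * e ^ j
      = ∑ i ∈ g.support.erase j, ι (g.coeff i) * e ^ i := by
    rw [eval_map, eval₂_eq_sum, Polynomial.sum_def]
    by_cases hj : j ∈ g.support
    · rw [← Finset.add_sum_erase _ _ hj]; ring
    · rw [Finset.erase_eq_of_notMem hj, notMem_support_iff.1 hj]; simp
  rw [h0]
  refine V.map_sum_le fun i hi => ?_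
  rw [map_mul, map_pow]
  exact h i (Finset.mem_of_mem_erase hi) (Finset.ne_of_mem_erase hi)

/-- Uniform precision for all divisors of `N`. -/
lemma isPw_congr_dvd (N : ℕ) (hN : 0 < N) : ∃ m : ℕ, 1 ≤ m ∧ ∀ n, n ∣ N → ∀ x y : U,
    V (x - y) ≤ V y * V (algebraMap k U π) ^ m → (IsPw n x ↔ IsPw n y) := by
  choose! f hf1 hf using H.isPw_congr
  refine ⟨(N.divisors.sup f) + 1, by omega, fun n hn x y h => ?_⟩
  refine hf n (Nat.pos_of_dvd_of_pos hn hN) x y (h.trans ?_)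
  gcongr 1
  refine H.pow_anti ?_
  have := Finset.le_sup (f := f) (Nat.mem_divisors.2 ⟨hn, hN.ne'⟩)
  omega

/-- Elements whose value is not attained on `L` are far away from every value of `L`. -/
lemma far {L : Type*} [Field L] [Algebra k L] (ι : L →ₐ[k] U) (e : U)
    (h1 : ∀ l : L, l ≠ 0 → V e ≠ V (ι l)) (x : L) (hx : x ≠ 0) (h : V e < V (ι x)) (n : ℤ) :
    V e < V (ι x) * V (algebraMap k U π) ^ n := by
  have hVx : 0 < V (ι x) := by rw [Valuation.pos_iff]; simpa using hx
  have hpk : algebraMap k L π ≠ 0 := by simpa using H.pi_ne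
  by_contra! hle
  obtain ⟨s, hs⟩ := H.exists_pow_eq (e / ι x)
    (by rw [map_div₀]; exact div_le_one_of_le₀ h.le zero_le) (n.toNat + 1) (by
      rw [map_div₀, lt_div_iff₀ hVx, mul_comm]
      refine lt_of_lt_of_le ?_ hle
      rw [mul_lt_mul_iff_right₀ hVx, ← zpow_natCast]
      exact zpow_lt_zpow_right_of_lt_one₀ H.pos H.pi_lt (by
        have := Int.self_le_toNat n; push_cast; omega))
  rw [map_div₀, div_eq_iff hVx.ne'] at hs
  refine h1 (algebraMap k L π ^ s * x) (mul_ne_zero (pow_ne_zero _ hpk) hx) ?_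
  rw [hs]; simp

omit H in
lemma far_inv {L : Type*} [Field L] [Algebra k L] (ι : L →ₐ[k] U) (e : U)
    (h1 : ∀ l : L, l ≠ 0 → V e ≠ V (ι l)) (l : L) (hl : l ≠ 0) : V e⁻¹ ≠ V (ι l) := by
  intro h
  refine h1 l⁻¹ (inv_ne_zero hl) ?_
  rw [map_inv₀] at h
  rw [map_inv₀, map_inv₀, ← h, inv_inv]

lemma far' {L : Type*} [Field L] [Algebra k L] (ι : L →ₐ[k] U) (e : U) (he : e ≠ 0)
    (h1 : ∀ l : L, l ≠ 0 → V e ≠ V (ι l)) (x : L) (hx : x ≠ 0) (h : V (ι x) < V e) (n : ℤ) :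
    V (ι x) * V (algebraMap k U π) ^ n < V e := by
  have hVx : 0 < V (ι x) := by rw [Valuation.pos_iff]; simpa using hx
  have hVe : 0 < V e := by rwa [Valuation.pos_iff]
  have := H.far ι e⁻¹ (far_inv ι e h1) x⁻¹ (inv_ne_zero hx) (by
    rw [map_inv₀, map_inv₀, map_inv₀]; exact (inv_lt_inv₀ hVe hVx).2 h) (-n)
  rw [map_inv₀, map_inv₀, map_inv₀, zpow_neg, ← mul_inv, inv_lt_inv₀ hVe
    (mul_pos hVx (zpow_pos H.pos _))] at this
  exact this

end PadicLike

/-- The filter on `L` of neighbourhoods of the cut defined by the value of `e`. -/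
def cutFilter {L U Γ : Type*} [Field L] [Field U] [LinearOrderedCommGroupWithZero Γ]
    (V : Valuation U Γ) (ι : L →+* U) (e : U) : Filter L where
  sets := {P | ∃ A B : Finset L, (∀ a ∈ A, V e < V (ι a)) ∧ (∀ b ∈ B, b ≠ 0 ∧ V (ι b) < V e) ∧
    ∀ y, y ≠ 0 → (∀ a ∈ A, V (ι y) ≤ V (ι a)) → (∀ b ∈ B, V (ι b) ≤ V (ι y)) → y ∈ P}
  univ_sets := ⟨∅, ∅, by simp, by simp, by simp⟩
  sets_of_superset := by
    rintro P Q ⟨A, B, hA, hB, h⟩ hPQ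
    exact ⟨A, B, hA, hB, fun y h0 h1 h2 => hPQ (h y h0 h1 h2)⟩
  inter_sets := by
    classical
    rintro P Q ⟨A, B, hA, hB, h⟩ ⟨A', B', hA', hB', h'⟩
    refine ⟨A ∪ A', B ∪ B', ?_, ?_, fun y h0 h1 h2 => ⟨h y h0 ?_ ?_, h' y h0 ?_ ?_⟩⟩
    · intro a ha; exact (Finset.mem_union.1 ha).elim (hA a) (hA' a)
    · intro a ha; exact (Finset.mem_union.1 ha).elim (hB a) (hB' a)
    · exact fun a ha => h1 a (Finset.mem_union_left _ ha)
    · exact fun a ha => h2 a (Finset.mem_union_left _ ha)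
    · exact fun a ha => h1 a (Finset.mem_union_right _ ha)
    · exact fun a ha => h2 a (Finset.mem_union_right _ ha)

namespace PadicLike

variable {k U Γ : Type*} [Field k] [Field U] [Algebra k U]
    [LinearOrderedCommGroupWithZero Γ] {V : Valuation U Γ} {π : k} (H : PadicLike k V π)
  {L : Type*} [Field L] [Algebra k L] (ι : L →ₐ[k] U)

include H

lemma exists_upper (hL : ∀ (y : U) (n : ℕ) (l : L), 0 < n → y ^ n = ι l → ∃ l', ι l' = y)
    (e : U) (h1 : ∀ l : L, l ≠ 0 → V e ≠ V (ι l)) (l : L) (hl : l ≠ 0) (j : ℕ)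
    (hj : 0 < j) (h : V (ι l) * V e ^ j ≤ 1) : ∃ a : L, V e < V (ι a) ∧
      ∀ y, V y ≤ V (ι a) → V (ι l) * V y ^ j ≤ 1 := by
  obtain ⟨S, hS0, hS⟩ := H.power_reps j hj
  have hl' : ι l ≠ 0 := by simpa using hl
  have hVl : 0 < V (ι l) := by rwa [Valuation.pos_iff]
  obtain ⟨κ, hκ, z, hz⟩ := hS (ι l)⁻¹ (inv_ne_zero hl')
  have hκ0 := hS0 κ hκ
  have hκU : algebraMap k U κ ≠ 0 := by simpa using hκ0
  obtain ⟨z, rfl⟩ := hL z j (l⁻¹ / algebraMap k L κ) hj (by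
    rw [map_div₀, map_inv₀, AlgHom.commutes, hz]; field_simp)
  have hz0 : z ≠ 0 := by
    rintro rfl
    rw [map_zero, zero_pow hj.ne', mul_zero] at hz
    exact inv_ne_zero hl' hz
  obtain ⟨n, hn⟩ := H.val_k κ hκ0
  have hV : (V (ι l))⁻¹ = V (algebraMap k U π) ^ n * V (ι z) ^ j := by
    rw [← map_inv₀, hz, map_mul, map_pow, hn]
  have hVz : 0 < V (ι z) := by rw [Valuation.pos_iff]; simpa using hz0
  have key : ∀ y, V (ι l) * V y ^ j ≤ 1 ↔ V y ^ j ≤ V (algebraMap k U π) ^ n * V (ι z) ^ j := by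
    intro y; rw [← hV, ← le_inv_mul_iff₀ hVl, mul_one]
  have hpk : algebraMap k L π ≠ 0 := by simpa using H.pi_ne
  have hjn : ∀ a : ℕ, a ≤ a * j := fun a => Nat.le_mul_of_pos_right a hj
  rcases lt_or_gt_of_ne (h1 z hz0) with hez | hez
  · have := H.far ι e h1 z hz0 hez n.toNat
    refine ⟨z * algebraMap k L π ^ n.toNat, ?_, fun y hy => (key y).2 ?_⟩
    · rw [map_mul, map_pow, AlgHom.commutes, map_mul, map_pow, ← zpow_natCast]; exact this
    · simp only [map_mul, map_pow, AlgHom.commutes] at hy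
      calc V y ^ j ≤ (V (ι z) * V (algebraMap k U π) ^ n.toNat) ^ j := by gcongr
        _ = V (algebraMap k U π) ^ ((n.toNat * j : ℕ) : ℤ) * V (ι z) ^ j := by
          rw [zpow_natCast, mul_pow, ← pow_mul, mul_comm]
        _ ≤ _ := by
          gcongr 1
          refine zpow_le_zpow_right_of_le_one₀ H.pos H.pi_lt.le ?_
          exact (Int.self_le_toNat n).trans (by exact_mod_cast hjn _)
  · exfalso
    have he : e ≠ 0 := by rintro rfl; simp at hez
    have := H.far' ι e he h1 z hz0 hez (-((-n).toNat : ℤ))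
    have h2 := (key e).1 h
    have h3 : (V (ι z) * V (algebraMap k U π) ^ (-((-n).toNat : ℤ))) ^ j < V e ^ j :=
      pow_lt_pow_left₀ this zero_le hj.ne'
    refine absurd (h3.trans_le h2) (not_lt.2 ?_)
    rw [mul_pow, mul_comm, ← zpow_natCast (V (algebraMap k U π) ^ _), ← zpow_mul]
    gcongr 1
    refine zpow_le_zpow_right_of_le_one₀ H.pos H.pi_lt.le ?_
    have h4 := hjn (-n).toNat
    have h5 := Int.self_le_toNat (-n)
    have h6 : ((-n).toNat : ℤ) ≤ (-n).toNat * j := by exact_mod_cast h4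
    linarith

lemma eventually_mul_zpow_le
    (hL : ∀ (y : U) (n : ℕ) (l : L), 0 < n → y ^ n = ι l → ∃ l', ι l' = y)
    (e : U) (he : e ≠ 0) (h1 : ∀ l : L, l ≠ 0 → V e ≠ V (ι l)) (l : L) (j : ℤ)
    (h : V (ι l) * V e ^ j ≤ 1) :
    ∀ᶠ y in cutFilter V (ι : L →+* U) e, V (ι l) * V (ι y) ^ j ≤ 1 := by
  by_cases hl : l = 0
  · simp [hl]
  rcases lt_trichotomy j 0 with hj | rfl | hj
  · obtain ⟨n, rfl⟩ : ∃ n : ℕ, j = -n := ⟨j.natAbs, by omega⟩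
    obtain ⟨a, ha, ha'⟩ := H.exists_upper ι hL e⁻¹ (far_inv ι e h1) l hl n (by omega)
      (by simpa using h)
    have ha0 : a ≠ 0 := by rintro rfl; simp at ha
    have hVa : 0 < V (ι a) := by rw [Valuation.pos_iff]; simpa using ha0
    have hVe : 0 < V e := by rwa [Valuation.pos_iff]
    refine ⟨∅, {a⁻¹}, by simp, ?_, fun y hy _ hy' => ?_⟩
    · simp only [Finset.mem_singleton, forall_eq]
      refine ⟨inv_ne_zero ha0, ?_⟩
      rw [map_inv₀] at ha
      simpa using (inv_lt_comm₀ hVe hVa).1 ha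
    · have hVy : 0 < V (ι y) := by rw [Valuation.pos_iff]; simpa using hy
      have := hy' a⁻¹ (by simp)
      simp only [RingHom.coe_coe, map_inv₀] at this
      have := ha' (ι y)⁻¹ (by rw [map_inv₀]; exact (inv_le_comm₀ hVa hVy).1 this)
      simpa using this
  · exact Filter.Eventually.of_forall fun y => by simpa using h
  · obtain ⟨n, rfl⟩ : ∃ n : ℕ, j = n := ⟨j.natAbs, by omega⟩
    obtain ⟨a, ha, ha'⟩ := H.exists_upper ι hL e h1 l hl n (by omega) (by simpa using h)
    refine ⟨{a}, ∅, by simpa using ha, by simp, fun y hy hy' _ => ?_⟩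
    simpa using ha' (ι y) (by simpa using hy' a)

/-- Elements of `L` in a prescribed power class, with value moved in a prescribed direction. -/
lemma exists_class (e : U) (he : e ≠ 0) (N : ℕ) (hN : 0 < N) (a : L) (ha : a ≠ 0) :
    ∃ (y : L) (z : U) (n : ℤ), y ≠ 0 ∧ e = ι y * z ^ N ∧ 0 ≤ n ∧
      V (ι y) = V (ι a) * V (algebraMap k U π) ^ n := by
  obtain ⟨S, hS0, hS⟩ := H.power_reps N hN
  have ha' : ι a ≠ 0 := by simpa using ha
  obtain ⟨κ, hκ, z, hz⟩ := hS (e / ι a) (div_ne_zero he ha')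
  obtain ⟨n, hn⟩ := H.val_k κ (hS0 κ hκ)
  have hpk : algebraMap k L π ≠ 0 := by simpa using H.pi_ne
  have hpU := H.pi_ne'
  refine ⟨a * algebraMap k L κ * (algebraMap k L π ^ n.natAbs) ^ N,
    z / algebraMap k U π ^ n.natAbs, n + n.natAbs * N, ?_, ?_, ?_, ?_⟩
  · refine mul_ne_zero (mul_ne_zero ha ?_) (pow_ne_zero _ (pow_ne_zero _ hpk))
    simpa using hS0 κ hκ
  · simp only [map_mul, map_pow, AlgHom.commutes, div_pow]
    rw [div_eq_iff ha'] at hz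
    rw [hz]; field_simp
  · have h1 : n.natAbs ≤ n.natAbs * N := Nat.le_mul_of_pos_right _ hN
    have h2 : (n.natAbs : ℤ) ≤ n.natAbs * N := by exact_mod_cast h1
    omega
  · simp only [map_mul, map_pow, AlgHom.commutes, hn]
    rw [zpow_add₀ H.pos.ne', ← Nat.cast_mul, zpow_natCast, pow_mul, mul_assoc]

lemma exists_of_eventually
    (e : U) (he : e ≠ 0) (h1 : ∀ l : L, l ≠ 0 → V e ≠ V (ι l)) (N : ℕ) (hN : 0 < N)
    (P : L → Prop) (hP : ∀ᶠ y in cutFilter V (ι : L →+* U) e, P y) :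
    ∃ (y : L) (z : U), y ≠ 0 ∧ e = ι y * z ^ N ∧ P y := by
  obtain ⟨A, B, hA, hB, h⟩ := hP
  simp only [RingHom.coe_coe] at hA hB h
  have hVe : 0 < V e := by rwa [Valuation.pos_iff]
  rcases A.eq_empty_or_nonempty with rfl | hne
  · rcases B.eq_empty_or_nonempty with rfl | hne
    · obtain ⟨y, z, n, hy, hz, -⟩ := H.exists_class ι e he N hN 1 one_ne_zero
      exact ⟨y, z, hy, hz, h y hy (by simp) (by simp)⟩
    · obtain ⟨b, hb, hmax⟩ := B.exists_max_image (fun b => V (ι b)) hne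
      have hb0 := (hB b hb).1
      have hVb : 0 < V (ι b) := by rw [Valuation.pos_iff]; simpa using hb0
      obtain ⟨y, z, n, hy, hz, hn, hyn⟩ := H.exists_class ι e⁻¹ (inv_ne_zero he) N hN b⁻¹
        (inv_ne_zero hb0)
      refine ⟨y⁻¹, z⁻¹, inv_ne_zero hy, ?_, h _ (inv_ne_zero hy) (by simp) fun b' hb' => ?_⟩
      · rw [← inv_inv e, hz]; simp [mul_comm]
      · refine (hmax b' hb').trans ?_
        have hVy : 0 < V (ι y) := by rw [Valuation.pos_iff]; simpa using hy
        rw [map_inv₀, map_inv₀, le_inv_comm₀ hVb hVy, hyn, map_inv₀, map_inv₀]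
        exact mul_le_of_le_one_right zero_le (zpow_le_one₀ H.pos H.pi_lt.le hn)
  · obtain ⟨a, ha, hmin⟩ := A.exists_min_image (fun b => V (ι b)) hne
    have ha0 : a ≠ 0 := by rintro rfl; simpa using hA _ ha
    obtain ⟨y, z, n, hy, hz, hn, hyn⟩ := H.exists_class ι e he N hN a ha0
    refine ⟨y, z, hy, hz, h _ hy (fun a' ha' => le_trans ?_ (hmin a' ha')) fun b' hb' => ?_⟩
    · rw [hyn]
      exact mul_le_of_le_one_right zero_le (zpow_le_one₀ H.pos H.pi_lt.le hn)
    · rw [hyn]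
      exact (hB b' hb').2.le.trans (H.far ι e h1 a ha0 (hA a ha) n).le

end PadicLike

end

section

open Polynomial

/-- Agreement of zero-ness, integrality and power classes for exponents dividing `N`. -/
def SamePred {U Γ : Type*} [Field U] [LinearOrderedCommGroupWithZero Γ] (V : Valuation U Γ)
    (N : ℕ) (x y : U) : Prop :=
  (x = 0 ↔ y = 0) ∧ (V x ≤ 1 ↔ V y ≤ 1) ∧ ∀ n, n ∣ N → (IsPw n x ↔ IsPw n y)

namespace SamePred

variable {U Γ : Type*} [Field U] [LinearOrderedCommGroupWithZero Γ] {V : Valuation U Γ}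
    {N : ℕ} {x y z : U}

lemma refl (x : U) : SamePred V N x x := ⟨Iff.rfl, Iff.rfl, fun _ _ => Iff.rfl⟩

lemma symm (h : SamePred V N x y) : SamePred V N y x :=
  ⟨h.1.symm, h.2.1.symm, fun n hn => (h.2.2 n hn).symm⟩

lemma trans (h : SamePred V N x y) (h' : SamePred V N y z) : SamePred V N x z :=
  ⟨h.1.trans h'.1, h.2.1.trans h'.2.1, fun n hn => (h.2.2 n hn).trans (h'.2.2 n hn)⟩

end SamePred

lemma isPw_mul_pow {U : Type*} [Field U] {n : ℕ} (x z : U) (hz : z ≠ 0) :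
    IsPw n (x * z ^ n) ↔ IsPw n x := by
  constructor
  · rintro ⟨w, hw⟩; exact ⟨w / z, by rw [div_pow, hw]; field_simp⟩
  · rintro ⟨w, hw⟩; exact ⟨w * z, by rw [mul_pow, hw]⟩

namespace PadicLike

variable {k U Γ : Type*} [Field k] [Field U] [Algebra k U]
    [LinearOrderedCommGroupWithZero Γ] {V : Valuation U Γ} {π : k} (H : PadicLike k V π)
  {L : Type*} [Field L] [Algebra k L] (ι : L →ₐ[k] U)

include H

lemma samePred_of_near (N : ℕ) (hN : 0 < N) : ∃ m : ℕ, 1 ≤ m ∧ ∀ x y : U,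
    V (x - y) ≤ V y * V (algebraMap k U π) ^ m → SamePred V N x y := by
  obtain ⟨m, hm, h⟩ := H.isPw_congr_dvd N hN
  refine ⟨m, hm, fun x y hxy => ?_⟩
  have hV := val_eq_of_near (H.pow_lt_one' hm) hxy
  refine ⟨?_, by rw [hV], fun n hn => h n hn x y hxy⟩
  rw [← V.zero_iff, hV, V.zero_iff]

/-- A field relatively algebraically closed in `U` is existentially closed in `U` for conditions
in one variable. -/
lemma exists_specialization
    (hL : ∀ f : L[X], f ≠ 0 → ∀ θ : U, eval₂ (ι : L →+* U) θ f = 0 → ∃ l, ι l = θ)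
    (t : U) (G : Finset L[X]) (N : ℕ) (hN : 0 < N) :
    ∃ t₀ : L, ∀ g ∈ G, SamePred V N ((g.map (ι : L →+* U)).eval t)
      ((g.map (ι : L →+* U)).eval (ι t₀)) := by
  have hroot : ∀ (y : U) (n : ℕ) (l : L), 0 < n → y ^ n = ι l → ∃ l', ι l' = y := by
    intro y n l hn h
    refine hL (X ^ n - C l) (X_pow_sub_C_ne_zero hn l) y ?_
    simp [h]
  rcases G.eq_empty_or_nonempty with rfl | hne
  · exact ⟨0, by simp⟩
  by_cases ht : ∃ l, ι l = t
  · obtain ⟨l, rfl⟩ := ht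
    exact ⟨l, fun g _ => SamePred.refl _⟩
  obtain ⟨m₀, hm₀, hnear⟩ := H.samePred_of_near N hN
  choose cg mg hcg using fun g : L[X] => H.exists_center (ι : L →+* U) g.natDegree
    (fun f hf _ => hL f hf) g le_rfl t
  simp only [RingHom.coe_coe] at hcg
  obtain ⟨g₀, hg₀, hmin⟩ := G.exists_min_image (fun g => V (t - ι (cg g))) hne
  set c := cg g₀ with hc
  set e := t - ι c with he
  have he0 : e ≠ 0 := fun h => ht ⟨c, (sub_eq_zero.1 h).symm⟩
  have hVe : 0 < V e := by rwa [Valuation.pos_iff]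
  set p := V (algebraMap k U π) with hp
  have F1 : ∀ g ∈ G, ∀ j, V ((taylor (ι c) (g.map (ι : L →+* U))).coeff j) * V e ^ j ≤
      V ((g.map (ι : L →+* U)).eval t) / p ^ mg g := by
    intro g hg j
    refine le_trans (by gcongr; exact hmin g hg) (recenter V (g.map (ι : L →+* U)) (ι (cg g))
      (ι c) (t - ι (cg g)) 0 _ ?_ (fun i _ => by
        rw [le_div_iff₀ (H.ppos _)]; exact hcg g i) j (Nat.zero_le _))
    have : ι c - ι (cg g) = (t - ι (cg g)) - e := by rw [he]; ring
    rw [this]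
    exact (V.map_sub _ _).trans (max_le le_rfl (hmin g hg))
  set M := m₀ + G.sup mg with hM
  have hMg : ∀ g ∈ G, m₀ + mg g ≤ M := fun g hg => by
    have := Finset.le_sup (f := mg) hg; omega
  by_cases hcase : ∃ l : L, l ≠ 0 ∧ V e = V (ι l)
  · obtain ⟨l, hl, hel⟩ := hcase
    obtain ⟨κ, hκ, -⟩ := H.exists_approx ι e l hl hel M (by omega)
    refine ⟨c + l * algebraMap k L κ, fun g hg => (hnear _ _ ?_).symm⟩
    set t₁ := ι (c + l * algebraMap k L κ) with ht₁
    have hdist : V (t₁ - t) ≤ V e * p ^ M := by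
      rw [V.map_sub_swap, ht₁, map_add, ← sub_sub]; exact hκ
    refine eval_sub_le V _ t t₁ _ fun j hj => ?_
    have h1 := recenter V (g.map (ι : L →+* U)) (ι c) t e 0 _ le_rfl
      (fun i _ => F1 g hg i) j (Nat.zero_le _)
    obtain ⟨j, rfl⟩ := Nat.exists_eq_add_of_le' hj
    calc _ ≤ V ((taylor t (g.map (ι : L →+* U))).coeff (j + 1)) * (V e * p ^ M) ^ (j + 1) := by
          gcongr
      _ = V ((taylor t (g.map (ι : L →+* U))).coeff (j + 1)) * V e ^ (j + 1)
          * (p ^ M * (p ^ M) ^ j) := by let := maxSemiring Γ; ring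
      _ ≤ V ((g.map (ι : L →+* U)).eval t) / p ^ mg g * (p ^ (m₀ + mg g) * 1) := by
        exact mul_le_mul' h1 (mul_le_mul' (H.pow_anti (hMg g hg))
          (pow_le_one₀ zero_le (H.pow_le_one M)))
      _ = _ := by
        rw [pow_add, mul_one, mul_comm (p ^ m₀), ← mul_assoc,
          div_mul_cancel₀ _ (H.ppos _).ne']
  · push Not at hcase
    have hfar : ∀ n, 1 ≤ n → ∀ l : L, l ≠ 0 → V e ^ n ≠ V (ι l) := by
      intro n hn l hl h
      obtain ⟨y, l', hl', hy, hye⟩ := H.exists_pow_root ι e l n hn hl h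
      obtain ⟨y, rfl⟩ := hroot y n l' hn hy
      refine hcase y ?_ hye.symm
      rintro rfl
      simp at hye
      exact hVe.ne hye
    have hev : ∀ g ∈ G, ∀ᶠ y in cutFilter V (ι : L →+* U) e, y ≠ 0 →
        (∃ z, e = ι y * z ^ N) → SamePred V N ((g.map (ι : L →+* U)).eval t)
          ((g.map (ι : L →+* U)).eval (ι (c + y))) := by
      intro g hg
      by_cases hg0 : g = 0
      · simp [hg0, SamePred.refl]
      set b := taylor c g with hb
      have hb0 : b ≠ 0 := by
        rw [hb]; simpa using hg0
      have hbev : ∀ s, (g.map (ι : L →+* U)).eval (s + ι c) = (b.map (ι : L →+* U)).eval s := by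
        intro s; rw [hb, map_taylor, taylor_eval]; simp
      obtain ⟨j, hj, hdom⟩ := H.exists_dominant ι e he0 b.natDegree
        (fun n hn _ => hfar n hn) b le_rfl hb0
      have hbj : ι (b.coeff j) ≠ 0 := by simpa using mem_support_iff.1 hj
      have hVbj : 0 < V (ι (b.coeff j)) := by rwa [Valuation.pos_iff]
      have hpk : algebraMap k L π ≠ 0 := by simpa using H.pi_ne
      have hrel : ∀ (i : ℕ) (s : Γ), 0 < s →
          (V (ι (b.coeff i / (b.coeff j * algebraMap k L π ^ m₀))) * s ^ ((i : ℤ) - j) ≤ 1 ↔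
            V (ι (b.coeff i)) * s ^ i ≤ V (ι (b.coeff j)) * s ^ j * p ^ m₀) := by
        intro i s hs
        simp only [map_div₀, map_mul, map_pow, AlgHom.commutes]
        rw [zpow_sub₀ hs.ne', zpow_natCast, zpow_natCast, div_mul_div_comm,
          div_le_one₀ (mul_pos (mul_pos hVbj (H.ppos _)) (pow_pos hs _)), mul_right_comm]
      have ev1 : ∀ᶠ y in cutFilter V (ι : L →+* U) e, ∀ i ∈ b.support, i ≠ j → y ≠ 0 →
          V (ι (b.coeff i)) * V (ι y) ^ i ≤ V (ι (b.coeff j)) * V (ι y) ^ j * p ^ m₀ := by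
        rw [Filter.eventually_all_finset]
        intro i _
        by_cases hij : i = j
        · simp [hij]
        filter_upwards [H.eventually_mul_zpow_le ι hroot e he0 (fun l hl => hcase l hl)
          (b.coeff i / (b.coeff j * algebraMap k L π ^ m₀)) ((i : ℤ) - j)
          ((hrel i _ hVe).2 (hdom i hij m₀))] with y hy _ hy0
        exact (hrel i _ (by rw [Valuation.pos_iff]; simpa using hy0)).1 hy
      have ev2 : ∀ᶠ y in cutFilter V (ι : L →+* U) e, y ≠ 0 →
          (V (ι (b.coeff j) * e ^ j) ≤ 1 ↔ V (ι (b.coeff j) * ι y ^ j) ≤ 1) := by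
        simp only [map_mul, map_pow]
        rcases le_or_gt (V (ι (b.coeff j)) * V e ^ j) 1 with hle | hlt
        · filter_upwards [H.eventually_mul_zpow_le ι hroot e he0 (fun l hl => hcase l hl)
            (b.coeff j) j (by simpa using hle)] with y hy _
          simp only [zpow_natCast] at hy
          exact iff_of_true hle hy
        · by_cases hj0 : j = 0
          · simp [hj0]
          have key : ∀ s : Γ, 0 < s → V (ι (b.coeff j * algebraMap k L π)⁻¹) * s ^ (-(j : ℤ)) =
              (V (ι (b.coeff j)) * s ^ j)⁻¹ * p⁻¹ := by
            intro s _
            rw [map_inv₀, map_inv₀, map_mul, map_mul, AlgHom.commutes, zpow_neg, zpow_natCast,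
              mul_inv, mul_inv, mul_right_comm]
          have key' : ∀ s : Γ, 0 < s → (V (ι (b.coeff j * algebraMap k L π)⁻¹) * s ^ (-(j : ℤ)) ≤ 1
              ↔ (V (ι (b.coeff j)) * s ^ j)⁻¹ ≤ p) := by
            intro s hs
            rw [key s hs, ← div_eq_mul_inv, div_le_one₀ H.pos]
          filter_upwards [H.eventually_mul_zpow_le ι hroot e he0 (fun l hl => hcase l hl)
            (b.coeff j * algebraMap k L π)⁻¹ (-j) (by
              rw [key' _ hVe]
              have := H.discrete (ι (b.coeff j) * e ^ j)⁻¹ (by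
                rw [map_inv₀, map_mul, map_pow]; exact inv_lt_one_of_one_lt₀ hlt)
              rwa [map_inv₀, map_mul, map_pow] at this)] with y hy hy0
          have hVy : 0 < V (ι y) := by rw [Valuation.pos_iff]; simpa using hy0
          rw [key' _ hVy] at hy
          refine iff_of_false hlt.not_ge (not_le.2 ?_)
          exact (inv_lt_one₀ (mul_pos hVbj (pow_pos hVy _))).1 (hy.trans_lt H.pi_lt)
      filter_upwards [ev1, ev2] with y h1 h2 hy0 ⟨z, hz⟩
      have hz0 : z ^ N ≠ 0 := right_ne_zero_of_mul (hz ▸ he0)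
      have hιy : ι y ≠ 0 := by simpa using hy0
      have e1 : t = e + ι c := by rw [he]; ring
      rw [e1, hbev, map_add, add_comm (ι c), hbev]
      refine (hnear _ (ι (b.coeff j) * e ^ j) ?_).trans
        (SamePred.trans ⟨?_, h2 hy0, fun n hn => ?_⟩
          (hnear _ (ι (b.coeff j) * ι y ^ j) ?_).symm)
      · refine eval_near_dominant (ι : L →+* U) e b j _ fun i _ hij => ?_
        rw [map_mul, map_pow]; exact hdom i hij m₀
      · simp [hbj, he0, hιy]
      · obtain ⟨q, rfl⟩ := hn
        have : ι (b.coeff j) * e ^ j = (ι (b.coeff j) * ι y ^ j) * ((z ^ q) ^ j) ^ n := by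
          rw [hz]; ring
        rw [this]
        refine isPw_mul_pow _ _ (pow_ne_zero _ ?_)
        rw [mul_comm, pow_mul] at hz0
        exact fun h => hz0 (by rw [h, zero_pow (by rintro rfl; simp at hN)])
      · refine eval_near_dominant (ι : L →+* U) (ι y) b j _ fun i hi hij => ?_
        rw [map_mul, map_pow]; exact h1 i hi hij hy0
    obtain ⟨y, z, hy0, hz, hy⟩ := H.exists_of_eventually ι e he0 (fun l hl => hcase l hl) N hN _
      ((Filter.eventually_all_finset G).2 hev)
    exact ⟨c + y, fun g hg => hy g hg hy0 ⟨z, hz⟩⟩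

end PadicLike

end

section

open Polynomial

/-- Two embeddings of `L` inducing the same integrality and power predicates. -/
def Compat {L U Γ : Type*} [Field L] [Field U] [LinearOrderedCommGroupWithZero Γ]
    (V : Valuation U Γ) (ι σ : L →+* U) : Prop :=
  ∀ x : L, ∀ N, 0 < N → SamePred V N (ι x) (σ x)

section

variable {L U Γ : Type*} [Field L] [Field U] [LinearOrderedCommGroupWithZero Γ]
    {V : Valuation U Γ} {ι σ : L →+* U}

lemma Compat.le_iff (h : Compat V ι σ) (x y : L) : V (ι x) ≤ V (ι y) ↔ V (σ x) ≤ V (σ y) := by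
  by_cases hy : y = 0
  · simp [hy]
  have h1 : 0 < V (ι y) := by rw [Valuation.pos_iff]; simpa using hy
  have h2 : 0 < V (σ y) := by rw [Valuation.pos_iff]; simpa using hy
  have := (h (x / y) 1 one_pos).2.1
  rwa [map_div₀, map_div₀, map_div₀, map_div₀, div_le_one₀ h1, div_le_one₀ h2] at this

lemma Compat.lt_iff (h : Compat V ι σ) (x y : L) : V (ι x) < V (ι y) ↔ V (σ x) < V (σ y) := by
  rw [← not_le, ← not_le, h.le_iff]

end

namespace PadicLike

variable {k U Γ : Type*} [Field k] [Field U] [Algebra k U]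
    [LinearOrderedCommGroupWithZero Γ] {V : Valuation U Γ} {π : k} (H : PadicLike k V π)

include H

lemma derivative_near (f : U[X]) (a b y : U) (m : ℕ) (B : Γ) (hy : y ≠ 0)
    (h : ∀ j, 1 ≤ j → V ((taylor a f).coeff j) * V y ^ j * V (algebraMap k U π) ^ m ≤ B * V y)
    (hab : V (b - a) ≤ V y * V (algebraMap k U π) ^ (m + 1)) :
    V ((taylor b f).coeff 1 - (taylor a f).coeff 1) ≤ B * V (algebraMap k U π) := by
  set p := V (algebraMap k U π) with hp
  have hVy : 0 < V y := by rwa [Valuation.pos_iff]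
  rw [taylor_coeff_one, taylor_coeff_one]
  refine eval_sub_le V _ a b _ fun j hj => ?_
  rw [taylor_derivative_coeff, map_mul]
  obtain ⟨j, rfl⟩ := Nat.exists_eq_add_of_le' hj
  refine le_of_mul_le_mul_left ?_ hVy
  calc V y * (V ((j + 1 + 1 : ℕ) : U) * V ((taylor a f).coeff (j + 1 + 1)) * V (b - a) ^ (j + 1))
      ≤ V y * (1 * V ((taylor a f).coeff (j + 1 + 1)) * (V y * p ^ (m + 1)) ^ (j + 1)) := by
        gcongr
        exact V.map_natCast_le_one' _
    _ = (V ((taylor a f).coeff (j + 1 + 1)) * V y ^ (j + 1 + 1) * p ^ m) *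
        (p * (p ^ (m + 1)) ^ j) := by let := maxSemiring Γ; ring
    _ ≤ (B * V y) * (p * 1) :=
      mul_le_mul' (h _ (by omega)) (mul_le_mul' le_rfl (pow_le_one₀ zero_le (H.pow_le_one _)))
    _ = _ := by let := maxSemiring Γ; ring

/-- In the Hensel ball around `a`, the distance to the root is `|f / f'|`. -/
lemma newton_dist (f : U[X]) (a y θ c : U) (m : ℕ) (hθ : f.eval θ = 0)
    (hy : (taylor a f).coeff 1 * y ≠ 0)
    (h : ∀ j, 1 ≤ j → V ((taylor a f).coeff j) * V y ^ j * V (algebraMap k U π) ^ m ≤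
      V ((taylor a f).coeff 1) * V y)
    (hθa : V (θ - a) ≤ V y * V (algebraMap k U π) ^ (m + 1))
    (hca : V (c - a) ≤ V y * V (algebraMap k U π) ^ (m + 1)) :
    V (f.eval c) = V ((taylor a f).coeff 1) * V (θ - c) := by
  set p := V (algebraMap k U π) with hp
  have hy0 := right_ne_zero_of_mul hy
  have hVy : 0 < V y := by rwa [Valuation.pos_iff]
  have hf1 : V ((taylor θ f).coeff 1) = V ((taylor a f).coeff 1) :=
    val_eq_of_near H.pi_lt (H.derivative_near f a θ y m _ hy0 h hθa)
  have hya : V (θ - a) ≤ V y := hθa.trans (mul_le_of_le_one_right zero_le (H.pow_le_one _))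
  have hdist : V (c - θ) ≤ V y * p ^ (m + 1) := by
    have : c - θ = (c - a) - (θ - a) := by ring
    rw [this]; exact (V.map_sub _ _).trans (max_le hca hθa)
  have h' : ∀ j, 1 ≤ j → V ((taylor θ f).coeff j) * V y ^ j ≤
      V ((taylor a f).coeff 1) * V y / p ^ m :=
    fun j hj => recenter V f a θ y 1 _ hya
      (fun i hi => by rw [le_div_iff₀ (H.ppos _)]; exact h i hi) j hj
  set b := (taylor θ f).coeff 1 with hb
  have key : V ((f - C b * (X - C θ)).eval c - (f - C b * (X - C θ)).eval θ) ≤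
      V ((taylor a f).coeff 1) * V (c - θ) * p := by
    refine eval_sub_le V _ θ c _ fun j hj => ?_
    have ht : taylor θ (f - C b * (X - C θ)) = taylor θ f - C b * X := by
      simp [taylor_mul]
    rw [ht, coeff_sub, coeff_C_mul]
    rcases j with _ | _ | j
    · omega
    · simp [hb]
    · have : (X : U[X]).coeff (j + 1 + 1) = 0 := by rw [coeff_X, if_neg (by omega)]
      rw [this, mul_zero, sub_zero]
      refine le_of_mul_le_mul_left ?_ hVy
      calc V y * (V ((taylor θ f).coeff (j + 1 + 1)) * V (c - θ) ^ (j + 1 + 1))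
          = V y * V ((taylor θ f).coeff (j + 1 + 1)) * V (c - θ) ^ (j + 1) * V (c - θ) := by
            let := maxSemiring Γ; ring
        _ ≤ V y * V ((taylor θ f).coeff (j + 1 + 1)) * (V y * p ^ (m + 1)) ^ (j + 1)
              * V (c - θ) := by gcongr
        _ = (V ((taylor θ f).coeff (j + 1 + 1)) * V y ^ (j + 1 + 1)) *
            (p ^ m * p * (p ^ (m + 1)) ^ j * V (c - θ)) := by let := maxSemiring Γ; ring
        _ ≤ (V ((taylor a f).coeff 1) * V y / p ^ m) * (p ^ m * p * 1 * V (c - θ)) := by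
          refine mul_le_mul' (h' _ (by omega)) ?_
          gcongr
          exact pow_le_one₀ zero_le (H.pow_le_one _)
        _ = V ((taylor a f).coeff 1) * V y * (p * V (c - θ)) := by
          rw [mul_one, mul_assoc (p ^ m), ← mul_assoc, div_mul_cancel₀ _ (H.ppos m).ne']
        _ = _ := by let := maxSemiring Γ; ring
  simp only [eval_sub, eval_mul, eval_C, eval_X, hθ, sub_self, mul_zero, sub_zero] at key
  have := val_eq_of_near H.pi_lt (x := f.eval c) (y := b * (c - θ)) (by rw [map_mul, hf1]; exact key)
  rw [this, map_mul, hf1, V.map_sub_swap]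

variable {L : Type*} [Field L] [Algebra k L] (ι σ : L →ₐ[k] U)

/-- Extension of a compatible pair of embeddings to a root lying in a Hensel ball over `L`. -/
lemma exists_conj_of_ball (hc : Compat V (ι : L →+* U) σ) (d : ℕ)
    (hmin : ∀ f : L[X], f ≠ 0 → f.natDegree < d → ∀ θ : U, eval₂ (ι : L →+* U) θ f = 0 →
      ∃ l, ι l = θ)
    (f : L[X]) (hf : f.natDegree = d) (hf0 : f ≠ 0) (θ : U) (hθ : eval₂ (ι : L →+* U) θ f = 0)
    (hθL : ¬ ∃ l, ι l = θ) (hd : ∀ c : L, ∃ l : L, V (θ - ι c) = V (ι l)) :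
    ∃ θ' : U, eval₂ (σ : L →+* U) θ' f = 0 ∧ ∀ g : L[X], g.natDegree < d → ∀ N, 0 < N →
      SamePred V N ((g.map (ι : L →+* U)).eval θ) ((g.map (σ : L →+* U)).eval θ') := by
  set p := V (algebraMap k U π) with hp
  have := H.charZero
  have : CharZero U := charZero_of_injective_algebraMap (algebraMap k U).injective
  have : CharZero L := charZero_of_injective_algebraMap (algebraMap k L).injective
  have hd0 : 0 < d := by
    rcases Nat.eq_zero_or_pos d with h | h
    · rw [h] at hf
      obtain ⟨x, rfl⟩ := natDegree_eq_zero.1 hf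
      simp at hθ hf0
      exact absurd hθ hf0
    · exact h
  have hL : ∀ g : L[X], g.natDegree < d → ∀ t : U, ∃ (c : L) (m : ℕ), ∀ j,
      V ((taylor (ι c) (g.map (ι : L →+* U))).coeff j) * V (t - ι c) ^ j * p ^ m ≤
        V ((g.map (ι : L →+* U)).eval t) := by
    intro g hg t
    exact H.exists_center (ι : L →+* U) (d - 1)
      (fun f hf hfd => hmin f hf (by omega)) g (by omega) t
  set F := f.map (ι : L →+* U) with hF
  set F' := f.map (σ : L →+* U) with hF'
  have hFθ : F.eval θ = 0 := by rwa [hF, eval_map]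
  have hder : (derivative F).eval θ ≠ 0 := by
    intro h
    rw [hF, derivative_map, eval_map] at h
    refine hθL (hmin (derivative f) ?_ (by rw [natDegree_derivative]; omega) θ h)
    intro h0
    have := derivative_eq_zero.1 h0
    omega
  obtain ⟨c, m₀, hc₀⟩ := hL (derivative f) (by rw [natDegree_derivative]; omega) θ
  obtain ⟨m₁, hm₁⟩ := H.nat_val_unif d
  set e := θ - ι c with he
  have he0 : e ≠ 0 := fun h => hθL ⟨c, (sub_eq_zero.1 h).symm⟩
  have hVe : 0 < V e := by rwa [Valuation.pos_iff]
  have hb : ∀ j, 1 ≤ j → V ((taylor (ι c) F).coeff j) * V e ^ j * p ^ (m₀ + m₁) ≤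
      V ((derivative F).eval θ) * V e := by
    intro j hj
    obtain ⟨j, rfl⟩ := Nat.exists_eq_add_of_le' hj
    rcases lt_or_ge d (j + 1) with hjd | hjd
    · rw [coeff_eq_zero_of_natDegree_lt (by rw [natDegree_taylor, hF, natDegree_map, hf]; exact hjd)]
      simp
    have := hc₀ j
    rw [← derivative_map, taylor_derivative_coeff, map_mul] at this
    calc _ = p ^ m₁ * V ((taylor (ι c) F).coeff (j + 1)) * V e ^ j * p ^ m₀ * V e := by
          let := maxSemiring Γ; ring
      _ ≤ V ((j + 1 : ℕ) : U) * V ((taylor (ι c) F).coeff (j + 1)) * V e ^ j * p ^ m₀ * V e := by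
        gcongr
        exact hm₁ _ (by omega) hjd
      _ ≤ _ := mul_le_mul' this le_rfl
  set m := m₀ + m₁ with hm
  obtain ⟨l, hl⟩ := hd c
  rw [← he] at hl
  have hl0 : l ≠ 0 := by rintro rfl; simp at hl; exact he0 hl
  obtain ⟨κ, hκ, -⟩ := H.exists_approx ι e l hl0 hl (2 * m + 1) (by omega)
  set a := c + l * algebraMap k L κ with ha
  have hθa : V (θ - ι a) ≤ V e * p ^ (2 * m + 1) := by
    rw [ha, map_add, ← sub_sub]; exact hκ
  have hac : V (ι a - ι c) ≤ V e := by
    have : ι a - ι c = e - (θ - ι a) := by rw [he]; ring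
    rw [this]
    exact (V.map_sub _ _).trans (max_le le_rfl
      (hθa.trans (mul_le_of_le_one_right zero_le (H.pow_le_one _))))
  have hba : ∀ j, 1 ≤ j → V ((taylor (ι a) F).coeff j) * V e ^ j * p ^ m ≤
      V ((derivative F).eval θ) * V e := by
    intro j hj
    rw [← le_div_iff₀ (H.ppos _)]
    exact recenter V F (ι c) (ι a) e 1 _ hac
      (fun i hi => by rw [le_div_iff₀ (H.ppos _)]; exact hb i hi) j hj
  have hθa' : V (θ - ι a) ≤ V e * p ^ (m + 1) :=
    hθa.trans (mul_le_mul' le_rfl (H.pow_anti (by omega)))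
  have hda : V ((taylor (ι a) F).coeff 1) = V ((derivative F).eval θ) := by
    rw [← taylor_coeff_one]
    refine val_eq_of_near H.pi_lt ?_
    rw [V.map_sub_swap]
    refine H.derivative_near F (ι a) θ e m _ he0 (fun j hj => ?_) hθa'
    rw [taylor_coeff_one]; exact hba j hj
  have hfa : V (F.eval (ι a)) ≤ V ((taylor (ι a) F).coeff 1) * V e * p ^ (m + 1) := by
    rw [← V.map_neg, ← zero_sub, ← hFθ]
    refine eval_sub_le V F (ι a) θ _ fun j hj => ?_
    obtain ⟨j, rfl⟩ := Nat.exists_eq_add_of_le' hj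
    calc _ ≤ V ((taylor (ι a) F).coeff (j + 1)) * (V e * p ^ (2 * m + 1)) ^ (j + 1) := by gcongr
      _ = (V ((taylor (ι a) F).coeff (j + 1)) * V e ^ (j + 1) * p ^ m) *
          (p ^ (m + 1) * (p ^ (2 * m + 1)) ^ j) := by let := maxSemiring Γ; ring
      _ ≤ (V ((derivative F).eval θ) * V e) * (p ^ (m + 1) * 1) :=
        mul_le_mul' (hba _ (by omega))
          (mul_le_mul' le_rfl (pow_le_one₀ zero_le (H.pow_le_one _)))
      _ = _ := by rw [hda, mul_one]
  have tc : ∀ (τ : L →ₐ[k] U) (g : L[X]) (x : L) (j : ℕ),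
      (taylor (τ x) (g.map (τ : L →+* U))).coeff j = τ ((taylor x g).coeff j) := by
    intro τ g x j
    have : taylor (τ x) (g.map (τ : L →+* U)) = (taylor x g).map (τ : L →+* U) := by
      rw [map_taylor]; simp
    rw [this, coeff_map]; simp
  have te : ∀ (τ : L →ₐ[k] U) (g : L[X]) (x : L),
      (g.map (τ : L →+* U)).eval (τ x) = τ (g.eval x) := by
    intro τ g x
    have := eval_map_apply (f := (τ : L →+* U)) (p := g) x
    simpa using this
  set q := algebraMap k L π with hq
  have tp : ∀ (τ : L →ₐ[k] U) (n : ℕ), V (τ (q ^ n)) = p ^ n := by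
    intro τ n; rw [map_pow, AlgHom.commutes, map_pow]
  have hle := fun x y => hc.le_iff x y
  have hlt := fun x y => hc.lt_iff x y
  simp only [RingHom.coe_coe] at hle hlt
  set b := (taylor a f).coeff 1 with hbdef
  have hb0 : ι b ≠ 0 := by
    rw [hbdef, ← tc]
    intro h
    rw [h, map_zero] at hda
    exact hder (by simpa using hda.symm)
  have hb0' : b ≠ 0 := by rintro h; simp [h] at hb0
  have hσb : σ b ≠ 0 := by simpa using hb0'
  have hσl : σ l ≠ 0 := by simpa using hl0
  have B1 : ∀ j, 1 ≤ j → V (ι ((taylor a f).coeff j)) * V (ι l) ^ j * p ^ m ≤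
      V (ι b) * V (ι l) := by
    intro j hj
    rw [← tc, hbdef, ← tc, hda, ← hl]
    exact hba j hj
  have B2 : V (ι (f.eval a)) ≤ V (ι b) * V (ι l) * p ^ (m + 1) := by
    rw [← te, hbdef, ← tc, ← hl]; exact hfa
  have B1' : ∀ j, 1 ≤ j → V (σ ((taylor a f).coeff j)) * V (σ l) ^ j * p ^ m ≤
      V (σ b) * V (σ l) := by
    intro j hj
    have := (hle ((taylor a f).coeff j * l ^ j * q ^ m) (b * l)).1 (by
      rw [map_mul, map_mul, map_mul, map_mul, tp, map_mul, map_mul, map_pow, map_pow]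
      exact B1 j hj)
    rwa [map_mul, map_mul, map_mul, map_mul, tp, map_mul, map_mul, map_pow, map_pow] at this
  have B2' : V (σ (f.eval a)) ≤ V (σ b) * V (σ l) * p ^ (m + 1) := by
    have := (hle (f.eval a) (b * l * q ^ (m + 1))).1 (by
      rw [map_mul, map_mul, map_mul, map_mul, tp]; exact B2)
    rwa [map_mul, map_mul, map_mul, map_mul, tp] at this
  have hpos' : 0 < V (σ b) * V (σ l) := by
    rw [← map_mul, Valuation.pos_iff]; exact mul_ne_zero hσb hσl
  obtain ⟨θ', hθ', hdist'⟩ := hensel_scaled V H.hensel F' (σ a) (σ (l * q ^ m))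
    (by rw [tc]; exact mul_ne_zero hσb (by
      rw [map_mul]; exact mul_ne_zero hσl (by simpa [hq] using fun h => absurd h H.pi_ne)))
    (by
      intro j hj
      rw [tc, tc, map_mul, map_mul, tp]
      obtain ⟨j, rfl⟩ := Nat.exists_eq_add_of_le' hj
      calc _ = (V (σ ((taylor a f).coeff (j + 2))) * V (σ l) ^ (j + 2) * p ^ m) *
            (p ^ m * (p ^ m) ^ j) := by let := maxSemiring Γ; ring
        _ ≤ (V (σ b) * V (σ l)) * (p ^ m * 1) :=
          mul_le_mul' (B1' _ (by omega))
            (mul_le_mul' le_rfl (pow_le_one₀ zero_le (H.pow_le_one _)))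
        _ = _ := by rw [mul_one, mul_assoc])
    (by
      rw [te, tc, map_mul, map_mul, tp, ← mul_assoc]
      refine B2'.trans_lt (mul_lt_mul_of_pos_left ?_ hpos')
      exact pow_lt_pow_right_of_lt_one₀ H.pos H.pi_lt (by omega))
  have hθa'' : V (θ' - σ a) ≤ V (σ l) * p ^ (m + 1) := by
    rw [tc, te] at hdist'
    have h1 : 0 < V (σ b) := by rwa [Valuation.pos_iff]
    refine le_of_mul_le_mul_right ?_ h1
    calc _ ≤ _ := hdist'.trans B2'
      _ = _ := by let := maxSemiring Γ; ring
  refine ⟨θ', by rwa [hF', eval_map] at hθ', fun g hg N hN => ?_⟩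
  rw [hl] at hθa'
  have hlne : ι l ≠ 0 := by simpa using hl0
  have nι : ∀ x : L, V (ι x - ι a) ≤ V (ι l) * p ^ (m + 1) →
      V (θ - ι x) = V (ι (f.eval x / b)) := by
    intro x hx
    have := H.newton_dist F (ι a) (ι l) θ (ι x) m hFθ (by rw [tc]; exact mul_ne_zero hb0 hlne)
      (fun j hj => by rw [tc, tc]; exact B1 j hj) hθa' hx
    rw [tc, te] at this
    rw [map_div₀, map_div₀, this, mul_div_cancel_left₀]
    rwa [V.ne_zero_iff]
  have nσ : ∀ x : L, V (σ x - σ a) ≤ V (σ l) * p ^ (m + 1) →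
      V (θ' - σ x) = V (σ (f.eval x / b)) := by
    intro x hx
    have := H.newton_dist F' (σ a) (σ l) θ' (σ x) m hθ' (by rw [tc]; exact mul_ne_zero hσb hσl)
      (fun j hj => by rw [tc, tc]; exact B1' j hj) hθa'' hx
    rw [tc, te] at this
    rw [map_div₀, map_div₀, this, mul_div_cancel_left₀]
    rwa [V.ne_zero_iff]
  obtain ⟨mN, hmN, hnear⟩ := H.samePred_of_near N hN
  obtain ⟨cg, mg, hcg⟩ := hL g hg θ
  have hball : ∀ x : L, V (θ - ι x) ≤ V (ι l) * p ^ (m + 1) →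
      V (ι x - ι a) ≤ V (ι l) * p ^ (m + 1) := by
    intro x hx
    have : ι x - ι a = (θ - ι a) - (θ - ι x) := by ring
    rw [this]; exact (V.map_sub _ _).trans (max_le hθa' hx)
  obtain ⟨c', hc'1, hc'2⟩ : ∃ c' : L, V (θ - ι c') ≤ V (θ - ι cg) ∧
      V (θ - ι c') ≤ V (ι l) * p ^ (m + 1) := by
    rcases le_total (V (θ - ι cg)) (V (θ - ι a)) with h | h
    · exact ⟨cg, le_rfl, h.trans hθa'⟩
    · exact ⟨a, h, hθa'⟩
  have hθc' : θ - ι c' ≠ 0 := fun h => hθL ⟨c', (sub_eq_zero.1 h).symm⟩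
  have hδ := nι c' (hball c' hc'2)
  obtain ⟨κ', hκ', -⟩ := H.exists_approx ι (θ - ι c') (f.eval c' / b) (by
    intro h; rw [h, map_zero, map_zero] at hδ; exact hθc' (by simpa using hδ)) hδ
    (mN + mg) (by omega)
  rw [sub_sub, ← map_add] at hκ'
  set c₂ := c' + f.eval c' / b * algebraMap k L κ' with hc₂
  have hc₂1 : V (θ - ι c₂) ≤ V (θ - ι c') :=
    hκ'.trans (mul_le_of_le_one_right zero_le (H.pow_le_one _))
  have hδ₂ := nι c₂ (hball c₂ (hc₂1.trans hc'2))
  set δ := f.eval c₂ / b with hδdef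
  have hδ₂' := nσ c₂ (by
    have := (hle (c₂ - a) (l * q ^ (m + 1))).1 (by
      rw [map_sub, map_mul, map_mul, tp]; exact hball c₂ (hc₂1.trans hc'2))
    rwa [map_sub, map_mul, map_mul, tp] at this)
  have G1 : ∀ j, 1 ≤ j → V ((taylor (ι c₂) (g.map (ι : L →+* U))).coeff j) *
      V (θ - ι c₂) ^ j ≤ V ((g.map (ι : L →+* U)).eval θ) * p ^ mN := by
    intro j hj
    have h1 := recenter V (g.map (ι : L →+* U)) (ι cg) (ι c₂) (θ - ι cg) 0
      (V ((g.map (ι : L →+* U)).eval θ) / p ^ mg) (by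
        have : ι c₂ - ι cg = (θ - ι cg) - (θ - ι c₂) := by ring
        rw [this]; exact (V.map_sub _ _).trans (max_le le_rfl (hc₂1.trans hc'1)))
      (fun i _ => by rw [le_div_iff₀ (H.ppos _)]; exact hcg i) j (Nat.zero_le _)
    have h2 : V (θ - ι c₂) ≤ V (θ - ι cg) * p ^ (mN + mg) :=
      hκ'.trans (mul_le_mul' hc'1 le_rfl)
    obtain ⟨j, rfl⟩ := Nat.exists_eq_add_of_le' hj
    calc _ ≤ V ((taylor (ι c₂) (g.map (ι : L →+* U))).coeff (j + 1)) *
          (V (θ - ι cg) * p ^ (mN + mg)) ^ (j + 1) := by gcongr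
      _ = V ((taylor (ι c₂) (g.map (ι : L →+* U))).coeff (j + 1)) * V (θ - ι cg) ^ (j + 1) *
          (p ^ (mN + mg) * (p ^ (mN + mg)) ^ j) := by let := maxSemiring Γ; ring
      _ ≤ V ((g.map (ι : L →+* U)).eval θ) / p ^ mg * (p ^ (mN + mg) * 1) :=
        mul_le_mul' h1 (mul_le_mul' le_rfl (pow_le_one₀ zero_le (H.pow_le_one _)))
      _ = _ := by
        rw [pow_add, mul_one, mul_comm (p ^ mN), ← mul_assoc, div_mul_cancel₀ _ (H.ppos _).ne']
  have hg1 := eval_sub_le V _ _ _ _ G1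
  have hVg : V (ι (g.eval c₂)) = V ((g.map (ι : L →+* U)).eval θ) := by
    rw [← te]
    exact val_eq_of_near (H.pow_lt_one' hmN) (by rwa [V.map_sub_swap])
  have G2 : ∀ j, 1 ≤ j → V ((taylor (σ c₂) (g.map (σ : L →+* U))).coeff j) *
      V (θ' - σ c₂) ^ j ≤ V (σ (g.eval c₂)) * p ^ mN := by
    intro j hj
    have := (hle ((taylor c₂ g).coeff j * δ ^ j) (g.eval c₂ * q ^ mN)).1 (by
      rw [map_mul, map_mul, map_mul, map_mul, tp, hVg, map_pow, map_pow, ← hδ₂, ← tc]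
      exact G1 j hj)
    rwa [map_mul, map_mul, map_mul, map_mul, tp, map_pow, map_pow, ← hδ₂', ← tc] at this
  have hg2 := eval_sub_le V _ _ _ _ G2
  rw [te] at hg2 hg1
  refine (hnear _ _ ?_).trans ((hc (g.eval c₂) N hN).trans (hnear _ _ hg2).symm)
  simp only [RingHom.coe_coe]
  rwa [hVg]

end PadicLike

end

section

open Polynomial

namespace PadicLike

variable {k U Γ : Type*} [Field k] [Field U] [Algebra k U]
    [LinearOrderedCommGroupWithZero Γ] {V : Valuation U Γ} {π : k} (H : PadicLike k V π)
  {L : Type*} [Field L] [Algebra k L] (ι σ : L →ₐ[k] U)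

include H

/-- A root whose distance to some point of `L` is not a value of `L` yields a radical over `L`. -/
lemma exists_radical (d : ℕ)
    (hmin : ∀ f : L[X], f ≠ 0 → f.natDegree < d → ∀ θ : U, eval₂ (ι : L →+* U) θ f = 0 →
      ∃ l, ι l = θ)
    (f : L[X]) (hf : f.natDegree = d) (hf0 : f ≠ 0) (θ : U) (hθ : eval₂ (ι : L →+* U) θ f = 0)
    (c : L) (hc : ∀ l : L, V (θ - ι c) ≠ V (ι l)) :
    ∃ (y : U) (l : L), 0 < d ∧ l ≠ 0 ∧ y ^ d = ι l ∧ (¬ ∃ x, ι x = y) ∧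
      ∀ n, 1 ≤ n → n < d → ∀ l : L, l ≠ 0 → V y ^ n ≠ V (ι l) := by
  set e := θ - ι c with he
  have he0 : e ≠ 0 := fun h => hc 0 (by rw [h]; simp)
  have hVe : 0 < V e := by rwa [Valuation.pos_iff]
  have hlow : ∀ n, 1 ≤ n → n < d → ∀ l : L, l ≠ 0 → V e ^ n ≠ V (ι l) := by
    intro n hn hnd l hl h
    obtain ⟨y, l', hl', hy, hye⟩ := H.exists_pow_root ι e l n hn hl h
    obtain ⟨x, rfl⟩ := hmin (X ^ n - C l') (X_pow_sub_C_ne_zero hn l')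
      (by rwa [natDegree_X_pow_sub_C]) y (by simp [hy])
    exact hc x hye.symm
  have hex : ∃ n, 1 ≤ n ∧ n ≤ d ∧ ∃ l : L, l ≠ 0 ∧ V e ^ n = V (ι l) := by
    by_contra! hno
    obtain ⟨j, hj, hdom⟩ := H.exists_dominant ι e he0 d hno (taylor c f)
      (by rw [natDegree_taylor, hf]) (by simpa using hf0)
    have h1 := eval_near_dominant (V := V) (ι : L →+* U) e (taylor c f) j
      (V (ι ((taylor c f).coeff j) * e ^ j) * V (algebraMap k U π) ^ 1) (fun i _ hij => by
        rw [map_mul, map_pow]; exact hdom i hij 1)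
    have h2 := val_eq_of_near (H.pow_lt_one' le_rfl) h1
    have h3 : ((taylor c f).map (ι : L →+* U)).eval e = 0 := by
      rw [map_taylor, taylor_eval, RingHom.coe_coe, he, sub_add_cancel, eval_map, hθ]
    rw [h3, map_zero, eq_comm, V.zero_iff] at h2
    have : ι ((taylor c f).coeff j) ≠ 0 := by simpa using mem_support_iff.1 hj
    exact (mul_ne_zero this (pow_ne_zero _ he0)) h2
  obtain ⟨n, hn, hnd, l, hl, h⟩ := hex
  obtain rfl : n = d := by
    by_contra hne
    exact hlow n hn (by omega) l hl h
  obtain ⟨y, l', hl', hy, hye⟩ := H.exists_pow_root ι e l n hn hl h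
  refine ⟨y, l', hn, hl', hy, ?_, by rwa [hye]⟩
  rintro ⟨x, rfl⟩
  exact hc x hye.symm

lemma exists_conj_of_radical (hc : Compat V (ι : L →+* U) σ) (d : ℕ) (hd : 0 < d) (y : U) (l : L)
    (hl : l ≠ 0) (hy : y ^ d = ι l)
    (hlow : ∀ n, 1 ≤ n → n < d → ∀ l : L, l ≠ 0 → V y ^ n ≠ V (ι l)) :
    ∃ y' : U, y' ^ d = σ l ∧ ∀ g : L[X], g.natDegree < d → ∀ N, 0 < N →
      SamePred V N ((g.map (ι : L →+* U)).eval y) ((g.map (σ : L →+* U)).eval y') := by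
  classical
  have hιl : ι l ≠ 0 := by simpa using hl
  have hσl : σ l ≠ 0 := by simpa using hl
  have hy0 : y ≠ 0 := by rintro rfl; rw [zero_pow hd.ne'] at hy; exact hιl hy.symm
  let P : ℕ → U → Prop := fun N y' => ∃ (κ : k) (z z' : U), κ ≠ 0 ∧
    y = algebraMap k U κ * z ^ N ∧ y' = algebraMap k U κ * z' ^ N
  have hP : ∀ N, 0 < N → ∃ y' : U, y' ^ d = σ l ∧ P N y' := by
    intro N hN
    obtain ⟨S, hS0, hS⟩ := H.power_reps N hN
    obtain ⟨κ, hκ, z, hz⟩ := hS y hy0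
    have hκ0 : algebraMap k U κ ≠ 0 := by simpa using hS0 κ hκ
    have h1 : IsPw (d * N) (ι (l / algebraMap k L κ ^ d)) := by
      refine ⟨z, ?_⟩
      rw [map_div₀, map_pow, AlgHom.commutes, ← hy, hz, mul_pow]
      field_simp
      ring
    obtain ⟨z', hz'⟩ := ((hc (l / algebraMap k L κ ^ d) (d * N) (by positivity)).2.2 _ dvd_rfl).1 h1
    refine ⟨algebraMap k U κ * z' ^ N, ?_, κ, z, z', hS0 κ hκ, hz, rfl⟩
    rw [mul_pow, ← pow_mul, mul_comm N, hz', RingHom.coe_coe, map_div₀, map_pow, AlgHom.commutes]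
    field_simp
  have hmono : ∀ M N y', M ∣ N → P N y' → P M y' := by
    rintro M _ y' ⟨q, rfl⟩ ⟨κ, z, z', hκ, h1, h2⟩
    exact ⟨κ, z ^ q, z' ^ q, hκ, by rw [h1]; ring, by rw [h2]; ring⟩
  have hall : ∃ y' : U, y' ^ d = σ l ∧ ∀ N, 0 < N → P N y' := by
    by_contra! hno
    choose! n hn0 hn using hno
    have hmem : ∀ x : U, x ^ d = σ l ↔ x ∈ (nthRoots d (σ l)).toFinset := by
      intro x; rw [Multiset.mem_toFinset, mem_nthRoots hd]
    obtain ⟨y', h1, h2⟩ := hP (∏ x ∈ (nthRoots d (σ l)).toFinset, n x)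
      (Finset.prod_pos fun x hx => hn0 x ((hmem x).2 hx))
    exact hn y' h1 (hmono _ _ _ (Finset.dvd_prod_of_mem n ((hmem y').1 h1)) h2)
  obtain ⟨y', hy', hPy⟩ := hall
  have hy'0 : y' ≠ 0 := by rintro rfl; rw [zero_pow hd.ne'] at hy'; exact hσl hy'.symm
  refine ⟨y', hy', ?_⟩
  have tr : ∀ (a b : L) (i j : ℕ), V (ι a) * V y ^ i ≤ V (ι b) * V y ^ j ↔
      V (σ a) * V y' ^ i ≤ V (σ b) * V y' ^ j := by
    intro a b i j
    rw [← pow_le_pow_iff_left₀ zero_le zero_le hd.ne',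
      ← pow_le_pow_iff_left₀ (a := V (σ a) * V y' ^ i) zero_le zero_le hd.ne']
    have e1 : ∀ (a : L) (i : ℕ), (V (ι a) * V y ^ i) ^ d = V (ι (a ^ d * l ^ i)) := by
      intro a i
      rw [map_mul, map_pow, map_pow, map_mul, map_pow, map_pow, ← hy, map_pow]
      let := maxSemiring Γ; ring
    have e2 : ∀ (a : L) (i : ℕ), (V (σ a) * V y' ^ i) ^ d = V (σ (a ^ d * l ^ i)) := by
      intro a i
      rw [map_mul, map_pow, map_pow, map_mul, map_pow, map_pow, ← hy', map_pow]
      let := maxSemiring Γ; ring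
    rw [e1, e1, e2, e2]
    exact hc.le_iff _ _
  intro g hg N hN
  by_cases hg0 : g = 0
  · simp [hg0, SamePred.refl]
  obtain ⟨m, hm1, hm⟩ := H.samePred_of_near N hN
  obtain ⟨j, hj, hdom⟩ := H.exists_dominant ι y hy0 (d - 1)
    (fun n hn hnd => hlow n hn (by omega)) g (by omega) hg0
  have hgj : g.coeff j ≠ 0 := mem_support_iff.1 hj
  refine (hm _ (ι (g.coeff j) * y ^ j) ?_).trans
        (SamePred.trans ⟨?_, ?_, fun n hn => ?_⟩
          (hm _ (σ (g.coeff j) * y' ^ j) ?_).symm)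
  · refine eval_near_dominant (ι : L →+* U) y g j _ fun i _ hij => ?_
    rw [map_mul, map_pow]; exact hdom i hij m
  · simp [hgj, hy0, hy'0]
  · have := tr (g.coeff j) 1 j 0
    simpa using this
  · obtain ⟨κ, z, z', hκ, h1, h2⟩ := hPy N hN
    have hκ0 : algebraMap k U κ ≠ 0 := by simpa using hκ
    have hz : z ≠ 0 := by rintro rfl; rw [zero_pow hN.ne', mul_zero] at h1; exact hy0 h1
    have hz' : z' ≠ 0 := by rintro rfl; rw [zero_pow hN.ne', mul_zero] at h2; exact hy'0 h2
    obtain ⟨q, rfl⟩ := hn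
    have e1 : ι (g.coeff j) * y ^ j =
        ι (g.coeff j * algebraMap k L κ ^ j) * (z ^ (q * j)) ^ n := by
      rw [h1, map_mul, map_pow, AlgHom.commutes]; ring
    have e2 : σ (g.coeff j) * y' ^ j =
        σ (g.coeff j * algebraMap k L κ ^ j) * (z' ^ (q * j)) ^ n := by
      rw [h2, map_mul, map_pow, AlgHom.commutes]; ring
    rw [e1, e2, isPw_mul_pow _ _ (pow_ne_zero _ hz), isPw_mul_pow _ _ (pow_ne_zero _ hz')]
    exact (hc _ (n * q) hN).2.2 n (dvd_mul_right _ _)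
  · refine eval_near_dominant (σ : L →+* U) y' g j _ fun i _ hij => ?_
    have h1 := hdom i hij m
    have h2 := (tr (g.coeff i) (g.coeff j * algebraMap k L π ^ m) i j).1 (by
      rw [map_mul, map_mul, map_pow, map_pow, AlgHom.commutes, mul_right_comm]; exact h1)
    rw [map_mul, map_mul, map_pow, map_pow, AlgHom.commutes, mul_right_comm] at h2
    rw [map_mul, map_pow]
    exact h2

/-- A compatible pair of embeddings of a field that is not relatively algebraically closed
extends to the field generated by some algebraic element. -/
lemma exists_conj (hc : Compat V (ι : L →+* U) σ)
    (hL : ¬ ∀ f : L[X], f ≠ 0 → ∀ θ : U, eval₂ (ι : L →+* U) θ f = 0 → ∃ l, ι l = θ) :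
    ∃ (f : L[X]) (y y' : U), f ≠ 0 ∧ (¬ ∃ l, ι l = y) ∧ eval₂ (ι : L →+* U) y f = 0 ∧
      eval₂ (σ : L →+* U) y' f = 0 ∧ ∀ g : L[X], g.natDegree < f.natDegree → ∀ N, 0 < N →
      SamePred V N ((g.map (ι : L →+* U)).eval y) ((g.map (σ : L →+* U)).eval y') := by
  classical
  have hex : ∃ d, ∃ f : L[X], f.natDegree = d ∧ f ≠ 0 ∧
      ∃ θ : U, eval₂ (ι : L →+* U) θ f = 0 ∧ ¬ ∃ l, ι l = θ := by
    push Not at hL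
    obtain ⟨f, hf, θ, h1, h2⟩ := hL
    exact ⟨_, f, rfl, hf, θ, h1, by push Not; exact h2⟩
  obtain ⟨f, hf, hf0, θ, hθ, hθL⟩ := Nat.find_spec hex
  set d := Nat.find hex
  have hmin : ∀ f : L[X], f ≠ 0 → f.natDegree < d → ∀ θ : U, eval₂ (ι : L →+* U) θ f = 0 →
      ∃ l, ι l = θ := by
    intro f hf hfd θ hθ
    by_contra hno
    exact Nat.find_min hex hfd ⟨f, rfl, hf, θ, hθ, hno⟩
  by_cases hd : ∀ c : L, ∃ l : L, V (θ - ι c) = V (ι l)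
  · obtain ⟨θ', h1, h2⟩ := H.exists_conj_of_ball ι σ hc d hmin f hf hf0 θ hθ hθL hd
    exact ⟨f, θ, θ', hf0, hθL, hθ, h1, by rwa [hf]⟩
  · push Not at hd
    obtain ⟨c, hcl⟩ := hd
    obtain ⟨y, l, hd0, hl, hy, hyL, hlow⟩ := H.exists_radical ι d hmin f hf hf0 θ hθ c hcl
    obtain ⟨y', hy', h2⟩ := H.exists_conj_of_radical ι σ hc d hd0 y l hl hy hlow
    exact ⟨X ^ d - C l, y, y', X_pow_sub_C_ne_zero hd0 l, hyL, by simp [hy], by simp [hy'],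
      by rwa [natDegree_X_pow_sub_C]⟩

end PadicLike

end

section

open Polynomial

namespace PadicLike

variable {k U Γ : Type*} [Field k] [Field U] [Algebra k U]
    [LinearOrderedCommGroupWithZero Γ] {V : Valuation U Γ} {π : k} (H : PadicLike k V π)

include H

omit [Field k] [Algebra k U] H in
lemma exists_unit_nat : ∃ M : ℕ, 2 ≤ M ∧ V (M : U) = 1 := by
  rcases lt_or_ge (V ((2 : ℕ) : U)) 1 with h | h
  · refine ⟨3, by norm_num, ?_⟩
    have : ((3 : ℕ) : U) = 1 + (2 : ℕ) := by push_cast; norm_num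
    rw [this]
    exact V.map_one_add_of_lt h
  · exact ⟨2, le_rfl, le_antisymm (V.map_natCast_le_one' 2) h⟩

/-- Divisibility is expressible by a power predicate. -/
lemma exists_le_iff_isPw : ∃ M : ℕ, 0 < M ∧ ∀ x y : U,
    V x ≤ V y ↔ IsPw M (y ^ M + algebraMap k U π * x ^ M) := by
  obtain ⟨M, hM, hVM⟩ := exists_unit_nat (V := V)
  have hM0 : 0 < M := by omega
  have near : ∀ x : U, V x < 1 → IsPw M (1 + x) := by
    intro x hx
    have ht : taylor (1 : U) (X ^ M - C (1 + x)) = (X + 1) ^ M - C (1 + x) := by simp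
    obtain ⟨s, hs, -⟩ := H.hensel (taylor (1 : U) (X ^ M - C (1 + x))) (fun i => by
        rw [ht, coeff_sub, coeff_X_add_one_pow, coeff_C]
        refine (V.map_sub _ _).trans (max_le (V.map_natCast_le_one' _) ?_)
        split_ifs
        · exact (V.map_add _ _).trans (max_le (by simp) hx.le)
        · simp)
      (by rw [ht, coeff_sub, coeff_X_add_one_pow, coeff_C, if_neg one_ne_zero,
            sub_zero, Nat.choose_one_right, hVM])
      (by rw [ht, coeff_sub, coeff_X_add_one_pow, coeff_C, if_pos rfl]
          simpa using hx)
    refine ⟨s + 1, ?_⟩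
    rw [taylor_eval] at hs
    simpa [sub_eq_zero] using hs
  refine ⟨M, hM0, fun x y => ⟨fun h => ?_, fun h => ?_⟩⟩
  · by_cases hy : y = 0
    · subst hy
      have : x = 0 := by simpa using h
      exact ⟨0, by rw [this, zero_pow hM0.ne']; simp⟩
    obtain ⟨w, hw⟩ := near (algebraMap k U π * (x / y) ^ M) (by
      rw [map_mul, map_pow, map_div₀]
      refine (mul_le_of_le_one_right' (pow_le_one₀ zero_le (div_le_one_of_le₀ h zero_le))).trans_lt
        H.pi_lt)
    refine ⟨y * w, ?_⟩
    rw [mul_pow, hw, div_pow]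
    field_simp
  · by_contra! hlt
    have hx : x ≠ 0 := by rintro rfl; simp at hlt
    have hVx : 0 < V x := by rwa [Valuation.pos_iff]
    have h1 : V (y / x) ≤ V (algebraMap k U π) := H.discrete _ (by
      rw [map_div₀, div_lt_one₀ hVx]; exact hlt)
    have hpi := H.pi_ne'
    obtain ⟨w, hw⟩ := near ((algebraMap k U π)⁻¹ * (y / x) ^ M) (by
      rw [map_mul, map_inv₀, map_pow, inv_mul_lt_iff₀ H.pos, mul_one]
      calc V (y / x) ^ M ≤ V (algebraMap k U π) ^ M := pow_le_pow_left₀ zero_le h1 _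
        _ ≤ V (algebraMap k U π) ^ 2 := H.pow_anti hM
        _ < _ := by
          rw [pow_two]; exact mul_lt_of_lt_one_right H.pos H.pi_lt)
    obtain ⟨u, hu⟩ := h
    have h2 : y ^ M + algebraMap k U π * x ^ M = algebraMap k U π * (x * w) ^ M := by
      rw [mul_pow, hw, div_pow]; field_simp; ring
    have hw0 : w ≠ 0 := by
      rintro rfl
      rw [zero_pow hM0.ne'] at hw
      have h3 : V ((algebraMap k U π)⁻¹ * (y / x) ^ M) = 1 := by
        rw [← neg_eq_iff_add_eq_zero.2 hw.symm]; simp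
      have h4 : V ((algebraMap k U π)⁻¹ * (y / x) ^ M) < 1 := by
        rw [map_mul, map_inv₀, map_pow, inv_mul_lt_iff₀ H.pos, mul_one]
        calc V (y / x) ^ M ≤ V (algebraMap k U π) ^ M := pow_le_pow_left₀ zero_le h1 _
          _ ≤ V (algebraMap k U π) ^ 2 := H.pow_anti hM
          _ < _ := by
            rw [pow_two]; exact mul_lt_of_lt_one_right H.pos H.pi_lt
      exact h4.ne h3
    rw [h2] at hu
    have h5 : V (u / (x * w)) ^ M = V (algebraMap k U π) := by
      rw [← map_pow, div_pow, hu, mul_div_assoc, div_self (pow_ne_zero _ (mul_ne_zero hx hw0)),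
        mul_one]
    have h6 : V (u / (x * w)) < 1 := by
      by_contra! hge
      exact (one_le_pow₀ hge).not_gt (h5 ▸ H.pi_lt)
    have h7 := pow_le_pow_left₀ zero_le (H.discrete _ h6) M
    rw [h5] at h7
    refine (h7.trans (H.pow_anti hM)).not_gt ?_
    rw [pow_two]; exact mul_lt_of_lt_one_right H.pos H.pi_lt

lemma compat_of_isPw {L : Type*} [Field L] [Algebra k L] (ι σ : L →ₐ[k] U)
    (h : ∀ x N, 0 < N → (IsPw N (ι x) ↔ IsPw N (σ x))) : Compat V (ι : L →+* U) σ := by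
  obtain ⟨M, hM, hMV⟩ := H.exists_le_iff_isPw
  refine fun x N hN => ⟨by simp, ?_, fun n hn => h x n (Nat.pos_of_dvd_of_pos hn hN)⟩
  have := h (1 ^ M + algebraMap k L π * x ^ M) M hM
  simp only [map_add, map_mul, map_pow, AlgHom.commutes, map_one] at this
  rw [← hMV, ← hMV, V.map_one] at this
  exact this

end PadicLike

end

section

open Polynomial

namespace IntermediateField.Lifts

variable {F E K : Type*} [Field F] [Field E] [Field K] [Algebra F E] [Algebra F K]

/-- Extension of a lift to a simple extension by prescribing the image of the generator. -/
lemma exists_lift_of_root (x : Lifts F E K) {s : E} (h1 : IsIntegral x.carrier s) (r : K)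
    (hr : eval₂ (x.emb : x.carrier →+* K) r (minpoly x.carrier s) = 0) :
    ∃ y : Lifts F E K, x ≤ y ∧ s ∈ y.carrier ∧ ∀ z : y.carrier, ∃ f : x.carrier[X],
      f.natDegree < (minpoly x.carrier s).natDegree ∧ (z : E) = aeval s f ∧
      y.emb z = eval₂ (x.emb : x.carrier →+* K) r f := by
  let : Algebra x.carrier K := x.emb.toRingHom.toAlgebra
  let carrier := x.carrier⟮s⟯.restrictScalars F
  let : Algebra x.carrier carrier := x.carrier⟮s⟯.toSubalgebra.algebra
  let φ : x.carrier⟮s⟯ →ₐ[x.carrier] K := ((algHomAdjoinIntegralEquiv x.carrier h1).symm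
    ⟨r, by
      rw [mem_aroots, and_iff_right (minpoly.ne_zero h1)]
      exact hr⟩)
  have hφ : φ (AdjoinSimple.gen x.carrier s) = r :=
    algHomAdjoinIntegralEquiv_symm_apply_gen x.carrier h1 _
  refine ⟨⟨carrier, (@algHomEquivSigma F x.carrier carrier K _ _ _ _ _ _ _ _
      (IsScalarTower.of_algebraMap_eq fun _ ↦ rfl)).symm ⟨x.emb, φ⟩⟩,
    ⟨fun z hz ↦ algebraMap_mem x.carrier⟮s⟯ ⟨z, hz⟩, φ.commutes⟩,
    mem_adjoin_simple_self x.carrier s, fun z => ?_⟩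
  obtain ⟨f, hf, hz⟩ := (adjoin.powerBasis h1).exists_eq_aeval (y := (z : x.carrier⟮s⟯))
  rw [adjoin.powerBasis_dim] at hf
  rw [adjoin.powerBasis_gen] at hz
  refine ⟨f, hf, ?_, ?_⟩
  · have := congrArg (algebraMap x.carrier⟮s⟯ E) hz
    rw [← aeval_algebraMap_apply, AdjoinSimple.algebraMap_gen] at this
    exact this
  · have := congrArg φ hz
    rw [← aeval_algHom_apply, hφ] at this
    exact this

open scoped algebraAdjoinAdjoin in
/-- The lift sending generators `a i` to `b i`. -/
lemma exists_lift_of_gens {ρ : Type*} (a : ρ → E) (b : ρ → K)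
    (h : ∀ f : MvPolynomial ρ F, MvPolynomial.aeval a f = 0 ↔ MvPolynomial.aeval b f = 0) :
    ∃ y : Lifts F E K, (∀ i, ∃ hi : a i ∈ y.carrier, y.emb ⟨a i, hi⟩ = b i) ∧
      ∀ z : y.carrier, ∃ f g : MvPolynomial ρ F, MvPolynomial.aeval a g ≠ 0 ∧
      (z : E) = MvPolynomial.aeval a f / MvPolynomial.aeval a g ∧
      y.emb z = MvPolynomial.aeval b f / MvPolynomial.aeval b g := by
  let A := Algebra.adjoin F (Set.range a)
  have hmem : ∀ f, MvPolynomial.aeval a f ∈ A := fun f => by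
    rw [show A = _ from Algebra.adjoin_range_eq_range_aeval F a]; exact ⟨f, rfl⟩
  let e : MvPolynomial ρ F →ₐ[F] A := (MvPolynomial.aeval a).codRestrict A hmem
  have he : Function.Surjective e := by
    rintro ⟨x, hx⟩
    rw [show A = _ from Algebra.adjoin_range_eq_range_aeval F a] at hx
    obtain ⟨f, hf⟩ := hx
    exact ⟨f, Subtype.ext hf⟩
  have he0 : ∀ f, (e f : E) = MvPolynomial.aeval a f := fun f => rfl
  let ψ : A →ₐ[F] K := AlgHom.liftOfSurjective e he (MvPolynomial.aeval b) (fun f hf => by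
    have hf' : e f = 0 := hf
    exact (h f).1 (by rw [← he0, hf']; rfl))
  have hψ : ∀ f, ψ (e f) = MvPolynomial.aeval b f := fun f =>
    AlgHom.liftOfSurjective_apply e he _ _ f
  have hinj : Function.Injective ψ := by
    rw [injective_iff_map_eq_zero]
    intro x hx
    obtain ⟨f, rfl⟩ := he x
    rw [hψ] at hx
    exact Subtype.ext ((h f).2 hx)
  let Ψ : adjoin F (Set.range a) →ₐ[F] K := IsFractionRing.liftAlgHom (K := adjoin F (Set.range a)) hinj
  have hΨ : ∀ x : A, Ψ (algebraMap A (adjoin F (Set.range a)) x) = ψ x := fun x =>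
    IsFractionRing.lift_algebraMap hinj x
  refine ⟨⟨adjoin F (Set.range a), Ψ⟩, fun i => ⟨subset_adjoin _ _ ⟨i, rfl⟩, ?_⟩, fun z => ?_⟩
  · have := hΨ (e (MvPolynomial.X i))
    rw [hψ, MvPolynomial.aeval_X] at this
    rw [← this]
    congr 1
    exact Subtype.ext (MvPolynomial.aeval_X a i).symm
  · obtain ⟨x, y, hy, hz⟩ := IsFractionRing.div_surjective (A := A) z
    obtain ⟨f, rfl⟩ := he x
    obtain ⟨g, rfl⟩ := he y
    refine ⟨f, g, ?_, ?_, ?_⟩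
    · rw [← he0]; exact fun h0 => nonZeroDivisors.ne_zero hy (Subtype.ext h0)
    · rw [← hz]; rfl
    · change Ψ z = _
      rw [← hz, map_div₀, hΨ, hΨ, hψ, hψ]

end IntermediateField.Lifts

namespace PadicLike

open IntermediateField

variable {k U Γ : Type*} [Field k] [Field U] [Algebra k U]
    [LinearOrderedCommGroupWithZero Γ] {V : Valuation U Γ} {π : k} (H : PadicLike k V π)

include H

lemma exists_maximal_lift (φ₀ : Lifts k U U)
    (h₀ : Compat V (φ₀.carrier.val : φ₀.carrier →+* U) φ₀.emb) :
    ∃ φ : Lifts k U U, φ₀ ≤ φ ∧ Compat V (φ.carrier.val : φ.carrier →+* U) φ.emb ∧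
      ∀ f : φ.carrier[X], f ≠ 0 → ∀ θ : U, eval₂ (φ.carrier.val : φ.carrier →+* U) θ f = 0 →
        ∃ l, φ.carrier.val l = θ := by
  obtain ⟨φ, hle, hφ⟩ := zorn_le_nonempty₀
    {φ : Lifts k U U | Compat V (φ.carrier.val : φ.carrier →+* U) φ.emb} (fun c hc hchain ψ hψ =>
      ⟨Lifts.union c hchain, fun x N hN => by
        have hx : (x : U) ∈ ⨆ i : c, i.1.carrier := by
          rw [← Lifts.carrier_union c hchain]; exact x.2
        have : Nonempty c := ⟨⟨ψ, hψ⟩⟩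
        have hdir : Directed (· ≤ ·) fun i : c => i.1.carrier :=
          hchain.directedOn.directed_val.mono_comp _ fun _ _ h => h.1
        have hx' : (x : U) ∈ ⋃ i : c, (i.1.carrier : Set U) := by
          rw [← IntermediateField.coe_iSup_of_directed hdir]; exact hx
        obtain ⟨i, hi⟩ := Set.mem_iUnion.1 hx'
        have h1 := hc i.2 ⟨x, hi⟩ N hN
        have h2 := (Lifts.le_union c hchain i.2).2 ⟨x, hi⟩
        simp only [RingHom.coe_coe] at h1 ⊢
        rw [← h2] at h1
        exact h1, Lifts.le_union c hchain⟩) φ₀ h₀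
  refine ⟨φ, hle, hφ.1, ?_⟩
  by_contra hno
  obtain ⟨f, y, y', hf, hyL, hy, hy', hsame⟩ := H.exists_conj φ.carrier.val φ.emb hφ.1 hno
  have hy1 : aeval y f = 0 := hy
  have h_int : IsIntegral φ.carrier y := IsAlgebraic.isIntegral ⟨f, hf, hy1⟩
  have hdvd := minpoly.dvd φ.carrier y hy1
  have hdeg : (minpoly φ.carrier y).natDegree ≤ f.natDegree := natDegree_le_of_dvd hdvd hf
  have hroot : eval₂ (φ.emb : φ.carrier →+* U) y' (minpoly φ.carrier y) = 0 := by
    rcases hdeg.lt_or_eq with hlt | heq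
    · have := (hsame _ hlt 1 one_pos).1
      rw [eval_map, eval_map] at this
      exact this.1 (minpoly.aeval φ.carrier y)
    · obtain ⟨q, hq⟩ := hdvd
      have hq0 : q ≠ 0 := by rintro rfl; simp at hq; exact hf hq
      have hqd : q.natDegree = 0 := by
        have := congrArg natDegree hq
        rw [natDegree_mul (minpoly.ne_zero h_int) hq0] at this
        omega
      obtain ⟨u, rfl⟩ := natDegree_eq_zero.1 hqd
      rw [hq, eval₂_mul, eval₂_C, mul_eq_zero] at hy'
      refine hy'.resolve_right fun h => hq0 ?_
      rw [(map_eq_zero _).1 h, C_0]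
  obtain ⟨φ', hφ', hmem, hz⟩ := φ.exists_lift_of_root h_int y' hroot
  refine hyL ⟨⟨y, (hφ.2 (y := φ') (fun z N hN => ?_) hφ').1 hmem⟩, rfl⟩
  obtain ⟨g, hg, h1, h2⟩ := hz z
  have := hsame g (hg.trans_le hdeg) N hN
  rw [eval_map, eval_map] at this
  simp only [RingHom.coe_coe] at h2 ⊢
  rw [h2, IntermediateField.coe_val, h1]
  exact this

omit [Field k] [Algebra k U] [LinearOrderedCommGroupWithZero Γ] H in
lemma isPw_div_iff {N : ℕ} (hN : 0 < N) (x y : U) (hy : y ≠ 0) :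
    IsPw N (x / y) ↔ IsPw N (x * y ^ (N - 1)) := by
  have : x * y ^ (N - 1) = x / y * y ^ N := by
    obtain ⟨n, rfl⟩ := Nat.exists_eq_add_of_le' hN
    simp; field_simp; ring
  rw [this, isPw_mul_pow _ _ hy]

/-- Back and forth: tuples with the same power predicates have the same one-point extensions. -/
lemma exists_extension {ρ : Type*} (a b : ρ → U)
    (hab : ∀ (f : MvPolynomial ρ k) (N : ℕ), 0 < N →
      (IsPw N (MvPolynomial.aeval a f) ↔ IsPw N (MvPolynomial.aeval b f)))
    (t : U) (S : Finset (ℕ+ × MvPolynomial (Option ρ) k)) :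
    ∃ t' : U, ∀ q ∈ S, (IsPw q.1 (MvPolynomial.aeval (fun o : Option ρ => o.elim t a) q.2) ↔
      IsPw q.1 (MvPolynomial.aeval (fun o : Option ρ => o.elim t' b) q.2)) := by
  classical
  obtain ⟨M, hM, hMV⟩ := H.exists_le_iff_isPw
  have hzero : ∀ x : U, x = 0 ↔ IsPw M (algebraMap k U π * x ^ M) := fun x => by
    have := hMV x 0
    rw [V.map_zero, zero_pow hM.ne', zero_add, le_zero_iff, V.zero_iff] at this
    exact this
  have h0 : ∀ f : MvPolynomial ρ k, MvPolynomial.aeval a f = 0 ↔ MvPolynomial.aeval b f = 0 := by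
    intro f
    rw [hzero, hzero]
    have := hab (MvPolynomial.C π * f ^ M) M hM
    simp only [map_mul, map_pow, MvPolynomial.aeval_C] at this
    exact this
  obtain ⟨φ₀, hφ₀, hz⟩ := Lifts.exists_lift_of_gens a b h0
  have hc₀ : Compat V (φ₀.carrier.val : φ₀.carrier →+* U) φ₀.emb := by
    refine H.compat_of_isPw _ _ fun x N hN => ?_
    obtain ⟨f, g, hg, h1, h2⟩ := hz x
    rw [h2, IntermediateField.coe_val, h1, isPw_div_iff hN _ _ hg,
      isPw_div_iff hN _ _ (fun h => hg ((h0 g).2 h))]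
    have := hab (f * g ^ (N - 1)) N hN
    simp only [map_mul, map_pow] at this
    exact this
  obtain ⟨φ, hle, hc, hL⟩ := H.exists_maximal_lift φ₀ hc₀
  have hmem : ∀ i, a i ∈ φ.carrier := fun i => hle.1 (hφ₀ i).1
  have himg : ∀ i, φ.emb ⟨a i, hmem i⟩ = b i := fun i => by
    rw [← (hφ₀ i).2, ← hle.2]; rfl
  let Θ : MvPolynomial (Option ρ) k →ₐ[k] φ.carrier[X] :=
    MvPolynomial.aeval (fun o : Option ρ => o.elim X fun i => C ⟨a i, hmem i⟩)
  have hΘ : ∀ (χ : φ.carrier →ₐ[k] U) (s : U) (q : MvPolynomial (Option ρ) k),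
      ((Θ q).map (χ : φ.carrier →+* U)).eval s =
        MvPolynomial.aeval (fun o : Option ρ => o.elim s fun i => χ ⟨a i, hmem i⟩) q := by
    intro χ s q
    have : ((eval₂AlgHom χ s fun _ => Commute.all _ _).comp Θ) =
      MvPolynomial.aeval (fun o : Option ρ => o.elim s fun i => χ ⟨a i, hmem i⟩) := by
      ext o; cases o <;> simp [Θ]
    rw [← this, eval_map]; rfl
  obtain ⟨t₀, ht₀⟩ := H.exists_specialization φ.carrier.val hL t (S.image fun q => Θ q.2)
    (∏ q ∈ S, (q.1 : ℕ)) (Finset.prod_pos fun q _ => q.1.pos)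
  refine ⟨φ.emb t₀, fun q hq => ?_⟩
  have h1 := (ht₀ _ (Finset.mem_image_of_mem _ hq)).2.2 q.1 (Finset.dvd_prod_of_mem _ hq)
  have h2 := (hc ((Θ q.2).eval t₀) q.1 q.1.pos).2.2 _ dvd_rfl
  have h3 : ∀ χ : φ.carrier →ₐ[k] U, (χ : φ.carrier →+* U) ((Θ q.2).eval t₀) =
      ((Θ q.2).map (χ : φ.carrier →+* U)).eval (χ t₀) := fun χ => by
    rw [eval_map, ← RingHom.coe_coe χ, eval₂_at_apply]
  rw [h3, h3, hΘ, hΘ] at h2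
  rw [hΘ, hΘ] at h1
  simp only [himg] at h2
  exact h1.trans h2

end PadicLike

end

section

open Polynomial Filter

section germ

variable {k K Γ I : Type*} [Field k] [Field K] [Algebra k K]
    [LinearOrderedCommGroupWithZero Γ] (V : Valuation K Γ) (φ : Ultrafilter I)

/-- The `k`-algebra structure of an ultrapower of `K`. -/
@[reducible] noncomputable def germAlgebra (k : Type*) {K I : Type*} [Field k] [Field K]
    [Algebra k K] (φ : Ultrafilter I) : Algebra k ((φ : Filter I).Germ K) :=
  ((Germ.coeRingHom (φ : Filter I)).comp (algebraMap k (I → K))).toAlgebra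

/-- The valuation subring of an ultrapower. -/
def germSubring : ValuationSubring ((φ : Filter I).Germ K) where
  carrier := {x | x.LiftPred fun y => V y ≤ 1}
  mul_mem' := by
    intro x y hx hy
    induction x using Germ.inductionOn with | _ x
    induction y using Germ.inductionOn with | _ y
    change ∀ᶠ i in _, V (x i * y i) ≤ 1
    have hx : ∀ᶠ i in (φ : Filter I), V (x i) ≤ 1 := hx
    have hy : ∀ᶠ i in (φ : Filter I), V (y i) ≤ 1 := hy
    filter_upwards [hx, hy] with i hx hy
    rw [map_mul]; exact mul_le_one' hx hy
  one_mem' := by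
    change ∀ᶠ i in (φ : Filter I), V 1 ≤ 1
    simp
  add_mem' := by
    intro x y hx hy
    induction x using Germ.inductionOn with | _ x
    induction y using Germ.inductionOn with | _ y
    change ∀ᶠ i in _, V (x i + y i) ≤ 1
    have hx : ∀ᶠ i in (φ : Filter I), V (x i) ≤ 1 := hx
    have hy : ∀ᶠ i in (φ : Filter I), V (y i) ≤ 1 := hy
    filter_upwards [hx, hy] with i hx hy
    exact (V.map_add _ _).trans (max_le hx hy)
  zero_mem' := by
    change ∀ᶠ i in (φ : Filter I), V 0 ≤ 1
    simp
  neg_mem' := by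
    intro x hx
    induction x using Germ.inductionOn with | _ x
    change ∀ᶠ i in _, V (-x i) ≤ 1
    have hx : ∀ᶠ i in (φ : Filter I), V (x i) ≤ 1 := hx
    filter_upwards [hx] with i hx
    rwa [Valuation.map_neg]
  mem_or_inv_mem' := by
    intro x
    induction x using Germ.inductionOn with | _ x
    change (∀ᶠ i in φ, V (x i) ≤ 1) ∨ (∀ᶠ i in φ, V (x i)⁻¹ ≤ 1)
    rw [← Ultrafilter.eventually_or]
    refine Eventually.of_forall fun i => ?_
    rcases le_total (V (x i)) 1 with h | h
    · exact Or.inl h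
    · right; rw [map_inv₀]; exact inv_le_one_of_one_le₀ h

lemma germ_valuation_le_iff (x y : I → K) :
    (germSubring V φ).valuation (x : (φ : Filter I).Germ K) ≤ (germSubring V φ).valuation
      (y : (φ : Filter I).Germ K) ↔ ∀ᶠ i in φ, V (x i) ≤ V (y i) := by
  rw [ValuationSubring.valuation_le_iff]
  constructor
  · rintro ⟨⟨a, ha⟩, h⟩
    induction a using Germ.inductionOn with | _ a
    have ha : ∀ᶠ i in (φ : Filter I), V (a i) ≤ 1 := ha
    have h : ∀ᶠ i in (φ : Filter I), a i * y i = x i := Germ.coe_eq.1 h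
    filter_upwards [ha, h] with i h1 h2
    rw [← h2, map_mul]
    exact mul_le_of_le_one_left' h1
  · intro h
    refine ⟨⟨((fun i => x i / y i : I → K) : (φ : Filter I).Germ K), ?_⟩, Germ.coe_eq.2 ?_⟩
    · change ∀ᶠ i in (φ : Filter I), V (x i / y i) ≤ 1
      filter_upwards [h] with i h
      rw [map_div₀]; exact div_le_one_of_le₀ h zero_le
    · filter_upwards [h] with i h
      by_cases hy : y i = 0
      · rw [hy, V.map_zero, le_zero_iff, V.zero_iff] at h
        simp [h]
      · exact div_mul_cancel₀ _ hy

lemma germ_valuation_lt_iff (x y : I → K) :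
    (germSubring V φ).valuation (x : (φ : Filter I).Germ K) < (germSubring V φ).valuation
      (y : (φ : Filter I).Germ K) ↔ ∀ᶠ i in φ, V (x i) < V (y i) := by
  rw [← not_le, germ_valuation_le_iff, ← Ultrafilter.eventually_not]
  simp only [not_le]

lemma germ_valuation_eq_iff (x y : I → K) :
    (germSubring V φ).valuation (x : (φ : Filter I).Germ K) = (germSubring V φ).valuation
      (y : (φ : Filter I).Germ K) ↔ ∀ᶠ i in φ, V (x i) = V (y i) := by
  simp only [le_antisymm_iff, germ_valuation_le_iff, eventually_and]

lemma germ_isPw_iff (N : ℕ) (x : I → K) :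
    IsPw N (x : (φ : Filter I).Germ K) ↔ ∀ᶠ i in φ, IsPw N (x i) := by
  constructor
  · rintro ⟨y, hy⟩
    induction y using Germ.inductionOn with | _ y
    have hy : ∀ᶠ i in (φ : Filter I), y i ^ N = x i := Germ.coe_eq.1 hy
    exact hy.mono fun i hi => ⟨y i, hi⟩
  · intro h
    obtain ⟨y, hy⟩ := h.choice
    exact ⟨(y : (φ : Filter I).Germ K), Germ.coe_eq.2 hy⟩

lemma germ_aeval {ρ : Type*} (a : ρ → I → K) (f : MvPolynomial ρ k) :
    letI := germAlgebra k (K := K) φ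
    MvPolynomial.aeval (fun j => (a j : (φ : Filter I).Germ K)) f =
      ((fun i => MvPolynomial.aeval (fun j => a j i) f : I → K) : (φ : Filter I).Germ K) := by
  let := germAlgebra k (K := K) φ
  let e : (I → K) →ₐ[k] (φ : Filter I).Germ K :=
    { Germ.coeRingHom (φ : Filter I) with commutes' := fun _ => rfl }
  have h1 : MvPolynomial.aeval (fun j => (a j : (φ : Filter I).Germ K)) f =
      e (MvPolynomial.aeval a f) :=
    (congrArg (fun g => g f) (MvPolynomial.comp_aeval (R := k) a e)).symm
  rw [h1]
  have : MvPolynomial.aeval a f = fun i => MvPolynomial.aeval (fun j => a j i) f := by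
    funext i
    exact (congrArg (fun g => g f) (MvPolynomial.comp_aeval (R := k) a (Pi.evalAlgHom k _ i)))
  rw [this]; rfl

lemma germ_eval (f : (I → K)[X]) (s : I → K) :
    (f.map (Germ.coeRingHom (φ : Filter I))).eval (s : (φ : Filter I).Germ K) =
      ((fun i => (f.map (Pi.evalRingHom _ i)).eval (s i) : I → K) : (φ : Filter I).Germ K) := by
  have h1 : (f.map (Germ.coeRingHom (φ : Filter I))).eval (s : (φ : Filter I).Germ K) =
    Germ.coeRingHom (φ : Filter I) (f.eval s) := by
    rw [eval_map]; exact eval₂_at_apply _ s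
  rw [h1]
  have : f.eval s = fun i => (f.map (Pi.evalRingHom _ i)).eval (s i) := by
    funext i
    rw [eval_map]; exact (eval₂_at_apply (Pi.evalRingHom (fun _ => K) i) s).symm
  rw [this]; rfl

lemma PadicLike.germ {V : Valuation K Γ} {π : k} (H : PadicLike k V π) :
    letI := germAlgebra k (K := K) φ
    PadicLike k (germSubring V φ).valuation π := by
  let := germAlgebra k (K := K) φ
  have hk : ∀ κ : k, algebraMap k ((φ : Filter I).Germ K) κ =
    ((fun _ => algebraMap k K κ : I → K) : (φ : Filter I).Germ K) := fun _ => rfl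
  have h1 : (1 : (germSubring V φ).ValueGroup) =
    (germSubring V φ).valuation ((fun _ => 1 : I → K) : (φ : Filter I).Germ K) :=
      (map_one _).symm
  refine ⟨H.charZero, H.pi_ne, ?_, ?_, ?_, ?_, ?_, ?_⟩
  · rw [hk, h1, germ_valuation_lt_iff]
    simp [H.pi_lt]
  · intro f hf hf1 hf0
    obtain ⟨F, rfl⟩ := map_surjective (Germ.coeRingHom (φ : Filter I) : (I → K) →+* _)
      Quot.mk_surjective f
    simp only [coeff_map, Germ.coe_coeRingHom] at hf hf1 hf0
    rw [h1, germ_valuation_eq_iff] at hf1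
    rw [h1, germ_valuation_lt_iff] at hf0
    have hf' : ∀ᶠ i in φ, ∀ j ∈ F.support, V (F.coeff j i) ≤ 1 := by
      have : ∀ᶠ i in (φ : Filter I), ∀ j ∈ F.support, V (F.coeff j i) ≤ 1 := by
        rw [eventually_all_finset]
        intro j _
        have := hf j
        rw [h1, germ_valuation_le_iff] at this
        simpa using this
      exact this
    have hex : ∀ᶠ i in (φ : Filter I), ∃ s, (F.map (Pi.evalRingHom _ i)).eval s = 0 ∧
        V s ≤ V (F.coeff 0 i) := by
      filter_upwards [hf', hf1, hf0] with i h2 h3 h4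
      have h := H.hensel (F.map (Pi.evalRingHom _ i)) (fun j => ?_) ?_ ?_
      · simpa only [coeff_map, Pi.evalRingHom_apply] using h
      · by_cases hj : j ∈ F.support
        · simpa using h2 j hj
        · rw [coeff_map, notMem_support_iff.1 hj]; simp
      · simpa using h3
      · simpa using h4
    obtain ⟨s, hs⟩ := hex.choice
    refine ⟨(s : (φ : Filter I).Germ K), ?_, ?_⟩
    · rw [germ_eval]
      exact Germ.coe_eq.2 (hs.mono fun i hi => hi.1)
    · rw [coeff_map, Germ.coe_coeRingHom, germ_valuation_le_iff]
      exact hs.mono fun i hi => hi.2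
  · intro N hN
    obtain ⟨S, hS0, hS⟩ := H.power_reps N hN
    refine ⟨S, hS0, fun x hx => ?_⟩
    induction x using Germ.inductionOn with | _ x
    have hx' : ∀ᶠ i in φ, x i ≠ 0 := by
      rw [Ultrafilter.eventually_not]
      exact fun h => hx (Germ.coe_eq.2 h)
    obtain ⟨κ, hκ, h⟩ := (Ultrafilter.eventually_exists_mem_iff (f := φ) S.finite_toSet
      (P := fun κ i => ∃ y : K, x i = algebraMap k K κ * y ^ N)).1
      (hx'.mono fun i hi => hS (x i) hi)
    obtain ⟨y, hy⟩ := Eventually.choice h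
    exact ⟨κ, hκ, (y : (φ : Filter I).Germ K), Germ.coe_eq.2 hy⟩
  · intro M
    obtain ⟨S, hS⟩ := H.residue_reps M
    refine ⟨S, fun x hx => ?_⟩
    induction x using Germ.inductionOn with | _ x
    rw [h1, germ_valuation_le_iff] at hx
    obtain ⟨κ, hκ, h⟩ := (Ultrafilter.eventually_exists_mem_iff (f := φ) S.finite_toSet
      (P := fun κ i => V (x i - algebraMap k K κ) ≤ V (algebraMap k K π) ^ M)).1
      (hx.mono fun i hi => hS (x i) (by simpa using hi))
    refine ⟨κ, hκ, ?_⟩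
    rw [hk, hk, ← map_pow]
    refine (germ_valuation_le_iff V φ _ (fun _ => algebraMap k K π ^ M)).2 (h.mono fun i hi => ?_)
    simpa using hi
  · intro x hx
    induction x using Germ.inductionOn with | _ x
    rw [h1, germ_valuation_lt_iff] at hx
    rw [hk, germ_valuation_le_iff]
    exact hx.mono fun i hi => H.discrete _ (by simpa using hi)
  · intro κ hκ
    obtain ⟨n, hn⟩ := H.val_k κ hκ
    refine ⟨n, ?_⟩
    rw [← map_zpow₀, ← map_zpow₀, hk, hk, germ_valuation_eq_iff]
    refine Eventually.of_forall fun i => ?_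
    rw [map_zpow₀, map_zpow₀, hn]

end germ

end

section

open Filter FirstOrder

/-- `S` is a union of classes of the relation that the same polynomials among the members of a
finite list take values that are powers of the prescribed exponents. -/
def PowDefinable (k : Type*) {K ρ : Type*} [Field k] [Field K] [Algebra k K]
    (S : Set (ρ → K)) : Prop :=
  ∃ F : Finset (ℕ+ × MvPolynomial ρ k), ∀ x y : ρ → K,
    (∀ p ∈ F, IsPw p.1 (MvPolynomial.aeval x p.2) ↔ IsPw p.1 (MvPolynomial.aeval y p.2)) →
    x ∈ S → y ∈ S

namespace PowDefinable

variable {k K ρ : Type*} [Field k] [Field K] [Algebra k K]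

lemma empty : PowDefinable k (∅ : Set (ρ → K)) := ⟨∅, fun _ _ _ h => h⟩

lemma compl {S : Set (ρ → K)} (h : PowDefinable k S) : PowDefinable k Sᶜ := by
  obtain ⟨F, hF⟩ := h
  exact ⟨F, fun x y hxy hx hy => hx (hF y x (fun p hp => (hxy p hp).symm) hy)⟩

lemma union {S T : Set (ρ → K)} (hS : PowDefinable k S) (hT : PowDefinable k T) :
    PowDefinable k (S ∪ T) := by
  classical
  obtain ⟨F, hF⟩ := hS
  obtain ⟨G, hG⟩ := hT
  refine ⟨F ∪ G, fun x y hxy => ?_⟩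
  rintro (h | h)
  · exact Or.inl (hF x y (fun p hp => hxy p (Finset.mem_union_left _ hp)) h)
  · exact Or.inr (hG x y (fun p hp => hxy p (Finset.mem_union_right _ hp)) h)

lemma comp {ρ' : Type*} (e : ρ' → ρ) {S : Set (ρ' → K)} (h : PowDefinable k S) :
    PowDefinable k {x : ρ → K | x ∘ e ∈ S} := by
  classical
  obtain ⟨F, hF⟩ := h
  refine ⟨F.image fun p => (p.1, MvPolynomial.rename e p.2), fun x y hxy hx => ?_⟩
  refine hF _ _ (fun p hp => ?_) hx
  have := hxy _ (Finset.mem_image_of_mem _ hp)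
  simpa only [MvPolynomial.aeval_rename] using this

variable {Γ : Type*} [LinearOrderedCommGroupWithZero Γ] {V : Valuation K Γ} {π : k}

lemma eq_zero (H : PadicLike k V π) (f : MvPolynomial ρ k) :
    PowDefinable k {x : ρ → K | MvPolynomial.aeval x f = 0} := by
  obtain ⟨M, hM, h⟩ := H.exists_le_iff_isPw
  have key : ∀ x : ρ → K, MvPolynomial.aeval x f = 0 ↔
      IsPw M (MvPolynomial.aeval x (MvPolynomial.C π * f ^ M)) := by
    intro x
    have := h (MvPolynomial.aeval x f) 0
    rw [V.map_zero, le_zero_iff, V.zero_iff, zero_pow hM.ne', zero_add] at this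
    simp only [map_mul, map_pow, MvPolynomial.aeval_C]
    exact this
  refine ⟨{(⟨M, hM⟩, MvPolynomial.C π * f ^ M)}, fun x y hxy hx => ?_⟩
  have := hxy _ (Finset.mem_singleton_self _)
  exact (key y).2 (this.1 ((key x).1 hx))

lemma exists_elim (H : PadicLike k V π) {S : Set (Option ρ → K)} (h : PowDefinable k S) :
    PowDefinable k {x : ρ → K | ∃ t : K, (fun o : Option ρ => o.elim t x) ∈ S} := by
  obtain ⟨G, hG⟩ := h
  by_contra hcon
  unfold PowDefinable at hcon
  push Not at hcon
  choose a b hab ha hb using hcon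
  simp only [Set.mem_ofPred_eq, not_exists] at ha hb
  choose t ht using ha
  let φ : Ultrafilter (Finset (ℕ+ × MvPolynomial ρ k)) := Ultrafilter.of atTop
  let := germAlgebra k (K := K) φ
  have H' := H.germ φ
  have hab' (f : MvPolynomial ρ k) (N : ℕ) (hN : 0 < N) :
      (IsPw N (MvPolynomial.aeval
        (fun j => ((fun i => a i j : Finset (ℕ+ × MvPolynomial ρ k) → K) : (φ : Filter (Finset (ℕ+ × MvPolynomial ρ k))).Germ K)) f) ↔
      IsPw N (MvPolynomial.aeval
        (fun j => ((fun i => b i j : Finset (ℕ+ × MvPolynomial ρ k) → K) : (φ : Filter (Finset (ℕ+ × MvPolynomial ρ k))).Germ K)) f)) := by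
    have h1 := germ_aeval φ (fun j i => a i j) f
    have h2 := germ_aeval φ (fun j i => b i j) f
    rw [h1, h2, germ_isPw_iff, germ_isPw_iff]
    have : ∀ᶠ i in (φ : Filter (Finset (ℕ+ × MvPolynomial ρ k))), (⟨N, hN⟩, f) ∈ i :=
      (Ultrafilter.of_le atTop) ((eventually_ge_atTop {((⟨N, hN⟩ : ℕ+), f)}).mono
        fun i hi => hi (Finset.mem_singleton_self _))
    exact eventually_congr (this.mono fun i hi => hab i _ hi)
  obtain ⟨t', ht'⟩ := H'.exists_extension _ _ hab'
    ((fun i => t i : _ → K) : (φ : Filter (Finset (ℕ+ × MvPolynomial ρ k))).Germ K) G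
  induction t' using Germ.inductionOn with | _ t'
  have e1 : ∀ (s : Finset (ℕ+ × MvPolynomial ρ k) → K) (c : Finset (ℕ+ × MvPolynomial ρ k) → ρ → K),
      (fun o : Option ρ => o.elim ((s : (φ : Filter (Finset (ℕ+ × MvPolynomial ρ k))).Germ K))
        (fun j => ((fun i => c i j : _ → K) : (φ : Filter (Finset (ℕ+ × MvPolynomial ρ k))).Germ K))) =
      fun o : Option ρ => ((fun i => o.elim (s i) (c i) : _ → K) : (φ : Filter (Finset (ℕ+ × MvPolynomial ρ k))).Germ K) := by
    intro s c; funext o; cases o <;> rfl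
  have h2 : ∀ᶠ i in φ, ∀ q ∈ G,
      (IsPw q.1 (MvPolynomial.aeval (fun o : Option ρ => o.elim (t i) (a i)) q.2) ↔
      IsPw q.1 (MvPolynomial.aeval (fun o : Option ρ => o.elim (t' i) (b i)) q.2)) := by
    have : ∀ᶠ i in (φ : Filter (Finset (ℕ+ × MvPolynomial ρ k))), ∀ q ∈ G,
      (IsPw q.1 (MvPolynomial.aeval (fun o : Option ρ => o.elim (t i) (a i)) q.2) ↔
      IsPw q.1 (MvPolynomial.aeval (fun o : Option ρ => o.elim (t' i) (b i)) q.2)) := by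
      rw [eventually_all_finset]
      intro q hq
      have h3 := ht' q hq
      rw [e1, e1, germ_aeval φ (fun (o : Option ρ) i => o.elim (t i) (a i)),
        germ_aeval φ (fun (o : Option ρ) i => o.elim (t' i) (b i)), germ_isPw_iff,
        germ_isPw_iff] at h3
      by_cases h4 : ∀ᶠ i in (φ : Filter (Finset (ℕ+ × MvPolynomial ρ k))), IsPw q.1
          (MvPolynomial.aeval (fun o : Option ρ => o.elim (t i) (a i)) q.2)
      · filter_upwards [h4, h3.1 h4] with i h5 h6
        exact iff_of_true h5 h6
      · have h5 := fun h => h4 (h3.2 h)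
        filter_upwards [Ultrafilter.eventually_not.2 h4, Ultrafilter.eventually_not.2 h5]
          with i h5 h6
        exact iff_of_false h5 h6
    exact this
  obtain ⟨i, hi⟩ := h2.exists
  exact hb i (t' i) (hG _ _ hi (ht i))

end PowDefinable

section language

variable {k K : Type*} [Field k] [Field K] [Algebra k K] {α : Type*}

lemma exists_mvPolynomial_realize [Ring.CompatibleRing K]
    (t : (Language.ring[[Set.range (algebraMap k K)]]).Term α) :
    ∃ f : MvPolynomial α k, ∀ v : α → K, t.realize v = MvPolynomial.aeval v f := by
  induction t with
  | var a => exact ⟨MvPolynomial.X a, fun v => by simp⟩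
  | @func l f ts ih =>
    choose g hg using ih
    cases f with
    | inl f =>
      have h0 : ∀ v : α → K, (Language.Term.func (Sum.inl f) ts :
          (Language.ring[[Set.range (algebraMap k K)]]).Term α).realize v =
          Language.Structure.funMap (L := Language.ring) f (fun i => (ts i).realize v) :=
        fun v => rfl
      simp only [h0, hg]
      cases f with
      | add => exact ⟨g 0 + g 1, fun v => by
          rw [map_add]; exact Ring.CompatibleRing.funMap_add (R := K) _⟩
      | mul => exact ⟨g 0 * g 1, fun v => by
          rw [map_mul]; exact Ring.CompatibleRing.funMap_mul (R := K) _⟩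
      | neg => exact ⟨-g 0, fun v => by
          rw [map_neg]; exact Ring.CompatibleRing.funMap_neg (R := K) _⟩
      | zero => exact ⟨0, fun v => by
          rw [map_zero]; exact Ring.CompatibleRing.funMap_zero (R := K) _⟩
      | one => exact ⟨1, fun v => by
          rw [map_one]; exact Ring.CompatibleRing.funMap_one (R := K) _⟩
    | inr c =>
      match l, c with
      | 0, c =>
        obtain ⟨x, κ, hκ⟩ := (c : Set.range (algebraMap k K))
        refine ⟨MvPolynomial.C κ, fun v => ?_⟩
        rw [MvPolynomial.aeval_C]
        exact hκ.symm
      | (n + 1), c => exact PEmpty.elim c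

variable {Γ : Type*} [LinearOrderedCommGroupWithZero Γ] {V : Valuation K Γ} {π : k}

lemma powDefinable_realize [Ring.CompatibleRing K] (H : PadicLike k V π) {n : ℕ}
    (φ : (Language.ring[[Set.range (algebraMap k K)]]).BoundedFormula α n) :
    PowDefinable k {x : α ⊕ Fin n → K | φ.Realize (x ∘ Sum.inl) (x ∘ Sum.inr)} := by
  induction φ with
  | falsum => exact PowDefinable.empty
  | @equal n t₁ t₂ =>
    obtain ⟨f, hf⟩ := exists_mvPolynomial_realize t₁
    obtain ⟨g, hg⟩ := exists_mvPolynomial_realize t₂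
    convert PowDefinable.eq_zero H (f - g) using 2
    ext x
    change Language.Term.realize (Sum.elim (x ∘ Sum.inl) (x ∘ Sum.inr)) t₁ =
      Language.Term.realize (Sum.elim (x ∘ Sum.inl) (x ∘ Sum.inr)) t₂ ↔ _
    rw [hf, hg, Sum.elim_comp_inl_inr, map_sub, sub_eq_zero]
  | rel R => rcases R with R | R <;> exact isEmptyElim R
  | imp f g ihf ihg =>
    convert ihf.compl.union ihg using 2
    ext x
    simp only [Set.mem_union, Set.mem_compl_iff, Set.mem_ofPred_eq,
      Language.BoundedFormula.realize_imp, imp_iff_not_or]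
  | @all n f ih =>
    let e : α ⊕ Fin (n + 1) → Option (α ⊕ Fin n) :=
      Sum.elim (fun a => some (Sum.inl a)) (Fin.snoc (fun i => some (Sum.inr i)) none)
    convert ((ih.compl.comp e).exists_elim H).compl using 2
    ext x
    simp only [Set.mem_compl_iff, Set.mem_ofPred_eq, Language.BoundedFormula.realize_all,
      not_exists, not_not]
    refine forall_congr' fun t => ?_
    have h1 : ((fun o : Option (α ⊕ Fin n) => o.elim t x) ∘ e) ∘ Sum.inl = x ∘ Sum.inl := by
      funext a; rfl
    have h2 : ((fun o : Option (α ⊕ Fin n) => o.elim t x) ∘ e) ∘ Sum.inr =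
        Fin.snoc (x ∘ Sum.inr) t := by
      funext i
      refine Fin.lastCases ?_ (fun i => ?_) i <;> simp [e]
    rw [h1, h2]

lemma Set.Definable.powDefinable [Ring.CompatibleRing K] (H : PadicLike k V π)
    {S : Set (α → K)} (h : (Set.range (algebraMap k K)).Definable Language.ring S) :
    PowDefinable k S := by
  obtain ⟨φ, rfl⟩ := h
  have := (powDefinable_realize H φ).comp (Sum.elim id (fun i : Fin 0 => i.elim0))
  convert this using 2
  ext x
  simp only [Set.mem_ofPred_eq, Language.Formula.Realize]
  rw [Subsingleton.elim (_ ∘ Sum.inr) default]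
  rfl

end language

end

section

open Polynomial IsDedekindDomain WithZero Filter

section newton

/-- The Newton iteration with constant slope. -/
lemma exists_seq_dvd_eval {R : Type*} [CommRing R] (F : R[X]) (u : R) (hu : F.coeff 1 * u = 1) :
    ∃ s : ℕ → R, ∀ n, F.coeff 0 ∣ s n ∧ F.coeff 0 ^ (n + 1) ∣ F.eval (s n) ∧
      s (n + 1) = s n - u * F.eval (s n) := by
  let s : ℕ → R := fun n => Nat.rec 0 (fun _ t => t - u * F.eval t) n
  have hs : ∀ n, s (n + 1) = s n - u * F.eval (s n) := fun n => rfl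
  suffices H : ∀ n, F.coeff 0 ∣ s n ∧ F.coeff 0 ^ (n + 1) ∣ F.eval (s n) from
    ⟨s, fun n => ⟨(H n).1, (H n).2, hs n⟩⟩
  intro n
  induction n with
  | zero =>
    refine ⟨dvd_zero _, ?_⟩
    rw [zero_add, pow_one]
    change _ ∣ F.eval 0
    rw [coeff_zero_eq_eval_zero]
  | succ n ih =>
    obtain ⟨h1, h2⟩ := ih
    have h3 : F.coeff 0 ∣ F.eval (s n) := (dvd_pow_self _ n.succ_ne_zero).trans h2
    refine ⟨by rw [hs]; exact dvd_sub h1 (h3.mul_left _), ?_⟩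
    rw [hs]
    obtain ⟨q, hq⟩ := F.binomExpansion (s n) (-(u * F.eval (s n)))
    rw [sub_eq_add_neg, hq]
    have h4 : F.coeff 0 ∣ F.derivative.eval (s n) - F.coeff 1 := by
      have := (sub_dvd_eval_sub (s n) 0 F.derivative)
      rw [sub_zero, ← coeff_zero_eq_eval_zero, coeff_derivative] at this
      simp only [zero_add, Nat.cast_zero, mul_one] at this
      exact h1.trans this
    have h5 : F.eval (s n) + F.derivative.eval (s n) * -(u * F.eval (s n)) +
        q * (-(u * F.eval (s n))) ^ 2 =
        F.eval (s n) * (-(u * (F.derivative.eval (s n) - F.coeff 1)) + q * u ^ 2 * F.eval (s n)) := by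
      linear_combination (-F.eval (s n)) * hu
    rw [h5, pow_succ]
    exact mul_dvd_mul h2 (dvd_add ((h4.mul_left _).neg_right) (h3.mul_left _))

lemma valued_ball_mem_nhds {K Γ : Type*} [Field K] [LinearOrderedCommGroupWithZero Γ] [Valued K Γ]
    (y : K) {x : K} (hx : x ≠ 0) : {z : K | Valued.v (z - y) < Valued.v x} ∈ nhds y := by
  refine Valued.mem_nhds.2 ⟨Units.mk0 (Valued.v.restrict x) (by simpa using hx), fun z hz => ?_⟩
  simpa using hz

lemma hensel_of_completeSpace {K : Type*} [Field K] [Valued K ℤᵐ⁰] [CompleteSpace K] (φ : K[X])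
    (hφ : ∀ i, Valued.v (φ.coeff i) ≤ 1) (h1 : Valued.v (φ.coeff 1) = 1)
    (h0 : Valued.v (φ.coeff 0) < 1) :
    ∃ s : K, φ.eval s = 0 ∧ Valued.v s ≤ Valued.v (φ.coeff 0) := by
  let R := (Valued.v : Valuation K ℤᵐ⁰).integer
  have hc : ((φ.coeffs : Finset K) : Set K) ⊆ R := by
    intro x hx
    obtain ⟨n, -, rfl⟩ := mem_coeffs_iff.1 hx
    exact hφ n
  let F := φ.toSubring R hc
  have hu' : Valued.v (φ.coeff 1)⁻¹ ≤ 1 := by rw [map_inv₀, h1, inv_one]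
  have hF : ∀ n, (F.coeff n : K) = φ.coeff n := fun n => coeff_toSubring _ _ _
  obtain ⟨s, hs⟩ := exists_seq_dvd_eval F ⟨(φ.coeff 1)⁻¹, hu'⟩ (Subtype.ext (by
    rw [Subring.coe_mul, hF]
    change φ.coeff 1 * (φ.coeff 1)⁻¹ = 1
    refine mul_inv_cancel₀ fun h => ?_
    rw [h] at h1; simp at h1))
  have hev : ∀ n, ((F.eval (s n) : R) : K) = φ.eval (s n : K) := by
    intro n
    have : φ = F.map R.subtype := by ext n; rw [coeff_map]; exact (hF n).symm
    rw [this, eval_map]; exact (eval₂_at_apply R.subtype (s n)).symm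
  set a := Valued.v (φ.coeff 0) with ha
  have hdvd : ∀ (x y : R), x ∣ y → Valued.v (y : K) ≤ Valued.v (x : K) := by
    rintro x y ⟨z, rfl⟩
    rw [Subring.coe_mul, map_mul]
    exact mul_le_of_le_one_right' z.2
  have hsa : ∀ n, Valued.v (s n : K) ≤ a := fun n => by
    have := hdvd _ _ (hs n).1
    rwa [hF] at this
  have hfa : ∀ n, Valued.v (φ.eval (s n : K)) ≤ a ^ (n + 1) := by
    intro n
    have := hdvd _ _ (hs n).2.1
    rwa [hev, Subring.coe_pow, map_pow, hF] at this
  have hstep : ∀ n, Valued.v ((s (n + 1) : K) - s n) ≤ a ^ (n + 1) := by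
    intro n
    rw [(hs n).2.2, AddSubgroupClass.coe_sub, Subring.coe_mul, hev, sub_sub_cancel_left,
      Valuation.map_neg, map_mul]
    exact (mul_le_mul' hu' (hfa n)).trans_eq (one_mul _)
  have hdiff : ∀ n m, n ≤ m → Valued.v ((s m : K) - s n) ≤ a ^ (n + 1) := by
    intro n m hnm
    induction m, hnm using Nat.le_induction with
    | base => simp
    | succ m hm ih =>
      rw [← sub_add_sub_cancel]
      refine (Valuation.map_add _ _ _).trans (max_le ((hstep m).trans ?_) ih)
      exact pow_le_pow_of_le_one zero_le h0.le (by omega)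
  have hcauchy : CauchySeq fun n => (s n : K) := by
    refine Valued.cauchy_iff.2 ⟨inferInstance, fun γ => ?_⟩
    obtain ⟨N, hN⟩ := exists_pow_lt₀ (a := a) h0 (Units.map
      (MonoidWithZeroHom.ValueGroup₀.embedding (f := .ofClass (Valued.v : Valuation K ℤᵐ⁰))).toMonoidHom γ)
    refine ⟨(fun n => (s n : K)) '' Set.Ici N, image_mem_map (Ici_mem_atTop N), ?_⟩
    rintro _ ⟨n, hn, rfl⟩ _ ⟨m, hm, rfl⟩
    rw [Valuation.restrict_lt_iff_lt_embedding]
    refine lt_of_le_of_lt ?_ hN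
    have key : ∀ n m, N ≤ n → n ≤ m → Valued.v ((s m : K) - s n) ≤ a ^ N := fun n m h1 h2 =>
      (hdiff n m h2).trans (pow_le_pow_of_le_one zero_le h0.le (by omega))
    rcases le_total n m with h | h
    · exact key n m hn h
    · rw [Valuation.map_sub_swap]; exact key m n hm h
  obtain ⟨t, ht⟩ := cauchySeq_tendsto_of_complete hcauchy
  have hclose : ∀ γ : ℤᵐ⁰, (∃ x : K, x ≠ 0 ∧ Valued.v x = γ) → ∀ (x : ℕ → K) (y : K),
      Tendsto x atTop (nhds y) → ∀ᶠ n in atTop, Valued.v (x n - y) < γ := by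
    rintro _ ⟨x, hx, rfl⟩ u y hu
    exact hu (valued_ball_mem_nhds y hx)
  by_cases ha0 : φ.coeff 0 = 0
  · exact ⟨0, by rw [← coeff_zero_eq_eval_zero, ha0], by simp⟩
  refine ⟨t, ?_, ?_⟩
  · by_contra hne
    have h2 : Tendsto (fun n => φ.eval (s n : K)) atTop (nhds (φ.eval t)) :=
      (φ.continuous.tendsto t).comp ht
    have h3 := hclose _ ⟨φ.eval t, hne, rfl⟩ _ _ h2
    obtain ⟨N, hN⟩ := exists_pow_lt₀ (a := a) h0 (Units.mk0 (Valued.v (φ.eval t)) (by simpa using hne))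
    obtain ⟨n, hn, hn'⟩ := (h3.and (eventually_ge_atTop N)).exists
    have h4 : Valued.v (φ.eval (s n : K)) = Valued.v (φ.eval t) := by
      have := Valuation.map_add_eq_of_lt_left _ hn
      rwa [add_sub_cancel] at this
    have h5 := (hfa n).trans (pow_le_pow_of_le_one zero_le h0.le (show N ≤ n + 1 by omega))
    rw [h4] at h5
    exact absurd h5 (not_le.2 hN)
  · obtain ⟨n, hn⟩ := (hclose _ ⟨φ.coeff 0, ha0, rfl⟩ _ _ ht).exists
    have : t = s n - ((s n : K) - t) := by ring
    rw [this]
    exact (Valuation.map_sub _ _ _).trans (max_le (hsa n) hn.le)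

end newton

section completion

/-- Elements close to `1` are `N`-th powers. -/
lemma isPw_of_sub_one_lt {U Γ : Type*} [Field U] [LinearOrderedCommGroupWithZero Γ]
    (V : Valuation U Γ) (hh : ∀ φ : U[X], (∀ i, V (φ.coeff i) ≤ 1) → V (φ.coeff 1) = 1 →
    V (φ.coeff 0) < 1 → ∃ s, φ.eval s = 0 ∧ V s ≤ V (φ.coeff 0)) {N : ℕ} (hN : (N : U) ≠ 0)
    {x : U} (hx : V (x - 1) < V N * V N) : IsPw N x := by
  have ht : taylor (1 : U) (X ^ N - C x) = (X + 1) ^ N - C x := by simp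
  have hcoef : ∀ j, 1 ≤ j → (taylor (1 : U) (X ^ N - C x)).coeff j = (N.choose j : U) := by
    intro j hj
    rw [ht, coeff_sub, coeff_C, if_neg (by omega), sub_zero, coeff_X_add_one_pow]
  have h1 := hcoef 1 le_rfl
  rw [Nat.choose_one_right] at h1
  obtain ⟨θ, hθ, -⟩ := hensel_scaled V hh (X ^ N - C x) 1 (N : U)
    (by rw [h1]; exact mul_ne_zero hN hN) (by
      intro j hj
      rw [hcoef j (by omega), h1]
      obtain ⟨j, rfl⟩ := Nat.exists_eq_add_of_le' hj
      rw [pow_add, pow_two, ← mul_assoc]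
      refine mul_le_of_le_one_left' (mul_le_one' (V.map_natCast_le_one' _) ?_)
      exact pow_le_one₀ zero_le (V.map_natCast_le_one' _)) (by
      rw [h1]
      have : V (eval 1 (X ^ N - C x)) = V (x - 1) := by
        rw [← V.map_neg]; simp
      rwa [this])
  refine ⟨θ, ?_⟩
  simpa [sub_eq_zero] using hθ

variable {k : Type*} [Field k] [NumberField k]
  (v : HeightOneSpectrum (NumberField.RingOfIntegers k))

lemma valued_algebraMap (κ : k) : Valued.v (algebraMap k (v.adicCompletion k) κ) =
    v.valuation k κ := HeightOneSpectrum.adicCompletion.valued_coe k v κ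

lemma exists_algebraMap_sub_lt (x : v.adicCompletion k) {γ : k} (hγ : γ ≠ 0) :
    ∃ κ : k, Valued.v (x - algebraMap k (v.adicCompletion k) κ) < v.valuation k γ := by
  have h := v.denseRange_algebraMap (K := k) x
  have hγ' : algebraMap k (v.adicCompletion k) γ ≠ 0 := by simpa using hγ
  obtain ⟨_, h1, κ, rfl⟩ := mem_closure_iff_nhds.1 h _ (valued_ball_mem_nhds x hγ')
  refine ⟨κ, ?_⟩
  rw [Valuation.map_sub_swap, ← valued_algebraMap]
  exact h1

lemma exists_integer_reps (M : ℕ) : ∃ S : Finset (NumberField.RingOfIntegers k),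
    ∀ κ : k, v.valuation k κ ≤ 1 → ∃ ρ ∈ S, v.valuation k (κ - algebraMap _ k ρ) ≤
      exp (-(M : ℤ)) := by
  classical
  have : Finite (NumberField.RingOfIntegers k ⧸ v.asIdeal ^ M) :=
    Ideal.finiteQuotientOfFreeOfNeBot _ (pow_ne_zero _ v.ne_bot)
  let := Fintype.ofFinite (NumberField.RingOfIntegers k ⧸ v.asIdeal ^ M)
  refine ⟨Finset.univ.image fun x : NumberField.RingOfIntegers k ⧸ v.asIdeal ^ M =>
    Quotient.out x, fun κ hκ => ?_⟩
  obtain ⟨a, ha⟩ := v.exists_valuation_sub_lt_of_integer hκ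
    (Units.mk0 (exp (-(M : ℤ))) exp_ne_zero)
  refine ⟨_, Finset.mem_image_of_mem _ (Finset.mem_univ (Ideal.Quotient.mk _ a)), ?_⟩
  have h1 : a - Quotient.out (Ideal.Quotient.mk (v.asIdeal ^ M) a) ∈ v.asIdeal ^ M := by
    rw [← Ideal.Quotient.eq]
    exact (Ideal.Quotient.mk_out _).symm
  rw [← HeightOneSpectrum.intValuation_le_pow_iff_mem,
    ← HeightOneSpectrum.valuation_of_algebraMap (K := k)] at h1
  have h1 : v.valuation k (algebraMap _ k a - algebraMap _ k (Quotient.out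
    (Ideal.Quotient.mk (v.asIdeal ^ M) a))) ≤ exp (-(M : ℤ)) := by rwa [← map_sub]
  rw [← sub_add_sub_cancel κ (algebraMap _ k a)]
  refine (Valuation.map_add _ _ _).trans (max_le ?_ h1)
  rw [Valuation.map_sub_swap]
  exact ha.le

theorem padicLike_adicCompletion : ∃ π : k, v.valuation k π = exp (-1 : ℤ) ∧
    PadicLike k (Valued.v : Valuation (v.adicCompletion k) ℤᵐ⁰) π := by
  classical
  obtain ⟨π, hπ⟩ := v.valuation_exists_uniformizer k
  have hπ0 : π ≠ 0 := by rintro rfl; rw [map_zero] at hπ; exact exp_ne_zero hπ.symm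
  have hVπ : Valued.v (algebraMap k (v.adicCompletion k) π) = exp (-1 : ℤ) := by
    rw [valued_algebraMap, hπ]
  have hpow : ∀ n : ℤ, (exp (-1 : ℤ)) ^ n = (exp (-n) : ℤᵐ⁰) := fun n => by
    rw [← exp_zsmul]; simp
  have hval : ∀ x : v.adicCompletion k, x ≠ 0 → ∃ n : ℤ, Valued.v x = exp (-1 : ℤ) ^ n := by
    intro x hx
    refine ⟨-log (Valued.v x), ?_⟩
    rw [hpow, neg_neg, exp_log (by simpa using hx)]
  have hlt : (exp (-1 : ℤ) : ℤᵐ⁰) < 1 := by rw [← exp_zero, exp_lt_exp]; norm_num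
  have hreps : ∀ M : ℕ, ∃ S : Finset k, ∀ x : v.adicCompletion k, Valued.v x ≤ 1 → ∃ κ ∈ S,
      Valued.v (x - algebraMap k _ κ) ≤
        Valued.v (algebraMap k (v.adicCompletion k) π) ^ M := by
    intro M
    obtain ⟨S, hS⟩ := exists_integer_reps v M
    refine ⟨S.image (algebraMap _ k), fun x hx => ?_⟩
    obtain ⟨κ, hκ⟩ := exists_algebraMap_sub_lt v x (pow_ne_zero M hπ0)
    have hM : v.valuation k (π ^ M) = exp (-(M : ℤ)) := by
      rw [map_pow, hπ, ← hpow (M : ℤ), zpow_natCast]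
    have hM1 : v.valuation k (π ^ M) ≤ 1 := by
      rw [map_pow, hπ]; exact pow_le_one₀ zero_le hlt.le
    have hκ1 : v.valuation k κ ≤ 1 := by
      rw [← valued_algebraMap, ← sub_sub_cancel x (algebraMap k _ κ)]
      exact (Valuation.map_sub _ _ _).trans (max_le hx (hκ.le.trans hM1))
    obtain ⟨ρ, hρ, h⟩ := hS κ hκ1
    refine ⟨_, Finset.mem_image_of_mem _ hρ, ?_⟩
    rw [← map_pow Valued.v, ← map_pow, valued_algebraMap v (π ^ M), ← sub_add_sub_cancel x (algebraMap k _ κ)]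
    refine (Valuation.map_add _ _ _).trans (max_le hκ.le ?_)
    rw [← map_sub, valued_algebraMap, hM]
    exact h
  have hpi' : algebraMap k (v.adicCompletion k) π ≠ 0 := by simpa using hπ0
  refine ⟨π, hπ, inferInstance, hπ0, by rw [hVπ]; exact hlt, hensel_of_completeSpace, ?_, hreps,
    ?_, ?_⟩
  · intro N hN
    have hN0 : (N : v.adicCompletion k) ≠ 0 := by
      rw [← map_natCast (algebraMap k (v.adicCompletion k)), _root_.map_ne_zero]
      exact_mod_cast hN.ne'
    have hVN : Valued.v (N : v.adicCompletion k) ≠ 0 := by simpa using hN0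
    obtain ⟨M, hM⟩ := exists_pow_lt₀ hlt
      (Units.mk0 (Valued.v (N : v.adicCompletion k) * Valued.v (N : v.adicCompletion k))
        (mul_ne_zero hVN hVN))
    rw [Units.val_mk0] at hM
    have hM1 : (exp (-1 : ℤ) : ℤᵐ⁰) ^ M < 1 := hM.trans_le
      (mul_le_one' (Valuation.map_natCast_le_one' _ _) (Valuation.map_natCast_le_one' _ _))
    obtain ⟨S, hS⟩ := hreps M
    refine ⟨((S.filter (· ≠ 0)) ×ˢ Finset.range N).image fun p => π ^ p.2 * p.1, ?_, ?_⟩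
    · intro κ hκ
      obtain ⟨p, hp, rfl⟩ := Finset.mem_image.1 hκ
      simp only [Finset.mem_product, Finset.mem_filter] at hp
      exact mul_ne_zero (pow_ne_zero _ hπ0) hp.1.2
    · intro x hx
      obtain ⟨n, hn⟩ := hval x hx
      set u := x / (algebraMap k (v.adicCompletion k) π) ^ n with hu
      have hu1 : Valued.v u = 1 := by
        rw [hu, map_div₀, map_zpow₀, hVπ, hn, div_self]
        exact zpow_ne_zero _ exp_ne_zero
      obtain ⟨κ, hκ, hκ'⟩ := hS u hu1.le
      rw [hVπ] at hκ'
      have hVκ : Valued.v (algebraMap k (v.adicCompletion k) κ) = 1 := by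
        have h1 : Valued.v (u - algebraMap k (v.adicCompletion k) κ) < Valued.v u := by
          rw [hu1]; exact hκ'.trans_lt hM1
        have := Valuation.map_sub_eq_of_lt_right _ h1
        rw [sub_sub_cancel_left, Valuation.map_neg, hu1] at this
        exact this
      have hκ0 : algebraMap k (v.adicCompletion k) κ ≠ 0 := by
        intro h; rw [h] at hVκ; simp at hVκ
      obtain ⟨y, hy⟩ := isPw_of_sub_one_lt Valued.v hensel_of_completeSpace hN0
        (x := u / algebraMap k (v.adicCompletion k) κ) (by
          rw [div_sub_one hκ0, map_div₀, hVκ, div_one]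
          exact hκ'.trans_lt hM)
      have hκk : κ ≠ 0 := fun h => hκ0 (by rw [h, map_zero])
      have hN' : (N : ℤ) ≠ 0 := by exact_mod_cast hN.ne'
      refine ⟨_, Finset.mem_image_of_mem _ (a := (κ, (n % N).toNat))
        (Finset.mem_product.2 ⟨Finset.mem_filter.2
        ⟨hκ, hκk⟩, Finset.mem_range.2
        (show (n % N).toNat < N from ?_)⟩), algebraMap k _ π ^ (n / N) * y, ?_⟩
      · have := Int.emod_lt_of_pos n (show (0 : ℤ) < N by exact_mod_cast hN)
        omega
      · rw [mul_pow, hy, map_mul, map_pow, ← zpow_natCast, ← zpow_natCast (_ ^ _) N, ← zpow_mul,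
          Int.toNat_of_nonneg (Int.emod_nonneg _ hN')]
        have : x = algebraMap k (v.adicCompletion k) π ^ n * u := by
          rw [hu]; field_simp
        conv_lhs => rw [this, ← Int.emod_add_mul_ediv n N, zpow_add₀ hpi']
        rw [mul_comm (N : ℤ)]
        field_simp
  · intro x hx
    by_cases hx0 : x = 0
    · simp [hx0]
    obtain ⟨n, hn⟩ := hval x hx0
    rw [hVπ]
    rw [hn, hpow] at hx ⊢
    rw [← exp_zero, exp_lt_exp] at hx
    rw [exp_le_exp]; omega
  · intro κ hκ
    rw [hVπ]
    exact hval _ (by simpa using hκ)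

end completion

end

section dio

variable {k σ : Type*} [Field k]

/-- Diophantine sets with an arbitrary type of coordinates. -/
def Dio (S : Set (σ → k)) : Prop :=
  ∃ (m r : ℕ) (f : Fin r → MvPolynomial (σ ⊕ Fin m) k), ∀ a, a ∈ S ↔
    ∃ b : Fin m → k, ∀ i, MvPolynomial.eval (Sum.elim a b) (f i) = 0

/-- The ring of functions on `k`-points given by polynomials with coefficients in `Ω`. -/
noncomputable def polyFun (σ k Ω : Type*) [Field k] [Field Ω] [Algebra k Ω] : Subring ((σ → k) → Ω) :=
  (RingHom.pi fun a : σ → k =>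
    (MvPolynomial.eval fun i => algebraMap k Ω (a i) : MvPolynomial σ Ω →+* Ω)).range

section polyFun

variable {Ω : Type*} [Field Ω] [Algebra k Ω]

lemma mem_polyFun_iff {g : (σ → k) → Ω} : g ∈ polyFun σ k Ω ↔ ∃ f : MvPolynomial σ Ω,
    ∀ a, MvPolynomial.eval (fun i => algebraMap k Ω (a i)) f = g a :=
  ⟨fun ⟨f, hf⟩ => ⟨f, fun a => congrFun hf a⟩, fun ⟨f, hf⟩ => ⟨f, funext hf⟩⟩

lemma const_mem_polyFun (c : Ω) : (fun _ => c) ∈ polyFun σ k Ω :=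
  mem_polyFun_iff.2 ⟨MvPolynomial.C c, fun a => by simp⟩

lemma coord_mem_polyFun (i : σ) : (fun a => algebraMap k Ω (a i)) ∈ polyFun σ k Ω :=
  mem_polyFun_iff.2 ⟨MvPolynomial.X i, fun a => by simp⟩

lemma coord_mem_polyFun_self (i : σ) : (fun a => a i) ∈ polyFun σ k k :=
  coord_mem_polyFun (Ω := k) i

end polyFun

namespace Dio

lemma mk {S : Set (σ → k)} {τ ι : Type*} [Finite τ] [Finite ι] (f : ι → MvPolynomial (σ ⊕ τ) k)
    (h : ∀ a, a ∈ S ↔ ∃ b : τ → k, ∀ i, MvPolynomial.eval (Sum.elim a b) (f i) = 0) : Dio S := by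
  obtain ⟨m, ⟨e⟩⟩ := Finite.exists_equiv_fin τ
  obtain ⟨r, ⟨e'⟩⟩ := Finite.exists_equiv_fin ι
  refine ⟨m, r, fun i => MvPolynomial.rename (Sum.map id e) (f (e'.symm i)), fun a => ?_⟩
  rw [h]
  have key : ∀ (b : Fin m → k) i, MvPolynomial.eval (Sum.elim a b)
      (MvPolynomial.rename (Sum.map id e) (f i)) =
      MvPolynomial.eval (Sum.elim a (b ∘ e)) (f i) := by
    intro b i
    rw [MvPolynomial.eval_rename, Sum.elim_comp_map, Function.comp_id]
  constructor
  · rintro ⟨b, hb⟩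
    refine ⟨b ∘ e.symm, fun i => ?_⟩
    rw [key, Function.comp_assoc, Equiv.symm_comp_self, Function.comp_id]
    exact hb _
  · rintro ⟨b, hb⟩
    refine ⟨b ∘ e, fun i => ?_⟩
    rw [← key]
    simpa using hb (e' i)

lemma eq_zero (f : MvPolynomial σ k) : Dio {a : σ → k | MvPolynomial.eval a f = 0} :=
  mk (τ := Empty) (fun _ : Unit => MvPolynomial.rename Sum.inl f) fun a => by
    simp [MvPolynomial.eval_rename]

lemma inter {S T : Set (σ → k)} (hS : Dio S) (hT : Dio T) : Dio (S ∩ T) := by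
  obtain ⟨m, r, f, hf⟩ := hS
  obtain ⟨m', r', f', hf'⟩ := hT
  refine mk (τ := Fin m ⊕ Fin m') (ι := Fin r ⊕ Fin r')
    (Sum.elim (fun i => MvPolynomial.rename (Sum.map id Sum.inl) (f i))
      (fun i => MvPolynomial.rename (Sum.map id Sum.inr) (f' i))) fun a => ?_
  rw [Set.mem_inter_iff, hf, hf']
  simp only [Sum.forall, Sum.elim_inl, Sum.elim_inr, MvPolynomial.eval_rename, Sum.elim_comp_map,
    Function.comp_id]
  constructor
  · rintro ⟨⟨b, hb⟩, b', hb'⟩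
    exact ⟨Sum.elim b b', hb, hb'⟩
  · rintro ⟨b, h1, h2⟩
    exact ⟨⟨_, h1⟩, _, h2⟩

lemma union {S T : Set (σ → k)} (hS : Dio S) (hT : Dio T) : Dio (S ∪ T) := by
  obtain ⟨m, r, f, hf⟩ := hS
  obtain ⟨m', r', f', hf'⟩ := hT
  refine mk (τ := Fin m ⊕ Fin m') (ι := Fin r × Fin r')
    (fun i => MvPolynomial.rename (Sum.map id Sum.inl) (f i.1) *
      MvPolynomial.rename (Sum.map id Sum.inr) (f' i.2)) fun a => ?_
  rw [Set.mem_union, hf, hf']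
  simp only [map_mul, MvPolynomial.eval_rename, Sum.elim_comp_map, Function.comp_id, Prod.forall]
  constructor
  · rintro (⟨b, hb⟩ | ⟨b, hb⟩)
    · exact ⟨Sum.elim b 0, fun i j => by rw [Sum.elim_comp_inl, hb, zero_mul]⟩
    · exact ⟨Sum.elim 0 b, fun i j => by rw [Sum.elim_comp_inr, hb, mul_zero]⟩
  · rintro ⟨b, h⟩
    by_contra hcon
    push Not at hcon
    obtain ⟨i, hi⟩ := hcon.1 (b ∘ Sum.inl)
    obtain ⟨j, hj⟩ := hcon.2 (b ∘ Sum.inr)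
    exact mul_ne_zero hi hj (h i j)

lemma ex {τ : Type*} [Finite τ] {P : (σ → k) → (τ → k) → Prop}
    (h : Dio {c : σ ⊕ τ → k | P (c ∘ Sum.inl) (c ∘ Sum.inr)}) : Dio {a | ∃ b, P a b} := by
  obtain ⟨m, r, f, hf⟩ := h
  refine mk (τ := τ ⊕ Fin m)
    (fun i => MvPolynomial.rename (Equiv.sumAssoc σ τ (Fin m)) (f i)) fun a => ?_
  have key : ∀ (b : τ ⊕ Fin m → k), (Sum.elim a b ∘ (Equiv.sumAssoc σ τ (Fin m))) =
      Sum.elim (Sum.elim a (b ∘ Sum.inl)) (b ∘ Sum.inr) := by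
    intro b; funext x; rcases x with (x | x) | x <;> rfl
  simp only [MvPolynomial.eval_rename, key]
  have h2 : ∀ b, P a b ↔ _ := fun b => hf (Sum.elim a b)
  simp only [Set.mem_ofPred_eq, h2]
  constructor
  · rintro ⟨b, b', h⟩
    exact ⟨Sum.elim b b', h⟩
  · rintro ⟨b, h⟩
    exact ⟨_, _, h⟩

lemma ex₁ {P : (σ → k) → k → Prop}
    (h : Dio {c : σ ⊕ Unit → k | P (c ∘ Sum.inl) (c (Sum.inr ()))}) : Dio {a | ∃ b, P a b} := by
  have := ex (P := fun a (b : Unit → k) => P a (b ())) h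
  convert this using 2
  ext a
  exact ⟨fun ⟨b, hb⟩ => ⟨fun _ => b, hb⟩, fun ⟨b, hb⟩ => ⟨b (), hb⟩⟩

lemma preimage {σ' : Type*} {S : Set (σ' → k)} (hS : Dio S) (g : σ' → (σ → k) → k)
    (hg : ∀ i, g i ∈ polyFun σ k k) : Dio {a : σ → k | (fun i => g i a) ∈ S} := by
  choose p hp using fun i => mem_polyFun_iff.1 (hg i)
  obtain ⟨m, r, f, hf⟩ := hS
  refine mk (τ := Fin m) (fun i => MvPolynomial.aeval (Sum.elim
    (fun j => MvPolynomial.rename Sum.inl (p j)) (fun j => MvPolynomial.X (Sum.inr j)))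
    (f i)) fun a => ?_
  rw [Set.mem_ofPred_eq, hf]
  refine exists_congr fun b => forall_congr' fun i => ?_
  rw [← MvPolynomial.coe_aeval_eq_eval, ← MvPolynomial.coe_aeval_eq_eval]
  simp only [RingHom.coe_coe]
  rw [← AlgHom.comp_apply, MvPolynomial.comp_aeval]
  have : (Sum.elim (fun i => g i a) b : σ' ⊕ Fin m → k) = fun i =>
      MvPolynomial.aeval (Sum.elim a b) ((Sum.elim
    (fun j => MvPolynomial.rename Sum.inl (p j)) (fun j => MvPolynomial.X (Sum.inr j)) :
      σ' ⊕ Fin m → MvPolynomial (σ ⊕ Fin m) k) i) := by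
    funext i
    rcases i with i | i
    · rw [Sum.elim_inl, Sum.elim_inl, MvPolynomial.aeval_rename, Sum.elim_comp_inl]
      exact (hp i a).symm
    · simp
  rw [this]

lemma eq_zero_of_mem {Ω : Type*} [Field Ω] [Algebra k Ω] {g : (σ → k) → Ω}
    (hg : g ∈ polyFun σ k Ω) : Dio {a : σ → k | g a = 0} := by
  classical
  obtain ⟨f, hf⟩ := mem_polyFun_iff.1 hg
  let B := Module.Basis.ofVectorSpace k Ω
  let T := f.support.biUnion fun m => (B.repr (f.coeff m)).support
  refine mk (τ := Empty) (ι := T) (fun i => MvPolynomial.rename Sum.inl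
    (∑ m ∈ f.support, MvPolynomial.monomial m (B.repr (f.coeff m) i))) fun a => ?_
  have h1 : g a = ∑ m ∈ f.support, (m.prod fun i e => a i ^ e) • f.coeff m := by
    rw [← hf, MvPolynomial.eval_eq]
    refine Finset.sum_congr rfl fun m _ => ?_
    rw [Algebra.smul_def, mul_comm, Finsupp.prod, map_prod]
    simp only [map_pow]
  have h2 : ∀ i, B.repr (g a) i = MvPolynomial.eval a
      (∑ m ∈ f.support, MvPolynomial.monomial m (B.repr (f.coeff m) i)) := by
    intro i
    rw [h1, map_sum, map_sum, Finsupp.finsetSum_apply]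
    refine Finset.sum_congr rfl fun m _ => ?_
    rw [map_smul, Finsupp.smul_apply, MvPolynomial.eval_monomial, smul_eq_mul, mul_comm]
  simp only [MvPolynomial.eval_rename, Sum.elim_comp_inl, ← h2, exists_const, Set.mem_ofPred_eq]
  constructor
  · intro h i; rw [h]; simp
  · intro h
    rw [← B.repr.map_eq_zero_iff]
    ext i
    by_cases hi : i ∈ T
    · exact h ⟨i, hi⟩
    · rw [h2, Finset.sum_eq_zero, map_zero, Finsupp.zero_apply]
      intro m hm
      have : i ∉ (B.repr (f.coeff m)).support := fun h' =>
        hi (Finset.mem_biUnion.2 ⟨m, hm, h'⟩)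
      rw [Finsupp.notMem_support_iff.1 this, map_zero]

lemma eq_of_mem {Ω : Type*} [Field Ω] [Algebra k Ω] {g h : (σ → k) → Ω}
    (hg : g ∈ polyFun σ k Ω) (hh : h ∈ polyFun σ k Ω) : Dio {a : σ → k | g a = h a} := by
  convert eq_zero_of_mem (sub_mem hg hh) using 2
  ext a
  exact sub_eq_zero.symm

lemma univ : Dio (Set.univ : Set (σ → k)) := by
  simpa using eq_zero (0 : MvPolynomial σ k)

lemma empty : Dio (∅ : Set (σ → k)) := by
  simpa using eq_zero (1 : MvPolynomial σ k)

lemma ne_zero_of_mem {g : (σ → k) → k} (hg : g ∈ polyFun σ k k) : Dio {a : σ → k | g a ≠ 0} := by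
  have : {a : σ → k | g a ≠ 0} = {a | ∃ b, g a * b = 1} := by
    ext a
    exact ⟨fun h => ⟨(g a)⁻¹, mul_inv_cancel₀ h⟩, fun ⟨b, hb⟩ => left_ne_zero_of_mul_eq_one hb⟩
  rw [this]
  obtain ⟨f, hf⟩ := mem_polyFun_iff.1 hg
  refine ex₁ (P := fun a b => g a * b = 1) (eq_of_mem (mul_mem (mem_polyFun_iff.2
    ⟨MvPolynomial.rename Sum.inl f, fun c => ?_⟩) (coord_mem_polyFun_self _))
    (const_mem_polyFun _))
  rw [MvPolynomial.eval_rename, ← hf]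
  rfl

lemma biUnion {ι : Type*} (s : Finset ι) {S : ι → Set (σ → k)} (h : ∀ i ∈ s, Dio (S i)) :
    Dio (⋃ i ∈ s, S i) := by
  classical
  induction s using Finset.induction_on with
  | empty => simpa using empty
  | insert i s hi ih =>
    rw [Finset.set_biUnion_insert]
    exact (h i (s.mem_insert_self i)).union (ih fun j hj => h j (Finset.mem_insert_of_mem hj))

lemma biInter {ι : Type*} (s : Finset ι) {S : ι → Set (σ → k)} (h : ∀ i ∈ s, Dio (S i)) :
    Dio (⋂ i ∈ s, S i) := by
  classical
  induction s using Finset.induction_on with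
  | empty => simpa using univ
  | insert i s hi ih =>
    rw [Finset.set_biInter_insert]
    exact (h i (s.mem_insert_self i)).inter (ih fun j hj => h j (Finset.mem_insert_of_mem hj))

lemma isDiophantine {n : ℕ} {S : Set (Fin n → k)} (h : Dio S) : IsDiophantine k S := by
  obtain ⟨m, r, f, hf⟩ := h
  refine ⟨m, r, fun i => MvPolynomial.rename finSumFinEquiv (f i), ?_⟩
  ext a
  rw [hf]
  refine exists_congr fun b => forall_congr' fun i => ?_
  rw [MvPolynomial.eval_rename]
  have : Fin.append a b ∘ finSumFinEquiv = Sum.elim a b := by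
    funext x; rcases x with x | x <;> simp
  rw [this]

end Dio

/-- Diophantine subsets of the field. -/
def Dio₁ (T : Set k) : Prop := Dio {a : Unit → k | a () ∈ T}

lemma Dio₁.preimage {T : Set k} (hT : Dio₁ T) {g : (σ → k) → k} (hg : g ∈ polyFun σ k k) :
    Dio {a : σ → k | g a ∈ T} :=
  Dio.preimage hT (fun _ => g) fun _ => hg

lemma Dio₁.biUnion {ι : Type*} (s : Finset ι) {T : ι → Set k} (h : ∀ i ∈ s, Dio₁ (T i)) :
    Dio₁ (⋃ i ∈ s, T i) := by
  have e : {a : Unit → k | a () ∈ ⋃ i ∈ s, T i} = ⋃ i ∈ s, {a | a () ∈ T i} := by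
    ext a
    simp
  rw [Dio₁, e]
  exact Dio.biUnion s h

end dio

section

open IsDedekindDomain
section dioTrace

open WithZero

variable {k : Type*} [Field k] [NumberField k]
  (v : HeightOneSpectrum (NumberField.RingOfIntegers k))

lemma exists_algebraMap_sub_le_mul {π : k} (hπ : v.valuation k π = exp (-1 : ℤ)) {Y : v.adicCompletion k}
    (hY : Y ≠ 0) (m : ℕ) : ∃ y : k, Valued.v (Y - algebraMap k _ y) <
      Valued.v Y * (v.valuation k π) ^ m := by
  have h0 : π ≠ 0 := by rintro rfl; rw [map_zero] at hπ; exact WithZero.exp_ne_zero hπ.symm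
  have hv : (Valued.v Y : ℤᵐ⁰) ≠ 0 := (Valuation.ne_zero_iff _).2 hY
  obtain ⟨y, hy⟩ := exists_algebraMap_sub_lt v Y (γ := π ^ (m + (-(WithZero.log (Valued.v Y : ℤᵐ⁰))).toNat))
    (pow_ne_zero _ h0)
  refine ⟨y, hy.trans_le ?_⟩
  rw [map_pow, pow_add, mul_comm]
  refine mul_le_mul' ?_ le_rfl
  rw [hπ, ← WithZero.exp_nsmul, ← WithZero.exp_log hv, WithZero.exp_le_exp, WithZero.log_exp]
  simp only [nsmul_eq_mul, mul_neg, mul_one]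
  omega

variable {v} in
lemma isPw_algebraMap_iff {π : k} (hπ : v.valuation k π = exp (-1 : ℤ))
    (H : PadicLike k (Valued.v : Valuation (v.adicCompletion k) ℤᵐ⁰) π) {N : ℕ} (hN : 0 < N) :
    ∃ m : ℕ, ∀ x : k, IsPw N (algebraMap k (v.adicCompletion k) x) ↔
      x = 0 ∨ ∃ y z : k, y ≠ 0 ∧ v.valuation k z ≤ 1 ∧ x = y ^ N * (1 + π ^ m * z) := by
  obtain ⟨m, hm1, hm⟩ := H.isPw_of_near N hN
  have hπ0 : π ≠ 0 := by rintro rfl; rw [map_zero] at hπ; exact WithZero.exp_ne_zero hπ.symm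
  refine ⟨m, fun x => ⟨?_, ?_⟩⟩
  · rintro ⟨Y, hY⟩
    rcases eq_or_ne x 0 with rfl | hx
    · exact Or.inl rfl
    right
    have hY0 : Y ≠ 0 := by
      rintro rfl
      rw [zero_pow hN.ne', eq_comm, map_eq_zero] at hY
      exact hx hY
    obtain ⟨y, hy⟩ := exists_algebraMap_sub_le_mul v hπ hY0 m
    have hvp : v.valuation k π ^ m ≤ 1 := by
      rw [hπ]; exact pow_le_one' (by rw [← WithZero.exp_zero, WithZero.exp_le_exp]; norm_num) _
    have hyY : Valued.v (algebraMap k (v.adicCompletion k) y) = Valued.v Y := by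
      refine (Valuation.map_eq_of_sub_lt _ ?_)
      rw [Valuation.map_sub_swap]
      exact hy.trans_le (mul_le_of_le_one_right' hvp)
    have hy0 : y ≠ 0 := by
      rintro rfl
      rw [map_zero, map_zero, eq_comm, map_eq_zero] at hyY
      exact hY0 hyY
    refine ⟨y, (x / y ^ N - 1) / π ^ m, hy0, ?_, ?_⟩
    · have hy0' : algebraMap k (v.adicCompletion k) y ≠ 0 := (map_ne_zero _).2 hy0
      have h1 : Valued.v (Y / algebraMap k (v.adicCompletion k) y - 1) ≤ v.valuation k π ^ m := by
        rw [div_sub_one hy0', map_div₀, hyY]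
        refine (div_le_iff₀ (zero_lt_iff.2 ((Valuation.ne_zero_iff _).2 hY0))).2 ?_
        rw [mul_comm]; exact hy.le
      have h2 : Valued.v (algebraMap k (v.adicCompletion k) (x / y ^ N - 1)) ≤ v.valuation k π ^ m := by
        rw [map_sub, map_div₀, map_pow, ← hY, map_one, ← div_pow]
        set t := Y / algebraMap k (v.adicCompletion k) y
        have ht : Valued.v t ≤ (1 : ℤᵐ⁰) := by
          rw [map_div₀, hyY, div_self ((Valuation.ne_zero_iff _).2 hY0)]
        rw [← mul_geom_sum t N, map_mul]
        refine (mul_le_mul' h1 (Valuation.map_sum_le _ fun i _ => ?_)).trans_eq (mul_one _)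
        rw [map_pow]; exact pow_le_one' ht _
      rw [valued_algebraMap] at h2
      rw [map_div₀, map_pow]
      exact (div_le_iff₀ (zero_lt_iff.2 (pow_ne_zero _ ((Valuation.ne_zero_iff _).2 hπ0)))).2
        (by rwa [one_mul])
    · field_simp
      ring
  · rintro (rfl | ⟨y, z, hy, hz, rfl⟩)
    · exact ⟨0, by rw [zero_pow hN.ne', map_zero]⟩
    · obtain ⟨t, ht⟩ := hm (algebraMap k (v.adicCompletion k) (1 + π ^ m * z)) (by
        rw [← map_one (algebraMap k (v.adicCompletion k)), ← map_sub, add_sub_cancel_left,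
          valued_algebraMap, valued_algebraMap, map_mul, map_pow]
        exact mul_le_of_le_one_right' hz)
      exact ⟨algebraMap k _ y * t, by rw [mul_pow, ht, map_mul, map_pow]⟩

variable {v} {π : k} (hπ : v.valuation k π = exp (-1 : ℤ))
    (H : PadicLike k (Valued.v : Valuation (v.adicCompletion k) ℤᵐ⁰) π)
    (hO : Dio₁ {x : k | v.valuation k x ≤ 1})

include hπ H hO

lemma dio_isPw {N : ℕ} (hN : 0 < N) :
    Dio₁ {x : k | IsPw N (algebraMap k (v.adicCompletion k) x)} := by
  obtain ⟨m, hm⟩ := isPw_algebraMap_iff hπ H hN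
  simp only [Dio₁, Set.mem_ofPred_eq, hm]
  refine Dio.union (S := {a : Unit → k | a () = 0}) (Dio.eq_zero_of_mem (coord_mem_polyFun_self _)) ?_
  refine Dio.ex₁ (Dio.ex₁ ?_)
  have h1 : (fun a : (Unit ⊕ Unit) ⊕ Unit → k => a (Sum.inl (Sum.inr ()))) ∈ polyFun _ k k :=
    coord_mem_polyFun_self _
  have h2 : (fun a : (Unit ⊕ Unit) ⊕ Unit → k => a (Sum.inr ())) ∈ polyFun _ k k :=
    coord_mem_polyFun_self _
  have h3 : (fun a : (Unit ⊕ Unit) ⊕ Unit → k => a (Sum.inl (Sum.inl ()))) ∈ polyFun _ k k :=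
    coord_mem_polyFun_self _
  exact (Dio.ne_zero_of_mem h1).inter ((hO.preimage h2).inter (Dio.eq_of_mem h3
    (mul_mem (pow_mem h1 N) (add_mem (one_mem _) (mul_mem (const_mem_polyFun (π ^ m)) h2)))))

lemma dio_not_isPw {N : ℕ} (hN : 0 < N) :
    Dio₁ {x : k | ¬ IsPw N (algebraMap k (v.adicCompletion k) x)} := by
  classical
  obtain ⟨S, hS0, hS⟩ := H.power_reps N hN
  have key : {x : k | ¬ IsPw N (algebraMap k (v.adicCompletion k) x)} =
      {x | x ≠ 0} ∩ ⋃ κ ∈ S.filter (fun κ => ¬ IsPw N (algebraMap k (v.adicCompletion k) κ)),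
        {x | IsPw N (algebraMap k (v.adicCompletion k) (κ⁻¹ * x))} := by
    ext x
    simp only [Set.mem_ofPred_eq, Set.mem_inter_iff, Set.mem_iUnion, Finset.mem_filter, exists_prop]
    constructor
    · intro hx
      have hx0 : x ≠ 0 := by
        rintro rfl
        exact hx ⟨0, by rw [zero_pow hN.ne', map_zero]⟩
      obtain ⟨κ, hκ, y, hy⟩ := hS (algebraMap k _ x) ((map_ne_zero _).2 hx0)
      refine ⟨hx0, κ, ⟨hκ, ?_⟩, y, ?_⟩
      · rintro ⟨z, hz⟩
        exact hx ⟨z * y, by rw [mul_pow, hz, hy]⟩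
      · rw [map_mul, hy, map_inv₀, inv_mul_cancel_left₀ ((map_ne_zero _).2 (hS0 κ hκ))]
    · rintro ⟨hx0, κ, ⟨hκ, hκ'⟩, y, hy⟩ ⟨z, hz⟩
      have hy0 : y ≠ 0 := by
        rintro rfl
        rw [zero_pow hN.ne', eq_comm, map_eq_zero] at hy
        exact mul_ne_zero (inv_ne_zero (hS0 κ hκ)) hx0 hy
      refine hκ' ⟨z / y, ?_⟩
      rw [div_pow, hz, hy, map_mul, map_inv₀]
      have h1 : algebraMap k (v.adicCompletion k) κ ≠ 0 := (map_ne_zero _).2 (hS0 κ hκ)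
      have h2 : algebraMap k (v.adicCompletion k) x ≠ 0 := (map_ne_zero _).2 hx0
      field_simp
  rw [key]
  have h1 : (fun a : Unit → k => a ()) ∈ polyFun Unit k k := coord_mem_polyFun_self _
  refine (Dio.ne_zero_of_mem h1).inter ?_
  exact Dio₁.biUnion _ fun κ _ =>
    (dio_isPw hπ H hO hN).preimage (mul_mem (const_mem_polyFun κ⁻¹) h1)

lemma PowDefinable.dio {ρ : Type*} {S : Set (ρ → v.adicCompletion k)} (hS : PowDefinable k S) :
    Dio {a : ρ → k | (fun i => algebraMap k (v.adicCompletion k) (a i)) ∈ S} := by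
  classical
  obtain ⟨F, hF⟩ := hS
  let P : (ρ → k) → ℕ+ × MvPolynomial ρ k → Prop := fun a p =>
    IsPw p.1 (algebraMap k (v.adicCompletion k) (MvPolynomial.eval a p.2))
  have hP : ∀ a p, P a p ↔ IsPw p.1 (MvPolynomial.aeval
      (fun i => algebraMap k (v.adicCompletion k) (a i)) p.2) := by
    intro a p
    rw [show (fun i => algebraMap k (v.adicCompletion k) (a i)) = algebraMap k _ ∘ a from rfl,
      MvPolynomial.aeval_algebraMap_apply]
    rfl
  let good : Finset (ℕ+ × MvPolynomial ρ k) → Prop := fun G =>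
    ∃ a : ρ → k, (fun i => algebraMap k (v.adicCompletion k) (a i)) ∈ S ∧ F.filter (P a) = G
  have key : {a : ρ → k | (fun i => algebraMap k (v.adicCompletion k) (a i)) ∈ S} =
      ⋃ G ∈ F.powerset.filter good, (⋂ p ∈ G, {a | P a p}) ∩ ⋂ p ∈ F \ G, {a | ¬ P a p} := by
    ext a
    simp only [Set.mem_ofPred_eq, Set.mem_iUnion, Finset.mem_filter, Finset.mem_powerset,
      Set.mem_inter_iff, Set.mem_iInter, Finset.mem_sdiff, exists_prop]
    constructor
    · intro ha
      exact ⟨F.filter (P a), ⟨Finset.filter_subset _ _, a, ha, rfl⟩,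
        fun p hp => (Finset.mem_filter.1 hp).2, fun p hp h => hp.2 (Finset.mem_filter.2 ⟨hp.1, h⟩)⟩
    · rintro ⟨_, ⟨-, b, hb, rfl⟩, h1, h2⟩
      refine hF _ _ (fun p hp => ?_) hb
      rw [← hP, ← hP]
      constructor
      · intro h
        exact h1 p (Finset.mem_filter.2 ⟨hp, h⟩)
      · intro h
        by_contra hcon
        exact h2 p ⟨hp, fun h' => hcon (Finset.mem_filter.1 h').2⟩ h
  rw [key]
  have hpoly : ∀ p : MvPolynomial ρ k, (fun a => MvPolynomial.eval a p) ∈ polyFun ρ k k :=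
    fun p => mem_polyFun_iff.2 ⟨p, fun a => rfl⟩
  exact Dio.biUnion _ fun G _ => (Dio.biInter _ fun p _ =>
    (dio_isPw hπ H hO p.1.pos).preimage (hpoly p.2)).inter (Dio.biInter _ fun p _ =>
    (dio_not_isPw hπ H hO p.1.pos).preimage (hpoly p.2))

end dioTrace

end

section integersAtPlace

open WithZero IsDedekindDomain NumberField

variable {k : Type*} [Field k] [NumberField k] (v : HeightOneSpectrum (𝓞 k))

/-- Elements of high order at `v` which are units elsewhere. -/
lemma exists_intValuation_le_and_isUnit (N : ℕ) : ∃ c : 𝓞 k, c ≠ 0 ∧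
    v.intValuation c ≤ exp (-(N : ℤ)) ∧
    ∀ z : 𝓞 k, z ∉ v.asIdeal → ∃ (n : ℕ) (z' : 𝓞 k), z ^ (n + 1) = 1 + c * z' := by
  have hI : v.asIdeal ∈ nonZeroDivisors (Ideal (𝓞 k)) := mem_nonZeroDivisors_of_ne_zero v.ne_bot
  have h1 : ((v.asIdeal ^ Fintype.card (ClassGroup (𝓞 k))) : Ideal (𝓞 k)).IsPrincipal := by
    rw [← ClassGroup.mk0_eq_one_iff (pow_mem hI _)]
    have := map_pow ClassGroup.mk0 ⟨v.asIdeal, hI⟩ (Fintype.card (ClassGroup (𝓞 k)))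
    rw [pow_card_eq_one] at this
    exact this
  obtain ⟨ϖ, hϖ⟩ := h1
  have hc : v.asIdeal ^ (Fintype.card (ClassGroup (𝓞 k)) * N) = Ideal.span {ϖ ^ N} := by
    rw [pow_mul, hϖ, ← Ideal.span_singleton_pow]
  have hne : v.asIdeal ^ (Fintype.card (ClassGroup (𝓞 k)) * N) ≠ ⊥ := pow_ne_zero _ v.ne_bot
  refine ⟨ϖ ^ N, ?_, ?_, ?_⟩
  · intro h0
    rw [hc, h0] at hne
    simp at hne
  · rw [HeightOneSpectrum.intValuation_le_pow_iff_mem]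
    refine Ideal.pow_le_pow_right (Nat.le_mul_of_pos_left N (Fintype.card_pos (α := ClassGroup (𝓞 k)))) ?_
    rw [hc]
    exact Ideal.mem_span_singleton_self _
  · intro z hz
    have hcop : IsCoprime (Ideal.span {z}) (v.asIdeal ^ (Fintype.card (ClassGroup (𝓞 k)) * N)) := by
      refine IsCoprime.pow_right ?_
      rw [Ideal.isCoprime_iff_sup_eq, sup_comm]
      exact v.isMaximal.out.2 _ (left_lt_sup.2 (by rwa [Ideal.span_singleton_le_iff_mem]))
    have : Finite (𝓞 k ⧸ (Ideal.span {ϖ ^ N})) := by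
      rw [← hc]; exact Ideal.finiteQuotientOfFreeOfNeBot _ hne
    rw [hc, Ideal.isCoprime_span_singleton_iff] at hcop
    have hu : IsUnit (Ideal.Quotient.mk (Ideal.span {ϖ ^ N}) z) := by
      obtain ⟨a, b, hab⟩ := hcop
      refine IsUnit.of_mul_eq_one (Ideal.Quotient.mk _ a) ?_
      rw [← map_mul, ← map_one (Ideal.Quotient.mk _), Ideal.Quotient.mk_eq_mk_iff_sub_mem,
        Ideal.mem_span_singleton]
      exact ⟨-b, by linear_combination hab⟩
    obtain ⟨u, hu⟩ := hu
    obtain ⟨n, hn⟩ : ∃ n, Nat.card (𝓞 k ⧸ Ideal.span {ϖ ^ N})ˣ = n + 1 :=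
      Nat.exists_eq_add_one.2 Nat.card_pos
    have h2 : Ideal.Quotient.mk (Ideal.span {ϖ ^ N}) (z ^ (n + 1)) = Ideal.Quotient.mk _ 1 := by
      rw [map_pow, ← hu, ← Units.val_pow_eq_pow_val, ← hn, pow_card_eq_one', map_one, Units.val_one]
    rw [Ideal.Quotient.mk_eq_mk_iff_sub_mem, Ideal.mem_span_singleton] at h2
    obtain ⟨z', hz'⟩ := h2
    exact ⟨n, z', by linear_combination hz'⟩

/-- A bounded diophantine set containing a multiple of the integers yields the valuation ring. -/
lemma dio_valuation_le_one_of_bounded {T : Set k} (hT : Dio₁ T) (hT1 : ∀ x ∈ T, v.valuation k x ≤ 1)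
    {Q : ℕ} (hQ : Q ≠ 0) (hTQ : ∀ n : ℤ, (Q * n : k) ∈ T) :
    Dio₁ {x : k | v.valuation k x ≤ 1} := by
  have hQk : (Q : k) ≠ 0 := Nat.cast_ne_zero.2 hQ
  have hvQ : v.valuation k (Q : k) ≠ 0 := (Valuation.ne_zero_iff _).2 hQk
  let ω := RingOfIntegers.basis k
  let T4 : Set k := {x | ∃ y : Module.Free.ChooseBasisIndex ℤ (𝓞 k) → k,
    (∀ i, Q * y i ∈ T) ∧ x = ∑ i, y i * algebraMap (𝓞 k) k (ω i)}
  have h4le : ∀ x ∈ T4, v.valuation k Q * v.valuation k x ≤ 1 := by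
    rintro x ⟨y, hy, rfl⟩
    rw [← map_mul, Finset.mul_sum]
    refine Valuation.map_sum_le _ fun i _ => ?_
    rw [← mul_assoc, map_mul]
    exact mul_le_one' (hT1 _ (hy i)) (v.valuation_le_one _)
  have h4int : ∀ x : 𝓞 k, algebraMap (𝓞 k) k x ∈ T4 := by
    intro x
    refine ⟨fun i => (ω.repr x i : ℤ), fun i => hTQ _, ?_⟩
    conv_lhs => rw [← ω.sum_repr x]
    rw [map_sum]
    refine Finset.sum_congr rfl fun i _ => ?_
    rw [zsmul_eq_mul, map_mul, map_intCast]
  have h4dio : Dio₁ T4 := by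
    refine Dio.ex (P := fun (a : Unit → k) (y : _ → k) => (∀ i, Q * y i ∈ T) ∧ a () = ∑ i, y i * algebraMap (𝓞 k) k (ω i)) ?_
    have e : {c : Unit ⊕ Module.Free.ChooseBasisIndex ℤ (𝓞 k) → k | (∀ i, (Q : k) * c (Sum.inr i) ∈ T) ∧
      c (Sum.inl ()) = ∑ i, c (Sum.inr i) * algebraMap (𝓞 k) k (ω i)} =
      (⋂ i ∈ (Finset.univ : Finset (Module.Free.ChooseBasisIndex ℤ (𝓞 k))), {c | (Q : k) * c (Sum.inr i) ∈ T}) ∩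
      {c | c (Sum.inl ()) = ∑ i, c (Sum.inr i) * algebraMap (𝓞 k) k (ω i)} := by
      ext c; simp
    refine (congrArg Dio e).mpr (Dio.inter (Dio.biInter _ fun i _ =>
      hT.preimage (mul_mem (const_mem_polyFun (Q : k)) (coord_mem_polyFun_self _))) ?_)
    refine Dio.eq_of_mem (coord_mem_polyFun_self _) ?_
    have : (fun c : Unit ⊕ Module.Free.ChooseBasisIndex ℤ (𝓞 k) → k =>
      ∑ i, c (Sum.inr i) * algebraMap (𝓞 k) k (ω i)) = ∑ i, (fun c => c (Sum.inr i)) *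
        fun _ => algebraMap (𝓞 k) k (ω i) := by
      ext c; simp
    rw [this]
    exact sum_mem fun i _ => mul_mem (coord_mem_polyFun_self _) (const_mem_polyFun _)
  obtain ⟨N, hN⟩ : ∃ N : ℕ, (exp (-(N : ℤ)) : ℤᵐ⁰) < v.valuation k Q := by
    refine ⟨(1 - log (v.valuation k (Q : k))).toNat, ?_⟩
    conv_rhs => rw [← exp_log hvQ]
    rw [exp_lt_exp]
    omega
  obtain ⟨c, hc0, hcN, hc⟩ := exists_intValuation_le_and_isUnit v N
  have hcv : v.valuation k (algebraMap (𝓞 k) k c) < v.valuation k Q := by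
    rw [HeightOneSpectrum.valuation_of_algebraMap]
    exact hcN.trans_lt hN
  have hck : algebraMap (𝓞 k) k c ≠ 0 := by simpa using hc0
  have hvc : v.valuation k (algebraMap (𝓞 k) k c) ≠ 0 := (Valuation.ne_zero_iff _).2 hck
  have hcT4 : ∀ z ∈ T4, v.valuation k (algebraMap (𝓞 k) k c * z) < 1 := by
    intro z hz
    rcases eq_or_ne z 0 with rfl | hz0
    · simp
    rw [map_mul]
    refine lt_of_lt_of_le ?_ (h4le z hz)
    exact (mul_lt_mul_iff_left₀ (zero_lt_iff.2 ((Valuation.ne_zero_iff _).2 hz0))).2 hcv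
  let T5 : Set k := {x | ∃ y z, y ∈ T4 ∧ z ∈ T4 ∧ x * (1 + algebraMap (𝓞 k) k c * z) = y}
  have h5le : ∀ x ∈ T5, v.valuation k (algebraMap (𝓞 k) k c * x) ≤ 1 := by
    rintro x ⟨y, z, hy, hz, rfl⟩
    have h1 := hcT4 _ hy
    rw [map_mul, map_mul, Valuation.map_one_add_of_lt _ (hcT4 z hz), mul_one] at h1
    rw [map_mul]
    exact h1.le
  have h5int : ∀ x, v.valuation k x ≤ 1 → x ∈ T5 := by
    intro x hx
    obtain ⟨y, d, hd⟩ := v.exists_primeCompl_mul_eq_of_integer x hx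
    obtain ⟨n, z', hz'⟩ := hc d d.2
    refine ⟨algebraMap (𝓞 k) k (y * d ^ n), algebraMap (𝓞 k) k z', h4int _, h4int _, ?_⟩
    rw [← map_mul, ← map_one (algebraMap (𝓞 k) k), ← map_add, ← hz', map_mul, ← hd, pow_succ, map_mul]
    ring
  have h5dio : Dio₁ T5 := by
    refine Dio.ex₁ (Dio.ex₁ ?_)
    have h1 : (fun a : (Unit ⊕ Unit) ⊕ Unit → k => a (Sum.inl (Sum.inr ()))) ∈ polyFun _ k k :=
      coord_mem_polyFun_self _
    have h2 : (fun a : (Unit ⊕ Unit) ⊕ Unit → k => a (Sum.inr ())) ∈ polyFun _ k k :=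
      coord_mem_polyFun_self _
    have h3 : (fun a : (Unit ⊕ Unit) ⊕ Unit → k => a (Sum.inl (Sum.inl ()))) ∈ polyFun _ k k :=
      coord_mem_polyFun_self _
    exact (h4dio.preimage h1).inter ((h4dio.preimage h2).inter (Dio.eq_of_mem (mul_mem h3
      (add_mem (one_mem _) (mul_mem (const_mem_polyFun (algebraMap (𝓞 k) k c)) h2))) h1))
  obtain ⟨M, hM⟩ : ∃ M : ℕ, (exp (-(M : ℤ)) : ℤᵐ⁰) ≤ v.valuation k (algebraMap (𝓞 k) k c) := by
    refine ⟨(- log (v.valuation k (algebraMap (𝓞 k) k c))).toNat, ?_⟩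
    conv_rhs => rw [← exp_log hvc]
    rw [exp_le_exp]
    omega
  obtain ⟨S, hS⟩ := exists_integer_reps v M
  have key : {x : k | v.valuation k x ≤ 1} = ⋃ ρ ∈ S, {x | (algebraMap (𝓞 k) k c)⁻¹ *
      (x - algebraMap (𝓞 k) k ρ) ∈ T5} := by
    ext x
    simp only [Set.mem_ofPred_eq, Set.mem_iUnion, exists_prop]
    constructor
    · intro hx
      obtain ⟨ρ, hρ, h⟩ := hS x hx
      refine ⟨ρ, hρ, h5int _ ?_⟩
      rw [map_mul, map_inv₀]
      exact inv_mul_le_one_of_le₀ (h.trans hM) zero_le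
    · rintro ⟨ρ, -, h⟩
      have h1 := h5le _ h
      rw [mul_inv_cancel_left₀ hck] at h1
      rw [← sub_add_cancel x (algebraMap (𝓞 k) k ρ)]
      exact (Valuation.map_add _ _ _).trans (max_le h1 (v.valuation_le_one _))
  rw [key]
  exact Dio₁.biUnion _ fun ρ _ => h5dio.preimage (mul_mem (const_mem_polyFun _)
    (sub_mem (coord_mem_polyFun_self _) (const_mem_polyFun _)))

end integersAtPlace

section cyclicAlgebra

variable {ℓ : ℕ} [hℓ : Fact ℓ.Prime] {Ω : Type*} [Field Ω]

/-- Elements of a cyclic algebra of degree `ℓ` as matrices over a splitting field: the matrix of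
`∑ w i j * X ^ i * Y ^ j`, where `X ^ ℓ = γ ^ ℓ`, `Y ^ ℓ = η ^ ℓ`, and `X` is diagonal. -/
noncomputable def cycMat (ψ : AddChar (ZMod ℓ) Ω) (γ η : Ω) (w : ZMod ℓ → ZMod ℓ → Ω) :
    Matrix (ZMod ℓ) (ZMod ℓ) Ω :=
  Matrix.of fun s t => ∑ i, w i (s - t) * γ ^ i.val * ψ (i * s) * η ^ (s - t).val

/-- The carry digit of the addition of two residues. -/
def ZMod.carry (a b : ZMod ℓ) : ℕ := (a.val + b.val) / ℓ

lemma ZMod.pow_val_mul_pow_val (x : Ω) (a b : ZMod ℓ) :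
    x ^ a.val * x ^ b.val = x ^ (a + b).val * (x ^ ℓ) ^ ZMod.carry a b := by
  rw [← pow_add, ← pow_mul, ← pow_add, ZMod.val_add, ZMod.carry, Nat.mod_add_div]

variable (ψ : AddChar (ZMod ℓ) Ω) (γ η : Ω)

lemma cycMat_apply (w : ZMod ℓ → ZMod ℓ → Ω) (s t : ZMod ℓ) :
    cycMat ψ γ η w s t = ∑ i, w i (s - t) * γ ^ i.val * ψ (i * s) * η ^ (s - t).val := rfl

lemma cycMat_add (w w' : ZMod ℓ → ZMod ℓ → Ω) :
    cycMat ψ γ η (w + w') = cycMat ψ γ η w + cycMat ψ γ η w' := by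
  ext s t
  simp only [cycMat_apply, Matrix.add_apply, Pi.add_apply, add_mul, Finset.sum_add_distrib]

lemma cycMat_smul (a : Ω) (w : ZMod ℓ → ZMod ℓ → Ω) :
    cycMat ψ γ η (a • w) = a • cycMat ψ γ η w := by
  ext s t
  simp only [cycMat_apply, Matrix.smul_apply, Pi.smul_apply, smul_eq_mul, mul_assoc, Finset.mul_sum]

lemma cycMat_sub (w w' : ZMod ℓ → ZMod ℓ → Ω) :
    cycMat ψ γ η (w - w') = cycMat ψ γ η w - cycMat ψ γ η w' := by
  rw [eq_sub_iff_add_eq, ← cycMat_add, sub_add_cancel]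

/-- The coordinates of a product. -/
noncomputable def cycMul (w w' : ZMod ℓ → ZMod ℓ → Ω) (a b : ZMod ℓ) : Ω :=
  ∑ i, ∑ j, w i j * w' (a - i) (b - j) * ψ (-((a - i) * j)) *
    ((γ ^ ℓ) ^ ZMod.carry i (a - i) * (η ^ ℓ) ^ ZMod.carry j (b - j))

lemma cycMat_mul (w w' : ZMod ℓ → ZMod ℓ → Ω) :
    cycMat ψ γ η w * cycMat ψ γ η w' = cycMat ψ γ η (cycMul ψ γ η w w') := by
  ext s t
  simp only [Matrix.mul_apply, cycMat_apply, cycMul]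
  rw [← (Equiv.subLeft s).sum_comp]
  simp only [Equiv.subLeft_apply, sub_sub_cancel, Finset.sum_mul_sum]
  rw [Finset.sum_comm]
  have : ∀ i j : ZMod ℓ, (∑ i', w i j * γ ^ i.val * ψ (i * s) * η ^ j.val *
      (w' i' (s - j - t) * γ ^ i'.val * ψ (i' * (s - j)) * η ^ (s - j - t).val)) =
      ∑ a, w i j * w' (a - i) (s - t - j) * ψ (-((a - i) * j)) *
        ((γ ^ ℓ) ^ ZMod.carry i (a - i) * (η ^ ℓ) ^ ZMod.carry j (s - t - j)) * γ ^ a.val *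
        ψ (a * s) * η ^ (s - t).val := by
    intro i j
    rw [← (Equiv.subRight i).sum_comp]
    refine Finset.sum_congr rfl fun a _ => ?_
    have h1 := ZMod.pow_val_mul_pow_val γ i (a - i)
    have h2 := ZMod.pow_val_mul_pow_val η j (s - t - j)
    have h3 : ψ (i * s) * ψ ((a - i) * (s - j)) = ψ (-((a - i) * j)) * ψ (a * s) := by
      rw [← AddChar.map_add_eq_mul, ← AddChar.map_add_eq_mul]
      congr 1; ring
    rw [add_sub_cancel] at h1 h2
    rw [Equiv.subRight_apply, show s - j - t = s - t - j by ring]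
    calc _ = w i j * w' (a - i) (s - t - j) * (γ ^ i.val * γ ^ (a - i).val) *
          (ψ (i * s) * ψ ((a - i) * (s - j))) * (η ^ j.val * η ^ (s - t - j).val) := by ring
      _ = _ := by rw [h1, h2, h3]; ring
  simp only [this, Finset.sum_mul]
  rw [Finset.sum_congr rfl fun i _ => Finset.sum_comm, Finset.sum_comm]

variable {ψ}

lemma AddChar.sum_mul_left_eq_ite (hψ : ψ.IsPrimitive) (i : ZMod ℓ) :
    ∑ s, ψ (i * s) = if i = 0 then (ℓ : Ω) else 0 := by
  have := AddChar.sum_mulShift i hψ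
  simp only [ZMod.card] at this
  simpa only [mul_comm i, Nat.cast_ite, Nat.cast_zero] using this

lemma trace_cycMat (hψ : ψ.IsPrimitive) (w : ZMod ℓ → ZMod ℓ → Ω) :
    (cycMat ψ γ η w).trace = ℓ * w 0 0 := by
  simp only [Matrix.trace, Matrix.diag_apply, cycMat_apply, sub_self, ZMod.val_zero, pow_zero,
    mul_one]
  rw [Finset.sum_comm]
  simp only [← Finset.mul_sum, AddChar.sum_mul_left_eq_ite hψ]
  simp [mul_comm]

variable (ψ)

lemma cycMat_single_zero_right (i : ZMod ℓ) (a : Ω) :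
    cycMat ψ γ η (Pi.single i (Pi.single 0 a)) =
      Matrix.diagonal fun s => a * γ ^ i.val * ψ (i * s) := by
  ext s t
  rw [cycMat_apply, Finset.sum_eq_single i]
  · rw [Pi.single_eq_same]
    rcases eq_or_ne s t with rfl | h
    · simp
    · rw [Pi.single_eq_of_ne (sub_ne_zero.2 h), Matrix.diagonal_apply_ne _ h]
      simp
  · intro b _ hb
    rw [Pi.single_eq_of_ne hb]; simp
  · simp

lemma cycMat_scalar (a : Ω) :
    cycMat ψ γ η (Pi.single 0 (Pi.single 0 a)) = a • (1 : Matrix (ZMod ℓ) (ZMod ℓ) Ω) := by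
  rw [cycMat_single_zero_right, Matrix.smul_one_eq_diagonal]
  simp

/-- The algebra generated by `X` and `Y` over a subfield. -/
def cycAlg (A : Subfield Ω) (hψ : ∀ a, ψ a ∈ A) (hγ : γ ^ ℓ ∈ A) (hη : η ^ ℓ ∈ A) :
    Subalgebra A (Matrix (ZMod ℓ) (ZMod ℓ) Ω) where
  carrier := {M | ∃ w : ZMod ℓ → ZMod ℓ → Ω, (∀ i j, w i j ∈ A) ∧ cycMat ψ γ η w = M}
  mul_mem' := by
    rintro _ _ ⟨w, hw, rfl⟩ ⟨w', hw', rfl⟩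
    refine ⟨_, fun a b => sum_mem fun i _ => sum_mem fun j _ => ?_, (cycMat_mul ψ γ η w w').symm⟩
    exact mul_mem (mul_mem (mul_mem (hw _ _) (hw' _ _)) (hψ _))
      (mul_mem (pow_mem hγ _) (pow_mem hη _))
  add_mem' := by
    rintro _ _ ⟨w, hw, rfl⟩ ⟨w', hw', rfl⟩
    exact ⟨_, fun a b => add_mem (hw _ _) (hw' _ _), cycMat_add ψ γ η w w'⟩
  algebraMap_mem' := by
    intro a
    refine ⟨Pi.single 0 (Pi.single 0 (a : Ω)), fun i j => ?_, ?_⟩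
    · simp only [Pi.single_apply, ite_apply]
      split_ifs
      · exact a.2
      · exact zero_mem _
      · exact zero_mem _
    · rw [cycMat_scalar, Algebra.algebraMap_eq_smul_one]; rfl

lemma mem_cycAlg_iff {A : Subfield Ω} {hψ : ∀ a, ψ a ∈ A} {hγ : γ ^ ℓ ∈ A} {hη : η ^ ℓ ∈ A}
    {M : Matrix (ZMod ℓ) (ZMod ℓ) Ω} : M ∈ cycAlg ψ γ η A hψ hγ hη ↔
      ∃ w : ZMod ℓ → ZMod ℓ → Ω, (∀ i j, w i j ∈ A) ∧ cycMat ψ γ η w = M := Iff.rfl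

variable {ψ γ η}

lemma eq_zero_of_forall_trace_mul_eq_zero [CharZero Ω] {A : Subfield Ω} {hψA : ∀ a, ψ a ∈ A}
    {hγ : γ ^ ℓ ∈ A} {hη : η ^ ℓ ∈ A}
    (hψ : ψ.IsPrimitive) (hγ0 : γ ≠ 0) (hη0 : η ≠ 0) {M : Matrix (ZMod ℓ) (ZMod ℓ) Ω}
    (hM : M ∈ cycAlg ψ γ η A hψA hγ hη)
    (h : ∀ M' ∈ cycAlg ψ γ η A hψA hγ hη, (M * M').trace = 0) : M = 0 := by
  obtain ⟨w, hw, rfl⟩ := hM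
  suffices hw0 : w = 0 by
    rw [hw0]; ext s t; simp [cycMat_apply]
  ext i j
  have h1 := h (cycMat ψ γ η (Pi.single (-i) (Pi.single (-j) 1))) ⟨_, fun a b => by
    simp only [Pi.single_apply, ite_apply]
    split_ifs
    · exact one_mem _
    · exact zero_mem _
    · exact zero_mem _, rfl⟩
  rw [cycMat_mul, trace_cycMat _ _ hψ, mul_eq_zero, or_iff_right (Nat.cast_ne_zero.2 hℓ.out.ne_zero),
    cycMul, Finset.sum_eq_single i, Finset.sum_eq_single j] at h1
  · simp only [zero_sub, Pi.single_eq_same, mul_one, mul_eq_zero, pow_eq_zero_iff', hγ0, hη0,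
      false_and, or_false] at h1
    exact h1.resolve_right (ψ.val_isUnit _).ne_zero
  · intro b _ hb
    have : 0 - b ≠ -j := by simpa using hb
    rw [show (0 : ZMod ℓ) - i = - i by ring, Pi.single_eq_same, Pi.single_eq_of_ne this]; simp
  · simp
  · intro b _ hb
    have : 0 - b ≠ -i := by simpa using hb
    simp only [Pi.single_eq_of_ne this, Pi.zero_apply, mul_zero, zero_mul,
      Finset.sum_const_zero]
  · simp

end cyclicAlgebra

section localDivision

variable {ℓ : ℕ} [hℓ : Fact ℓ.Prime] {Ω : Type*} [Field Ω]
  {Γ : Type*} [LinearOrderedCommGroupWithZero Γ]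

/-- A matrix whose entries have valuations depending only on the (cyclic) diagonal, with a
dominant diagonal. -/
lemma Valuation.map_det_of_dominant_diagonal (V : Valuation Ω Γ)
    (A : Matrix (ZMod ℓ) (ZMod ℓ) Ω) (N : ZMod ℓ → Γ) (hA : ∀ s t, V (A s t) = N (s - t))
    (j : ZMod ℓ) (hj : ∀ i ≠ j, N i < N j) : V A.det = N j ^ ℓ := by
  classical
  have hle : ∀ i, N i ≤ N j := fun i => by
    rcases eq_or_ne i j with rfl | h
    · rfl
    · exact (hj i h).le
  have : Nontrivial (ZMod ℓ) := ZMod.nontrivial_iff.2 hℓ.out.ne_one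
  obtain ⟨i, hi⟩ := exists_ne j
  have hpos : 0 < N j := zero_le.trans_lt (hj i hi)
  have hsgn : ∀ σ : Equiv.Perm (ZMod ℓ), V ((Equiv.Perm.sign σ : ℤ) : Ω) = 1 := by
    intro σ
    rcases Int.units_eq_one_or (Equiv.Perm.sign σ) with h | h <;> simp [h]
  rw [Matrix.det_apply', ← Finset.add_sum_erase _ _ (Finset.mem_univ (Equiv.addRight j))]
  have h0 : V (((Equiv.Perm.sign (Equiv.addRight j) : ℤ) : Ω) *
      ∏ i, A ((Equiv.addRight j) i) i) = N j ^ ℓ := by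
    rw [map_mul, hsgn, one_mul, map_prod, Finset.prod_congr rfl fun s _ => hA _ _]
    simp [ZMod.card]
  rw [Valuation.map_add_eq_of_lt_left, h0]
  rw [h0]
  refine Valuation.map_sum_lt _ (pow_pos hpos _).ne' fun σ hσ => ?_
  rw [map_mul, hsgn, one_mul, map_prod, Finset.prod_congr rfl fun s _ => hA _ _]
  obtain ⟨s, hs⟩ : ∃ s, σ s - s ≠ j := by
    by_contra! h
    refine (Finset.mem_erase.1 hσ).1 (Equiv.ext fun s => ?_)
    change σ s = s + j
    rw [← h s]; ring
  rw [← Finset.mul_prod_erase _ _ (Finset.mem_univ s)]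
  have h1 := Finset.prod_le_pow_card (Finset.univ.erase s) (fun s => N (σ s - s)) (N j)
    fun s _ => hle _
  rw [Finset.card_erase_of_mem (Finset.mem_univ s), Finset.card_univ, ZMod.card] at h1
  calc _ ≤ N (σ s - s) * N j ^ (ℓ - 1) := mul_le_mul' le_rfl h1
    _ < N j * N j ^ (ℓ - 1) := mul_lt_mul_of_pos_right (hj _ hs) (pow_pos hpos _)
    _ = N j ^ ℓ := by rw [← pow_succ', Nat.sub_add_cancel hℓ.out.one_le]

lemma exists_map_det_cycMat_eq_pow (V : Valuation Ω Γ) (E : Subfield Ω)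
    (ψ : AddChar (ZMod ℓ) Ω) {γ η : Ω} (hψE : ∀ a, ψ a ∈ E) (hψV : ∀ a, V (ψ a) = 1)
    (hγ : V γ = 1) (hη : η ≠ 0)
    (h1 : ∀ f : ZMod ℓ → Ω, (∀ a, f a ∈ E) → ∀ a, V (f a) ≤ V (∑ a, f a * γ ^ a.val))
    (h2 : ∀ e ∈ E, ∀ b : ℕ, 0 < b → b < ℓ → V e ≠ V η ^ b)
    (w : ZMod ℓ → ZMod ℓ → Ω) (hw : ∀ i j, w i j ∈ E) :
    ∃ M : Γ, V (cycMat ψ γ η w).det = M ^ ℓ ∧ ∀ i j, V (w i j) * V η ^ j.val ≤ M := by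
  choose m hm using fun j => Finite.exists_max fun i => V (w i j)
  set N : ZMod ℓ → Γ := fun j => V (w (m j) j) * V η ^ j.val with hN
  have hA : ∀ s t, V (cycMat ψ γ η w s t) = N (s - t) := by
    intro s t
    rw [cycMat_apply, ← Finset.sum_mul, map_mul, map_pow]
    congr 1
    apply le_antisymm
    · refine Valuation.map_sum_le _ fun i _ => ?_
      rw [map_mul, map_mul, map_pow, hγ, hψV, one_pow, mul_one, mul_one]
      exact hm _ _
    · have := h1 (fun a => w a (s - t) * ψ (a * s)) (fun a => mul_mem (hw _ _) (hψE _)) (m (s - t))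
      rw [map_mul, hψV, mul_one] at this
      rwa [Finset.sum_congr rfl fun a _ => mul_right_comm _ _ _] at this
  have hle : ∀ i j, V (w i j) * V η ^ j.val ≤ N j := fun i j => mul_le_mul' (hm j i) le_rfl
  obtain ⟨j, hj⟩ := Finite.exists_max N
  refine ⟨N j, ?_, fun i j' => (hle i j').trans (hj j')⟩
  rcases eq_or_ne (N j) 0 with h0 | h0
  · have : cycMat ψ γ η w = 0 := by
      ext s t
      have h3 := hj (s - t)
      rw [h0, ← hA, le_zero_iff, Valuation.zero_iff] at h3
      exact h3
    rw [this, h0, Matrix.det_zero, map_zero, zero_pow hℓ.out.ne_zero]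
  have key : ∀ i j : ZMod ℓ, N j ≠ 0 → N i = N j → j.val < i.val → False := by
    intro i j h0 h h3
    refine h2 (w (m j) j / w (m i) i) (div_mem (hw _ _) (hw _ _)) (i.val - j.val) (by omega)
      ((Nat.sub_le _ _).trans_lt (ZMod.val_lt i)) ?_
    have hVη : V η ≠ 0 := (Valuation.ne_zero_iff _).2 hη
    have h4 : V (w (m i) i) ≠ 0 := fun h4 => h0 (by rw [← h, hN]; simp [h4])
    rw [map_div₀, div_eq_iff h4]
    have h5 : V (w (m i) i) * (V η ^ (i.val - j.val) * V η ^ j.val) =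
        V (w (m j) j) * V η ^ j.val := by
      rw [← pow_add, Nat.sub_add_cancel h3.le]; exact h
    rw [← mul_assoc] at h5
    rw [mul_comm]
    exact (mul_right_cancel₀ (pow_ne_zero _ hVη) h5).symm
  refine V.map_det_of_dominant_diagonal _ N hA j fun i hi => lt_of_le_of_ne (hj i) fun h => ?_
  rcases lt_trichotomy i.val j.val with h3 | h3 | h3
  · exact key j i (h ▸ h0) h.symm h3
  · exact hi (ZMod.val_injective _ h3)
  · exact key i j h0 h h3

end localDivision

section

open Polynomial

section localConditions

variable {Ω : Type*} [Field Ω] (B : ValuationSubring Ω)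

/-- The image of a subfield in the residue field of a valuation ring. -/
noncomputable def ValuationSubring.residueSubfield (K : Subfield Ω) :
    Subfield (IsLocalRing.ResidueField B) where
  toSubring := (K.toSubring.comap B.subtype).map (IsLocalRing.residue B)
  inv_mem' := by
    rintro _ ⟨x, hx, rfl⟩
    by_cases h : IsUnit x
    · obtain ⟨u, rfl⟩ := h
      refine ⟨(u⁻¹ : Bˣ), ?_, ?_⟩
      · have : ((u⁻¹ : Bˣ) : Ω) = ((u : B) : Ω)⁻¹ := by
                  exact eq_inv_of_mul_eq_one_left (congrArg Subtype.val u.inv_mul)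
        change ((u⁻¹ : Bˣ) : Ω) ∈ K
        rw [this]
        exact inv_mem hx
      · exact eq_inv_of_mul_eq_one_left (by rw [← map_mul, u.inv_mul, map_one])
    · have : IsLocalRing.residue B x = 0 := by
        rw [IsLocalRing.residue_eq_zero_iff, IsLocalRing.mem_maximalIdeal]; exact h
      rw [this, inv_zero]
      exact (Subring.map _ _).zero_mem

variable {B}

lemma ValuationSubring.residue_eq_zero_iff {x : B} :
    IsLocalRing.residue B x = 0 ↔ B.valuation x < 1 := by
  rw [IsLocalRing.residue_eq_zero_iff, B.valuation_lt_one_iff]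

/-- A polynomial over a subfield whose value is smaller than the Gauss norm reduces, after
normalization, to a nonzero polynomial vanishing at the residue. -/
lemma ValuationSubring.exists_residue_polynomial (K : Subfield Ω) (x : B) (P : Polynomial Ω)
    (hP : ∀ n, P.coeff n ∈ K) (n : ℕ) (hn : B.valuation (P.eval (x : Ω)) < B.valuation (P.coeff n)) :
    ∃ g : (B.residueSubfield K)[X], g ≠ 0 ∧ g.natDegree ≤ P.natDegree ∧
      aeval (IsLocalRing.residue B x) g = 0 := by
  obtain ⟨a, ha, hmax⟩ := Finset.exists_max_image (Finset.range (P.natDegree + 1))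
    (fun i => B.valuation (P.coeff i)) ⟨0, by simp⟩
  have hmax' : ∀ i, B.valuation (P.coeff i) ≤ B.valuation (P.coeff a) := by
    intro i
    by_cases hi : i < P.natDegree + 1
    · exact hmax i (Finset.mem_range.2 hi)
    · rw [P.coeff_eq_zero_of_natDegree_lt (by omega), map_zero]; exact zero_le
  have hn' := hn.trans_le (hmax' n)
  set c := P.coeff a with hc
  have hVc : B.valuation c ≠ 0 := (zero_le.trans_lt hn').ne'
  have hc0 : c ≠ 0 := (Valuation.ne_zero_iff _).1 hVc
  have hq : ∀ i, P.coeff i / c ∈ B := by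
    intro i
    rw [← B.valuation_le_one_iff, map_div₀]
    exact (div_le_one₀ (zero_lt_iff.2 hVc)).2 (hmax' i)
  let q : ℕ → B := fun i => ⟨P.coeff i / c, hq i⟩
  let g : (B.residueSubfield K)[X] := ∑ i ∈ Finset.range (P.natDegree + 1),
    monomial i ⟨IsLocalRing.residue B (q i), q i, div_mem (hP i) (hP a), rfl⟩
  have hg : g.coeff a = 1 := by
    simp only [g, finsetSum_coeff, coeff_monomial, Finset.sum_ite_eq', if_pos ha]
    ext
    have : q a = 1 := Subtype.ext (div_self hc0)
    simp [this]
  refine ⟨g, fun h => by simp [h] at hg, ?_, ?_⟩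
  · refine natDegree_sum_le_of_forall_le _ _ fun i hi => (natDegree_monomial_le _).trans ?_
    rw [Finset.mem_range] at hi; omega
  · have : aeval (IsLocalRing.residue B x) g =
        IsLocalRing.residue B (∑ i ∈ Finset.range (P.natDegree + 1), q i * x ^ i) := by
      simp only [g, map_sum, aeval_monomial, map_mul, map_pow]
      rfl
    rw [this, ValuationSubring.residue_eq_zero_iff]
    have h2 : ((∑ i ∈ Finset.range (P.natDegree + 1), q i * x ^ i : B) : Ω) =
        P.eval (x : Ω) / c := by
      rw [eval_eq_sum_range, Finset.sum_div]
      push_cast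
      exact Finset.sum_congr rfl fun i _ => by simp only [q]; ring
    rw [h2, map_div₀]
    exact (div_lt_one₀ (zero_lt_iff.2 hVc)).2 hn'

/-- An element of a compositum satisfies an equation of small degree. -/
lemma IntermediateField.exists_polynomial_of_mem_sup [CharZero Ω] (K L : IntermediateField ℚ Ω)
    [FiniteDimensional ℚ K] [FiniteDimensional ℚ L] {d : Ω} (hd : d ∈ K ⊔ L) :
    ∃ P : Polynomial Ω, P ≠ 0 ∧ (∀ n, P.coeff n ∈ K) ∧ P.natDegree ≤ Module.finrank ℚ L ∧
      P.eval d = 0 := by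
  have hfin : FiniteDimensional ℚ (K ⊔ L : IntermediateField ℚ Ω) :=
    IntermediateField.finiteDimensional_sup K L
  have h_int : IsIntegral K d := by
    have : IsIntegral ℚ (⟨d, hd⟩ : (K ⊔ L : IntermediateField ℚ Ω)) := Algebra.IsIntegral.isIntegral _
    have : IsIntegral ℚ d := (isIntegral_algebraMap_iff
      (algebraMap (K ⊔ L : IntermediateField ℚ Ω) Ω).injective).2 this
    exact this.tower_top
  refine ⟨(minpoly K d).map (algebraMap K Ω), ?_, fun n => ?_, ?_, ?_⟩
  · exact (Polynomial.map_ne_zero_iff (algebraMap K Ω).injective).2 (minpoly.ne_zero h_int)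
  · rw [coeff_map]; exact ((minpoly K d).coeff n).2
  · rw [natDegree_map, ← IntermediateField.adjoin.finrank h_int]
    have h1 := IntermediateField.finrank_sup_le K L
    have h2 : Module.finrank ℚ K * Module.finrank K (IntermediateField.adjoin K {d}) ≤
        Module.finrank ℚ (K ⊔ L : IntermediateField ℚ Ω) := by
      rw [Module.finrank_mul_finrank]
      have : (IntermediateField.adjoin K {d}).restrictScalars ℚ ≤ K ⊔ L := by
        intro y hy
        have h3 : IntermediateField.adjoin K {d} ≤
            IntermediateField.extendScalars (le_sup_left : K ≤ K ⊔ L) := by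
          rw [IntermediateField.adjoin_le_iff, Set.singleton_subset_iff]
          exact hd
        exact h3 hy
      exact Submodule.finrank_mono (R := ℚ) (M := Ω)
        (s := ((IntermediateField.adjoin K {d}).restrictScalars ℚ).toSubmodule)
        (t := (K ⊔ L).toSubmodule) this
    exact Nat.le_of_mul_le_mul_left (h2.trans h1) Module.finrank_pos
  · rw [eval_map_algebraMap, minpoly.aeval]

/-- If `γ ^ ℓ` is a unit of `F` whose residue is not an `ℓ`-th power, the Gauss norm of
a polynomial of degree less than `ℓ` over an extension of `F` of degree prime to `ℓ` is
the valuation of its value at `γ`. -/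
lemma ValuationSubring.valuation_le_valuation_sum_mul_pow [CharZero Ω] {ℓ : ℕ} [hℓ : Fact ℓ.Prime]
    (K L : IntermediateField ℚ Ω) [FiniteDimensional ℚ K] [FiniteDimensional ℚ L]
    (hL : Module.finrank ℚ L < ℓ) {γ : Ω} (hγB : γ ∈ B) (hγ : γ ^ ℓ ∈ K)
    (hres : ∀ d ∈ K, d ∈ B → 1 ≤ B.valuation (γ ^ ℓ - d ^ ℓ)) (f : ZMod ℓ → Ω)
    (hf : ∀ a, f a ∈ K ⊔ L) (a : ZMod ℓ) :
    B.valuation (f a) ≤ B.valuation (∑ a, f a * γ ^ a.val) := by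
  by_contra! hlt
  set g0 : B := ⟨γ, hγB⟩ with hg0
  set res := IsLocalRing.residue B
  have hdeg : ∀ (M : IntermediateField ℚ Ω) (hM : K ≤ M) (y : B) (P : Polynomial Ω) (n : ℕ),
      (∀ n, P.coeff n ∈ M) → P.natDegree < ℓ →
      B.valuation (P.eval (y : Ω)) < B.valuation (P.coeff n) → res y ^ ℓ = res g0 ^ ℓ →
      ∃ d ∈ M, ∃ h : d ∈ B, res ⟨d, h⟩ ^ ℓ = res g0 ^ ℓ := by
    intro M hM y P n hPM hPd hlt hy
    obtain ⟨g, hg0', hgd, hgx⟩ := ValuationSubring.exists_residue_polynomial M.toSubfield y P hPM n hlt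
    by_contra! hcon
    have hc : res g0 ^ ℓ ∈ B.residueSubfield M.toSubfield := by
      refine ⟨g0 ^ ℓ, hM ?_, map_pow _ _ _⟩
      simpa using hγ
    have hirr : Irreducible (X ^ ℓ - C (⟨res g0 ^ ℓ, hc⟩ : B.residueSubfield M.toSubfield)) := by
      refine X_pow_sub_C_irreducible_of_prime hℓ.out fun b hb => ?_
      obtain ⟨d, hd, hdb⟩ := b.2
      refine hcon d hd d.2 ?_
      have := congrArg Subtype.val hb
      simp only [SubmonoidClass.coe_pow] at this
      rw [← hdb] at this
      exact this
    have hroot : aeval (res y) (X ^ ℓ - C (⟨res g0 ^ ℓ, hc⟩ : B.residueSubfield M.toSubfield)) = 0 := by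
      rw [map_sub, map_pow, aeval_X, aeval_C, hy]
      exact sub_self _
    have h1 := minpoly.dvd _ _ hgx
    have hmon : (X ^ ℓ - C (⟨res g0 ^ ℓ, hc⟩ : B.residueSubfield M.toSubfield)).Monic :=
      monic_X_pow_sub_C _ hℓ.out.ne_zero
    rw [← minpoly.eq_of_irreducible_of_monic hirr hroot hmon] at h1
    have := natDegree_le_of_dvd h1 hg0'
    rw [natDegree_X_pow_sub_C] at this
    omega
  obtain ⟨d, hd, hdB, hdg⟩ := hdeg (K ⊔ L) le_sup_left g0 (∑ a, C (f a) * X ^ a.val) a.val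
    (fun n => by
      rw [finsetSum_coeff]
      refine sum_mem fun i _ => ?_
      rw [coeff_C_mul, coeff_X_pow]
      split_ifs
      · rw [mul_one]; exact hf i
      · rw [mul_zero]; exact (K ⊔ L).zero_mem)
    (by
      refine Nat.lt_of_le_of_lt (natDegree_sum_le_of_forall_le (n := ℓ - 1) _
        (fun a : ZMod ℓ => C (f a) * X ^ a.val) fun i _ => ?_)
        (Nat.sub_lt hℓ.out.pos one_pos)
      exact (natDegree_C_mul_X_pow_le (f i) _).trans (Nat.le_sub_one_of_lt (ZMod.val_lt i)))
    (by
      have h1 : (∑ a, C (f a) * X ^ a.val).coeff a.val = f a := by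
        rw [finsetSum_coeff, Finset.sum_eq_single a]
        · simp
        · intro b _ hb
          rw [coeff_C_mul, coeff_X_pow, if_neg fun h => hb (ZMod.val_injective _ h.symm), mul_zero]
        · simp
      rw [eval_finsetSum, h1]
      simpa using hlt) rfl
  obtain ⟨P, hP0, hPK, hPd, hPe⟩ := IntermediateField.exists_polynomial_of_mem_sup K L hd
  obtain ⟨n, hn⟩ : ∃ n, P.coeff n ≠ 0 := by
    by_contra! h
    exact hP0 (Polynomial.ext h)
  obtain ⟨d', hd', hdB', hdg'⟩ := hdeg K le_rfl ⟨d, hdB⟩ P n hPK (hPd.trans_lt hL)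
    (by rw [hPe, map_zero]; exact zero_lt_iff.2 ((Valuation.ne_zero_iff _).2 hn)) hdg
  have h1 := hres d' hd' hdB'
  have h2 : res (g0 ^ ℓ - ⟨d', hdB'⟩ ^ ℓ) = 0 := by
    rw [map_sub, map_pow, map_pow, hdg', sub_self]
  rw [ValuationSubring.residue_eq_zero_iff] at h2
  refine h2.not_ge ?_
  simpa using h1

end localConditions

end

section

open Polynomial

section valueGroup

variable {Ω : Type*} [Field Ω] (B : ValuationSubring Ω)

lemma ValuationSubring.exists_valuation_pow_eq (K : Subfield Ω) {P : Polynomial Ω} (hP0 : P ≠ 0)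
    (hP : ∀ n, P.coeff n ∈ K) {x : Ω} (hx : x ≠ 0) (hPx : P.eval x = 0) :
    ∃ a, 0 < a ∧ a ≤ P.natDegree ∧ ∃ c ∈ K, c ≠ 0 ∧ B.valuation x ^ a = B.valuation c := by
  obtain ⟨i, hi, hmax⟩ := Finset.exists_max_image (Finset.range (P.natDegree + 1))
    (fun i => B.valuation (P.coeff i * x ^ i)) ⟨0, by simp⟩
  have hVx : B.valuation x ≠ 0 := (Valuation.ne_zero_iff _).2 hx
  have hpos : B.valuation (P.coeff i * x ^ i) ≠ 0 := by
    have h1 := hmax P.natDegree (Finset.mem_range.2 (Nat.lt_succ_self _))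
    refine (zero_lt_iff.2 ?_ |>.trans_le h1).ne'
    exact (Valuation.ne_zero_iff _).2 (mul_ne_zero (leadingCoeff_ne_zero.2 hP0) (pow_ne_zero _ hx))
  obtain ⟨j, hj, hji, heq⟩ : ∃ j ∈ Finset.range (P.natDegree + 1), j ≠ i ∧
      B.valuation (P.coeff j * x ^ j) = B.valuation (P.coeff i * x ^ i) := by
    by_contra! hcon
    rw [eval_eq_sum_range, ← Finset.add_sum_erase _ _ hi] at hPx
    have h1 : B.valuation (∑ j ∈ (Finset.range (P.natDegree + 1)).erase i, P.coeff j * x ^ j) <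
        B.valuation (P.coeff i * x ^ i) := by
      refine Valuation.map_sum_lt _ hpos fun j hj => ?_
      rw [Finset.mem_erase] at hj
      exact lt_of_le_of_ne (hmax j hj.2) (hcon j hj.2 hj.1)
    have h2 := Valuation.map_add_eq_of_lt_left _ h1
    rw [hPx, map_zero] at h2
    exact hpos h2.symm
  have key : ∀ i j : ℕ, i < j → i ≤ P.natDegree → j ≤ P.natDegree →
      B.valuation (P.coeff i * x ^ i) ≠ 0 →
      B.valuation (P.coeff j * x ^ j) = B.valuation (P.coeff i * x ^ i) →
      ∃ a, 0 < a ∧ a ≤ P.natDegree ∧ ∃ c ∈ K, c ≠ 0 ∧ B.valuation x ^ a = B.valuation c := by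
    intro i j hij _ _ h0 h
    have hj0 : P.coeff j ≠ 0 := fun h1 => h0 (by rw [← h, h1]; simp)
    have hi0 : P.coeff i ≠ 0 := fun h1 => h0 (by rw [h1]; simp)
    refine ⟨j - i, by omega, by omega, P.coeff i / P.coeff j, div_mem (hP _) (hP _),
      div_ne_zero hi0 hj0, ?_⟩
    rw [map_div₀, eq_div_iff ((Valuation.ne_zero_iff _).2 hj0)]
    rw [map_mul, map_mul, map_pow, map_pow, ← Nat.sub_add_cancel hij.le, pow_add, ← mul_assoc] at h
    rw [mul_comm, ← mul_right_cancel₀ (pow_ne_zero _ hVx) h, Nat.sub_add_cancel hij.le]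
  rw [Finset.mem_range] at hi hj
  rcases lt_or_gt_of_ne hji with h | h
  · exact key j i h (by omega) (by omega) (heq ▸ hpos) heq.symm
  · exact key i j h (by omega) (by omega) hpos heq

lemma ValuationSubring.valuation_intCast_le_one (n : ℤ) : B.valuation (n : Ω) ≤ 1 := by
  rw [B.valuation_le_one_iff]
  exact intCast_mem B n

lemma ValuationSubring.valuation_natCast_eq_one {p n : ℕ} (hp : B.valuation (p : Ω) < 1)
    (h : p.Coprime n) : B.valuation (n : Ω) = 1 := by
  refine le_antisymm (by simp) ?_
  by_contra! hlt
  have h1 := Nat.gcd_eq_gcd_ab p n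
  rw [h] at h1
  have h2 : (1 : Ω) = p * (p.gcdA n : ℤ) + n * (p.gcdB n : ℤ) := by exact_mod_cast congrArg (Int.cast : ℤ → Ω) h1
  have h3 : B.valuation (1 : Ω) < 1 := by
    rw [h2]
    refine Valuation.map_add_lt _ ?_ ?_
    · rw [map_mul]; exact mul_lt_one_of_lt_of_le hp (B.valuation_intCast_le_one _)
    · rw [map_mul]; exact mul_lt_one_of_lt_of_le hlt (B.valuation_intCast_le_one _)
  rw [map_one] at h3
  exact h3.false

lemma ValuationSubring.exists_valuation_natCast_eq {p n : ℕ} (hp : p.Prime)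
    (hpB : B.valuation (p : Ω) < 1) (hn : n ≠ 0) :
    ∃ t : ℕ, B.valuation (n : Ω) = B.valuation (p : Ω) ^ t := by
  obtain ⟨t, m, hm, rfl⟩ := Nat.exists_eq_pow_mul_and_not_dvd hn p hp.ne_one
  refine ⟨t, ?_⟩
  rw [Nat.cast_mul, map_mul, Nat.cast_pow, map_pow,
    B.valuation_natCast_eq_one hpB ((Nat.Prime.coprime_iff_not_dvd hp).2 hm), mul_one]

lemma ValuationSubring.exists_valuation_ratCast_mul_eq [CharZero Ω] {p : ℕ} (hp : p.Prime)
    (hpB : B.valuation (p : Ω) < 1) {q : ℚ} (hq : q ≠ 0) :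
    ∃ t t' : ℕ, B.valuation (q : Ω) * B.valuation (p : Ω) ^ t = B.valuation (p : Ω) ^ t' := by
  obtain ⟨t, ht⟩ := B.exists_valuation_natCast_eq hp hpB q.den_ne_zero
  obtain ⟨t', ht'⟩ := B.exists_valuation_natCast_eq hp hpB (Int.natAbs_ne_zero.2 (Rat.num_ne_zero.2 hq))
  refine ⟨t, t', ?_⟩
  rw [← ht, ← ht', ← map_mul]
  have h1 : (q : Ω) * (q.den : Ω) = (q.num : Ω) := by exact_mod_cast congrArg (Rat.cast : ℚ → Ω) (Rat.mul_den_eq_num q)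
  rw [h1]
  rcases Int.natAbs_eq q.num with h | h
  · conv_lhs => rw [h]
    simp
  · conv_lhs => rw [h]
    simp

/-- Over a compositum of two fields of degree less than `ℓ`, no new `ℓ`-th roots of `p`
appear in the value group. -/
lemma ValuationSubring.valuation_ne_pow_of_mem_sup [CharZero Ω] {ℓ p : ℕ} (hℓ : ℓ.Prime) (hp : p.Prime)
    (hpB : B.valuation (p : Ω) < 1) (K L : IntermediateField ℚ Ω)
    [FiniteDimensional ℚ K] [FiniteDimensional ℚ L]
    (hK : Module.finrank ℚ K < ℓ) (hL : Module.finrank ℚ L < ℓ) {η : Ω}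
    (hη : B.valuation η ^ ℓ = B.valuation (p : Ω)) {e : Ω} (he : e ∈ K ⊔ L) {b : ℕ} (hb : 0 < b)
    (hbℓ : b < ℓ) : B.valuation e ≠ B.valuation η ^ b := by
  intro heq
  have hp0 : B.valuation (p : Ω) ≠ 0 := (Valuation.ne_zero_iff _).2 (Nat.cast_ne_zero.2 hp.ne_zero)
  have hη0 : B.valuation η ≠ 0 := fun h => hp0 (by rw [← hη, h, zero_pow hℓ.ne_zero])
  have hη1 : B.valuation η < 1 := by
    by_contra! h
    exact (one_le_pow₀ h).not_gt (hη ▸ hpB : B.valuation η ^ ℓ < 1)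
  have he0 : e ≠ 0 := fun h => by
    rw [h, map_zero] at heq
    exact pow_ne_zero _ hη0 heq.symm
  obtain ⟨P, hP0, hPK, hPd, hPe⟩ := IntermediateField.exists_polynomial_of_mem_sup K L he
  obtain ⟨a, ha, had, c, hcK, hc0, hac⟩ := B.exists_valuation_pow_eq K.toSubfield hP0 hPK he0 hPe
  obtain ⟨P', hP0', hPK', hPd', hPe'⟩ := IntermediateField.exists_polynomial_of_mem_sup ⊥ K
    (show c ∈ (⊥ ⊔ K : IntermediateField ℚ Ω) by rwa [bot_sup_eq])
  obtain ⟨a', ha', had', c', hcK', hc0', hac'⟩ :=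
    B.exists_valuation_pow_eq (⊥ : IntermediateField ℚ Ω).toSubfield hP0' hPK' hc0 hPe'
  obtain ⟨q, rfl⟩ := IntermediateField.mem_bot.1 hcK'
  have hq : q ≠ 0 := fun h => hc0' (by rw [h, map_zero])
  obtain ⟨t, t', ht⟩ := B.exists_valuation_ratCast_mul_eq hp hpB hq
  rw [eq_ratCast] at hac'
  rw [← hac', ← hac, heq, ← hη] at ht
  simp only [← pow_mul, ← pow_add] at ht
  have h1 := pow_right_injective₀ (zero_lt_iff.2 hη0) hη1.ne ht
  have h2 : ℓ ∣ b * a * a' := by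
    have h3 : ℓ ∣ b * a * a' + ℓ * t := h1 ▸ dvd_mul_right _ _
    exact (Nat.dvd_add_left (dvd_mul_right _ _)).1 h3
  rcases (Nat.Prime.dvd_mul hℓ).1 h2 with h3 | h3
  · rcases (Nat.Prime.dvd_mul hℓ).1 h3 with h4 | h4
    · exact (Nat.le_of_dvd hb h4).not_gt hbℓ
    · exact (Nat.le_of_dvd ha h4).not_gt (by omega)
  · exact (Nat.le_of_dvd ha' h3).not_gt (by omega)

end valueGroup

end

section

open Polynomial

section boundedSet

variable {Ω : Type*} [Field Ω] [CharZero Ω] (B : ValuationSubring Ω)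
  {ℓ : ℕ} [hℓ : Fact ℓ.Prime] (K L : IntermediateField ℚ Ω)

/-- The conditions making a cyclic algebra over `K` remain a division algebra after completing
at a valuation ring, even over the compositum with `L`. -/
structure IsLocallyDivision (p : ℕ) (ψ : AddChar (ZMod ℓ) Ω) (γ η : Ω) : Prop where
  prime : p.Prime
  valuation_p : B.valuation (p : Ω) < 1
  finrank_K : Module.finrank ℚ K < ℓ
  finrank_L : Module.finrank ℚ L < ℓ
  apply_mem : ∀ a, ψ a ∈ K
  γ_pow_mem : γ ^ ℓ ∈ K
  γ_mem : γ ∈ B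
  residue : ∀ d ∈ K, d ∈ B → 1 ≤ B.valuation (γ ^ ℓ - d ^ ℓ)
  valuation_η : B.valuation η ^ ℓ = B.valuation (p : Ω)

variable {B K L} [FiniteDimensional ℚ K] [FiniteDimensional ℚ L]
  {p : ℕ} {ψ : AddChar (ZMod ℓ) Ω} {γ η : Ω}

omit [CharZero Ω] in
lemma ValuationSubring.valuation_eq_one_of_pow_eq_one {n : ℕ} (hn : n ≠ 0) {x : Ω}
    (hx : x ^ n = 1) : B.valuation x = 1 := by
  have : B.valuation x ^ n = 1 := by rw [← map_pow, hx, map_one]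
  exact (pow_eq_one_iff_of_nonneg zero_le hn).1 this

omit [CharZero Ω] in
lemma AddChar.pow_prime_eq_one (ψ : AddChar (ZMod ℓ) Ω) (a : ZMod ℓ) : ψ a ^ ℓ = 1 := by
  rw [← AddChar.map_nsmul_eq_pow, nsmul_eq_mul, CharP.cast_eq_zero, zero_mul,
    AddChar.map_zero_eq_one]

lemma IsLocallyDivision.exists_valuation_det (H : IsLocallyDivision B K L p ψ γ η)
    {w : ZMod ℓ → ZMod ℓ → Ω} (hw : ∀ i j, w i j ∈ K ⊔ L) :
    ∃ M, B.valuation (cycMat ψ γ η w).det = M ^ ℓ ∧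
      ∀ i j, B.valuation (w i j) * B.valuation η ^ j.val ≤ M := by
  refine exists_map_det_cycMat_eq_pow B.valuation (K ⊔ L).toSubfield ψ
    (fun a => (le_sup_left : K ≤ K ⊔ L) (H.apply_mem a))
    (fun a => B.valuation_eq_one_of_pow_eq_one hℓ.out.ne_zero (ψ.pow_prime_eq_one a)) ?_ ?_
    (fun f hf a => ValuationSubring.valuation_le_valuation_sum_mul_pow K L H.finrank_L H.γ_mem
      H.γ_pow_mem H.residue f hf a)
    (fun e he b hb hbℓ => B.valuation_ne_pow_of_mem_sup hℓ.out H.prime H.valuation_p K L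
      H.finrank_K H.finrank_L H.valuation_η he hb hbℓ) w hw
  · refine le_antisymm ((B.valuation_le_one_iff _).2 H.γ_mem) ?_
    have := H.residue 0 (zero_mem _) (zero_mem _)
    rw [zero_pow hℓ.out.ne_zero, sub_zero, map_pow] at this
    exact (one_le_pow_iff_of_nonneg zero_le hℓ.out.ne_zero).1 this
  · rintro rfl
    have := H.valuation_η
    rw [map_zero, zero_pow hℓ.out.ne_zero] at this
    exact (Valuation.ne_zero_iff B.valuation).2 (Nat.cast_ne_zero.2 H.prime.ne_zero) this.symm

lemma IsLocallyDivision.det_ne_zero (H : IsLocallyDivision B K L p ψ γ η)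
    {w : ZMod ℓ → ZMod ℓ → Ω} (hw : ∀ i j, w i j ∈ K ⊔ L) (hw0 : w ≠ 0) :
    (cycMat ψ γ η w).det ≠ 0 := by
  obtain ⟨M, hM, hle⟩ := H.exists_valuation_det hw
  intro h0
  rw [h0, map_zero] at hM
  have hM0 : M = 0 := (pow_eq_zero_iff hℓ.out.ne_zero).1 hM.symm
  refine hw0 (funext fun i => funext fun j => ?_)
  have := hle i j
  rw [hM0, le_zero_iff, mul_eq_zero] at this
  rcases this with h | h
  · exact (Valuation.zero_iff _).1 h
  · have h1 := H.valuation_η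
    rw [(pow_eq_zero_iff' .. |>.1 h).1, zero_pow hℓ.out.ne_zero] at h1
    exact absurd h1.symm ((Valuation.ne_zero_iff B.valuation).2 (Nat.cast_ne_zero.2 H.prime.ne_zero))

lemma IsLocallyDivision.valuation_le_one (H : IsLocallyDivision B K L p ψ γ η)
    {ζ : Ω} (hζ : IsPrimitiveRoot ζ ℓ) (hζK : ζ ∈ K)
    {x μ u z : Ω} (hx : x ∈ K ⊔ L) (hμ : B.valuation μ ≤ 1) (hz : z ∈ K)
    (hz1 : B.valuation z = 1) (huz : B.valuation (u - z ^ ℓ) < 1)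
    {w : ZMod ℓ → ZMod ℓ → Ω} (hw : ∀ i j, w i j ∈ K ⊔ L) (hw0 : w 0 0 = 0)
    (hwx : cycMat ψ γ η w ^ ℓ = ((μ + x ^ ℓ) * u) • (1 : Matrix (ZMod ℓ) (ZMod ℓ) Ω)) :
    B.valuation x ≤ 1 := by
  by_contra! hlt
  have hx0 : x ≠ 0 := fun h => by simp [h] at hlt
  have hz0 : z ≠ 0 := fun h => by simp [h] at hz1
  have hKL : K ≤ K ⊔ L := le_sup_left
  have hu : B.valuation u ≤ 1 := by
    rw [← sub_add_cancel u (z ^ ℓ)]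
    refine (Valuation.map_add _ _ _).trans (max_le huz.le ?_)
    rw [map_pow, hz1, one_pow]
  set Z := cycMat ψ γ η ((x * z)⁻¹ • w) with hZ
  set ε : Ω := (u - z ^ ℓ + μ * u / x ^ ℓ) / z ^ ℓ with hε
  have hεV : B.valuation ε < 1 := by
    rw [hε, map_div₀, map_pow B.valuation z, hz1, one_pow, div_one]
    refine Valuation.map_add_lt _ huz ?_
    rw [map_div₀, map_mul, map_pow, div_lt_one₀ (pow_pos (zero_lt_one.trans hlt) _)]
    exact (mul_le_one' hμ hu).trans_lt (one_lt_pow₀ hlt hℓ.out.ne_zero)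
  have hZε : Z ^ ℓ - 1 = ε • (1 : Matrix (ZMod ℓ) (ZMod ℓ) Ω) := by
    rw [hZ, cycMat_smul, _root_.smul_pow, hwx, smul_smul, sub_eq_iff_eq_add]
    nth_rw 3 [← one_smul Ω (1 : Matrix (ZMod ℓ) (ZMod ℓ) Ω)]
    rw [← add_smul]
    congr 1
    rw [hε, inv_pow, mul_pow]
    field_simp
    ring
  let f : Polynomial Ω →* Ω := Matrix.detMonoidHom.comp
    ((aeval Z : Polynomial Ω →ₐ[Ω] _) : Polynomial Ω →* Matrix (ZMod ℓ) (ZMod ℓ) Ω)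
  have hf1 : f (X ^ ℓ - 1) = ε ^ ℓ := by
    change (aeval Z (X ^ ℓ - 1 : Polynomial Ω)).det = _
    rw [map_sub, map_pow, aeval_X, map_one, hZε, Matrix.det_smul, Matrix.det_one, mul_one, ZMod.card]
  rw [X_pow_sub_one_eq_prod hℓ.out.pos hζ, map_prod] at hf1
  have hge : 1 ≤ B.valuation (∏ ρ ∈ nthRootsFinset ℓ (1 : Ω), f (X - C ρ)) := by
    rw [map_prod]
    refine Finset.one_le_prod' fun ρ hρ => ?_
    rw [mem_nthRootsFinset hℓ.out.pos] at hρ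
    obtain ⟨i, -, rfl⟩ := hζ.eq_pow_of_pow_eq_one hρ
    have h1 : f (X - C (ζ ^ i)) = (cycMat ψ γ η ((x * z)⁻¹ • w -
        Pi.single 0 (Pi.single 0 (ζ ^ i)))).det := by
      change (aeval Z (X - C (ζ ^ i) : Polynomial Ω)).det = _
      rw [map_sub, aeval_X, aeval_C, cycMat_sub, cycMat_scalar, Algebra.algebraMap_eq_smul_one]
    obtain ⟨M, hM, hle⟩ := H.exists_valuation_det (w := (x * z)⁻¹ • w -
        Pi.single 0 (Pi.single 0 (ζ ^ i))) fun i j => by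
      refine sub_mem (mul_mem (inv_mem (mul_mem hx (hKL hz))) (hw i j)) ?_
      simp only [Pi.single_apply, ite_apply]
      split_ifs
      · exact pow_mem (hKL hζK) _
      · exact (K ⊔ L).zero_mem
      · exact (K ⊔ L).zero_mem
    rw [h1, hM]
    refine one_le_pow₀ ?_
    have := hle 0 0
    simp only [Pi.sub_apply, Pi.smul_apply, hw0, smul_zero, Pi.single_eq_same, zero_sub,
      Valuation.map_neg, ZMod.val_zero, pow_zero, mul_one] at this
    rwa [B.valuation_eq_one_of_pow_eq_one hℓ.out.ne_zero hρ] at this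
  rw [hf1, map_pow] at hge
  exact hge.not_gt (pow_lt_one₀ zero_le hεV hℓ.out.ne_zero)

end boundedSet

end

section boundedSet

variable {k Ω : Type*} [Field k] [Field Ω] [Algebra k Ω] {ℓ : ℕ} [hℓ : Fact ℓ.Prime]

/-- Coordinates in a cyclic algebra written out over `k` on powers of `ζ`. -/
noncomputable def cycCoord (ζ : Ω) (y : ZMod ℓ × ZMod ℓ × ZMod ℓ → k) (i j : ZMod ℓ) : Ω :=
  ∑ s, algebraMap k Ω (y (i, j, s)) * ζ ^ s.val

/-- The set of `x` for which `(μ + x ^ ℓ) * u` is the `ℓ`-th power of an element of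
reduced trace zero of a cyclic algebra. -/
def cycSet (k : Type*) [Field k] [Algebra k Ω] (ζ : Ω) (ψ : AddChar (ZMod ℓ) Ω) (γ η μ u : Ω) :
    Set k :=
  {x | ∃ y : ZMod ℓ × ZMod ℓ × ZMod ℓ → k, cycCoord ζ y 0 0 = 0 ∧
    cycMat ψ γ η (cycCoord ζ y) ^ ℓ =
      ((μ + algebraMap k Ω x ^ ℓ) * u) • (1 : Matrix (ZMod ℓ) (ZMod ℓ) Ω)}

lemma Matrix.pow_apply_mem_polyFun {σ ι : Type*} [Fintype ι] [DecidableEq ι]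
    {M : (σ → k) → Matrix ι ι Ω} (hM : ∀ i j, (fun a => M a i j) ∈ polyFun σ k Ω) (n : ℕ) :
    ∀ i j, (fun a => (M a ^ n) i j) ∈ polyFun σ k Ω := by
  induction n with
  | zero =>
    intro i j
    simp only [pow_zero]
    exact const_mem_polyFun _
  | succ n ih =>
    intro i j
    have : (fun a => (M a ^ (n + 1)) i j) = ∑ l, (fun a => (M a ^ n) i l) * fun a => M a l j := by
      funext a
      simp [pow_succ, Matrix.mul_apply]
    rw [this]
    exact sum_mem fun l _ => mul_mem (ih i l) (hM l j)

lemma dio₁_cycSet (ζ : Ω) (ψ : AddChar (ZMod ℓ) Ω) (γ η μ u : Ω) :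
    Dio₁ (cycSet k ζ ψ γ η μ u) := by
  have hy : ∀ i j, (fun c : Unit ⊕ ZMod ℓ × ZMod ℓ × ZMod ℓ → k =>
      cycCoord ζ (c ∘ Sum.inr) i j) ∈ polyFun (Unit ⊕ ZMod ℓ × ZMod ℓ × ZMod ℓ) k Ω := by
    intro i j
    have : (fun c : Unit ⊕ ZMod ℓ × ZMod ℓ × ZMod ℓ → k => cycCoord ζ (c ∘ Sum.inr) i j) =
        ∑ s : ZMod ℓ, (fun c => algebraMap k Ω (c (Sum.inr (i, j, s)))) * fun _ => ζ ^ s.val := by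
      funext c
      simp [cycCoord]
    rw [this]
    exact sum_mem fun s _ => mul_mem (coord_mem_polyFun _) (const_mem_polyFun _)
  have hM : ∀ s t, (fun c : Unit ⊕ ZMod ℓ × ZMod ℓ × ZMod ℓ → k =>
      cycMat ψ γ η (cycCoord ζ (c ∘ Sum.inr)) s t) ∈
      polyFun (Unit ⊕ ZMod ℓ × ZMod ℓ × ZMod ℓ) k Ω := by
    intro s t
    have : (fun c : Unit ⊕ ZMod ℓ × ZMod ℓ × ZMod ℓ → k =>
        cycMat ψ γ η (cycCoord ζ (c ∘ Sum.inr)) s t) =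
        ∑ i : ZMod ℓ, (fun c : Unit ⊕ ZMod ℓ × ZMod ℓ × ZMod ℓ → k =>
          cycCoord ζ (c ∘ Sum.inr) i (s - t)) *
          fun _ => γ ^ i.val * ψ (i * s) * η ^ (s - t).val := by
      funext c
      simp [cycMat_apply, mul_assoc]
    rw [this]
    exact sum_mem fun s _ => mul_mem (hy _ _) (const_mem_polyFun _)
  refine Dio.ex (P := fun (a : Unit → k) (y : ZMod ℓ × ZMod ℓ × ZMod ℓ → k) =>
    cycCoord ζ y 0 0 = 0 ∧ cycMat ψ γ η (cycCoord ζ y) ^ ℓ =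
      ((μ + algebraMap k Ω (a ()) ^ ℓ) * u) • (1 : Matrix (ZMod ℓ) (ZMod ℓ) Ω)) ?_
  refine Dio.inter (Dio.eq_zero_of_mem (hy 0 0)) ?_
  have := Dio.biInter (Finset.univ : Finset (ZMod ℓ × ZMod ℓ)) fun i _ =>
    Dio.eq_of_mem (Matrix.pow_apply_mem_polyFun hM ℓ i.1 i.2)
      (h := (fun c => (((μ + algebraMap k Ω (c (Sum.inl ())) ^ ℓ) * u) •
        (1 : Matrix (ZMod ℓ) (ZMod ℓ) Ω)) i.1 i.2)) ?_
  · refine (congrArg Dio (Set.ext fun c => ?_)).mpr this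
    simp only [← Matrix.ext_iff, Set.mem_iInter, Finset.mem_univ, true_imp_iff, Prod.forall]
    exact Iff.rfl
  · have : (fun c : Unit ⊕ ZMod ℓ × ZMod ℓ × ZMod ℓ → k =>
        (((μ + algebraMap k Ω (c (Sum.inl ())) ^ ℓ) * u) •
        (1 : Matrix (ZMod ℓ) (ZMod ℓ) Ω)) i.1 i.2) =
        ((fun _ => μ) + (fun c => algebraMap k Ω (c (Sum.inl ()))) ^ ℓ) *
          fun _ => u * (1 : Matrix (ZMod ℓ) (ZMod ℓ) Ω) i.1 i.2 := by
      funext c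
      simp [mul_assoc]
    rw [this]
    exact mul_mem (add_mem (const_mem_polyFun _) (pow_mem (coord_mem_polyFun _) _))
      (const_mem_polyFun _)

end boundedSet

/-- A lattice of small index without short vectors is spanned by vectors of bounded size. -/
lemma exists_forall_eq_zero_of_forall_sum_eq_zero (ι : Type*) [Fintype ι] (C : ℝ) {ε : ℝ}
    (hε : 0 < ε) : ∃ B : ℝ, 0 < B ∧ ∀ (G : Type*) [AddCommGroup G] [Finite G]
      (φ : (ι → ℤ) →+ G) (l : ι → ℝ), (∀ i, 1 ≤ l i) → (Nat.card G : ℝ) ≤ C * ∏ i, l i →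
      (∀ a, φ a = 0 → a ≠ 0 → ∃ i, ε * l i ≤ |(a i : ℝ)|) →
      ∀ f : ι → ℝ, (∀ a, φ a = 0 → (∀ i, |(a i : ℝ)| ≤ B * l i) → ∑ i, f i * a i = 0) → f = 0 := by
  classical
  set N := Fintype.card ι
  set δ : ℝ := ε / (N + 1) with hδ
  have hN : (0 : ℝ) < N + 1 := by positivity
  have hδ0 : 0 < δ := by positivity
  set C' : ℝ := 1 / δ + 1
  have hC' : 0 < C' := by positivity
  set B : ℝ := max 1 (C * C' ^ (N - 1) + 1)
  have hB1 : 1 ≤ B := le_max_left _ _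
  have hB0 : 0 < B := zero_lt_one.trans_le hB1
  have hB2 : C * C' ^ (N - 1) < B := (lt_add_one _).trans_le (le_max_right _ _)
  refine ⟨B, hB0, fun G _ _ φ l hl hG hsep f hf => ?_⟩
  by_contra hf0
  have hl0 : ∀ i, 0 < l i := fun i => zero_lt_one.trans_le (hl i)
  have : Fintype G := Fintype.ofFinite G
  obtain ⟨i₁, hi₁⟩ := Function.ne_iff.1 hf0
  obtain ⟨i₀, -, hi₀⟩ := Finset.exists_max_image Finset.univ (fun i => |f i| * l i)
    ⟨i₁, Finset.mem_univ _⟩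
  have hfi₀ : 0 < |f i₀| := by
    have h1 : 0 < |f i₁| * l i₁ := mul_pos (abs_pos.2 hi₁) (hl0 _)
    exact pos_of_mul_pos_left (h1.trans_le (hi₀ i₁ (Finset.mem_univ _))) (hl0 _).le
  let box := Fintype.piFinset fun i => Finset.Ico (0 : ℤ) ⌈B * l i⌉
  let cell : ι → Finset ℤ := fun i => if i = i₀ then {0} else Finset.Icc 0 ⌊B / δ⌋
  let g : (ι → ℤ) → G × (ι → ℤ) := fun z =>
    (φ z, fun i => if i = i₀ then 0 else ⌊(z i : ℝ) / (δ * l i)⌋)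
  have hbox : ∀ z ∈ box, ∀ i, 0 ≤ (z i : ℝ) ∧ (z i : ℝ) < B * l i := by
    intro z hz i
    have := Finset.mem_Ico.1 (Fintype.mem_piFinset.1 hz i)
    exact ⟨by exact_mod_cast this.1, Int.lt_ceil.1 this.2⟩
  have hmaps : ∀ z ∈ box, g z ∈ (Finset.univ : Finset G) ×ˢ Fintype.piFinset cell := by
    intro z hz
    refine Finset.mem_product.2 ⟨Finset.mem_univ _, Fintype.mem_piFinset.2 fun i => ?_⟩
    obtain ⟨h1, h2⟩ := hbox z hz i
    simp only [g, cell]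
    split_ifs with h
    · exact Finset.mem_singleton_self _
    · refine Finset.mem_Icc.2 ⟨Int.floor_nonneg.2 (div_nonneg h1 (mul_pos hδ0 (hl0 i)).le),
        Int.floor_le_floor ?_⟩
      rw [div_le_div_iff₀ (mul_pos hδ0 (hl0 i)) hδ0]
      nlinarith
  have hcard : ((Finset.univ : Finset G) ×ˢ Fintype.piFinset cell).card < box.card := by
    have h1 : (((Finset.univ : Finset G) ×ˢ Fintype.piFinset cell).card : ℝ) ≤
        C * (∏ i, l i) * (C' * B) ^ (N - 1) := by
      rw [Finset.card_product, Finset.card_univ, ← Nat.card_eq_fintype_card, Nat.cast_mul,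
        Fintype.card_piFinset, Nat.cast_prod]
      refine mul_le_mul hG ?_ (Finset.prod_nonneg fun _ _ => Nat.cast_nonneg _)
        ((Nat.cast_nonneg _).trans hG)
      rw [← Finset.mul_prod_erase _ _ (Finset.mem_univ i₀)]
      simp only [cell, if_true, Finset.card_singleton, Nat.cast_one, one_mul]
      rw [show N - 1 = (Finset.univ.erase i₀).card by
        rw [Finset.card_erase_of_mem (Finset.mem_univ _), Finset.card_univ] ]
      rw [← Finset.prod_const]
      refine Finset.prod_le_prod (fun i _ => Nat.cast_nonneg _) fun i hi => ?_
      rw [if_neg (Finset.ne_of_mem_erase hi), Int.card_Icc, sub_zero]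
      have h0 : 0 ≤ ⌊B / δ⌋ + 1 := by
        have := Int.floor_nonneg.2 (div_pos hB0 hδ0).le
        omega
      rw [← Int.cast_natCast (R := ℝ), Int.toNat_of_nonneg h0, Int.cast_add, Int.cast_one]
      have := Int.floor_le (B / δ)
      calc _ ≤ B / δ + B := add_le_add this hB1
        _ = C' * B := by simp only [C']; ring
    have h2 : B ^ N * ∏ i, l i ≤ (box.card : ℝ) := by
      rw [Fintype.card_piFinset, Nat.cast_prod, show N = Finset.univ.card from Finset.card_univ.symm,
        ← Finset.prod_const, ← Finset.prod_mul_distrib]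
      refine Finset.prod_le_prod (fun i _ => (mul_pos hB0 (hl0 i)).le) fun i _ => ?_
      rw [Int.card_Ico, sub_zero]
      refine (Int.le_ceil _).trans ?_
      exact_mod_cast Int.self_le_toNat _
    have hN1 : N = N - 1 + 1 := by
      have : 0 < N := Fintype.card_pos_iff.2 ⟨i₀⟩
      omega
    have h3 : C * (∏ i, l i) * (C' * B) ^ (N - 1) < B ^ N * ∏ i, l i := by
      rw [hN1, pow_succ, mul_pow, Nat.add_sub_cancel]
      have hp : 0 < ∏ i, l i := Finset.prod_pos fun i _ => hl0 i
      have hq : 0 < B ^ (N - 1) := by positivity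
      calc _ = (C * C' ^ (N - 1)) * (B ^ (N - 1) * ∏ i, l i) := by ring
        _ < B * (B ^ (N - 1) * ∏ i, l i) := by gcongr
        _ = _ := by ring
    exact_mod_cast h1.trans_lt (h3.trans_le h2)
  obtain ⟨z, hz, z', hz', hne, hg⟩ := Finset.exists_ne_map_eq_of_card_lt_of_maps_to hcard hmaps
  have hφ : φ (z - z') = 0 := by
    rw [map_sub, sub_eq_zero]
    exact congrArg Prod.fst hg
  have hsum := hf (z - z') hφ fun i => by
    have h1 := hbox z hz i
    have h2 := hbox z' hz' i
    rw [Pi.sub_apply, Int.cast_sub, abs_le]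
    constructor <;> linarith
  have hsmall : ∀ i, i ≠ i₀ → |(((z - z') i : ℤ) : ℝ)| < δ * l i := by
    intro i hi
    have h1 := congrFun (congrArg Prod.snd hg) i
    simp only [g, if_neg hi] at h1
    have h2 := Int.abs_sub_lt_one_of_floor_eq_floor h1
    rw [← sub_div, abs_div, abs_of_pos (mul_pos hδ0 (hl0 i)),
      div_lt_one (mul_pos hδ0 (hl0 i))] at h2
    simpa using h2
  obtain ⟨i, hi⟩ := hsep (z - z') hφ (sub_ne_zero.2 hne)
  have hδε : δ ≤ ε := by
    rw [hδ]
    exact div_le_self hε.le (by linarith [(Nat.cast_nonneg N : (0 : ℝ) ≤ N)])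
  by_cases h : i = i₀
  · subst h
    rw [← Finset.add_sum_erase _ _ (Finset.mem_univ i)] at hsum
    have h1 : |f i| * |(((z - z') i : ℤ) : ℝ)| ≤ N * (δ * (|f i| * l i)) := by
      rw [← abs_mul, eq_neg_of_add_eq_zero_left hsum, abs_neg]
      refine (Finset.abs_sum_le_sum_abs _ _).trans ?_
      refine (Finset.sum_le_card_nsmul _ _ (δ * (|f i| * l i)) fun j hj => ?_).trans ?_
      · rw [abs_mul]
        have h2 := hsmall j (Finset.ne_of_mem_erase hj)
        have h3 := hi₀ j (Finset.mem_univ _)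
        calc _ ≤ |f j| * (δ * l j) := by gcongr
          _ = δ * (|f j| * l j) := by ring
          _ ≤ _ := by gcongr
      · rw [nsmul_eq_mul]
        refine mul_le_mul_of_nonneg_right (Nat.cast_le.2 (Finset.card_le_univ _)) ?_
        exact mul_nonneg hδ0.le (mul_nonneg hfi₀.le (hl0 i).le)
    have h4 : |f i| * (ε * l i) ≤ |f i| * (N * δ * l i) :=
      (mul_le_mul_of_nonneg_left hi hfi₀.le).trans (h1.trans_eq (by ring))
    have h5 := le_of_mul_le_mul_right (le_of_mul_le_mul_left h4 hfi₀) (hl0 i)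
    have h6 : ε = N * δ + δ := by rw [hδ]; field_simp
    linarith
  · exact absurd hi (not_le.2 ((hsmall i h).trans_le (by gcongr; exact (hl0 i).le)))

section transfer

variable {Ω n ι : Type*} [Field Ω] [Fintype n] [DecidableEq n] [Fintype ι] {K : Subfield Ω}
  {A A' : Subalgebra K (Matrix n n Ω)} {α α' : ι → Matrix n n Ω}

lemma eq_sum_smul_of_forall_trace_mul_eq (hα' : ∀ q, α' q ∈ A')
    (hnd : ∀ x ∈ A', (∀ q, (x * α' q).trace = 0) → x = 0)
    (h2 : ∀ p q, (α p * α q).trace = (α' p * α' q).trace)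
    {x' : Matrix n n Ω} (hx' : x' ∈ A') {m : ι → K}
    (h : ∀ q, ((∑ p, m p • α p) * α q).trace = (x' * α' q).trace) : x' = ∑ p, m p • α' p := by
  refine sub_eq_zero.1 (hnd _ (sub_mem hx' (sum_mem fun p _ => A'.smul_mem (hα' p) _)) fun q => ?_)
  rw [sub_mul, Matrix.trace_sub, ← h, sub_eq_zero]
  simp only [Finset.sum_mul, Matrix.trace_sum, smul_mul_assoc, Matrix.trace_smul, h2]

/-- Two algebras with spanning families whose traces of products of length up to three agree
contain the same roots of scalars. -/
lemma exists_pow_eq_smul_one_of_trace_eq (hα' : ∀ q, α' q ∈ A')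
    (hspan : ∀ x ∈ A, ∃ m : ι → K, x = ∑ q, m q • α q)
    (hnd : ∀ x ∈ A', (∀ q, (x * α' q).trace = 0) → x = 0)
    (h1 : ∀ p, (α p).trace = (α' p).trace)
    (h2 : ∀ p q, (α p * α q).trace = (α' p * α' q).trace)
    (h3 : ∀ p q r, (α p * α q * α r).trace = (α' p * α' q * α' r).trace)
    {x : Matrix n n Ω} (hx : x ∈ A) {c : K} {e : ℕ} (hxe : x ^ e = c • (1 : Matrix n n Ω))
    (hx0 : x.trace = 0) :
    ∃ x' ∈ A', x' ^ e = c • (1 : Matrix n n Ω) ∧ x'.trace = 0 := by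
  let Rel : Matrix n n Ω → Matrix n n Ω → Prop := fun y y' =>
    y ∈ A ∧ y' ∈ A' ∧ ∀ q, (y * α q).trace = (y' * α' q).trace
  have hone : Rel 1 1 := ⟨one_mem _, one_mem _, fun q => by rw [one_mul, one_mul, h1]⟩
  have hrep : ∀ y y', Rel y y' → ∃ m : ι → K, y = ∑ q, m q • α q ∧ y' = ∑ q, m q • α' q := by
    rintro y y' ⟨hy, hy', h⟩
    obtain ⟨m, rfl⟩ := hspan y hy
    exact ⟨m, rfl, eq_sum_smul_of_forall_trace_mul_eq hα' hnd h2 hy' h⟩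
  have hmul : ∀ y y' z z', Rel y y' → Rel z z' → Rel (y * z) (y' * z') := by
    intro y y' z z' hy hz
    obtain ⟨m, e1, e2⟩ := hrep y y' hy
    obtain ⟨m', e3, e4⟩ := hrep z z' hz
    refine ⟨mul_mem hy.1 hz.1, mul_mem hy.2.1 hz.2.1, fun q => ?_⟩
    rw [e1, e2, e3, e4]
    simp only [Finset.sum_mul, Finset.mul_sum, Matrix.trace_sum, smul_mul_assoc, mul_smul_comm,
      Matrix.trace_smul, h3]
  have hpow : ∀ y y' (d : ℕ), Rel y y' → Rel (y ^ d) (y' ^ d) := by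
    intro y y' d h
    induction d with
    | zero => simpa using hone
    | succ d ih => simpa [pow_succ] using hmul _ _ _ _ ih h
  obtain ⟨m, rfl⟩ := hspan x hx
  have hRel : Rel (∑ q, m q • α q) (∑ q, m q • α' q) := by
    refine ⟨hx, sum_mem fun p _ => A'.smul_mem (hα' p) _, fun q => ?_⟩
    simp only [Finset.sum_mul, Matrix.trace_sum, smul_mul_assoc, Matrix.trace_smul, h2]
  refine ⟨_, hRel.2.1, ?_, ?_⟩
  · have hp := hpow _ _ e hRel
    rw [hxe] at hp
    refine sub_eq_zero.1 (hnd _ (sub_mem hp.2.1 (A'.smul_mem (one_mem _) _)) fun q => ?_)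
    rw [sub_mul, Matrix.trace_sub, ← hp.2.2 q, sub_eq_zero, smul_mul_assoc, smul_mul_assoc,
      Matrix.trace_smul, Matrix.trace_smul, one_mul, one_mul, h1]
  · rw [← hx0]
    simp only [Matrix.trace_sum, Matrix.trace_smul, h1]

end transfer

section integrality

variable {Ω Γ₀ : Type*} [Field Ω] [LinearOrderedCommGroupWithZero Γ₀] (V : Valuation Ω Γ₀)
  {ℓ : ℕ} [hℓ : Fact ℓ.Prime]

lemma AddChar.isPrimitiveRoot_apply_one {ψ : AddChar (ZMod ℓ) Ω} (hψ : ψ.IsPrimitive) :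
    IsPrimitiveRoot (ψ 1) ℓ := by
  have h1 : ψ 1 ^ ℓ = 1 := ψ.pow_prime_eq_one 1
  have h2 : ψ 1 ≠ 1 := by
    intro h
    refine hψ one_ne_zero ?_
    ext a
    rw [AddChar.mulShift_apply, one_mul, ← ZMod.natCast_zmod_val a, ← nsmul_one,
      AddChar.map_nsmul_eq_pow, h, one_pow, AddChar.one_apply]
  exact IsPrimitiveRoot.iff_orderOf.2 (orderOf_eq_prime h1 h2)

lemma AddChar.isPrimitive_inv {ψ : AddChar (ZMod ℓ) Ω} (hψ : ψ.IsPrimitive) :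
    ψ⁻¹.IsPrimitive := by
  intro a ha h
  refine hψ ha (DFunLike.ext _ _ fun x => ?_)
  have := DFunLike.congr_fun h (-x)
  rw [AddChar.mulShift_apply, AddChar.inv_apply] at this
  rw [AddChar.mulShift_apply]
  simpa using this

variable {V}

lemma Valuation.map_pow_sub_pow_le {a b : Ω} (ha : V a ≤ 1) (hb : V b ≤ 1) (n : ℕ) :
    V (a ^ n - b ^ n) ≤ V (a - b) := by
  obtain ⟨y, hy⟩ : ∃ y ∈ V.integer, a ^ n - b ^ n = (a - b) * y := by
    obtain ⟨y, hy⟩ := sub_dvd_pow_sub_pow (⟨a, ha⟩ : V.integer) ⟨b, hb⟩ n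
    exact ⟨y, y.2, congrArg Subtype.val hy⟩
  rw [hy.2, map_mul]
  exact mul_le_of_le_one_right' hy.1

lemma Valuation.map_eq_one_of_pow_eq_one {n : ℕ} (hn : n ≠ 0) {x : Ω} (hx : x ^ n = 1) :
    V x = 1 := by
  have : V x ^ n = 1 := by rw [← map_pow, hx, map_one]
  exact (pow_eq_one_iff_of_nonneg zero_le hn).1 this

lemma Valuation.map_sub_one_of_pow_eq_one (hVℓ : V (ℓ : Ω) = 1) {ρ : Ω} (hρ : ρ ^ ℓ = 1)
    (hρ1 : ρ ≠ 1) : V (ρ - 1) = 1 := by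
  have h1 : V ρ = 1 := V.map_eq_one_of_pow_eq_one hℓ.out.ne_zero hρ
  refine le_antisymm ((V.map_sub _ _).trans (by simp [h1])) ?_
  by_contra! hlt
  have hsum : ∑ i ∈ Finset.range ℓ, ρ ^ i = 0 := by
    have := mul_geom_sum ρ ℓ
    rw [hρ, sub_self, mul_eq_zero, sub_eq_zero] at this
    exact this.resolve_left hρ1
  have h2 : V (∑ i ∈ Finset.range ℓ, (ρ ^ i - 1)) < 1 := by
    refine V.map_sum_lt one_ne_zero fun i _ => ?_
    have := V.map_pow_sub_pow_le h1.le (map_one V).le i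
    rw [one_pow] at this
    exact this.trans_lt hlt
  rw [Finset.sum_sub_distrib, hsum, zero_sub, Valuation.map_neg] at h2
  simp only [Finset.sum_const, Finset.card_range, nsmul_eq_mul, mul_one] at h2
  exact h2.ne hVℓ

lemma Valuation.exists_map_sub_mul_le {ψ : AddChar (ZMod ℓ) Ω} (hψ : ψ.IsPrimitive)
    (hVℓ : V (ℓ : Ω) = 1) {a b : Ω} (hb : V b = 1) {r : Ω} (hr : V r < 1)
    (hab : V (a ^ ℓ - b ^ ℓ) ≤ V r) : ∃ k, V (a - ψ k * b) ≤ V r := by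
  have hζ := AddChar.isPrimitiveRoot_apply_one hψ
  rw [hζ.pow_sub_pow_eq_prod_sub_mul a b hℓ.out.pos, map_prod] at hab
  obtain ⟨ρ, hρ, hρ1⟩ : ∃ ρ ∈ Polynomial.nthRootsFinset ℓ (1 : Ω), V (a - ρ * b) < 1 := by
    by_contra! h
    exact ((Finset.one_le_prod' h).trans hab).not_gt hr
  have hρℓ := (Polynomial.mem_nthRootsFinset hℓ.out.pos _).1 hρ
  obtain ⟨i, -, rfl⟩ := hζ.eq_pow_of_pow_eq_one hρℓ
  refine ⟨i, ?_⟩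
  rw [← nsmul_one, AddChar.map_nsmul_eq_pow]
  rwa [Finset.prod_eq_single_of_mem _ hρ] at hab
  intro σ hσ hne
  have hσℓ := (Polynomial.mem_nthRootsFinset hℓ.out.pos _).1 hσ
  have hρ0 : ψ 1 ^ i ≠ 0 := fun h => by
    rw [h, zero_pow hℓ.out.ne_zero] at hρℓ
    exact zero_ne_one hρℓ
  have h1 : V (ψ 1 ^ i) = 1 := V.map_eq_one_of_pow_eq_one hℓ.out.ne_zero hρℓ
  have h2 : V ((ψ 1 ^ i - σ) * b) = 1 := by
    have : ψ 1 ^ i - σ = -(ψ 1 ^ i * (σ / ψ 1 ^ i - 1)) := by field_simp; ring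
    rw [map_mul, hb, mul_one, this, Valuation.map_neg, map_mul, h1, one_mul]
    refine V.map_sub_one_of_pow_eq_one hVℓ (by rw [div_pow, hσℓ, hρℓ, div_one]) ?_
    rwa [Ne, div_eq_one_iff_eq hρ0]
  have : a - σ * b = a - ψ 1 ^ i * b + (ψ 1 ^ i - σ) * b := by ring
  rw [this, Valuation.map_add_eq_of_lt_right _ (by rwa [h2]), h2]

/-- The representative of a residue between `1` and `ℓ`. -/
def ZMod.posVal (i : ZMod ℓ) : ℕ := (i - 1).val + 1

lemma ZMod.natCast_posVal (i : ZMod ℓ) : ((ZMod.posVal i : ℕ) : ZMod ℓ) = i := by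
  rw [ZMod.posVal, Nat.cast_add, ZMod.natCast_zmod_val, Nat.cast_one, sub_add_cancel]

/-- Lattice elements of a cyclic algebra, with denominator `e`. -/
noncomputable def latMat (ψ : AddChar (ZMod ℓ) Ω) (γ η e : Ω) (x : ZMod ℓ → ZMod ℓ → Ω) :
    Matrix (ZMod ℓ) (ZMod ℓ) Ω :=
  Matrix.of fun s t => e⁻¹ * ((∑ i, x i (s - t) * γ ^ ZMod.posVal i * ψ (i * s)) *
    η ^ ZMod.posVal (s - t))

lemma latMat_apply (ψ : AddChar (ZMod ℓ) Ω) (γ η e : Ω) (x : ZMod ℓ → ZMod ℓ → Ω) (s t : ZMod ℓ) :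
    latMat ψ γ η e x s t = e⁻¹ * ((∑ i, x i (s - t) * γ ^ ZMod.posVal i * ψ (i * s)) *
    η ^ ZMod.posVal (s - t)) := rfl

lemma map_mul_latMat_apply_le {ψ : AddChar (ZMod ℓ) Ω} {γ η e r γ₀ : Ω} (hγ : V γ ≤ 1)
    (hη : V η ^ ℓ = V r) (hr : V r ≤ 1) (he : V e = V r) (he0 : e ≠ 0) (hγ₀ : V γ₀ ≤ 1)
    {k : ZMod ℓ} (hk : V (γ - ψ k * γ₀) ≤ V r) {x : ZMod ℓ → ZMod ℓ → Ω} (hx : ∀ i j, V (x i j) ≤ 1)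
    (hcond : ∀ d b, ZMod.posVal d ≤ b.val →
      V (∑ i, x i d * γ₀ ^ ZMod.posVal i * ψ (i * b)) ≤ V r) (s t : ZMod ℓ) :
    V (latMat ψ γ η e x s t * η ^ (t + k).val) ≤ V (η ^ (s + k).val) := by
  have hψ1 : ∀ a, V (ψ a) = 1 := fun a =>
    V.map_eq_one_of_pow_eq_one hℓ.out.ne_zero (ψ.pow_prime_eq_one a)
  have hVη : V η ≤ 1 := by
    rw [← hη] at hr
    exact (pow_le_one_iff_of_nonneg zero_le hℓ.out.ne_zero).1 hr
  have hVe : V e ≠ 0 := (Valuation.ne_zero_iff _).2 he0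
  set d := s - t
  obtain ⟨q, hq⟩ : ∃ q, (t + k).val + ZMod.posVal d = (s + k).val + ℓ * q := by
    have h1 : ((((t + k).val + ZMod.posVal d : ℕ)) : ZMod ℓ) = s + k := by
      rw [Nat.cast_add, ZMod.natCast_zmod_val, ZMod.natCast_posVal]
      simp only [d]; ring
    have h2 := congrArg ZMod.val h1
    rw [ZMod.val_natCast] at h2
    exact ⟨_, by rw [← h2, Nat.mod_add_div]⟩
  have hsum : ZMod.posVal d ≤ (s + k).val →
      V (∑ i, x i d * γ ^ ZMod.posVal i * ψ (i * s)) ≤ V r := by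
    intro h
    have h1 : ∑ i, x i d * γ ^ ZMod.posVal i * ψ (i * s) =
        ∑ i, x i d * (γ ^ ZMod.posVal i - (ψ k * γ₀) ^ ZMod.posVal i) * ψ (i * s) +
          ∑ i, x i d * γ₀ ^ ZMod.posVal i * ψ (i * (s + k)) := by
      rw [← Finset.sum_add_distrib]
      refine Finset.sum_congr rfl fun i _ => ?_
      have : ψ k ^ ZMod.posVal i = ψ (i * k) := by
        rw [← AddChar.map_nsmul_eq_pow, nsmul_eq_mul, ZMod.natCast_posVal]
      rw [mul_add i, AddChar.map_add_eq_mul, mul_pow, this]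
      ring
    rw [h1]
    refine V.map_add_le (V.map_sum_le fun i _ => ?_) (hcond _ _ h)
    rw [map_mul, map_mul, hψ1, mul_one]
    refine (mul_le_of_le_one_left' (hx _ _)).trans ((V.map_pow_sub_pow_le hγ ?_ _).trans hk)
    rw [map_mul, hψ1, one_mul]
    exact hγ₀
  have hsum1 : V (∑ i, x i d * γ ^ ZMod.posVal i * ψ (i * s)) ≤ 1 := by
    refine V.map_sum_le fun i _ => ?_
    rw [map_mul, map_mul, hψ1, mul_one, map_pow]
    exact mul_le_one' (hx _ _) (pow_le_one' hγ _)
  have key : V (∑ i, x i d * γ ^ ZMod.posVal i * ψ (i * s)) * V η ^ (ZMod.posVal d + (t + k).val) ≤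
      V r * V η ^ (s + k).val := by
    rw [add_comm (ZMod.posVal d), hq, pow_add]
    rcases le_or_gt (ZMod.posVal d) (s + k).val with h | h
    · exact mul_le_mul' (hsum h) (mul_le_of_le_one_right' (pow_le_one' hVη _))
    · have hq1 : q ≠ 0 := by
        rintro rfl
        omega
      rw [mul_comm (V r)]
      refine (mul_le_of_le_one_left' hsum1).trans (mul_le_mul' le_rfl ?_)
      rw [pow_mul, hη]
      exact pow_le_of_le_one zero_le hr hq1
  rw [latMat_apply, map_mul, map_mul, map_mul, map_inv₀, map_pow, map_pow, map_pow, mul_assoc,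
    mul_assoc, ← pow_add, inv_mul_le_iff₀ (zero_lt_iff.2 hVe), he]
  exact key

lemma latMat_mul_fourier (ψ : AddChar (ZMod ℓ) Ω) (γ η e : Ω) (x : ZMod ℓ → ZMod ℓ → Ω) :
    latMat ψ γ η e x * Matrix.of (fun s t => ψ (s * t)) =
      Matrix.of (fun s t => ψ (s * t)) * latMat ψ⁻¹ η γ e fun d i => ψ (d * i) * x i d := by
  ext s u
  simp only [Matrix.mul_apply, latMat_apply, Matrix.of_apply]
  rw [← (Equiv.subLeft s).sum_comp]
  refine Eq.trans ?_ (Equiv.sum_comp (Equiv.addRight u) _)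
  simp only [Equiv.subLeft_apply, sub_sub_cancel, Equiv.coe_addRight, add_sub_cancel_right,
    Finset.mul_sum, Finset.sum_mul]
  rw [Finset.sum_comm]
  refine Finset.sum_congr rfl fun i _ => Finset.sum_congr rfl fun d _ => ?_
  have h1 : ψ (i * s) * ψ ((s - d) * u) = ψ (s * (i + u)) * ψ (d * i) * ψ⁻¹ (d * (i + u)) := by
    rw [AddChar.inv_apply, ← AddChar.map_add_eq_mul, ← AddChar.map_add_eq_mul,
      ← AddChar.map_add_eq_mul]
    congr 1; ring
  calc _ = e⁻¹ * x i d * γ ^ ZMod.posVal i * η ^ ZMod.posVal d * (ψ (i * s) * ψ ((s - d) * u)) := by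
        ring
    _ = _ := by rw [h1]; ring

end integrality

section integrality

variable {Ω : Type*} [Field Ω] {ℓ : ℕ} [hℓ : Fact ℓ.Prime]

lemma ValuationSubring.valuation_le_one_of_isIntegral (O : ValuationSubring Ω) {y : Ω}
    (hy : IsIntegral ℤ y) : O.valuation y ≤ 1 := by
  obtain ⟨z, hz⟩ := IsIntegrallyClosed.isIntegral_iff.1 (hy.tower_top (A := O))
  rw [← hz]
  exact O.valuation_le_one z

lemma isIntegral_of_forall_valuationSubring {y : Ω}
    (h : ∀ O : ValuationSubring Ω, O.valuation y ≤ 1) : IsIntegral ℤ y := by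
  have : IsIntegrallyClosedIn (integralClosure ℤ Ω).toSubring Ω :=
    inferInstanceAs (IsIntegrallyClosedIn (integralClosure ℤ Ω) Ω)
  by_contra hy
  obtain ⟨O, -, hO⟩ := Subring.exists_le_valuationSubring_of_isIntegrallyClosedIn
    (R := (integralClosure ℤ Ω).toSubring) hy
  exact hO ((O.valuation_le_one_iff y).1 (h O))

/-- Parameters of a cyclic algebra for which an explicit lattice of integral elements is
available. -/
structure IsLatticeDatum (ψ : AddChar (ZMod ℓ) Ω) (γ η γ₀ c w p r : Ω) : Prop where
  primitive : ψ.IsPrimitive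
  isIntegral_c : IsIntegral ℤ c
  isIntegral_w : IsIntegral ℤ w
  isIntegral_p : IsIntegral ℤ p
  isIntegral_r : IsIntegral ℤ r
  isIntegral_γ₀ : IsIntegral ℤ γ₀
  c_ne_zero : c ≠ 0
  r_ne_zero : r ≠ 0
  γ_pow : γ ^ ℓ = c * w
  η_pow : η ^ ℓ = p * r
  η_congr : ∃ y, IsIntegral ℤ y ∧ η ^ ℓ - 1 = c * y
  γ_congr : ∃ y, IsIntegral ℤ y ∧ γ ^ ℓ - γ₀ ^ ℓ = r * y
  coprime_r : ∃ a b, IsIntegral ℤ a ∧ IsIntegral ℤ b ∧ c * w * p * ℓ * a + r * b = 1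
  coprime_c : ∃ a b, IsIntegral ℤ a ∧ IsIntegral ℤ b ∧ w * ℓ * a + c * b = 1

/-- The congruence conditions defining the lattice. -/
structure IsAdmissible (ψ : AddChar (ZMod ℓ) Ω) (γ₀ c r : Ω) (x : ZMod ℓ → ZMod ℓ → Ω) : Prop where
  isIntegral : ∀ i j, IsIntegral ℤ (x i j)
  congr_r : ∀ d b : ZMod ℓ, ZMod.posVal d ≤ b.val → ∃ y, IsIntegral ℤ y ∧
    ∑ i, x i d * γ₀ ^ ZMod.posVal i * ψ (i * b) = r * y
  congr_c : ∀ i b : ZMod ℓ, ZMod.posVal i ≤ b.val → ∃ y, IsIntegral ℤ y ∧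
    ∑ d, ψ (d * i) * x i d * ψ⁻¹ (d * b) = c * y

variable {ψ : AddChar (ZMod ℓ) Ω} {γ η γ₀ c w p r : Ω}

lemma exists_mul_eq_one_of_congr {Γ₀ : Type*} [LinearOrderedCommGroupWithZero Γ₀]
    {V : Valuation Ω Γ₀} {e : Ω} (hγ : V γ ≤ 1) (hη0 : η ≠ 0)
    (hη : V η ^ ℓ = V r) (hr : V r ≤ 1) (he : V e = V r) (he0 : e ≠ 0) (hγ₀ : V γ₀ ≤ 1)
    {k : ZMod ℓ} (hk : V (γ - ψ k * γ₀) ≤ V r) :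
    ∃ P P' : Matrix (ZMod ℓ) (ZMod ℓ) Ω, P' * P = 1 ∧ ∀ x : ZMod ℓ → ZMod ℓ → Ω,
      (∀ i j, V (x i j) ≤ 1) → (∀ d b, ZMod.posVal d ≤ b.val →
        V (∑ i, x i d * γ₀ ^ ZMod.posVal i * ψ (i * b)) ≤ V r) →
      ∀ s t, V ((P' * latMat ψ γ η e x * P) s t) ≤ 1 := by
  refine ⟨Matrix.diagonal fun s => η ^ (s + k).val,
    Matrix.diagonal fun s => (η ^ (s + k).val)⁻¹, ?_, fun x hx hcond s t => ?_⟩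
  · rw [Matrix.diagonal_mul_diagonal, ← Matrix.diagonal_one]
    congr 1
    funext s
    exact inv_mul_cancel₀ (pow_ne_zero _ hη0)
  · have := map_mul_latMat_apply_le hγ hη hr he he0 hγ₀ hk hx hcond s t
    rw [Matrix.mul_diagonal, Matrix.diagonal_mul, mul_assoc, map_mul, map_inv₀,
      inv_mul_le_iff₀ (zero_lt_iff.2 ((Valuation.ne_zero_iff _).2 (pow_ne_zero _ hη0))), mul_one]
    exact this

lemma fourier_mul_fourier (hψ : ψ.IsPrimitive) (hℓΩ : (ℓ : Ω) ≠ 0) :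
    ((ℓ : Ω)⁻¹ • Matrix.of fun s t : ZMod ℓ => ψ (-(s * t))) * Matrix.of (fun s t => ψ (s * t)) =
      1 := by
  ext s u
  rw [smul_mul_assoc, Matrix.smul_apply, Matrix.mul_apply]
  have : ∀ t, (Matrix.of fun s t : ZMod ℓ => ψ (-(s * t))) s t *
      (Matrix.of fun s t : ZMod ℓ => ψ (s * t)) t u = ψ ((u - s) * t) := by
    intro t
    rw [Matrix.of_apply, Matrix.of_apply, ← AddChar.map_add_eq_mul]
    congr 1; ring
  simp only [this, AddChar.sum_mul_left_eq_ite hψ, Matrix.one_apply, sub_eq_zero, smul_eq_mul,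
    eq_comm (a := u)]
  split_ifs
  · exact inv_mul_cancel₀ hℓΩ
  · exact mul_zero _

lemma IsLatticeDatum.exists_forall_valuation_le_one
    (H : IsLatticeDatum ψ γ η γ₀ c w p r) (O : ValuationSubring Ω) :
    ∃ P P' : Matrix (ZMod ℓ) (ZMod ℓ) Ω, P' * P = 1 ∧ ∀ x, IsAdmissible ψ γ₀ c r x → ∀ s t,
      O.valuation ((P' * latMat ψ γ η (c * r) x * P) s t) ≤ 1 := by
  set V := O.valuation with hV
  have h_int : ∀ {y}, IsIntegral ℤ y → V y ≤ 1 := O.valuation_le_one_of_isIntegral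
  have hℓ0 := hℓ.out.ne_zero
  have hVℓ1 : V (ℓ : Ω) ≤ 1 := h_int (by simpa using isIntegral_algebraMap (R := ℤ) (x := (ℓ : ℤ)))
  have hψ1 : ∀ (χ : AddChar (ZMod ℓ) Ω) (a), V (χ a) = 1 := fun χ a =>
    V.map_eq_one_of_pow_eq_one hℓ0 (χ.pow_prime_eq_one a)
  have hγ1 : V γ ≤ 1 := by
    refine (pow_le_one_iff_of_nonneg zero_le hℓ0).1 ?_
    rw [← map_pow, H.γ_pow]
    exact h_int (H.isIntegral_c.mul H.isIntegral_w)
  have hη1 : V η ≤ 1 := by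
    refine (pow_le_one_iff_of_nonneg zero_le hℓ0).1 ?_
    rw [← map_pow, H.η_pow]
    exact h_int (H.isIntegral_p.mul H.isIntegral_r)
  have hunit : ∀ {a b : Ω}, V a ≤ 1 → V b ≤ 1 → V (a * b) = 1 → V a = 1 ∧ V b = 1 := by
    intro a b ha hb h
    rw [map_mul] at h
    exact ⟨le_antisymm ha (h.ge.trans (mul_le_of_le_one_right' hb)),
      le_antisymm hb (h.ge.trans (mul_le_of_le_one_left' ha))⟩
  have hcop : ∀ {a b e f : Ω}, V f ≤ 1 → V b ≤ 1 → V e < 1 → V a ≤ 1 → a * f + e * b = 1 →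
      V a = 1 := by
    intro a b e f hf hb he ha h
    have h1 : V (a * f) = 1 := by
      rw [eq_sub_of_add_eq h, Valuation.map_one_sub_of_lt]
      rw [map_mul]
      exact mul_lt_one_of_lt_of_le he hb
    exact (hunit ha hf h1).1
  have hpow : ∀ {a : Ω}, V (a ^ ℓ) = 1 → V a = 1 := by
    intro a h
    rw [map_pow] at h
    exact (pow_eq_one_iff_of_nonneg zero_le hℓ0).1 h
  have hVc := h_int H.isIntegral_c
  have hVr := h_int H.isIntegral_r
  have hVp := h_int H.isIntegral_p
  have hVw := h_int H.isIntegral_w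
  rcases hVr.lt_or_eq with hr | hr
  · obtain ⟨a, b, ha, hb, hab⟩ := H.coprime_r
    have h1 := hcop (h_int ha) (h_int hb) hr (by
      simp only [map_mul]
      exact mul_le_one' (mul_le_one' (mul_le_one' hVc hVw) hVp) hVℓ1) hab
    obtain ⟨h2, hℓ1⟩ := hunit (by
      simp only [map_mul]
      exact mul_le_one' (mul_le_one' hVc hVw) hVp) hVℓ1 h1
    obtain ⟨h3, hp1⟩ := hunit (by simp only [map_mul]; exact mul_le_one' hVc hVw) hVp h2
    have hc1 := (hunit hVc hVw h3).1
    obtain ⟨y, hy, hγy⟩ := H.γ_congr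
    have hγγ₀ : V (γ ^ ℓ - γ₀ ^ ℓ) ≤ V r := by
      rw [hγy, map_mul]
      exact mul_le_of_le_one_right' (h_int hy)
    have hγℓ : V (γ ^ ℓ) = 1 := by rw [H.γ_pow, h3]
    have hγ₀ : V γ₀ = 1 := by
      refine hpow ?_
      rw [← sub_sub_cancel (γ ^ ℓ) (γ₀ ^ ℓ), Valuation.map_sub_eq_of_lt_left, hγℓ]
      rw [hγℓ]
      exact hγγ₀.trans_lt hr
    obtain ⟨k, hk⟩ := V.exists_map_sub_mul_le H.primitive hℓ1 hγ₀ hr hγγ₀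
    have hη0 : η ≠ 0 := by
      rintro rfl
      have := H.η_pow
      rw [zero_pow hℓ0, eq_comm, mul_eq_zero] at this
      rcases this with h | h
      · rw [h, map_zero] at hp1
        exact zero_ne_one hp1
      · exact H.r_ne_zero h
    have hVη : V η ^ ℓ = V r := by rw [← map_pow, H.η_pow, map_mul, hp1, one_mul]
    obtain ⟨P, P', hP, h⟩ := exists_mul_eq_one_of_congr hγ1 hη0 hVη hVr (e := c * r)
      (by rw [map_mul, hc1, one_mul]) (mul_ne_zero H.c_ne_zero H.r_ne_zero) hγ₀.le hk
    refine ⟨P, P', hP, fun x hx => h x (fun i j => h_int (hx.isIntegral i j)) fun d b hdb => ?_⟩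
    obtain ⟨y, hy, h1⟩ := hx.congr_r d b hdb
    rw [h1, map_mul]
    exact mul_le_of_le_one_right' (h_int hy)
  · rcases hVc.lt_or_eq with hc | hc
    · obtain ⟨a, b, ha, hb, hab⟩ := H.coprime_c
      have h1 := hcop (h_int ha) (h_int hb) hc (by
        simp only [map_mul]
        exact mul_le_one' hVw hVℓ1) hab
      obtain ⟨hw1, hℓ1⟩ := hunit hVw hVℓ1 h1
      have hℓΩ : (ℓ : Ω) ≠ 0 := fun h => by
        rw [h, map_zero] at hℓ1
        exact zero_ne_one hℓ1
      obtain ⟨y, hy, hηy⟩ := H.η_congr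
      have hηη₀ : V (η ^ ℓ - 1 ^ ℓ) ≤ V c := by
        rw [one_pow, hηy, map_mul]
        exact mul_le_of_le_one_right' (h_int hy)
      have hγ0 : γ ≠ 0 := by
        rintro rfl
        have := H.γ_pow
        rw [zero_pow hℓ0, eq_comm, mul_eq_zero] at this
        rcases this with h | h
        · exact H.c_ne_zero h
        · rw [h, map_zero] at hw1
          exact zero_ne_one hw1
      have hVγ : V γ ^ ℓ = V c := by rw [← map_pow, H.γ_pow, map_mul, hw1, mul_one]
      obtain ⟨k, hk⟩ := V.exists_map_sub_mul_le (AddChar.isPrimitive_inv H.primitive) hℓ1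
        (map_one V) hc hηη₀
      obtain ⟨P, P', hP, h⟩ := exists_mul_eq_one_of_congr hη1 hγ0 hVγ hVc (e := c * r)
        (by rw [map_mul, hr, mul_one]) (mul_ne_zero H.c_ne_zero H.r_ne_zero) (map_one V).le hk
      have hF := fourier_mul_fourier H.primitive hℓΩ
      set U := Matrix.of fun s t : ZMod ℓ => ψ (s * t)
      set U' := (ℓ : Ω)⁻¹ • Matrix.of fun s t : ZMod ℓ => ψ (-(s * t))
      refine ⟨U * P, P' * U', ?_, fun x hx => ?_⟩
      · rw [Matrix.mul_assoc, ← Matrix.mul_assoc U', hF, Matrix.one_mul, hP]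
      · have : P' * U' * latMat ψ γ η (c * r) x * (U * P) =
            P' * latMat ψ⁻¹ η γ (c * r) (fun d i => ψ (d * i) * x i d) * P := by
          calc _ = P' * (U' * (latMat ψ γ η (c * r) x * U)) * P := by simp only [Matrix.mul_assoc]
            _ = P' * ((U' * U) * latMat ψ⁻¹ η γ (c * r) (fun d i => ψ (d * i) * x i d)) * P := by
              rw [latMat_mul_fourier, Matrix.mul_assoc U']
            _ = _ := by rw [hF, Matrix.one_mul]
        rw [this]
        refine h _ (fun i j => ?_) fun i b hib => ?_
        · rw [map_mul, hψ1, one_mul]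
          exact h_int (hx.isIntegral _ _)
        · obtain ⟨y, hy, h1⟩ := hx.congr_c i b hib
          simp only [one_pow, mul_one]
          rw [h1, map_mul]
          exact mul_le_of_le_one_right' (h_int hy)
    · refine ⟨1, 1, mul_one _, fun x hx s t => ?_⟩
      rw [Matrix.one_mul, Matrix.mul_one, latMat_apply]
      simp only [map_mul, map_inv₀, hc, hr, mul_one, inv_one, one_mul, map_pow]
      refine mul_le_one' (V.map_sum_le fun i _ => ?_) (pow_le_one' hη1 _)
      rw [map_mul, map_mul, hψ1, mul_one, map_pow]
      exact mul_le_one' (h_int (hx.isIntegral _ _)) (pow_le_one' hγ1 _)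

lemma Valuation.map_trace_le_one_and_map_det_le_one {Γ₀ n : Type*} [Fintype n] [DecidableEq n]
    [LinearOrderedCommGroupWithZero Γ₀] (V : Valuation Ω Γ₀) {M : Matrix n n Ω}
    (hM : ∀ s t, V (M s t) ≤ 1) : V M.trace ≤ 1 ∧ V M.det ≤ 1 := by
  refine ⟨V.map_sum_le fun i _ => hM i i, ?_⟩
  rw [Matrix.det_apply]
  refine V.map_sum_le fun σ _ => ?_
  have : V (∏ i, M (σ i) i) ≤ 1 := by
    rw [map_prod]
    exact Finset.prod_le_one' fun i _ => hM _ _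
  rcases Int.units_eq_one_or (Equiv.Perm.sign σ) with h | h <;> simpa [h] using this

lemma Valuation.map_mul_apply_le_one {Γ₀ n : Type*} [Fintype n]
    [LinearOrderedCommGroupWithZero Γ₀] (V : Valuation Ω Γ₀) {M N : Matrix n n Ω}
    (hM : ∀ s t, V (M s t) ≤ 1) (hN : ∀ s t, V (N s t) ≤ 1) (s t : n) : V ((M * N) s t) ≤ 1 := by
  rw [Matrix.mul_apply]
  refine V.map_sum_le fun i _ => ?_
  rw [map_mul]
  exact mul_le_one' (hM _ _) (hN _ _)

/-- Products of lattice elements have integral traces and determinants. -/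
lemma IsLatticeDatum.isIntegral_trace_prod (H : IsLatticeDatum ψ γ η γ₀ c w p r)
    (L : List (ZMod ℓ → ZMod ℓ → Ω)) (hL : ∀ x ∈ L, IsAdmissible ψ γ₀ c r x) :
    IsIntegral ℤ (L.map (latMat ψ γ η (c * r))).prod.trace ∧
      IsIntegral ℤ (L.map (latMat ψ γ η (c * r))).prod.det := by
  have key : ∀ O : ValuationSubring Ω,
      O.valuation (L.map (latMat ψ γ η (c * r))).prod.trace ≤ 1 ∧
      O.valuation (L.map (latMat ψ γ η (c * r))).prod.det ≤ 1 := by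
    intro O
    obtain ⟨P, P', hP, h⟩ := H.exists_forall_valuation_le_one O
    have hP' := mul_eq_one_comm.1 hP
    have h1 : ∀ L : List (ZMod ℓ → ZMod ℓ → Ω), (∀ x ∈ L, IsAdmissible ψ γ₀ c r x) → ∀ s t,
        O.valuation ((P' * (L.map (latMat ψ γ η (c * r))).prod * P) s t) ≤ 1 := by
      intro L
      induction L with
      | nil =>
        intro _ s t
        rw [List.map_nil, List.prod_nil, Matrix.mul_one, hP, Matrix.one_apply]
        split_ifs <;> simp
      | cons x L ih =>
        intro hL
        have : P' * (List.map (latMat ψ γ η (c * r)) (x :: L)).prod * P =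
            (P' * latMat ψ γ η (c * r) x * P) *
              (P' * (List.map (latMat ψ γ η (c * r)) L).prod * P) := by
          rw [List.map_cons, List.prod_cons]
          calc _ = P' * latMat ψ γ η (c * r) x * 1 *
                (List.map (latMat ψ γ η (c * r)) L).prod * P := by
                simp only [Matrix.mul_assoc, Matrix.one_mul]
            _ = _ := by rw [← hP']; simp only [Matrix.mul_assoc]
        rw [this]
        exact O.valuation.map_mul_apply_le_one (h x (hL x List.mem_cons_self))
          (ih fun y hy => hL y (List.mem_cons_of_mem _ hy))
    have h2 := O.valuation.map_trace_le_one_and_map_det_le_one (h1 L hL)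
    rw [Matrix.trace_mul_comm, ← Matrix.mul_assoc, hP', Matrix.one_mul, Matrix.det_mul_right_comm,
      hP, Matrix.det_mul] at h2
    simpa using h2
  exact ⟨isIntegral_of_forall_valuationSubring fun O => (key O).1,
    isIntegral_of_forall_valuationSubring fun O => (key O).2⟩

end integrality

section coordinates

variable {Ω : Type*} [Field Ω] {ℓ : ℕ} [hℓ : Fact ℓ.Prime]

lemma ZMod.one_le_posVal (i : ZMod ℓ) : 1 ≤ ZMod.posVal i := Nat.le_add_left _ _

lemma ZMod.posVal_le (i : ZMod ℓ) : ZMod.posVal i ≤ ℓ := ZMod.val_lt (i - 1)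

lemma ZMod.pow_posVal (a : Ω) (i : ZMod ℓ) :
    a ^ ZMod.posVal i = (if i = 0 then a ^ ℓ else 1) * a ^ i.val := by
  have h1 := congrArg ZMod.val (ZMod.natCast_posVal i)
  rw [ZMod.val_natCast] at h1
  rcases (ZMod.posVal_le i).lt_or_eq with h | h
  · rw [Nat.mod_eq_of_lt h] at h1
    rw [if_neg, h1, one_mul]
    rintro rfl
    have := ZMod.one_le_posVal (0 : ZMod ℓ)
    rw [h1, ZMod.val_zero] at this
    omega
  · rw [h, Nat.mod_self] at h1
    rw [if_pos ((ZMod.val_eq_zero i).1 h1.symm), h, ← h1, pow_zero, mul_one]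

/-- The coordinates with respect to `X ^ i * Y ^ j` of a lattice element. -/
noncomputable def latCoord (g h e : Ω) (x : ZMod ℓ → ZMod ℓ → Ω) (i j : ZMod ℓ) : Ω :=
  x i j * (if i = 0 then g else 1) * (if j = 0 then h else 1) * e⁻¹

lemma latMat_eq_cycMat (ψ : AddChar (ZMod ℓ) Ω) (γ η e : Ω) (x : ZMod ℓ → ZMod ℓ → Ω) :
    latMat ψ γ η e x = cycMat ψ γ η (latCoord (γ ^ ℓ) (η ^ ℓ) e x) := by
  ext s t
  rw [latMat_apply, cycMat_apply, Finset.sum_mul, Finset.mul_sum]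
  refine Finset.sum_congr rfl fun i _ => ?_
  rw [latCoord, ZMod.pow_posVal, ZMod.pow_posVal]
  ring

lemma latCoord_map {F : Type*} [Field F] (f : F →+* Ω) (g h e : F) (x : ZMod ℓ → ZMod ℓ → F)
    (i j : ZMod ℓ) :
    f (latCoord g h e x i j) = latCoord (f g) (f h) (f e) (fun i j => f (x i j)) i j := by
  simp only [latCoord, map_mul, map_inv₀, apply_ite f, map_one]

lemma norm_latMat_apply_le {ψ : AddChar (ZMod ℓ) Ω} {γ η e : Ω} (σ : Ω →+* ℂ) {ν ρ D D' A : ℝ}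
    (hν : 0 ≤ ν) (hρ : 0 ≤ ρ) (hD1 : 1 ≤ D) (hA : 0 ≤ A)
    (hγ : ‖σ γ‖ ≤ D * ν) (hη : ‖σ η‖ ≤ ρ) (he0 : e ≠ 0)
    (he : ν ^ ℓ * ρ ^ ℓ ≤ D' * ‖σ e‖) {x : ZMod ℓ → ZMod ℓ → Ω}
    (hx : ∀ i j, ‖σ (x i j)‖ ≤ A * (ν ^ (ℓ - ZMod.posVal i) * ρ ^ (ℓ - ZMod.posVal j)))
    (s t : ZMod ℓ) : ‖σ (latMat ψ γ η e x s t)‖ ≤ ℓ * D' * D ^ ℓ * A := by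
  have hψ : ∀ a, ‖σ (ψ a)‖ = 1 := fun a =>
    Complex.norm_eq_one_of_pow_eq_one (by rw [← map_pow, ψ.pow_prime_eq_one, map_one]) hℓ.out.ne_zero
  have he1 : 0 < ‖σ e‖ := norm_pos_iff.2 ((_root_.map_ne_zero σ).2 he0)
  rw [latMat_apply, map_mul, map_inv₀, norm_mul, norm_inv, inv_mul_le_iff₀ he1, map_mul, norm_mul,
    map_sum]
  set j := s - t
  have h1 : ‖∑ i, σ (x i j * γ ^ ZMod.posVal i * ψ (i * s))‖ ≤
      ℓ * (A * D ^ ℓ * ν ^ ℓ * ρ ^ (ℓ - ZMod.posVal j)) := by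
    refine (norm_sum_le _ _).trans ?_
    refine (Finset.sum_le_card_nsmul _ _ (A * D ^ ℓ * ν ^ ℓ * ρ ^ (ℓ - ZMod.posVal j))
      fun i _ => ?_).trans_eq (by rw [Finset.card_univ, ZMod.card, nsmul_eq_mul])
    rw [map_mul, map_mul, norm_mul, norm_mul, hψ, mul_one, map_pow, norm_pow]
    calc _ ≤ A * (ν ^ (ℓ - ZMod.posVal i) * ρ ^ (ℓ - ZMod.posVal j)) *
          (D ^ ℓ * ν ^ ZMod.posVal i) := by
          refine mul_le_mul (hx i j) ?_ (by positivity) (by positivity)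
          refine (pow_le_pow_left₀ (norm_nonneg _) hγ _).trans ?_
          rw [mul_pow]
          exact mul_le_mul_of_nonneg_right (pow_le_pow_right₀ hD1 (ZMod.posVal_le i))
            (by positivity)
      _ = A * D ^ ℓ * (ν ^ (ℓ - ZMod.posVal i) * ν ^ ZMod.posVal i) *
          ρ ^ (ℓ - ZMod.posVal j) := by ring
      _ = _ := by rw [← pow_add, Nat.sub_add_cancel (ZMod.posVal_le i)]
  rw [map_pow, norm_pow]
  calc _ ≤ ℓ * (A * D ^ ℓ * ν ^ ℓ * ρ ^ (ℓ - ZMod.posVal j)) * ρ ^ ZMod.posVal j :=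
        mul_le_mul h1 (pow_le_pow_left₀ (norm_nonneg _) hη _) (by positivity) (by positivity)
    _ = ℓ * A * D ^ ℓ * (ν ^ ℓ * (ρ ^ (ℓ - ZMod.posVal j) * ρ ^ ZMod.posVal j)) := by ring
    _ = ℓ * A * D ^ ℓ * (ν ^ ℓ * ρ ^ ℓ) := by
        rw [← pow_add, Nat.sub_add_cancel (ZMod.posVal_le j)]
    _ ≤ ℓ * A * D ^ ℓ * (D' * ‖σ e‖) := mul_le_mul_of_nonneg_left he (by positivity)
    _ = _ := by ring

/-- A nonzero algebraic integer has a conjugate of absolute value at least one. -/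
lemma exists_one_le_norm_map_of_isIntegral [CharZero Ω] [Algebra.IsAlgebraic ℚ Ω] {x : Ω}
    (hx : IsIntegral ℤ x) (hx0 : x ≠ 0) : ∃ σ : Ω →+* ℂ, 1 ≤ ‖σ x‖ := by
  by_contra! h
  have hroot : ∀ z ∈ ((minpoly ℚ x).aroots ℂ), ‖z‖ < 1 := by
    intro z hz
    have : z ∈ (minpoly ℚ x).rootSet ℂ := by
      rw [Polynomial.rootSet_def, Finset.mem_coe, Multiset.mem_toFinset]
      exact hz
    rw [← Algebra.IsAlgebraic.range_eval_eq_rootSet_minpoly ℂ x] at this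
    obtain ⟨σ, rfl⟩ := this
    exact h σ.toRingHom
  have hxQ : IsIntegral ℚ x := hx.tower_top
  have hmin := minpoly.isIntegrallyClosed_eq_field_fractions' ℚ hx
  have hprod : (algebraMap ℚ ℂ ((minpoly ℚ x).coeff 0)) =
      (-1) ^ (minpoly ℚ x).natDegree * ((minpoly ℚ x).aroots ℂ).prod := by
    have h1 := ((minpoly.monic hxQ).map (algebraMap ℚ ℂ))
    have h2 := (IsAlgClosed.splits ((minpoly ℚ x).map (algebraMap ℚ ℂ))).coeff_zero_eq_prod_roots_of_monic h1
    rwa [Polynomial.coeff_map, Polynomial.natDegree_map] at h2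
  have hc0 : (minpoly ℤ x).coeff 0 ≠ 0 := by
    intro h0
    refine minpoly.coeff_zero_ne_zero hxQ hx0 ?_
    rw [hmin, Polynomial.coeff_map, h0, map_zero]
  have h1 : (1 : ℝ) ≤ ‖algebraMap ℚ ℂ ((minpoly ℚ x).coeff 0)‖ := by
    rw [hmin, Polynomial.coeff_map]
    simp only [algebraMap_int_eq, eq_intCast, map_intCast]
    rw [Complex.norm_intCast]
    exact_mod_cast Int.one_le_abs hc0
  rw [hprod, norm_mul, norm_pow, norm_neg, norm_one, one_pow, one_mul] at h1
  have hne : (minpoly ℚ x).aroots ℂ ≠ 0 := by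
    intro h0
    have h2 := Polynomial.splits_iff_card_roots.1
      (IsAlgClosed.splits ((minpoly ℚ x).map (algebraMap ℚ ℂ)))
    rw [Polynomial.aroots_def] at h0
    rw [h0, Multiset.card_zero, Polynomial.natDegree_map] at h2
    exact (minpoly.natDegree_pos hxQ).ne h2
  have hlt : ∀ s : Multiset ℂ, s ≠ 0 → (∀ z ∈ s, ‖z‖ < 1) → ‖s.prod‖ < 1 := by
    intro s
    induction s using Multiset.induction with
    | empty => exact fun h => absurd rfl h
    | cons a s ih =>
      intro _ hs
      rw [Multiset.prod_cons, norm_mul]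
      rcases eq_or_ne s 0 with rfl | h0
      · simpa using hs a (Multiset.mem_cons_self _ _)
      · exact mul_lt_one_of_nonneg_of_lt_one_left (norm_nonneg _)
          (hs a (Multiset.mem_cons_self _ _))
          (ih h0 fun z hz => hs z (Multiset.mem_cons_of_mem hz)).le
  exact (hlt _ hne hroot).not_ge h1

end coordinates

section

open NumberField

section lattice

variable {ℓ : ℕ} [hℓ : Fact ℓ.Prime]

lemma ZMod.card_filter_le_val (u : ℕ) :
    (Finset.univ.filter fun b : ZMod ℓ => u ≤ b.val).card = ℓ - u := by
  rw [← Nat.card_Ico]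
  refine Finset.card_nbij' ZMod.val (fun n => (n : ZMod ℓ)) ?_ ?_ ?_ ?_
  · intro b hb
    simp only [Finset.coe_filter, Finset.mem_univ, true_and, Set.mem_ofPred_eq] at hb
    simpa using ⟨hb, ZMod.val_lt b⟩
  · intro n hn
    simp only [Finset.coe_Ico, Set.mem_Ico] at hn
    simpa [ZMod.val_natCast, Nat.mod_eq_of_lt hn.2] using hn.1
  · intro b _
    simp
  · intro n hn
    simp only [Finset.coe_Ico, Set.mem_Ico] at hn
    exact ZMod.val_cast_of_lt hn.2

/-- The index set of the congruence conditions. -/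
abbrev CongrIndex (ℓ : ℕ) [Fact ℓ.Prime] : Type :=
  {q : ZMod ℓ × ZMod ℓ // ZMod.posVal q.1 ≤ q.2.val}

lemma card_congrIndex : Fintype.card (CongrIndex ℓ) = ∑ i : ZMod ℓ, (ℓ - ZMod.posVal i) := by
  rw [Fintype.card_subtype, Finset.card_filter, Fintype.sum_prod_type]
  refine Finset.sum_congr rfl fun i _ => ?_
  rw [← ZMod.card_filter_le_val, Finset.card_filter]

variable (F : Type*) [Field F] [NumberField F]

variable {F} in
lemma absNorm_span_singleton_le {x : 𝓞 F} {b : ℝ} (hx : ∀ τ : F →+* ℂ, ‖τ x‖ ≤ b) :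
    (Ideal.absNorm (Ideal.span {x}) : ℝ) ≤ b ^ Module.finrank ℚ F := by
  have h2 : ((Ideal.absNorm (Ideal.span {x}) : ℕ) : ℝ) =
      ‖algebraMap ℚ ℂ (Algebra.norm ℚ (x : F))‖ := by
    rw [Ideal.absNorm_span_singleton, ← Algebra.coe_norm_int]
    simp [Nat.cast_natAbs]
  rw [h2, Algebra.norm_eq_prod_embeddings ℚ ℂ, norm_prod, ← AlgHom.card ℚ F ℂ, ← Finset.card_univ,
    ← Finset.prod_const]
  exact Finset.prod_le_prod (fun _ _ => norm_nonneg _) fun τ _ => hx τ.toRingHom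

/-- Index set for integral coordinates. -/
abbrev LatIndex (ℓ : ℕ) (F : Type*) [Field F] [NumberField F] : Type _ :=
  ZMod ℓ × ZMod ℓ × Module.Free.ChooseBasisIndex ℤ (𝓞 F)

lemma card_basisIndex :
    Fintype.card (Module.Free.ChooseBasisIndex ℤ (𝓞 F)) = Module.finrank ℚ F := by
  rw [← Module.finrank_eq_card_chooseBasisIndex, RingOfIntegers.rank]

/-- Weights of the coordinates. -/
noncomputable def latWeight (ν ρ : ℝ) (q : LatIndex ℓ F) : ℝ :=
  ν ^ (ℓ - ZMod.posVal q.1) * ρ ^ (ℓ - ZMod.posVal q.2.1)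

lemma prod_latWeight (ν ρ : ℝ) : ∏ q, latWeight (ℓ := ℓ) F ν ρ q =
    ((ν ^ ℓ * ρ ^ ℓ) ^ Module.finrank ℚ F) ^ Fintype.card (CongrIndex ℓ) := by
  simp only [latWeight, Finset.prod_mul_distrib, Finset.prod_pow_eq_pow_sum, card_congrIndex,
    Fintype.sum_prod_type, Finset.sum_const, Finset.card_univ, ZMod.card, Fintype.card_prod,
    card_basisIndex, smul_eq_mul, ← Finset.mul_sum]
  ring

/-- Integral coordinates attached to a vector of integers. -/
noncomputable def latVec : (LatIndex ℓ F → ℤ) →+ (ZMod ℓ → ZMod ℓ → 𝓞 F) where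
  toFun a i j := ∑ b, a (i, j, b) • RingOfIntegers.basis F b
  map_zero' := by ext; simp
  map_add' a b := by ext; simp [add_smul, Finset.sum_add_distrib]

variable {F}

/-- The congruence conditions as a homomorphism. -/
noncomputable def congrHom (ψ : AddChar (ZMod ℓ) (𝓞 F)) (γ₀ c : 𝓞 F) (r : ℕ) :
    (ZMod ℓ → ZMod ℓ → 𝓞 F) →+ (CongrIndex ℓ → 𝓞 F ⧸ Ideal.span {(r : 𝓞 F)}) ×
      (CongrIndex ℓ → 𝓞 F ⧸ Ideal.span {c}) :=
  AddMonoidHom.mk' (fun x =>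
    (fun q => Ideal.Quotient.mk _ (∑ i, x i q.1.1 * γ₀ ^ ZMod.posVal i * ψ (i * q.1.2)),
     fun q => Ideal.Quotient.mk _ (∑ d, ψ (d * q.1.1) * x q.1.1 d * ψ (-(d * q.1.2)))))
    fun x y => by
      refine Prod.ext (funext fun q => ?_) (funext fun q => ?_)
      · simp only [Prod.fst_add, Pi.add_apply, ← map_add, ← Finset.sum_add_distrib, add_mul]
      · simp only [Prod.snd_add, Pi.add_apply, ← map_add, ← Finset.sum_add_distrib, add_mul, mul_add]

lemma natCard_congrHom_le {c : 𝓞 F} {r : ℕ} {b b' : ℝ} (hr : (r : ℝ) ≤ b)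
    (hb' : 0 ≤ b') (hc : ∀ τ : F →+* ℂ, ‖τ c‖ ≤ b') :
    (Nat.card ((CongrIndex ℓ → 𝓞 F ⧸ Ideal.span {(r : 𝓞 F)}) ×
      (CongrIndex ℓ → 𝓞 F ⧸ Ideal.span {c})) : ℝ) ≤
      ((b' * b) ^ Module.finrank ℚ F) ^ Fintype.card (CongrIndex ℓ) := by
  have h1 : (Ideal.absNorm (Ideal.span {(r : 𝓞 F)}) : ℝ) ≤ b ^ Module.finrank ℚ F :=
    absNorm_span_singleton_le fun τ => by simpa using hr
  have h2 := absNorm_span_singleton_le hc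
  have hb : 0 ≤ b := (Nat.cast_nonneg r).trans hr
  rw [Nat.card_prod, Nat.card_pi, Nat.card_pi, Finset.prod_const, Finset.prod_const,
    Finset.card_univ, Nat.cast_mul, Nat.cast_pow, Nat.cast_pow, ← Submodule.cardQuot_apply,
    ← Submodule.cardQuot_apply, ← Ideal.absNorm_apply, ← Ideal.absNorm_apply, ← mul_pow, mul_pow b',
    mul_comm (b' ^ _)]
  gcongr

variable {Ω : Type*} [Field Ω] [Algebra F Ω]

/-- Extension of scalars of a character with integral values. -/
noncomputable def extChar (Ω : Type*) [Field Ω] [Algebra F Ω] (ψ : AddChar (ZMod ℓ) (𝓞 F)) :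
    AddChar (ZMod ℓ) Ω :=
  ((algebraMap F Ω).comp (algebraMap (𝓞 F) F)).toMonoidHom.compAddChar ψ

omit [NumberField F] in
lemma extChar_apply (ψ : AddChar (ZMod ℓ) (𝓞 F)) (a : ZMod ℓ) :
    extChar Ω ψ a = algebraMap F Ω (ψ a) := rfl

omit [NumberField F] in
lemma isIntegral_algebraMap_coe (x : 𝓞 F) : IsIntegral ℤ (algebraMap F Ω x) :=
  map_isIntegral_int (algebraMap F Ω) x.isIntegral_coe

omit [NumberField F] in
lemma isAdmissible_of_congrHom_eq_zero {ψ : AddChar (ZMod ℓ) (𝓞 F)} {γ₀ c : 𝓞 F} {r : ℕ}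
    {x : ZMod ℓ → ZMod ℓ → 𝓞 F} (h : congrHom ψ γ₀ c r x = 0) :
    IsAdmissible (extChar Ω ψ) (algebraMap F Ω γ₀) (algebraMap F Ω c) r
      fun i j => algebraMap F Ω (x i j) where
  isIntegral i j := isIntegral_algebraMap_coe _
  congr_r d b hdb := by
    have := congrFun (congrArg Prod.fst h) ⟨(d, b), hdb⟩
    obtain ⟨y, hy⟩ := Ideal.mem_span_singleton.1 (Ideal.Quotient.eq_zero_iff_mem.1 this)
    refine ⟨algebraMap F Ω y, isIntegral_algebraMap_coe _, ?_⟩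
    have := congrArg (fun z : 𝓞 F => algebraMap F Ω z) hy
    simpa [extChar_apply] using this
  congr_c i b hib := by
    have := congrFun (congrArg Prod.snd h) ⟨(i, b), hib⟩
    obtain ⟨y, hy⟩ := Ideal.mem_span_singleton.1 (Ideal.Quotient.eq_zero_iff_mem.1 this)
    refine ⟨algebraMap F Ω y, isIntegral_algebraMap_coe _, ?_⟩
    have := congrArg (fun z : 𝓞 F => algebraMap F Ω z) hy
    simpa [extChar_apply] using this

/-- Rational vectors are spanned by any set of integer vectors on which no nonzero real functional
vanishes. -/
lemma exists_family_spanning {ι : Type*} [Fintype ι] {S : Set (ι → ℤ)}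
    (hS : ∀ f : ι → ℝ, (∀ a ∈ S, ∑ i, f i * a i = 0) → f = 0) :
    ∃ a : ι → ι → ℤ, (∀ q, a q ∈ S) ∧ ∀ y : ι → ℚ, ∃ m : ι → ℚ, ∀ i, y i = ∑ q, m q * a q i := by
  classical
  let S' : Set (ι → ℚ) := (fun a i => (a i : ℚ)) '' S
  have hspan : ⊤ ≤ Submodule.span ℚ S' := by
    by_contra h
    obtain ⟨f, hf0, hf⟩ := Submodule.exists_le_ker_of_lt_top _ (lt_of_le_not_ge le_top h)
    refine hf0 ?_
    have h1 := hS (fun i => (f (Pi.single i 1) : ℝ)) fun a ha => by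
      have h2 : f (fun i => (a i : ℚ)) = 0 := hf (Submodule.subset_span ⟨a, ha, rfl⟩)
      rw [LinearMap.pi_apply_eq_sum_univ] at h2
      have h3 := congrArg (fun q : ℚ => (q : ℝ)) h2
      simp only [Rat.cast_zero] at h3
      rw [← h3]
      push_cast
      refine Finset.sum_congr rfl fun i _ => ?_
      rw [smul_eq_mul, Rat.cast_mul, Rat.cast_intCast, mul_comm]
      congr 3
      ext j
      simp [Pi.single_apply, eq_comm]
    refine LinearMap.pi_ext' fun i => LinearMap.ext_ring ?_
    have := congrFun h1 i
    simpa using this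
  let b := Module.Basis.ofSpan hspan
  let b' := b.reindex (b.indexEquiv (Pi.basisFun ℚ ι))
  have hb : ∀ q, b' q ∈ S' := fun q => by
    rw [Module.Basis.reindex_apply]
    exact Module.Basis.ofSpan_subset hspan ⟨_, rfl⟩
  choose a ha hab using hb
  refine ⟨a, ha, fun y => ⟨b'.equivFun y, fun i => ?_⟩⟩
  conv_lhs => rw [← b'.sum_equivFun y]
  rw [Finset.sum_apply]
  refine Finset.sum_congr rfl fun q _ => ?_
  rw [Pi.smul_apply, smul_eq_mul, ← hab q]

end lattice

end

section

open NumberField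

section lattice

variable {ℓ : ℕ} [hℓ : Fact ℓ.Prime] {F Ω : Type*} [Field F] [NumberField F] [Field Ω]
  [Algebra F Ω]

/-- Lattice data over a number field giving a division algebra, with archimedean sizes controlled
by a constant. -/
structure IsBoundedDatum (ψ : AddChar (ZMod ℓ) (𝓞 F)) (γ η : Ω) (γ₀ c w : 𝓞 F) (p r : ℕ)
    (C : ℝ) : Prop where
  lattice : IsLatticeDatum (extChar Ω ψ) γ η (algebraMap F Ω γ₀) (algebraMap F Ω c)
    (algebraMap F Ω w) p r
  w_ne_zero : w ≠ 0
  det_ne_zero : ∀ y : ZMod ℓ → ZMod ℓ → F, y ≠ 0 →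
    (cycMat (extChar Ω ψ) γ η fun i j => algebraMap F Ω (y i j)).det ≠ 0
  bounds : ∃ ν ρ : ℝ, 1 ≤ ν ∧ 1 ≤ ρ ∧ ρ ^ ℓ = p * r ∧
    ∀ τ : F →+* ℂ, ν ^ ℓ ≤ C * ‖τ c‖ ∧ ‖τ c‖ ≤ C * ν ^ ℓ ∧ ‖τ w‖ ≤ C

omit hℓ [NumberField F] in
lemma latVec_eq_zero [Fact ℓ.Prime] [NumberField F] {a : LatIndex ℓ F → ℤ}
    (h : latVec F a = 0) : a = 0 := by
  ext ⟨i, j, b⟩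
  exact Fintype.linearIndependent_iff.1 (RingOfIntegers.basis F).linearIndependent
    (fun b => a (i, j, b)) (congrFun (congrFun h i) j) b

lemma norm_latVec_le {W : ℝ} {τ : F →+* ℂ} (hW : ∑ b, ‖τ (RingOfIntegers.basis F b)‖ ≤ W)
    {A ν ρ : ℝ} (hA : 0 ≤ A) (hν : 0 ≤ ν) (hρ : 0 ≤ ρ) {a : LatIndex ℓ F → ℤ}
    (ha : ∀ q, |(a q : ℝ)| ≤ A * latWeight F ν ρ q) (i j : ZMod ℓ) :
    ‖τ (latVec F a i j)‖ ≤ A * W * (ν ^ (ℓ - ZMod.posVal i) * ρ ^ (ℓ - ZMod.posVal j)) := by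
  have h1 : (latVec F a i j : F) = ∑ b, (a (i, j, b) : F) * (RingOfIntegers.basis F b : F) := by
    simp [latVec]
  rw [h1, map_sum]
  calc _ ≤ ∑ b, ‖τ (a (i, j, b) * (RingOfIntegers.basis F b : F))‖ := norm_sum_le _ _
    _ ≤ ∑ b, A * (ν ^ (ℓ - ZMod.posVal i) * ρ ^ (ℓ - ZMod.posVal j)) *
        ‖τ (RingOfIntegers.basis F b)‖ := by
        refine Finset.sum_le_sum fun b _ => ?_
        rw [map_mul, norm_mul, map_intCast, Complex.norm_intCast]
        exact mul_le_mul_of_nonneg_right (ha (i, j, b)) (norm_nonneg _)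
    _ = A * (ν ^ (ℓ - ZMod.posVal i) * ρ ^ (ℓ - ZMod.posVal j)) *
        ∑ b, ‖τ (RingOfIntegers.basis F b)‖ := by rw [Finset.mul_sum]
    _ ≤ A * (ν ^ (ℓ - ZMod.posVal i) * ρ ^ (ℓ - ZMod.posVal j)) * W :=
        mul_le_mul_of_nonneg_left hW (by positivity)
    _ = _ := by ring

variable {ψ : AddChar (ZMod ℓ) (𝓞 F)} {γ η : Ω} {γ₀ c w : 𝓞 F} {p r : ℕ} {C : ℝ}

omit [NumberField F] in
lemma IsBoundedDatum.pow_γ (H : IsBoundedDatum ψ γ η γ₀ c w p r C) :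
    γ ^ ℓ = algebraMap F Ω (c * w) := by
  rw [H.lattice.γ_pow, map_mul]

omit [NumberField F] in
lemma IsBoundedDatum.pow_η (H : IsBoundedDatum ψ γ η γ₀ c w p r C) :
    η ^ ℓ = algebraMap F Ω (p * r) := by
  rw [H.lattice.η_pow, map_mul, map_natCast, map_natCast]

omit [NumberField F] in
lemma IsBoundedDatum.latMat_eq (H : IsBoundedDatum ψ γ η γ₀ c w p r C)
    (x : ZMod ℓ → ZMod ℓ → 𝓞 F) :
    latMat (extChar Ω ψ) γ η (algebraMap F Ω c * r) (fun i j => algebraMap F Ω (x i j)) =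
      cycMat (extChar Ω ψ) γ η fun i j =>
        algebraMap F Ω (latCoord ((c : F) * w) (p * r) (c * r) (fun i j => (x i j : F)) i j) := by
  rw [latMat_eq_cycMat, H.pow_γ, H.pow_η]
  congr 1
  ext i j
  rw [latCoord_map, map_mul (algebraMap F Ω) (c : F) r, map_natCast]

lemma IsBoundedDatum.ne_zero (H : IsBoundedDatum ψ γ η γ₀ c w p r C) (hp : p ≠ 0) :
    (c : F) * w ≠ 0 ∧ (p * r : F) ≠ 0 ∧ (c : F) * r ≠ 0 := by
  have hc : (c : F) ≠ 0 := fun h => H.lattice.c_ne_zero (by rw [h, map_zero])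
  have hr : (r : F) ≠ 0 := fun h => H.lattice.r_ne_zero (by
    rw [← map_natCast (algebraMap F Ω), h, map_zero])
  exact ⟨mul_ne_zero hc (RingOfIntegers.coe_ne_zero_iff.2 H.w_ne_zero),
    mul_ne_zero (Nat.cast_ne_zero.2 hp) hr, mul_ne_zero hc hr⟩

lemma latCoord_eq_zero {K : Type*} [Field K] {g h e : K} (hg : g ≠ 0) (hh : h ≠ 0) (he : e ≠ 0)
    {x : ZMod ℓ → ZMod ℓ → K} (hx : latCoord g h e x = 0) : x = 0 := by
  ext i j
  have := congrFun (congrFun hx i) j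
  simp only [latCoord, Pi.zero_apply, mul_eq_zero, inv_eq_zero, he, or_false] at this
  split_ifs at this <;> simpa [hg, hh] using this

/-- For bounded data there are lattices of integral elements spanned by elements of bounded size. -/
theorem exists_bounded_spanning [CharZero Ω] [Algebra.IsAlgebraic ℚ Ω]
    (ψ : AddChar (ZMod ℓ) (𝓞 F)) {p : ℕ} (hp : p ≠ 0) {C : ℝ} (hC : 1 ≤ C) :
    ∃ C' : ℝ, ∀ (γ η : Ω) (γ₀ c w : 𝓞 F) (r : ℕ), IsBoundedDatum ψ γ η γ₀ c w p r C →
      ∃ x : LatIndex ℓ F → ZMod ℓ → ZMod ℓ → 𝓞 F,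
        (∀ q, IsAdmissible (extChar Ω ψ) (algebraMap F Ω γ₀) (algebraMap F Ω c) r
          fun i j => algebraMap F Ω (x q i j)) ∧
        (∀ (σ : Ω →+* ℂ) q s t, ‖σ (latMat (extChar Ω ψ) γ η (algebraMap F Ω c * r)
          (fun i j => algebraMap F Ω (x q i j)) s t)‖ ≤ C') ∧
        ∀ y : ZMod ℓ → ZMod ℓ → F, ∃ m : LatIndex ℓ F → F, ∀ i j, y i j = ∑ q, m q * x q i j := by
  set W : ℝ := 1 + ∑ τ : F →+* ℂ, ∑ b, ‖τ (RingOfIntegers.basis F b)‖ with hWdef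
  have hW1 : 1 ≤ W := by
    rw [hWdef]
    exact le_add_of_nonneg_right (by positivity)
  have hW : ∀ τ : F →+* ℂ, ∑ b, ‖τ (RingOfIntegers.basis F b)‖ ≤ W := fun τ =>
    (Finset.single_le_sum (f := fun τ : F →+* ℂ => ∑ b, ‖τ (RingOfIntegers.basis F b)‖)
      (fun _ _ => by positivity) (Finset.mem_univ τ)).trans (by rw [hWdef]; linarith)
  have hp1 : (1 : ℝ) ≤ p := by exact_mod_cast Nat.one_le_iff_ne_zero.2 hp
  have hℓ1 : (1 : ℝ) ≤ ℓ := by exact_mod_cast hℓ.out.one_lt.le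
  have hC2 : 1 ≤ C ^ 2 := one_le_pow₀ hC
  set C₃ : ℝ := ℓ * (C * p) * (C ^ 2) ^ ℓ * W with hC₃
  have hC₃1 : 1 ≤ C₃ := one_le_mul_of_one_le_of_one_le (one_le_mul_of_one_le_of_one_le
    (one_le_mul_of_one_le_of_one_le hℓ1 (one_le_mul_of_one_le_of_one_le hC hp1))
    (one_le_pow₀ hC2)) hW1
  have hfac : (1 : ℝ) ≤ ℓ.factorial := by exact_mod_cast Nat.succ_le_of_lt ℓ.factorial_pos
  set ε : ℝ := (2 * C₃ * ℓ.factorial)⁻¹ with hε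
  have hε0 : 0 < ε := by positivity
  obtain ⟨B, hB, h⟩ := exists_forall_eq_zero_of_forall_sum_eq_zero (LatIndex ℓ F)
    ((C ^ Module.finrank ℚ F) ^ Fintype.card (CongrIndex ℓ)) hε0
  refine ⟨C₃ * B, fun γ η γ₀ c w r H => ?_⟩
  obtain ⟨ν, ρ, hν, hρ, hρℓ, hτ⟩ := H.bounds
  obtain ⟨hcw, hpr, hcr⟩ := H.ne_zero hp
  have hcrΩ : algebraMap F Ω c * r ≠ 0 := by
    have := (_root_.map_ne_zero (algebraMap F Ω)).2 hcr
    rwa [map_mul, map_natCast] at this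
  have hentry : ∀ (A : ℝ) (_ : 0 ≤ A) (a : LatIndex ℓ F → ℤ)
      (_ : ∀ q, |(a q : ℝ)| ≤ A * latWeight F ν ρ q) (σ : Ω →+* ℂ) (s t : ZMod ℓ),
      ‖σ (latMat (extChar Ω ψ) γ η (algebraMap F Ω c * r)
        (fun i j => algebraMap F Ω (latVec F a i j)) s t)‖ ≤ C₃ * A := by
    intro A hA a ha σ s t
    obtain ⟨h1, h2, h3⟩ := hτ (σ.comp (algebraMap F Ω))
    rw [RingHom.comp_apply] at h1 h2 h3
    have hη : ‖σ η‖ ≤ ρ := by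
      refine le_of_pow_le_pow_left₀ hℓ.out.ne_zero (by positivity) ?_
      rw [← norm_pow, ← map_pow, H.lattice.η_pow, hρℓ]
      simp
    have hγ : ‖σ γ‖ ≤ C ^ 2 * ν := by
      refine le_of_pow_le_pow_left₀ hℓ.out.ne_zero (by positivity) ?_
      rw [← norm_pow, ← map_pow, H.lattice.γ_pow, map_mul, norm_mul, mul_pow]
      calc _ ≤ C * ν ^ ℓ * C := mul_le_mul h2 h3 (norm_nonneg _) (by positivity)
        _ = C ^ 2 * ν ^ ℓ := by ring
        _ ≤ _ := mul_le_mul_of_nonneg_right (le_self_pow₀ hC2 hℓ.out.ne_zero) (by positivity)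
    refine (norm_latMat_apply_le σ (D := C ^ 2) (D' := C * p) (A := A * W) (by positivity)
      (by positivity) hC2 (by positivity) hγ hη hcrΩ ?_
      (fun i j => norm_latVec_le (hW (σ.comp (algebraMap F Ω))) hA (by positivity)
        (by positivity) ha i j) s t).trans_eq (by rw [hC₃]; ring)
    rw [map_mul, norm_mul, hρℓ, map_natCast, Complex.norm_natCast]
    calc _ ≤ C * ‖σ (algebraMap F Ω c)‖ * (p * r) := mul_le_mul_of_nonneg_right h1 (by positivity)
      _ = _ := by ring
  have hfin1 : Finite (𝓞 F ⧸ Ideal.span {(r : 𝓞 F)}) := by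
    refine Ideal.finiteQuotientOfFreeOfNeBot _ fun h => ?_
    rw [Ideal.span_singleton_eq_bot] at h
    exact H.lattice.r_ne_zero (by simpa using congrArg (fun z : 𝓞 F => algebraMap F Ω z) h)
  have hfin2 : Finite (𝓞 F ⧸ Ideal.span {c}) := by
    refine Ideal.finiteQuotientOfFreeOfNeBot _ fun h => ?_
    rw [Ideal.span_singleton_eq_bot] at h
    exact H.lattice.c_ne_zero (by simpa using congrArg (fun z : 𝓞 F => algebraMap F Ω z) h)
  have hrρ : (r : ℝ) ≤ ρ ^ ℓ := by
    rw [hρℓ]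
    exact le_mul_of_one_le_left (Nat.cast_nonneg _) hp1
  have hφ := h _ ((congrHom ψ γ₀ c r).comp (latVec F)) (latWeight F ν ρ)
    (fun q => one_le_mul_of_one_le_of_one_le (one_le_pow₀ hν) (one_le_pow₀ hρ)) (by
      refine (natCard_congrHom_le hrρ (b' := C * ν ^ ℓ) (by positivity)
        fun τ => (hτ τ).2.1).trans_eq ?_
      rw [prod_latWeight, ← mul_pow, ← mul_pow, mul_assoc C]) (by
      intro a ha ha0
      by_contra! hlt
      have hx0 : latVec F a ≠ 0 := fun h => ha0 (latVec_eq_zero h)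
      have hadm := isAdmissible_of_congrHom_eq_zero (Ω := Ω) ha
      have h1 := (H.lattice.isIntegral_trace_prod [_] (by simpa using hadm)).2
      rw [List.map_singleton, List.prod_singleton] at h1
      have h2 : (latMat (extChar Ω ψ) γ η (algebraMap F Ω c * r)
          fun i j => algebraMap F Ω (latVec F a i j)).det ≠ 0 := by
        rw [H.latMat_eq]
        refine H.det_ne_zero _ fun h0 => hx0 ?_
        have := latCoord_eq_zero hcw hpr hcr h0
        ext i j
        exact congrFun (congrFun this i) j
      obtain ⟨σ, hσ⟩ := exists_one_le_norm_map_of_isIntegral h1 h2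
      have h3 := fun s t => hentry ε hε0.le a (fun q => (hlt q).le) σ s t
      have h4 : ‖(σ.mapMatrix (latMat (extChar Ω ψ) γ η (algebraMap F Ω c * r)
          fun i j => algebraMap F Ω (latVec F a i j))).det‖ ≤
          (Fintype.card (ZMod ℓ)).factorial • (C₃ * ε) ^ Fintype.card (ZMod ℓ) :=
        Matrix.det_le (abv := IsAbsoluteValue.toAbsoluteValue (norm : ℂ → ℝ)) h3
      rw [← RingHom.map_det, ZMod.card, nsmul_eq_mul] at h4
      have h5 : C₃ * ε = (2 * (ℓ.factorial : ℝ))⁻¹ := by rw [hε]; field_simp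
      have h6 : (C₃ * ε) ^ ℓ ≤ C₃ * ε := by
        refine pow_le_of_le_one (by positivity) ?_ hℓ.out.ne_zero
        rw [h5]
        exact inv_le_one_of_one_le₀ (by linarith)
      have h7 : (ℓ.factorial : ℝ) * (C₃ * ε) = 2⁻¹ := by rw [h5]; field_simp
      have h8 := mul_le_mul_of_nonneg_left h6 (Nat.cast_nonneg (α := ℝ) ℓ.factorial)
      rw [h7] at h8
      have := (hσ.trans h4).trans h8
      norm_num at this)
  obtain ⟨a, ha, hspan⟩ := exists_family_spanning (S := {a | congrHom ψ γ₀ c r (latVec F a) = 0 ∧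
    ∀ q, |(a q : ℝ)| ≤ B * latWeight F ν ρ q}) fun f hf => hφ f fun a h1 h2 => hf a ⟨h1, h2⟩
  refine ⟨fun q => latVec F (a q), fun q => isAdmissible_of_congrHom_eq_zero (ha q).1,
    fun σ q s t => hentry B hB.le (a q) (ha q).2 σ s t, fun y => ?_⟩
  obtain ⟨m, hm⟩ := hspan fun q => (integralBasis F).equivFun (y q.1 q.2.1) q.2.2
  refine ⟨fun q => algebraMap ℚ F (m q), fun i j => ?_⟩
  rw [← (integralBasis F).sum_equivFun (y i j)]
  have h1 : ∀ b, (integralBasis F).equivFun (y i j) b = ∑ q, m q * a q (i, j, b) := fun b =>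
    hm (i, j, b)
  simp only [h1, Finset.sum_smul]
  rw [Finset.sum_comm]
  refine Finset.sum_congr rfl fun q _ => ?_
  simp only [latVec, AddMonoidHom.coe_mk, ZeroHom.coe_mk, integralBasis_apply, map_sum,
    Finset.mul_sum, Algebra.smul_def, map_mul, mul_assoc]
  simp

end lattice

end

section

open NumberField

section pattern

variable {ℓ : ℕ} [hℓ : Fact ℓ.Prime] {F Ω : Type*} [Field F] [Field Ω] [Algebra F Ω]

/-- Short words in a finite alphabet. -/
abbrev ShortList (ι : Type*) : Type _ := {L : List ι // L.length ≤ 3}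

instance (ι : Type*) [Finite ι] : Finite (ShortList ι) :=
  (List.finite_length_le ι 3).to_subtype

/-- A cyclic algebra with a spanning family for which the traces of short words are prescribed. -/
def HasPattern {ι : Type*} [Fintype ι] (ψ : AddChar (ZMod ℓ) Ω) (γ η : Ω)
    (t : ShortList ι → F) : Prop :=
  ∃ α : ι → Matrix (ZMod ℓ) (ZMod ℓ) Ω,
    (∀ q, ∃ y : ZMod ℓ → ZMod ℓ → F, cycMat ψ γ η (fun i j => algebraMap F Ω (y i j)) = α q) ∧
    (∀ y : ZMod ℓ → ZMod ℓ → F, ∃ m : ι → F,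
      cycMat ψ γ η (fun i j => algebraMap F Ω (y i j)) = ∑ q, algebraMap F Ω (m q) • α q) ∧
    ∀ L : ShortList ι, algebraMap F Ω (t L) = ((L.1.map α).prod).trace

/-- Parameters of a cyclic algebra defined over a subfield. -/
structure IsCyclicDatum (F : Type*) {Ω : Type*} [Field F] [Field Ω] [Algebra F Ω] {ℓ : ℕ}
    [Fact ℓ.Prime] (ψ : AddChar (ZMod ℓ) Ω) (γ η : Ω) : Prop where
  primitive : ψ.IsPrimitive
  apply_mem : ∀ a, ψ a ∈ (algebraMap F Ω).fieldRange
  γ_pow_mem : γ ^ ℓ ∈ (algebraMap F Ω).fieldRange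
  η_pow_mem : η ^ ℓ ∈ (algebraMap F Ω).fieldRange
  γ_ne_zero : γ ≠ 0
  η_ne_zero : η ≠ 0

/-- The cyclic algebra of a datum. -/
noncomputable abbrev IsCyclicDatum.alg {ψ : AddChar (ZMod ℓ) Ω} {γ η : Ω}
    (H : IsCyclicDatum F ψ γ η) :
    Subalgebra (algebraMap F Ω).fieldRange (Matrix (ZMod ℓ) (ZMod ℓ) Ω) :=
  cycAlg ψ γ η _ H.apply_mem H.γ_pow_mem H.η_pow_mem

lemma IsCyclicDatum.mem_alg_iff {ψ : AddChar (ZMod ℓ) Ω} {γ η : Ω} (H : IsCyclicDatum F ψ γ η)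
    {M : Matrix (ZMod ℓ) (ZMod ℓ) Ω} : M ∈ H.alg ↔ ∃ y : ZMod ℓ → ZMod ℓ → F,
      cycMat ψ γ η (fun i j => algebraMap F Ω (y i j)) = M := by
  rw [mem_cycAlg_iff]
  constructor
  · rintro ⟨w, hw, rfl⟩
    choose y hy using hw
    exact ⟨y, by congr 1; ext i j; exact hy i j⟩
  · rintro ⟨y, rfl⟩
    exact ⟨_, fun i j => ⟨y i j, rfl⟩, rfl⟩

/-- Two cyclic algebras with the same pattern of traces contain the same roots of scalars. -/
theorem HasPattern.exists_pow_eq [CharZero Ω] {ι : Type*} [Fintype ι] {ψ : AddChar (ZMod ℓ) Ω}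
    {γ η γ' η' : Ω} {t : ShortList ι → F} (h : HasPattern ψ γ η t) (h' : HasPattern ψ γ' η' t)
    (H : IsCyclicDatum F ψ γ η) (H' : IsCyclicDatum F ψ γ' η') :
    ∃ y : ZMod ℓ → ZMod ℓ → F, y 0 0 = 0 ∧
      cycMat ψ γ' η' (fun i j => algebraMap F Ω (y i j)) ^ ℓ = γ ^ ℓ • 1 := by
  obtain ⟨α, hα, hspan, ht⟩ := h
  obtain ⟨α', hα', hspan', ht'⟩ := h'
  have hL : ∀ L : List ι, L.length ≤ 3 → (L.map α).prod.trace = (L.map α').prod.trace :=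
    fun L hL => by rw [← ht ⟨L, hL⟩, ← ht' ⟨L, hL⟩]
  have hℓ1 : (1 : ZMod ℓ) ≠ 0 := one_ne_zero
  have hX : cycMat ψ γ η (Pi.single 1 (Pi.single 0 1)) = Matrix.diagonal fun s => γ * ψ s := by
    rw [cycMat_single_zero_right]
    congr 1
    ext s
    rw [one_mul, one_mul, ZMod.val_one, pow_one]
  have hXmem : cycMat ψ γ η (Pi.single 1 (Pi.single 0 1)) ∈ H.alg := by
    refine ⟨_, fun i j => ?_, rfl⟩
    rw [Pi.single_apply]
    split_ifs
    · rw [Pi.single_apply]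
      split_ifs
      · exact one_mem _
      · exact zero_mem _
    · exact zero_mem _
  obtain ⟨x', hx', hx'e, hx'0⟩ := exists_pow_eq_smul_one_of_trace_eq (A := H.alg) (A' := H'.alg)
    (α := α) (α' := α') (c := ⟨γ ^ ℓ, H.γ_pow_mem⟩) (e := ℓ)
    (fun q => H'.mem_alg_iff.2 (hα' q))
    (fun x hx => by
      obtain ⟨y, rfl⟩ := H.mem_alg_iff.1 hx
      obtain ⟨m, hm⟩ := hspan y
      exact ⟨fun q => ⟨algebraMap F Ω (m q), m q, rfl⟩, hm⟩)
    (fun x hx hx0 => by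
      refine eq_zero_of_forall_trace_mul_eq_zero H'.primitive H'.γ_ne_zero H'.η_ne_zero hx
        fun M' hM' => ?_
      obtain ⟨y, rfl⟩ := H'.mem_alg_iff.1 hM'
      obtain ⟨m, hm⟩ := hspan' y
      rw [hm, Finset.mul_sum, Matrix.trace_sum]
      refine Finset.sum_eq_zero fun q _ => ?_
      rw [mul_smul_comm, Matrix.trace_smul, hx0, smul_zero])
    (fun p => by simpa using hL [p] (by simp))
    (fun p q => by simpa using hL [p, q] (by simp))
    (fun p q r => by simpa [mul_assoc] using hL [p, q, r] (by simp))
    hXmem (by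
      rw [hX, Matrix.diagonal_pow]
      ext i j
      by_cases hij : i = j
      · subst hij
        simp [Subfield.smul_def, mul_pow, ψ.pow_prime_eq_one]
      · simp [hij])
    (by
      rw [trace_cycMat _ _ H.primitive, Pi.single_eq_of_ne hℓ1.symm]
      simp)
  obtain ⟨y, rfl⟩ := H'.mem_alg_iff.1 hx'
  refine ⟨y, ?_, hx'e⟩
  rw [trace_cycMat _ _ H'.primitive, mul_eq_zero,
    or_iff_right (Nat.cast_ne_zero.2 hℓ.out.ne_zero)] at hx'0
  simpa using hx'0

lemma cycMat_sum {ι : Type*} [Fintype ι] (ψ : AddChar (ZMod ℓ) Ω) (γ η : Ω) (m : ι → Ω)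
    (z : ι → ZMod ℓ → ZMod ℓ → Ω) :
    cycMat ψ γ η (fun i j => ∑ q, m q * z q i j) = ∑ q, m q • cycMat ψ γ η (z q) := by
  ext s t
  simp only [cycMat_apply, Matrix.sum_apply, Matrix.smul_apply, smul_eq_mul, Finset.sum_mul,
    Finset.mul_sum, mul_assoc]
  exact Finset.sum_comm

lemma Matrix.norm_list_prod_apply_le {n : Type*} [Fintype n] [DecidableEq n] {D : ℝ} (hD : 0 ≤ D)
    (L : List (Matrix n n ℂ)) (hL : ∀ M ∈ L, ∀ s t, ‖M s t‖ ≤ D) (s t : n) :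
    ‖L.prod s t‖ ≤ (Fintype.card n * D) ^ L.length := by
  induction L generalizing s t with
  | nil =>
    rw [List.prod_nil, Matrix.one_apply]
    split_ifs <;> simp
  | cons M L ih =>
    rw [List.prod_cons, Matrix.mul_apply, List.length_cons, pow_succ']
    refine (norm_sum_le _ _).trans ((Finset.sum_le_card_nsmul _ _ (D * (Fintype.card n * D) ^ L.length)
      fun i _ => ?_).trans_eq (by rw [Finset.card_univ, nsmul_eq_mul, mul_assoc]))
    rw [norm_mul]
    exact mul_le_mul (hL M List.mem_cons_self _ _)
      (ih (fun N hN => hL N (List.mem_cons_of_mem _ hN)) _ _) (norm_nonneg _) hD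

lemma exists_ringHom_comp_eq [NumberField F] [CharZero Ω] [Algebra.IsAlgebraic ℚ Ω] (τ : F →+* ℂ) :
    ∃ σ : Ω →+* ℂ, σ.comp (algebraMap F Ω) = τ := by
  have : Algebra.IsAlgebraic F Ω := Algebra.IsAlgebraic.tower_top (K := ℚ) F
  let _ : Algebra F ℂ := τ.toAlgebra
  let σ : Ω →ₐ[F] ℂ := IsAlgClosed.lift
  exact ⟨σ.toRingHom, σ.comp_algebraMap⟩

variable [NumberField F]

lemma IsBoundedDatum.isCyclicDatum {ψ : AddChar (ZMod ℓ) (𝓞 F)} {γ η : Ω} {γ₀ c w : 𝓞 F} {p r : ℕ}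
    {C : ℝ} (hp : p ≠ 0) (H : IsBoundedDatum ψ γ η γ₀ c w p r C) :
    IsCyclicDatum F (extChar Ω ψ) γ η := by
  obtain ⟨h1, h2, -⟩ := H.ne_zero hp
  refine ⟨H.lattice.primitive, fun a => ⟨_, rfl⟩, ⟨_, H.pow_γ.symm⟩, ⟨_, H.pow_η.symm⟩, ?_, ?_⟩
  · rintro rfl
    have := H.pow_γ
    rw [zero_pow hℓ.out.ne_zero, eq_comm, _root_.map_eq_zero] at this
    exact h1 this
  · rintro rfl
    have := H.pow_η
    rw [zero_pow hℓ.out.ne_zero, eq_comm, _root_.map_eq_zero] at this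
    exact h2 this

/-- Only finitely many patterns are needed for all bounded data. -/
theorem exists_finite_hasPattern [CharZero Ω] [Algebra.IsAlgebraic ℚ Ω]
    (ψ : AddChar (ZMod ℓ) (𝓞 F)) {p : ℕ} (hp : p ≠ 0) {C : ℝ} (hC : 1 ≤ C) :
    ∃ S : Set (ShortList (LatIndex ℓ F) → F), S.Finite ∧
      ∀ (γ η : Ω) (γ₀ c w : 𝓞 F) (r : ℕ), IsBoundedDatum ψ γ η γ₀ c w p r C →
        ∃ t ∈ S, HasPattern (extChar Ω ψ) γ η t := by
  obtain ⟨C', h⟩ := exists_bounded_spanning (Ω := Ω) ψ hp hC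
  set D := max 1 C'
  have hD1 : 1 ≤ D := le_max_left _ _
  have hℓ1 : (1 : ℝ) ≤ ℓ := by exact_mod_cast hℓ.out.one_lt.le
  refine ⟨Set.pi Set.univ fun _ => {x | IsIntegral ℤ x ∧ ∀ τ : F →+* ℂ, ‖τ x‖ ≤ ℓ * (ℓ * D) ^ 3},
    Set.Finite.pi fun _ => Embeddings.finite_of_norm_le F ℂ _, fun γ η γ₀ c w r H => ?_⟩
  obtain ⟨x, hadm, hbd, hspan⟩ := h γ η γ₀ c w r H
  have HC := H.isCyclicDatum hp
  obtain ⟨hcw, hpr, hcr⟩ := H.ne_zero hp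
  set α := fun q => latMat (extChar Ω ψ) γ η (algebraMap F Ω c * r)
    fun i j => algebraMap F Ω (x q i j) with hα
  have hαalg : ∀ q, α q ∈ HC.alg := fun q => HC.mem_alg_iff.2 ⟨_, (H.latMat_eq (x q)).symm⟩
  have htr : ∀ L : ShortList (LatIndex ℓ F), ∃ t : F,
      algebraMap F Ω t = ((L.1.map α).prod).trace := by
    intro L
    have h1 : (L.1.map α).prod ∈ HC.alg := by
      refine list_prod_mem fun M hM => ?_
      obtain ⟨q, -, rfl⟩ := List.mem_map.1 hM
      exact hαalg q
    obtain ⟨y, hy⟩ := HC.mem_alg_iff.1 h1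
    refine ⟨ℓ * y 0 0, ?_⟩
    rw [← hy, trace_cycMat _ _ HC.primitive, map_mul, map_natCast]
  choose t ht using htr
  refine ⟨t, fun L _ => ⟨?_, fun τ => ?_⟩, α, fun q => HC.mem_alg_iff.1 (hαalg q), fun y => ?_, ht⟩
  · have h1 := (H.lattice.isIntegral_trace_prod
      (L.1.map fun q i j => algebraMap F Ω (x q i j)) (by
        intro z hz
        obtain ⟨q, -, rfl⟩ := List.mem_map.1 hz
        exact hadm q)).1
    rw [List.map_map] at h1
    have h2 : IsIntegral ℤ (algebraMap F Ω (t L)) := by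
      rw [ht]
      exact h1
    exact (isIntegral_algebraMap_iff (algebraMap F Ω).injective).1 h2
  · obtain ⟨σ, rfl⟩ := exists_ringHom_comp_eq (Ω := Ω) τ
    have h0 (M : Matrix (ZMod ℓ) (ZMod ℓ) Ω) : σ M.trace = (M.map σ).trace := by
      simp [Matrix.trace]
    rw [RingHom.comp_apply, ht, h0]
    have h1 : ((L.1.map α).prod).map σ = (L.1.map fun q => σ.mapMatrix (α q)).prod := by
      have := map_list_prod σ.mapMatrix (L.1.map α)
      rw [List.map_map] at this
      exact this
    have h2 := Matrix.norm_list_prod_apply_le (D := D) (by positivity)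
      (L.1.map fun q => σ.mapMatrix (α q)) (by
        intro M hM
        obtain ⟨q, -, rfl⟩ := List.mem_map.1 hM
        exact fun s t => (hbd σ q s t).trans (le_max_right _ _))
    rw [List.length_map, ZMod.card] at h2
    have h3 : (ℓ * D) ^ L.1.length ≤ (ℓ * D) ^ 3 :=
      pow_le_pow_right₀ (one_le_mul_of_one_le_of_one_le hℓ1 hD1) L.2
    have h4 : ‖(((L.1.map α).prod).map σ).trace‖ ≤ ℓ * (ℓ * D) ^ 3 := by
      rw [h1, Matrix.trace]
      refine (norm_sum_le _ _).trans ((Finset.sum_le_card_nsmul _ _ _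
        fun i _ => (h2 i i).trans h3).trans_eq ?_)
      rw [Finset.card_univ, ZMod.card, nsmul_eq_mul]
    exact h4
  · obtain ⟨m, hm⟩ := hspan fun i j => y i j * ((if i = 0 then (c : F) * w else 1) *
      (if j = 0 then (p : F) * r else 1) * ((c : F) * r)⁻¹)⁻¹
    refine ⟨m, ?_⟩
    simp only [hα, H.latMat_eq]
    rw [← cycMat_sum]
    congr 1
    ext i j
    have h1 : (if i = 0 then (c : F) * w else 1) * (if j = 0 then (p : F) * r else 1) *
        ((c : F) * r)⁻¹ ≠ 0 := by
      refine mul_ne_zero (mul_ne_zero ?_ ?_) (inv_ne_zero hcr) <;> split_ifs <;>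
        simp_all
    have h2 := congrArg (· * ((if i = 0 then (c : F) * w else 1) *
      (if j = 0 then (p : F) * r else 1) * ((c : F) * r)⁻¹)) (hm i j)
    simp only [mul_assoc _ _ ((if i = 0 then (c : F) * w else 1) *
      (if j = 0 then (p : F) * r else 1) * ((c : F) * r)⁻¹), inv_mul_cancel₀ h1, mul_one] at h2
    rw [h2, Finset.sum_mul, map_sum]
    refine Finset.sum_congr rfl fun q _ => ?_
    refine Eq.trans (congrArg _ ?_) (map_mul (algebraMap F Ω) _ _)
    simp only [latCoord]
    ring

end pattern

end

section

open NumberField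

section transfer

variable {ℓ : ℕ} [hℓ : Fact ℓ.Prime] {F k Ω : Type*} [Field F] [Field k] [Field Ω] [CharZero F]
  [CharZero Ω] [Algebra F Ω] [Algebra k Ω]

lemma exists_eq_sum_mul_pow_val [CharZero k] [IsCyclotomicExtension {ℓ} ℚ F] {ζ : F}
    (hζ : IsPrimitiveRoot ζ ℓ) (y : F) : ∃ a : ZMod ℓ → k,
      algebraMap F Ω y = ∑ s, algebraMap k Ω (a s) * algebraMap F Ω ζ ^ s.val := by
  obtain ⟨f, hf⟩ := (hζ.powerBasis ℚ).exists_eq_aeval' y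
  rw [hζ.powerBasis_gen ℚ, Polynomial.aeval_eq_sum_range] at hf
  classical
  refine ⟨fun s => ∑ n ∈ (Finset.range (f.natDegree + 1)).filter fun n : ℕ => (n : ZMod ℓ) = s,
    ((f.coeff n : ℚ) : k), ?_⟩
  rw [hf, map_sum, ← Finset.sum_fiberwise (Finset.range (f.natDegree + 1))
    fun n : ℕ => (n : ZMod ℓ)]
  refine Finset.sum_congr rfl fun s _ => ?_
  rw [map_sum, Finset.sum_mul]
  refine Finset.sum_congr rfl fun n hn => ?_
  obtain rfl := (Finset.mem_filter.1 hn).2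
  rw [map_ratCast, ZMod.val_natCast, ← map_pow,
    ← pow_eq_pow_mod n hζ.pow_eq_one, Algebra.smul_def, map_mul]
  simp

/-- Data with the same pattern produce elements of the same diophantine set. -/
theorem HasPattern.mem_cycSet [CharZero k] [IsCyclotomicExtension {ℓ} ℚ F] {ζ : F}
    (hζ : IsPrimitiveRoot ζ ℓ) {ι : Type*} [Fintype ι] {ψ : AddChar (ZMod ℓ) Ω}
    {γ η γ' η' μ u : Ω} {t : ShortList ι → F} (h : HasPattern ψ γ η t) (h' : HasPattern ψ γ' η' t)
    (H : IsCyclicDatum F ψ γ η) (H' : IsCyclicDatum F ψ γ' η') {x : k}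
    (hx : γ ^ ℓ = (μ + algebraMap k Ω x ^ ℓ) * u) :
    x ∈ cycSet k (algebraMap F Ω ζ) ψ γ' η' μ u := by
  obtain ⟨y, hy0, hy⟩ := h.exists_pow_eq h' H H'
  choose a ha using fun i j => exists_eq_sum_mul_pow_val (k := k) (Ω := Ω) hζ (y i j)
  have h1 : cycCoord (algebraMap F Ω ζ) (fun q : ZMod ℓ × ZMod ℓ × ZMod ℓ => a q.1 q.2.1 q.2.2) =
      fun i j => algebraMap F Ω (y i j) := by
    ext i j
    rw [ha]
    rfl
  refine ⟨fun q => a q.1 q.2.1 q.2.2, ?_, ?_⟩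
  · rw [h1]
    simp only [hy0, map_zero]
  · rw [h1, hy, hx]

end transfer

end

section gaussPow

variable {R : Type*} [CommRing R] {s : ℕ} [Fact s.Prime]

/-- The power of the Gauss sum of a character of prime modulus to the order of the character,
written in terms of Jacobi sums. -/
noncomputable def gaussPow (χ : MulChar (ZMod s) R) : R :=
  χ (-1) * s * ∏ i ∈ Finset.Ico 1 (orderOf χ - 1), jacobiSum χ (χ ^ i)

lemma gaussPow_eq [IsDomain R] {χ : MulChar (ZMod s) R} (hχ : 2 ≤ orderOf χ)
    {ψ : AddChar (ZMod s) R} (hψ : ψ.IsPrimitive) : gaussSum χ ψ ^ orderOf χ = gaussPow χ := by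
  rw [gaussSum_pow_eq_prod_jacobiSum hχ hψ, ZMod.card, gaussPow]

lemma map_gaussPow {S : Type*} [CommRing S] {χ : MulChar (ZMod s) R} (φ : R →+* S)
    (h : orderOf (χ.ringHomComp φ) = orderOf χ) : φ (gaussPow χ) = gaussPow (χ.ringHomComp φ) := by
  simp only [gaussPow, map_mul, map_prod, map_natCast, h, MulChar.ringHomComp_apply]
  simp only [MulChar.ringHomComp_pow, jacobiSum_ringHomComp]

lemma exists_isPrimitive_addChar (Ω : Type*) [Field Ω] [IsAlgClosed Ω] (hs : (s : Ω) ≠ 0) :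
    ∃ ψ : AddChar (ZMod s) Ω, ψ.IsPrimitive := by
  have : NeZero (s : Ω) := ⟨hs⟩
  obtain ⟨ζ, hζ⟩ := HasEnoughRootsOfUnity.exists_primitiveRoot Ω s
  exact ⟨AddChar.zmodChar s hζ.pow_eq_one, AddChar.zmodChar_primitive_of_primitive_root s hζ⟩

variable {ℓ : ℕ} [hℓ : Fact ℓ.Prime] {χ : MulChar (ZMod s) R}

lemma MulChar.pow_eq_one_of_isUnit (hχ : orderOf χ = ℓ) {a : ZMod s} (ha : IsUnit a) :
    χ a ^ ℓ = 1 := by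
  rw [← MulChar.pow_apply' χ hℓ.out.ne_zero, ← hχ, pow_orderOf_eq_one, MulChar.one_apply ha]

omit hℓ in
lemma map_ne_one_of_pow_eq_one [IsDomain R] {S : Type*} [CommRing S] (φ : R →+* S)
    (h : (ℓ : S) ≠ 0) {x : R} (hx : x ^ ℓ = 1) (hx1 : x ≠ 1) : φ x ≠ 1 := by
  intro h1
  have h2 : ∑ i ∈ Finset.range ℓ, x ^ i = 0 := by
    have h3 := mul_geom_sum x ℓ
    rw [hx, sub_self, mul_eq_zero, or_iff_right (sub_ne_zero.2 hx1)] at h3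
    exact h3
  have h3 := congrArg φ h2
  rw [map_sum, map_zero] at h3
  simp only [map_pow, h1, one_pow, Finset.sum_const, Finset.card_range, nsmul_eq_mul, mul_one] at h3
  exact h h3

lemma orderOf_ringHomComp [IsDomain R] {S : Type*} [CommRing S] (φ : R →+* S)
    (h : (ℓ : S) ≠ 0) (hχ : orderOf χ = ℓ) : orderOf (χ.ringHomComp φ) = ℓ := by
  refine orderOf_eq_prime ?_ ?_
  · rw [MulChar.ringHomComp_pow, ← hχ, pow_orderOf_eq_one, MulChar.ringHomComp_one]
  · intro h1
    obtain ⟨a, ha⟩ : ∃ a : (ZMod s)ˣ, χ a ≠ 1 := by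
      by_contra! h2
      have : χ = 1 := MulChar.eq_one_iff.2 h2
      rw [this, orderOf_one] at hχ
      exact hℓ.out.one_lt.ne hχ
    refine map_ne_one_of_pow_eq_one φ h (MulChar.pow_eq_one_of_isUnit hχ a.isUnit) ha ?_
    have h3 := congrArg (fun f : MulChar (ZMod s) S => f a) h1
    simpa using h3

lemma map_gaussPow_pow_mul [IsDomain R] {κ : Type*} [Field κ] [Fintype κ] (φ : R →+* κ)
    (hs : (s : κ) ≠ 0) (hl : (ℓ : κ) ≠ 0) (hd : ℓ ∣ Fintype.card κ - 1) (hχ : orderOf χ = ℓ) :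
    φ (gaussPow χ) ^ ((Fintype.card κ - 1) / ℓ) * φ (χ (Fintype.card κ)) = 1 := by
  let Ω := AlgebraicClosure κ
  have hinj := (algebraMap κ Ω).injective
  have hs' : (s : Ω) ≠ 0 := by
    rw [← map_natCast (algebraMap κ Ω)]
    exact (map_ne_zero_iff _ hinj).2 hs
  have hl' : (ℓ : Ω) ≠ 0 := by
    rw [← map_natCast (algebraMap κ Ω)]
    exact (map_ne_zero_iff _ hinj).2 hl
  set q := Fintype.card κ with hq
  set θ := (algebraMap κ Ω).comp φ with hθ
  set χ' := χ.ringHomComp θ with hχ'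
  have hord : orderOf χ' = ℓ := orderOf_ringHomComp θ hl' hχ
  have h1 : χ' ≠ 1 := by
    intro h
    rw [h, orderOf_one] at hord
    exact hℓ.out.one_lt.ne hord
  obtain ⟨ψ, hψ⟩ := exists_isPrimitive_addChar (s := s) Ω hs'
  have hg : gaussSum χ' ψ ≠ 0 := by
    intro h
    have := gaussSum_mul_gaussSum_eq_card h1 hψ
    rw [h, zero_mul, ZMod.card] at this
    exact hs' this.symm
  have hgp : gaussSum χ' ψ ^ ℓ = θ (gaussPow χ) := by
    rw [map_gaussPow θ (hord.trans hχ.symm), ← gaussPow_eq (hord.symm ▸ hℓ.out.two_le) hψ, hord]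
  obtain ⟨p, hp⟩ := CharP.exists κ
  have hpp : Fact p.Prime := ⟨CharP.char_is_prime κ p⟩
  obtain ⟨f, -, hf⟩ := FiniteField.card κ p
  have hcp : CharP Ω p := charP_of_injective_algebraMap hinj p
  have hunit : IsUnit (q : ZMod s) := by
    rw [isUnit_iff_ne_zero, Ne, hq, hf, Nat.cast_pow, pow_eq_zero_iff f.ne_zero,
      ZMod.natCast_eq_zero_iff]
    intro h
    rcases (Nat.dvd_prime hpp.out).1 h with h | h
    · exact (Fact.out : s.Prime).one_lt.ne' h
    · exact hs (h ▸ CharP.cast_eq_zero κ p)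
  have hfrob : gaussSum χ' ψ ^ q = gaussSum χ' (ψ.mulShift (q : ZMod s)) := by
    rw [gaussSum, hq, hf, sum_pow_char_pow, ← hf, ← hq, gaussSum]
    refine Finset.sum_congr rfl fun a _ => ?_
    rw [mul_pow, ← AddChar.pow_mulShift, AddChar.pow_apply]
    congr 1
    rw [hχ', MulChar.ringHomComp_apply, hθ, RingHom.comp_apply, ← map_pow, hq,
      FiniteField.pow_card]
  have hmul := gaussSum_mulShift χ' ψ hunit.unit
  rw [IsUnit.unit_spec, ← hfrob] at hmul
  have hq1 : q = ℓ * ((q - 1) / ℓ) + 1 := by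
    rw [Nat.mul_div_cancel' hd]
    have : 0 < q := Fintype.card_pos
    omega
  have h2 : θ (gaussPow χ) ^ ((q - 1) / ℓ) * θ (χ q) = 1 := by
    refine mul_right_cancel₀ hg ?_
    rw [one_mul, ← hgp, ← pow_mul]
    have h3 : gaussSum χ' ψ ^ q = gaussSum χ' ψ ^ (ℓ * ((q - 1) / ℓ)) * gaussSum χ' ψ := by
      rw [← pow_succ, ← hq1]
    rw [h3, show χ' (q : ZMod s) = θ (χ q) from rfl] at hmul
    linear_combination hmul
  apply hinj
  rw [map_mul, map_pow, map_one]
  exact h2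

lemma gaussPow_dvd [IsDomain R] [CharZero R] (hχ : orderOf χ = ℓ) : gaussPow χ ∣ (s : R) ^ ℓ := by
  let Ω := AlgebraicClosure (FractionRing R)
  have hinj : Function.Injective (algebraMap R Ω) := by
    rw [IsScalarTower.algebraMap_eq R (FractionRing R) Ω, RingHom.coe_comp]
    exact (algebraMap (FractionRing R) Ω).injective.comp (IsFractionRing.injective R _)
  have : CharZero Ω := charZero_of_injective_algebraMap hinj
  have hs' : (s : Ω) ≠ 0 := Nat.cast_ne_zero.2 (Fact.out : s.Prime).ne_zero
  have hl' : (ℓ : Ω) ≠ 0 := Nat.cast_ne_zero.2 hℓ.out.ne_zero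
  set θ := algebraMap R Ω with hθ
  have hord := orderOf_ringHomComp θ hl' hχ
  have hχi : orderOf χ⁻¹ = ℓ := by rw [orderOf_inv, hχ]
  have hordi := orderOf_ringHomComp θ hl' hχi
  have h1 : χ.ringHomComp θ ≠ 1 := by
    intro h
    rw [h, orderOf_one] at hord
    exact hℓ.out.one_lt.ne hord
  obtain ⟨ψ, hψ⟩ := exists_isPrimitive_addChar (s := s) Ω hs'
  refine ⟨gaussPow χ⁻¹, hinj ?_⟩
  have hψi : ψ⁻¹.IsPrimitive := by
    intro a ha h
    rw [AddChar.inv_mulShift, AddChar.mulShift_mulShift, neg_one_mul] at h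
    exact hψ (neg_ne_zero.2 ha) h
  rw [map_mul, map_gaussPow θ (hord.trans hχ.symm), map_gaussPow θ (hordi.trans hχi.symm),
    ← gaussPow_eq (hord.symm ▸ hℓ.out.two_le) hψ, ← gaussPow_eq (hordi.symm ▸ hℓ.out.two_le) hψi,
    hord, hordi, ← mul_pow, ← MulChar.ringHomComp_inv, gaussSum_mul_gaussSum_eq_card h1 hψ, ZMod.card,
    map_pow, map_natCast]

end gaussPow

section control

variable {ℓ : ℕ} [hℓ : Fact ℓ.Prime]

lemma Nat.Prime.dvd_pow_sub_one_of_ne {r : ℕ} (hr : r.Prime) (h : r ≠ ℓ) :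
    ℓ ∣ r ^ (ℓ - 1) - 1 := by
  have h1 : (r : ZMod ℓ) ≠ 0 := by
    rw [Ne, ZMod.natCast_eq_zero_iff, Nat.prime_dvd_prime_iff_eq hℓ.out hr]
    exact h.symm
  rw [← ZMod.natCast_eq_zero_iff, Nat.cast_sub (Nat.one_le_pow _ _ hr.pos), Nat.cast_pow,
    ZMod.pow_card_sub_one_eq_one h1, Nat.cast_one, sub_self]

omit hℓ in
lemma natCast_ne_zero_of_card {κ : Type*} [Field κ] [Fintype κ] {r m : ℕ} (hr : r.Prime)
    (h : Fintype.card κ = r ^ m) {s : ℕ} (hs : ¬ r ∣ s) : (s : κ) ≠ 0 := by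
  have h1 : (r : κ) = 0 := by
    have h2 := FiniteField.cast_card_eq_zero κ
    rw [h, Nat.cast_pow] at h2
    exact eq_zero_of_pow_eq_zero h2
  intro h0
  obtain ⟨a, b, h3⟩ := Nat.isCoprime_iff_coprime.2 (hr.coprime_iff_not_dvd.2 hs)
  have h4 := congrArg (Int.cast : ℤ → κ) h3
  simp [h1, h0] at h4

lemma exists_mulChar_apply_ne_one {R : Type*} [CommRing R] [IsDomain R] {ζ : R}
    (hζ : IsPrimitiveRoot ζ ℓ) {s : ℕ} [Fact s.Prime] (hs : s ≡ 1 [MOD ℓ]) :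
    ∃ χ : MulChar (ZMod s) R, orderOf χ = ℓ ∧ ∃ g : ℕ, g.Coprime s ∧ χ g ≠ 1 := by
  have h1 : ℓ ∣ Fintype.card (ZMod s) - 1 := by
    rw [ZMod.card]
    exact (Nat.modEq_iff_dvd' (Fact.out : s.Prime).one_lt.le).1 hs.symm
  obtain ⟨χ, hχ⟩ := MulChar.exists_mulChar_orderOf (ZMod s) h1 hζ
  refine ⟨χ, hχ, ?_⟩
  by_contra! h2
  have : χ = 1 := by
    refine MulChar.eq_one_iff.2 fun a => ?_
    have h3 := h2 (a : ZMod s).val (ZMod.val_coe_unit_coprime a)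
    rwa [ZMod.natCast_zmod_val] at h3
  rw [this, orderOf_one] at hχ
  exact hℓ.out.one_lt.ne hχ

/-- There is an element supported at a given set of primes which is an `ℓ`-th power in a given
residue field, but not in the residue fields of inert primes in a certain residue class. -/
theorem exists_isPowResidue_of_modEq {R : Type*} [CommRing R] [IsDomain R] [CharZero R] {ζ : R}
    (hζ : IsPrimitiveRoot ζ ℓ) {p : ℕ} (hp : p.Prime) (hpl : p ≠ ℓ) {κ₀ : Type*} [Field κ₀]
    [Fintype κ₀] {m : ℕ} (hcard : Fintype.card κ₀ = p ^ m) (hd : ℓ ∣ Fintype.card κ₀ - 1)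
    (φ₀ : R →+* κ₀) :
    ∃ (u : R) (s g : ℕ), s.Coprime p ∧ s.Coprime ℓ ∧ g.Coprime s ∧ (∃ M, u ∣ (s : R) ^ M) ∧
      φ₀ u ^ ((Fintype.card κ₀ - 1) / ℓ) = 1 ∧
      ∀ r : ℕ, r.Prime → r ≠ ℓ → r ≡ g [MOD s] → ∀ (κ : Type*) [Field κ] [Fintype κ] (φ : R →+* κ),
        Fintype.card κ = r ^ (ℓ - 1) → φ u ^ ((Fintype.card κ - 1) / ℓ) ≠ 1 := by
  obtain ⟨s₀, hs₀, hs₀p, hs₀1⟩ := Nat.exists_prime_gt_modEq_one (p + ℓ) hℓ.out.ne_zero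
  obtain ⟨s₁, hs₁, hs₁p, hs₁1⟩ := Nat.exists_prime_gt_modEq_one s₀ hℓ.out.ne_zero
  have := Fact.mk hs₀
  have := Fact.mk hs₁
  obtain ⟨χ₀, hχ₀, g₀, hg₀, hχg₀⟩ := exists_mulChar_apply_ne_one hζ hs₀1
  obtain ⟨χ₁, hχ₁, g₁, hg₁, hχg₁⟩ := exists_mulChar_apply_ne_one hζ hs₁1
  have hcop : s₀.Coprime s₁ := (Nat.coprime_primes hs₀ hs₁).2 hs₁p.ne
  set q := Fintype.card κ₀ with hq
  have hunit : ∀ {s r n : ℕ}, s.Prime → r.Prime → s ≠ r → IsUnit ((r ^ n : ℕ) : ZMod s) := by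
    intro s r n hs hr hne
    rw [ZMod.isUnit_iff_coprime]
    exact Nat.Coprime.pow_left _ ((Nat.coprime_primes hr hs).2 hne.symm)
  have hq₀ : IsUnit (q : ZMod s₀) := hcard ▸ hunit hs₀ hp (by omega)
  have hq₁ : IsUnit (q : ZMod s₁) := hcard ▸ hunit hs₁ hp (by omega)
  obtain ⟨a, b, hab, g, hgs₀, hgs₁, hg⟩ : ∃ a b : ℕ, χ₀ q ^ a * χ₁ q ^ b = 1 ∧ ∃ g : ℕ,
      g.Coprime s₀ ∧ g.Coprime s₁ ∧ χ₀ g ^ a * χ₁ g ^ b ≠ 1 := by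
    by_cases h : χ₀ q = 1
    · obtain ⟨g, h0, h1⟩ := Nat.chineseRemainder hcop g₀ 1
      refine ⟨1, 0, by simp [h], g, ?_, ?_, ?_⟩
      · rw [Nat.Coprime, h0.gcd_eq]; exact hg₀
      · rw [Nat.Coprime, h1.gcd_eq]; exact Nat.gcd_one_left _
      · rwa [pow_one, pow_zero, mul_one, (ZMod.natCast_eq_natCast_iff _ _ _).2 h0]
    · obtain ⟨g, h0, h1⟩ := Nat.chineseRemainder hcop 1 g₁
      have hprim : IsPrimitiveRoot (χ₀ q) ℓ :=
        IsPrimitiveRoot.iff_orderOf.2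
          (orderOf_eq_prime (MulChar.pow_eq_one_of_isUnit hχ₀ hq₀) h)
      obtain ⟨a, -, ha⟩ := hprim.eq_pow_of_pow_eq_one (ξ := χ₁ q ^ (ℓ - 1)) (by
        rw [← pow_mul, mul_comm, pow_mul, MulChar.pow_eq_one_of_isUnit hχ₁ hq₁, one_pow])
      refine ⟨a, 1, ?_, g, ?_, ?_, ?_⟩
      · rw [ha, ← pow_add, Nat.sub_add_cancel hℓ.out.one_lt.le,
          MulChar.pow_eq_one_of_isUnit hχ₁ hq₁]
      · rw [Nat.Coprime, h0.gcd_eq]; exact Nat.gcd_one_left _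
      · rw [Nat.Coprime, h1.gcd_eq]; exact hg₁
      · rwa [(ZMod.natCast_eq_natCast_iff _ _ _).2 h0, Nat.cast_one, map_one, one_pow, one_mul,
          pow_one, (ZMod.natCast_eq_natCast_iff _ _ _).2 h1]
  have hnd : ∀ {r s : ℕ}, r.Prime → s.Prime → s ≠ r → ¬ r ∣ s := fun hr hs h h' =>
    h ((Nat.prime_dvd_prime_iff_eq hr hs).1 h').symm
  have hcopl : ∀ {s : ℕ}, s.Prime → p + ℓ < s → s.Coprime p ∧ s.Coprime ℓ := fun hs h =>
    ⟨(Nat.coprime_primes hs hp).2 (by omega), (Nat.coprime_primes hs hℓ.out).2 (by omega)⟩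
  refine ⟨gaussPow χ₀ ^ a * gaussPow χ₁ ^ b, s₀ * s₁, g,
    (hcopl hs₀ hs₀p).1.mul_left (hcopl hs₁ (hs₀p.trans hs₁p)).1,
    (hcopl hs₀ hs₀p).2.mul_left (hcopl hs₁ (hs₀p.trans hs₁p)).2,
    hgs₀.mul_right hgs₁, ⟨ℓ * a + ℓ * b, ?_⟩, ?_, ?_⟩
  · rw [pow_add, pow_mul, pow_mul]
    refine mul_dvd_mul (pow_dvd_pow_of_dvd ((gaussPow_dvd hχ₀).trans ?_) _)
      (pow_dvd_pow_of_dvd ((gaussPow_dvd hχ₁).trans ?_) _) <;>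
    refine pow_dvd_pow_of_dvd ?_ _ <;> simp
  · have hl0 : (ℓ : κ₀) ≠ 0 := natCast_ne_zero_of_card hp hcard (hnd hp hℓ.out hpl.symm)
    have h0 := map_gaussPow_pow_mul φ₀
      (natCast_ne_zero_of_card hp hcard (hnd hp hs₀ (by omega))) hl0 hd hχ₀
    have h1 := map_gaussPow_pow_mul φ₀
      (natCast_ne_zero_of_card hp hcard (hnd hp hs₁ (by omega))) hl0 hd hχ₁
    rw [← hq] at h0 h1
    have h2 := congrArg φ₀ hab
    rw [map_mul, map_pow, map_pow, map_one] at h2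
    calc _ = (φ₀ (gaussPow χ₀) ^ ((q - 1) / ℓ)) ^ a * (φ₀ (gaussPow χ₁) ^ ((q - 1) / ℓ)) ^ b *
          (φ₀ (χ₀ q) ^ a * φ₀ (χ₁ q) ^ b) := by
            rw [h2, map_mul, map_pow, map_pow]
            ring
      _ = (φ₀ (gaussPow χ₀) ^ ((q - 1) / ℓ) * φ₀ (χ₀ q)) ^ a *
          (φ₀ (gaussPow χ₁) ^ ((q - 1) / ℓ) * φ₀ (χ₁ q)) ^ b := by ring
      _ = 1 := by rw [h0, h1, one_pow, one_pow, one_mul]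
  · intro r hr hrl hrg κ _ _ φ hκ
    have hrs : ¬ r ∣ s₀ * s₁ := by
      intro h
      have h1 : (g.gcd (s₀ * s₁)) = 1 := hgs₀.mul_right hgs₁
      rw [← hrg.gcd_eq, Nat.gcd_eq_left h] at h1
      exact hr.one_lt.ne' h1
    have hrs₀ : ¬ r ∣ s₀ := fun h => hrs (h.mul_right _)
    have hrs₁ : ¬ r ∣ s₁ := fun h => hrs (h.mul_left _)
    have hl0 : (ℓ : κ) ≠ 0 := natCast_ne_zero_of_card hr hκ (hnd hr hℓ.out hrl.symm)
    have hdr : ℓ ∣ Fintype.card κ - 1 := hκ ▸ hr.dvd_pow_sub_one_of_ne hrl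
    have key : ∀ {s : ℕ} [Fact s.Prime] {χ : MulChar (ZMod s) R}, orderOf χ = ℓ → ¬ r ∣ s →
        IsUnit (r : ZMod s) ∧ φ (gaussPow χ) ^ ((Fintype.card κ - 1) / ℓ) = φ (χ r) := by
      intro s hs χ hχ hrs
      have h1 : IsUnit (r : ZMod s) := by
        rw [ZMod.isUnit_iff_coprime]
        exact (Nat.Prime.coprime_iff_not_dvd hr).2 hrs
      refine ⟨h1, ?_⟩
      have h2 := map_gaussPow_pow_mul φ (natCast_ne_zero_of_card hr hκ hrs) hl0 hdr hχ
      have h3 : χ (Fintype.card κ) * χ r = 1 := by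
        rw [hκ, Nat.cast_pow, map_pow, ← pow_succ, Nat.sub_add_cancel hℓ.out.one_lt.le,
          MulChar.pow_eq_one_of_isUnit hχ h1]
      have h4 := congrArg φ h3
      rw [map_mul, map_one] at h4
      rw [← mul_one (φ (gaussPow χ) ^ _), ← h4, ← mul_assoc, h2, one_mul]
    obtain ⟨hu₀, hk₀⟩ := key hχ₀ hrs₀
    obtain ⟨hu₁, hk₁⟩ := key hχ₁ hrs₁
    have h1 : φ (gaussPow χ₀ ^ a * gaussPow χ₁ ^ b) ^ ((Fintype.card κ - 1) / ℓ) =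
        φ (χ₀ r ^ a * χ₁ r ^ b) := by
      rw [map_mul, map_pow, map_pow, map_mul, map_pow, map_pow, ← hk₀, ← hk₁]
      ring
    rw [h1]
    refine map_ne_one_of_pow_eq_one φ hl0 ?_ ?_
    · rw [mul_pow, ← pow_mul, ← pow_mul, mul_comm a, mul_comm b, pow_mul, pow_mul,
        MulChar.pow_eq_one_of_isUnit hχ₀ hu₀, MulChar.pow_eq_one_of_isUnit hχ₁ hu₁, one_pow,
        one_pow, one_mul]
    · rw [(ZMod.natCast_eq_natCast_iff _ _ _).2 (hrg.of_dvd (dvd_mul_right _ _)),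
        (ZMod.natCast_eq_natCast_iff _ _ _).2 (hrg.of_dvd (dvd_mul_left _ _))]
      exact hg

end control

section

open NumberField

section residueField

variable {ℓ : ℕ} [hℓ : Fact ℓ.Prime]

lemma dvd_card_sub_one_of_isPrimitiveRoot {R κ : Type*} [CommRing R] [IsDomain R] [Field κ]
    [Fintype κ] (φ : R →+* κ) (hl : (ℓ : κ) ≠ 0) {ζ : R} (hζ : IsPrimitiveRoot ζ ℓ) :
    ℓ ∣ Fintype.card κ - 1 := by
  have h1 : φ ζ ≠ 1 := map_ne_one_of_pow_eq_one φ hl hζ.pow_eq_one (hζ.ne_one hℓ.out.one_lt)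
  have h2 : φ ζ ^ ℓ = 1 := by rw [← map_pow, hζ.pow_eq_one, map_one]
  rw [← orderOf_eq_prime h2 h1]
  refine orderOf_dvd_of_pow_eq_one (FiniteField.pow_card_sub_one_eq_one _ ?_)
  intro h0
  rw [h0, zero_pow hℓ.out.ne_zero] at h2
  exact zero_ne_one h2

lemma FiniteField.exists_generator_units (κ : Type*) [Field κ] [Fintype κ] :
    ∃ g : κ, g ≠ 0 ∧ (∀ x : κ, x ≠ 0 → ∃ n : ℕ, g ^ n = x) ∧
      ∀ n, g ^ n = 1 → Fintype.card κ - 1 ∣ n := by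
  classical
  obtain ⟨g, hg⟩ := IsCyclic.exists_generator (α := κˣ)
  refine ⟨g, g.ne_zero, fun x hx => ?_, fun n hn => ?_⟩
  · obtain ⟨n, hn⟩ := (mem_powers_iff_mem_zpowers.2 (hg (Units.mk0 x hx)))
    exact ⟨n, by simpa using congrArg Units.val hn⟩
  · rw [← Fintype.card_units, ← Nat.card_eq_fintype_card, ← orderOf_eq_card_of_forall_mem_zpowers hg]
    exact orderOf_dvd_of_pow_eq_one (Units.ext (by simpa using hn))

lemma FiniteField.exists_eq_pow_of_pow_eq_one {κ : Type*} [Field κ] [Fintype κ]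
    (hd : ℓ ∣ Fintype.card κ - 1) {x : κ} (hx0 : x ≠ 0)
    (hx : x ^ ((Fintype.card κ - 1) / ℓ) = 1) : ∃ z, x = z ^ ℓ := by
  obtain ⟨g, hg0, hg, hg1⟩ := FiniteField.exists_generator_units κ
  obtain ⟨n, rfl⟩ := hg x hx0
  obtain ⟨e, he⟩ := hd
  have he0 : 0 < e := by
    rcases Nat.eq_zero_or_pos e with h | h
    · have := Fintype.one_lt_card (α := κ)
      rw [h, mul_zero] at he
      omega
    · exact h
  rw [he, Nat.mul_div_cancel_left _ hℓ.out.pos, ← pow_mul] at hx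
  have h1 := hg1 _ hx
  rw [he] at h1
  obtain ⟨m, rfl⟩ := Nat.dvd_of_mul_dvd_mul_right he0 h1
  exact ⟨g ^ m, by rw [← pow_mul, mul_comm]⟩

lemma FiniteField.exists_mul_pow_eq_pow {κ : Type*} [Field κ] [Fintype κ]
    (hd : ℓ ∣ Fintype.card κ - 1) {x y : κ} (hx : x ≠ 0) (hy0 : y ≠ 0)
    (hy : y ^ ((Fintype.card κ - 1) / ℓ) ≠ 1) : ∃ i < ℓ, ∃ z, x * y ^ i = z ^ ℓ := by
  set e := (Fintype.card κ - 1) / ℓ with he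
  have hpow : ∀ w : κ, w ≠ 0 → (w ^ e) ^ ℓ = 1 := fun w hw => by
    rw [← pow_mul, Nat.div_mul_cancel hd, FiniteField.pow_card_sub_one_eq_one w hw]
  have hprim : IsPrimitiveRoot (y ^ e) ℓ :=
    IsPrimitiveRoot.iff_orderOf.2 (orderOf_eq_prime (hpow y hy0) hy)
  obtain ⟨i, hi, hxi⟩ := hprim.eq_pow_of_pow_eq_one (ξ := (x ^ e)⁻¹) (by
    rw [inv_pow, hpow x hx, inv_one])
  refine ⟨i, hi, exists_eq_pow_of_pow_eq_one hd (mul_ne_zero hx (pow_ne_zero _ hy0)) ?_⟩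
  rw [mul_pow, ← pow_mul, mul_comm i, pow_mul, hxi, mul_inv_cancel₀ (pow_ne_zero _ hx)]

lemma FiniteField.exists_forall_pow_ne {κ : Type*} [Field κ] [Fintype κ]
    (hd : ℓ ∣ Fintype.card κ - 1) : ∃ μ : κ, μ ≠ 0 ∧ ∀ a b : κ, b ≠ 0 → a ^ ℓ ≠ μ * b ^ ℓ := by
  obtain ⟨g, hg0, hg, hg1⟩ := FiniteField.exists_generator_units κ
  refine ⟨g, hg0, fun a b hb h => ?_⟩
  have h1 : (a / b) ^ ℓ = g := by rw [div_pow, h, mul_div_cancel_right₀ _ (pow_ne_zero _ hb)]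
  have h2 : a / b ≠ 0 := by
    intro h0
    rw [h0, zero_pow hℓ.out.ne_zero] at h1
    exact hg0 h1.symm
  have h3 := Fintype.one_lt_card (α := κ)
  have h4 : g ^ ((Fintype.card κ - 1) / ℓ) = 1 := by
    rw [← h1, ← pow_mul, Nat.mul_div_cancel' hd, FiniteField.pow_card_sub_one_eq_one _ h2]
  have h5 := Nat.le_of_dvd (Nat.div_pos (Nat.le_of_dvd (by omega) hd) hℓ.out.pos) (hg1 _ h4)
  exact absurd h5 (not_le.2 (Nat.div_lt_self (by omega) hℓ.out.one_lt))

variable {F : Type*} [Field F] [NumberField F]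

lemma natCard_quotient_maximal {P : Ideal (𝓞 F)} [P.IsMaximal] {r : ℕ} (hr : r.Prime)
    (hrP : (r : 𝓞 F) ∈ P) : ∃ f, f ≠ 0 ∧ Nat.card (𝓞 F ⧸ P) = r ^ f := by
  have hP : P ≠ ⊥ := by
    rintro rfl
    rw [Ideal.mem_bot, Nat.cast_eq_zero] at hrP
    exact hr.ne_zero hrP
  have : Finite (𝓞 F ⧸ P) := Ideal.finiteQuotientOfFreeOfNeBot P hP
  let _ : Field (𝓞 F ⧸ P) := Ideal.Quotient.field P
  let _ : Fintype (𝓞 F ⧸ P) := Fintype.ofFinite _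
  have hr0 : (r : 𝓞 F ⧸ P) = 0 := by
    rw [← map_natCast (Ideal.Quotient.mk P)]
    exact Ideal.Quotient.eq_zero_iff_mem.2 hrP
  have : CharP (𝓞 F ⧸ P) r := by
    obtain ⟨q, hq⟩ := CharP.exists (𝓞 F ⧸ P)
    rcases (Nat.dvd_prime hr).1 ((CharP.cast_eq_zero_iff _ q r).1 hr0) with h | h
    · exact absurd h (CharP.char_is_prime (𝓞 F ⧸ P) q).ne_one
    · exact h ▸ hq
  obtain ⟨f, -, hf⟩ := FiniteField.card (𝓞 F ⧸ P) r
  exact ⟨f, f.ne_zero, by rw [Nat.card_eq_fintype_card, hf]⟩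

variable [IsCyclotomicExtension {ℓ} ℚ F]

/-- A prime number which is a primitive root modulo `ℓ` is inert in the `ℓ`-th cyclotomic field. -/
theorem isMaximal_span_natCast {r : ℕ} (hr : r.Prime) (hord : orderOf (r : ZMod ℓ) = ℓ - 1)
    (hrl : r ≠ ℓ) : (Ideal.span {(r : 𝓞 F)}).IsMaximal ∧
      Nat.card (𝓞 F ⧸ Ideal.span {(r : 𝓞 F)}) = r ^ (ℓ - 1) := by
  have hcard : Nat.card (𝓞 F ⧸ Ideal.span {(r : 𝓞 F)}) = r ^ (ℓ - 1) := by
    have h1 := Ideal.absNorm_span_natCast (S := 𝓞 F) r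
    rw [Ideal.absNorm_apply, Submodule.cardQuot_apply, RingOfIntegers.rank,
      IsCyclotomicExtension.Rat.finrank ℓ F, Nat.totient_prime hℓ.out] at h1
    exact h1
  refine ⟨?_, hcard⟩
  have hne : Ideal.span {(r : 𝓞 F)} ≠ ⊤ := by
    intro h
    rw [← Ideal.absNorm_eq_one_iff, Ideal.absNorm_apply, Submodule.cardQuot_apply] at h
    rw [hcard] at h
    have := Nat.one_lt_pow (Nat.sub_ne_zero_of_lt hℓ.out.one_lt) hr.one_lt
    omega
  obtain ⟨P, hP, hle⟩ := Ideal.exists_le_maximal _ hne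
  have hrP : (r : 𝓞 F) ∈ P := hle (Ideal.mem_span_singleton_self _)
  obtain ⟨f, hf0, hf⟩ := natCard_quotient_maximal hr hrP
  have hpos : 0 < r ^ f := pow_pos hr.pos f
  have : Finite (𝓞 F ⧸ P) := Nat.finite_of_card_ne_zero (by omega)
  let _ : Field (𝓞 F ⧸ P) := Ideal.Quotient.field P
  let _ : Fintype (𝓞 F ⧸ P) := Fintype.ofFinite _
  rw [Nat.card_eq_fintype_card] at hf
  have hl : ((ℓ : ℕ) : 𝓞 F ⧸ P) ≠ 0 := natCast_ne_zero_of_card hr hf fun h =>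
    hrl ((Nat.prime_dvd_prime_iff_eq hr hℓ.out).1 h)
  have h1 := dvd_card_sub_one_of_isPrimitiveRoot (Ideal.Quotient.mk P) hl
    (IsCyclotomicExtension.zeta_spec ℓ ℚ F).toInteger_isPrimitiveRoot
  have h2 : (r : ZMod ℓ) ^ f = 1 := by
    rw [hf, ← ZMod.natCast_eq_zero_iff, Nat.cast_sub hpos, Nat.cast_pow, Nat.cast_one,
      sub_eq_zero] at h1
    exact h1
  have h3 : ℓ - 1 ≤ f := Nat.le_of_dvd (Nat.pos_of_ne_zero hf0) (hord ▸ orderOf_dvd_of_pow_eq_one h2)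
  obtain ⟨J, hJ⟩ := Ideal.dvd_iff_le.2 hle
  have h4 := congrArg Ideal.absNorm hJ
  rw [map_mul, Ideal.absNorm_apply, Submodule.cardQuot_apply, Ideal.absNorm_apply P,
    Submodule.cardQuot_apply] at h4
  rw [hcard, Nat.card_eq_fintype_card, hf] at h4
  have h5 : J.absNorm = 1 := by
    have h6 : r ^ (ℓ - 1) ≤ r ^ f := Nat.pow_le_pow_right hr.pos h3
    have h7 : 0 < r ^ (ℓ - 1) := pow_pos hr.pos _
    rcases Nat.lt_trichotomy J.absNorm 1 with h | h | h
    · rw [Nat.lt_one_iff.1 h] at h4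
      omega
    · exact h
    · nlinarith
  rw [Ideal.absNorm_eq_one_iff.1 h5, Ideal.mul_top] at hJ
  exact hJ ▸ hP

end residueField

end

section

open NumberField

section parameters

universe u

variable {ℓ : ℕ} [hℓ : Fact ℓ.Prime] {F : Type u} [Field F] [NumberField F]

lemma exists_natCast_dvd_coprime {c : 𝓞 F} (hc : c ≠ 0) {m : ℕ} (h : IsCoprime c (m : 𝓞 F)) :
    ∃ N : ℕ, N ≠ 0 ∧ c ∣ (N : 𝓞 F) ∧ N.Coprime m := by
  classical
  have hex : ∃ N : ℕ, N ≠ 0 ∧ c ∣ (N : 𝓞 F) := by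
    refine ⟨(Ideal.span {c}).absNorm, ?_, Ideal.mem_span_singleton.1 (Ideal.absNorm_mem _)⟩
    rwa [Ne, Ideal.absNorm_eq_zero_iff, Ideal.span_singleton_eq_bot]
  obtain ⟨h0, h1⟩ := Nat.find_spec hex
  refine ⟨Nat.find hex, h0, h1, Nat.coprime_of_dvd fun t ht htN htm => ?_⟩
  obtain ⟨N, hN⟩ := htN
  obtain ⟨m', rfl⟩ := htm
  have h2 : IsCoprime c (t : 𝓞 F) := by
    rw [Nat.cast_mul] at h
    exact h.of_mul_right_left
  have h3 : c ∣ (N : 𝓞 F) := by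
    rw [hN, Nat.cast_mul] at h1
    exact h2.dvd_of_dvd_mul_left h1
  have hN0 : N ≠ 0 := by
    rintro rfl
    exact h0 (by rw [hN, mul_zero])
  have h4 := Nat.find_min' hex ⟨hN0, h3⟩
  rw [hN] at h4
  have := Nat.mul_lt_mul_of_pos_right ht.one_lt (Nat.pos_of_ne_zero hN0)
  omega

lemma exists_orderOf_eq_sub_one (ℓ : ℕ) [hℓ : Fact ℓ.Prime] :
    ∃ g : ℕ, g.Coprime ℓ ∧ orderOf (g : ZMod ℓ) = ℓ - 1 := by
  obtain ⟨g, hg⟩ := IsCyclic.exists_generator (α := (ZMod ℓ)ˣ)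
  refine ⟨(g : ZMod ℓ).val, ZMod.val_coe_unit_coprime g, ?_⟩
  rw [ZMod.natCast_zmod_val, orderOf_units, orderOf_eq_card_of_forall_mem_zpowers hg,
    Nat.card_eq_fintype_card, ZMod.card_units]

lemma IsCoprime.natCast_of_coprime {R : Type*} [CommRing R] {a b : ℕ} (h : a.Coprime b) :
    IsCoprime (a : R) (b : R) := by
  have := (Nat.isCoprime_iff_coprime.2 h).map (Int.castRingHom R)
  simpa using this

/-- Existence of a prime satisfying the congruences which make the discriminant of the
associated cyclic algebra trivial away from a given prime. -/
theorem exists_prime_parameters [IsCyclotomicExtension {ℓ} ℚ F] {p s g : ℕ} (hp : p.Prime)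
    (hsl : s.Coprime ℓ) (hs0 : s ≠ 0) (hgs : g.Coprime s) {c u : 𝓞 F} (hc0 : c ≠ 0)
    (hc : IsCoprime c ((p * ℓ * s : ℕ) : 𝓞 F)) {M : ℕ} (hu : u ∣ (s : 𝓞 F) ^ M)
    (H : ∀ r : ℕ, r.Prime → r ≠ ℓ → r ≡ g [MOD s] → ∀ (κ : Type u) [Field κ] [Fintype κ]
      (φ : 𝓞 F →+* κ), Fintype.card κ = r ^ (ℓ - 1) → φ u ^ ((Fintype.card κ - 1) / ℓ) ≠ 1)
    (n₀ : ℕ) :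
    ∃ r : ℕ, r.Prime ∧ n₀ < r ∧ c ∣ (p * r - 1 : 𝓞 F) ∧ ∃ i < ℓ, ∃ γ₀ : 𝓞 F,
      (r : 𝓞 F) ∣ c * u ^ i - γ₀ ^ ℓ ∧ IsCoprime (c * u ^ i * p * ℓ) (r : 𝓞 F) ∧
      IsCoprime (u ^ i * ℓ) c := by
  obtain ⟨N, hN0, hcN, hNco⟩ := exists_natCast_dvd_coprime hc0 hc
  have hNp : N.Coprime p := hNco.coprime_dvd_right ⟨ℓ * s, by ring⟩
  have hNl : N.Coprime ℓ := hNco.coprime_dvd_right ⟨p * s, by ring⟩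
  have hNs : N.Coprime s := hNco.coprime_dvd_right ⟨p * ℓ, by ring⟩
  obtain ⟨b, hbl, hb⟩ := exists_orderOf_eq_sub_one ℓ
  obtain ⟨p', hp'⟩ : ∃ p' : ℕ, p * p' ≡ 1 [MOD N] := by
    have : NeZero N := ⟨hN0⟩
    refine ⟨((p : ZMod N)⁻¹).val, ?_⟩
    rw [← ZMod.natCast_eq_natCast_iff, Nat.cast_mul, ZMod.natCast_zmod_val,
      ZMod.coe_mul_inv_eq_one p hNp.symm, Nat.cast_one]
  have hp'N : p'.Coprime N := by
    have h1 : (p * p').Coprime N := by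
      rw [Nat.Coprime, hp'.gcd_eq]
      exact Nat.gcd_one_left _
    exact h1.coprime_dvd_left (dvd_mul_left _ _)
  obtain ⟨a₁, ha₁, ha₁'⟩ := Nat.chineseRemainder hsl g b
  obtain ⟨a, ha, ha'⟩ := Nat.chineseRemainder (hNs.mul_right hNl) p' a₁
  have hao : a.Coprime (N * (s * ℓ)) := by
    refine Nat.Coprime.mul_right ?_ ?_
    · rw [Nat.Coprime, ha.gcd_eq]; exact hp'N
    · rw [Nat.Coprime, ha'.gcd_eq]
      refine Nat.Coprime.mul_right ?_ ?_
      · rw [Nat.Coprime, ha₁.gcd_eq]; exact hgs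
      · rw [Nat.Coprime, ha₁'.gcd_eq]; exact hbl
  obtain ⟨r, hr0, hr, hra⟩ := Nat.forall_exists_prime_gt_and_modEq (n₀ + N + s + p + ℓ)
    (mul_ne_zero hN0 (mul_ne_zero hs0 hℓ.out.ne_zero)) hao
  have hrN : r ≡ p' [MOD N] := (hra.of_dvd (dvd_mul_right _ _)).trans ha
  have hrsl : r ≡ a₁ [MOD s * ℓ] := (hra.of_dvd (dvd_mul_left _ _)).trans ha'
  have hrs : r ≡ g [MOD s] := (hrsl.of_dvd (dvd_mul_right _ _)).trans ha₁
  have hrl : r ≡ b [MOD ℓ] := (hrsl.of_dvd (dvd_mul_left _ _)).trans ha₁'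
  have hrl' : r ≠ ℓ := by omega
  have hcop : ∀ {t : ℕ}, t ≠ 0 → t < r → IsCoprime (t : 𝓞 F) (r : 𝓞 F) := fun h0 h =>
    IsCoprime.natCast_of_coprime (Nat.coprime_of_lt_prime h0 h hr).symm
  have hcr : IsCoprime c (r : 𝓞 F) := (hcop hN0 (by omega)).of_isCoprime_of_dvd_left hcN
  have hur : IsCoprime u (r : 𝓞 F) :=
    ((hcop hs0 (by omega)).pow_left (m := M)).of_isCoprime_of_dvd_left hu
  have hcs : IsCoprime (s : 𝓞 F) c := by
    rw [Nat.cast_mul] at hc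
    exact hc.of_mul_right_right.symm
  have hcl : IsCoprime (ℓ : 𝓞 F) c := by
    rw [Nat.cast_mul, Nat.cast_mul] at hc
    exact hc.of_mul_right_left.of_mul_right_right.symm
  have huc : IsCoprime u c := (hcs.pow_left (m := M)).of_isCoprime_of_dvd_left hu
  obtain ⟨hmax, hcard⟩ := isMaximal_span_natCast (F := F) hr
    (by rw [(ZMod.natCast_eq_natCast_iff _ _ _).2 hrl, hb]) hrl'
  have : Finite (𝓞 F ⧸ Ideal.span {(r : 𝓞 F)}) :=
    Nat.finite_of_card_ne_zero (hcard ▸ (pow_pos hr.pos _).ne')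
  let _ : Field (𝓞 F ⧸ Ideal.span {(r : 𝓞 F)}) := Ideal.Quotient.field _
  let _ : Fintype (𝓞 F ⧸ Ideal.span {(r : 𝓞 F)}) := Fintype.ofFinite _
  rw [Nat.card_eq_fintype_card] at hcard
  set φ := Ideal.Quotient.mk (Ideal.span {(r : 𝓞 F)}) with hφ
  have hφr : φ r = 0 := Ideal.Quotient.eq_zero_iff_mem.2 (Ideal.mem_span_singleton_self _)
  have hne : ∀ {x : 𝓞 F}, IsCoprime x (r : 𝓞 F) → φ x ≠ 0 := by
    intro x hx h0
    have h1 := hx.map φ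
    rw [h0, hφr] at h1
    exact not_isCoprime_zero_zero h1
  have hd : ℓ ∣ Fintype.card (𝓞 F ⧸ Ideal.span {(r : 𝓞 F)}) - 1 :=
    hcard ▸ hr.dvd_pow_sub_one_of_ne hrl'
  obtain ⟨i, hi, z, hz⟩ := FiniteField.exists_mul_pow_eq_pow hd (hne hcr) (hne hur)
    (H r hr hrl' hrs _ φ hcard)
  obtain ⟨γ₀, rfl⟩ := Ideal.Quotient.mk_surjective z
  refine ⟨r, hr, by omega, ?_, i, hi, γ₀, ?_, ?_, ?_⟩
  · have h1 : p * r ≡ 1 [MOD N] := (hrN.mul_left p).trans hp'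
    have h2 := (Nat.modEq_iff_dvd.1 h1.symm)
    have h3 := map_dvd (Int.castRingHom (𝓞 F)) h2
    refine hcN.trans ?_
    simpa using h3
  · rw [← Ideal.mem_span_singleton, ← Ideal.Quotient.eq_zero_iff_mem, map_sub, map_mul, map_pow,
      map_pow]
    exact sub_eq_zero.2 hz
  · exact ((hcr.mul_left hur.pow_left).mul_left (hcop hp.ne_zero (by omega))).mul_left
      (hcop hℓ.out.ne_zero (by omega))
  · exact huc.pow_left.mul_left hcl

end parameters

end

section

open NumberField IsDedekindDomain

section residueDatum

variable {F : Type*} [Field F] [NumberField F]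

lemma exists_sub_mem_isCoprime {Q : ℕ} (hQ : Q ≠ 0) (w : HeightOneSpectrum (𝓞 F)) (m : 𝓞 F)
    (hm : m ∉ w.asIdeal) (hw : (Q : 𝓞 F) ∈ w.asIdeal) :
    ∃ μ : 𝓞 F, μ - m ∈ w.asIdeal ∧ IsCoprime μ (Q : 𝓞 F) := by
  classical
  have hQ0 : Ideal.span {(Q : 𝓞 F)} ≠ 0 := by
    rw [Ne, Submodule.zero_eq_bot, Ideal.span_singleton_eq_bot]
    exact Nat.cast_ne_zero.2 hQ
  have hmem : ∀ i : HeightOneSpectrum (𝓞 F),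
      i ∈ (Ideal.finite_factors hQ0).toFinset ↔ (Q : 𝓞 F) ∈ i.asIdeal := fun i => by
    rw [Set.Finite.mem_toFinset, Set.mem_ofPred_eq, Ideal.dvd_span_singleton]
  obtain ⟨μ, hμ⟩ := IsDedekindDomain.exists_forall_sub_mem_ideal
    (s := (Ideal.finite_factors hQ0).toFinset) (fun i => i.asIdeal) (fun _ => 1)
    (fun i _ => i.prime) (fun i _ j _ hij h => hij (HeightOneSpectrum.ext h))
    (fun i => if (i : HeightOneSpectrum (𝓞 F)) = w then m else 1)
  simp only [pow_one] at hμ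
  refine ⟨μ, by simpa using hμ w ((hmem w).2 hw), ?_⟩
  rw [← Ideal.isCoprime_span_singleton_iff, Ideal.isCoprime_iff_sup_eq]
  by_contra hne
  obtain ⟨N, hN, hle⟩ := Ideal.exists_le_maximal _ hne
  have hμN : μ ∈ N := hle (Ideal.mem_sup_left (Ideal.mem_span_singleton_self _))
  have hQN : (Q : 𝓞 F) ∈ N := hle (Ideal.mem_sup_right (Ideal.mem_span_singleton_self _))
  have hN0 : N ≠ ⊥ := by
    rintro rfl
    exact hQ (by simpa using hQN)
  let i : HeightOneSpectrum (𝓞 F) := ⟨N, hN.isPrime, hN0⟩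
  have h1 := hμ i ((hmem i).2 hQN)
  have h2 : (if i = w then m else 1) ∈ N := by
    have := N.sub_mem hμN h1
    rwa [sub_sub_cancel] at this
  split_ifs at h2 with h
  · exact hm (h ▸ h2)
  · exact hN.ne_top ((Ideal.eq_top_iff_one _).2 h2)

variable {Ω : Type*} [Field Ω] [Algebra F Ω] (B : ValuationSubring Ω)

omit [NumberField F] in
lemma ValuationSubring.valuation_algebraMap_coe_le_one (x : 𝓞 F) :
    B.valuation (algebraMap F Ω x) ≤ 1 :=
  B.valuation_le_one_of_isIntegral (isIntegral_algebraMap_coe x)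

/-- The place of a number field induced by a valuation ring of an overfield. -/
lemma ValuationSubring.exists_heightOneSpectrum {p : ℕ} (hp0 : p ≠ 0)
    (hp : B.valuation (p : Ω) < 1) :
    ∃ w : HeightOneSpectrum (𝓞 F),
      (∀ x : 𝓞 F, x ∈ w.asIdeal ↔ B.valuation (algebraMap F Ω x) < 1) ∧
      ∀ d : F, B.valuation (algebraMap F Ω d) ≤ 1 →
        ∃ a b : 𝓞 F, b ∉ w.asIdeal ∧ d * b = a := by
  let P : Ideal (𝓞 F) :=
    { carrier := {x | B.valuation (algebraMap F Ω x) < 1}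
      add_mem' := fun {x y} hx hy => by
        simp only [Set.mem_ofPred_eq, map_add] at *
        exact B.valuation.map_add_lt hx hy
      zero_mem' := by simp
      smul_mem' := fun c x hx => by
        simp only [Set.mem_ofPred_eq, smul_eq_mul, map_mul] at *
        exact mul_lt_one_of_nonneg_of_lt_one_right (B.valuation_algebraMap_coe_le_one c) zero_le hx }
  have hP : ∀ x : 𝓞 F, x ∈ P ↔ B.valuation (algebraMap F Ω x) < 1 := fun x => Iff.rfl
  have hprime : P.IsPrime := by
    refine ⟨fun h => ?_, fun {x y} hxy => ?_⟩
    · have := (hP 1).1 (h ▸ Submodule.mem_top)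
      simp at this
    · by_contra! h
      simp only [hP, not_lt, map_mul] at hxy h
      exact absurd hxy (not_lt.2 (one_le_mul h.1 h.2))
  have hpP : (p : 𝓞 F) ∈ P := by
    rw [hP]
    simpa using hp
  have hbot : P ≠ ⊥ := by
    intro h
    rw [h] at hpP
    exact hp0 (by simpa using hpP)
  let w : HeightOneSpectrum (𝓞 F) := ⟨P, hprime, hbot⟩
  have hone : ∀ b : 𝓞 F, b ∉ w.asIdeal → B.valuation (algebraMap F Ω b) = 1 := fun b hb =>
    le_antisymm (B.valuation_algebraMap_coe_le_one b) (not_lt.1 fun h => hb ((hP b).2 h))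
  refine ⟨w, hP, fun d hd => ?_⟩
  rcases le_or_gt (w.valuation F d) 1 with h | h
  · obtain ⟨a, b, hab⟩ := w.exists_primeCompl_mul_eq_of_integer d h
    exact ⟨a, b, b.2, hab⟩
  · exfalso
    have hd0 : d ≠ 0 := by
      rintro rfl
      simp at h
    obtain ⟨a, b, hab⟩ := w.exists_primeCompl_mul_eq_of_integer d⁻¹ (by
      rw [map_inv₀]
      exact inv_le_one_of_one_le₀ h.le)
    have hb := hone b b.2
    have ha : a ∈ w.asIdeal := by
      rw [← w.valuation_lt_one_iff_mem (K := F)]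
      change w.valuation F (algebraMap (𝓞 F) F a) < 1
      rw [← hab, map_mul, map_inv₀]
      exact mul_lt_one_of_lt_of_le (inv_lt_one_of_one_lt₀ h) (w.valuation_le_one _)
    have ha1 := (hP a).1 ha
    have h2 : algebraMap F Ω (b : 𝓞 F) = algebraMap F Ω d * algebraMap F Ω a := by
      rw [← map_mul]
      congr 1
      change algebraMap (𝓞 F) F b = d * algebraMap (𝓞 F) F a
      rw [← hab, mul_inv_cancel_left₀ hd0]
    rw [h2, map_mul] at hb
    exact absurd hb (mul_lt_one_of_nonneg_of_lt_one_right hd zero_le ha1).ne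

end residueDatum

end

section

open NumberField IsDedekindDomain

section residueParameters

universe u

variable {ℓ : ℕ} [hℓ : Fact ℓ.Prime] {F : Type u} [Field F] [NumberField F]
  {Ω : Type*} [Field Ω] [Algebra F Ω] (B : ValuationSubring Ω)

/-- Existence of a non-residue `μ` and a residue `u` at the place induced by a valuation ring. -/
theorem exists_residue_parameters {ζ : 𝓞 F}
    (hζ : IsPrimitiveRoot ζ ℓ) {p : ℕ} (hp : p.Prime) (hpl : p ≠ ℓ)
    (hpB : B.valuation (p : Ω) < 1) :
    ∃ (u μ z : 𝓞 F) (s g : ℕ), s.Coprime ℓ ∧ s ≠ 0 ∧ g.Coprime s ∧ (∃ M, u ∣ (s : 𝓞 F) ^ M) ∧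
      (∀ r : ℕ, r.Prime → r ≠ ℓ → r ≡ g [MOD s] → ∀ (κ : Type u) [Field κ] [Fintype κ]
        (φ : 𝓞 F →+* κ), Fintype.card κ = r ^ (ℓ - 1) →
          φ u ^ ((Fintype.card κ - 1) / ℓ) ≠ 1) ∧
      IsCoprime μ ((p * ℓ * s : ℕ) : 𝓞 F) ∧ B.valuation (algebraMap F Ω z) = 1 ∧
      B.valuation (algebraMap F Ω u - algebraMap F Ω z ^ ℓ) < 1 ∧
      ∀ c : 𝓞 F, B.valuation (algebraMap F Ω c - algebraMap F Ω μ) < 1 → ∀ (i : ℕ) (d : F),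
        B.valuation (algebraMap F Ω d) ≤ 1 →
          1 ≤ B.valuation (algebraMap F Ω (c * u ^ i : 𝓞 F) - algebraMap F Ω d ^ ℓ) := by
  obtain ⟨w, hw, hwd⟩ := B.exists_heightOneSpectrum (F := F) hp.ne_zero hpB
  have hpw : (p : 𝓞 F) ∈ w.asIdeal := by
    rw [hw]
    simpa using hpB
  have hmax : w.asIdeal.IsMaximal := w.isMaximal
  let : Field (𝓞 F ⧸ w.asIdeal) := Ideal.Quotient.field _
  have : Finite (𝓞 F ⧸ w.asIdeal) := Ideal.finiteQuotientOfFreeOfNeBot _ w.ne_bot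
  let : Fintype (𝓞 F ⧸ w.asIdeal) := Fintype.ofFinite _
  obtain ⟨m, hm, hcard⟩ := natCard_quotient_maximal hp hpw
  rw [Nat.card_eq_fintype_card] at hcard
  let φ := Ideal.Quotient.mk w.asIdeal
  have hφ : ∀ x, φ x = 0 ↔ x ∈ w.asIdeal := fun x => Ideal.Quotient.eq_zero_iff_mem
  have hφs : Function.Surjective φ := Ideal.Quotient.mk_surjective
  have hne : ∀ n : ℕ, ¬ p ∣ n → φ n ≠ 0 := fun n hn => by
    rw [map_natCast]
    exact natCast_ne_zero_of_card hp hcard hn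
  have hl : ((ℓ : ℕ) : 𝓞 F ⧸ w.asIdeal) ≠ 0 :=
    natCast_ne_zero_of_card hp hcard (by rwa [Nat.prime_dvd_prime_iff_eq hp hℓ.out])
  have hd := dvd_card_sub_one_of_isPrimitiveRoot φ hl hζ
  obtain ⟨u, s, g, hsp, hsl, hgs, ⟨M, hM⟩, hu1, H⟩ :=
    exists_isPowResidue_of_modEq hζ hp hpl hcard hd φ
  have hps : ¬ p ∣ s := (hp.coprime_iff_not_dvd).1 hsp.symm
  have hs0 : s ≠ 0 := by
    rintro rfl
    exact hps (dvd_zero p)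
  have hu0 : φ u ≠ 0 := by
    intro h0
    have := map_dvd φ hM
    rw [h0, zero_dvd_iff, map_pow] at this
    exact pow_ne_zero M (hne s hps) this
  obtain ⟨z', hz'⟩ := FiniteField.exists_eq_pow_of_pow_eq_one hd hu0 hu1
  obtain ⟨z, rfl⟩ := hφs z'
  obtain ⟨μ', hμ'0, hμ'⟩ := FiniteField.exists_forall_pow_ne (κ := 𝓞 F ⧸ w.asIdeal) hd
  obtain ⟨μ₀, rfl⟩ := hφs μ'
  have hQ0 : p * ℓ * s ≠ 0 := mul_ne_zero (mul_ne_zero hp.ne_zero hℓ.out.ne_zero) hs0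
  obtain ⟨μ, hμ, hμco⟩ := exists_sub_mem_isCoprime hQ0 w μ₀ (by rwa [← hφ])
    (by push_cast; exact w.asIdeal.mul_mem_right _ (w.asIdeal.mul_mem_right _ hpw))
  have hz0 : φ z ≠ 0 := by
    intro h0
    rw [h0, zero_pow hℓ.out.ne_zero] at hz'
    exact hu0 hz'
  refine ⟨u, μ, z, s, g, hsl, hs0, hgs, ⟨M, hM⟩, fun r h1 h2 h3 κ _ _ ψ h4 => H r h1 h2 h3 κ ψ h4,
    hμco, ?_, ?_, fun c hc i d hdB => ?_⟩
  · refine le_antisymm (B.valuation_algebraMap_coe_le_one z) (not_lt.1 fun h => ?_)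
    exact hz0 ((hφ z).2 ((hw z).2 h))
  · have h1 : u - z ^ ℓ ∈ w.asIdeal := by
      rw [← hφ, map_sub, map_pow, ← hz', sub_self]
    have := (hw _).1 h1
    simpa using this
  · by_contra! hlt
    obtain ⟨a, b, hb, hab⟩ := hwd d hdB
    have hc' : φ c = φ μ₀ := by
      rw [← sub_eq_zero, ← map_sub, hφ]
      have : c - μ ∈ w.asIdeal := by
        rw [hw]
        simpa using hc
      simpa using w.asIdeal.add_mem this hμ
    have h1 : c * u ^ i * b ^ ℓ - a ^ ℓ ∈ w.asIdeal := by
      rw [hw]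
      have h2 : algebraMap F Ω ((c * u ^ i * b ^ ℓ - a ^ ℓ : 𝓞 F) : F) =
          (algebraMap F Ω (c * u ^ i : 𝓞 F) - algebraMap F Ω d ^ ℓ) * algebraMap F Ω b ^ ℓ := by
        have h3 : ((c * u ^ i * b ^ ℓ - a ^ ℓ : 𝓞 F) : F) =
            (((c * u ^ i : 𝓞 F) : F) - d ^ ℓ) * (b : F) ^ ℓ := by
          rw [sub_mul, ← mul_pow, hab]
          simp
        rw [h3, map_mul, map_sub, map_pow, map_pow]
      rw [h2, map_mul, map_pow]
      exact mul_lt_one_of_lt_of_le hlt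
        (pow_le_one₀ zero_le (B.valuation_algebraMap_coe_le_one b))
    rw [← hφ, map_sub, sub_eq_zero, map_mul, map_mul, map_pow, map_pow, map_pow, hc', hz'] at h1
    refine hμ' (φ a) (φ z ^ i * φ b) (mul_ne_zero (pow_ne_zero _ hz0) ?_) ?_
    · rwa [Ne, hφ]
    · rw [← h1]
      ring

end residueParameters

end

section

open NumberField IsDedekindDomain

section embedding

variable (F Ω : Type*) [Field F] [NumberField F] [Field Ω] [CharZero Ω] [Algebra F Ω]

/-- The image of a number field in an overfield, as a field over the rationals. -/
noncomputable def ratRange : IntermediateField ℚ Ω := (algebraMap F Ω).toRatAlgHom.fieldRange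

variable {F} in
lemma algebraMap_mem_ratRange (x : F) : algebraMap F Ω x ∈ ratRange F Ω := ⟨x, rfl⟩

instance : FiniteDimensional ℚ (ratRange F Ω) :=
  (AlgEquiv.ofInjectiveField (algebraMap F Ω).toRatAlgHom).toLinearEquiv.finiteDimensional

lemma finrank_ratRange : Module.finrank ℚ (ratRange F Ω) = Module.finrank ℚ F :=
  (AlgEquiv.ofInjectiveField (algebraMap F Ω).toRatAlgHom).toLinearEquiv.finrank_eq.symm

end embedding

section datum

universe u

variable {ℓ : ℕ} [hℓ : Fact ℓ.Prime] {F : Type u} [Field F] [NumberField F]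

omit hℓ in
lemma exists_forall_norm_le (hl : ℓ ≠ 0) (μ u : 𝓞 F) : ∃ C : ℝ, 1 ≤ C ∧ ∃ n₀ : ℕ, ∀ n : ℤ, (n₀ : ℤ) ≤ |n| →
    1 ≤ |(n : ℝ)| ∧ ∀ τ : F →+* ℂ, |(n : ℝ)| ^ ℓ ≤ C * ‖τ (μ + (n : 𝓞 F) ^ ℓ : 𝓞 F)‖ ∧
      ‖τ (μ + (n : 𝓞 F) ^ ℓ : 𝓞 F)‖ ≤ C * |(n : ℝ)| ^ ℓ ∧
      ∀ i < ℓ, ‖τ (u ^ i : 𝓞 F)‖ ≤ C := by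
  set A := ∑ τ : F →+* ℂ, ‖τ μ‖ with hA
  set D := ∑ τ : F →+* ℂ, ∑ i ∈ Finset.range ℓ, ‖τ (u ^ i : 𝓞 F)‖ with hD
  have hA0 : 0 ≤ A := Finset.sum_nonneg fun _ _ => norm_nonneg _
  have hD0 : 0 ≤ D := Finset.sum_nonneg fun _ _ => Finset.sum_nonneg fun _ _ => norm_nonneg _
  obtain ⟨n₀, hn₀⟩ := exists_nat_ge (2 * A + 1)
  refine ⟨2 + D, by linarith, n₀, fun n hn => ?_⟩
  have hn' : (n₀ : ℝ) ≤ |(n : ℝ)| := by exact_mod_cast hn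
  have h1 : 1 ≤ |(n : ℝ)| := by linarith
  have h2 : |(n : ℝ)| ≤ |(n : ℝ)| ^ ℓ := le_self_pow₀ h1 hl
  refine ⟨h1, fun τ => ?_⟩
  have h3 : ‖τ μ‖ ≤ A :=
    Finset.single_le_sum (f := fun τ : F →+* ℂ => ‖τ μ‖) (fun _ _ => norm_nonneg _)
      (Finset.mem_univ τ)
  have h4 : τ (μ + (n : 𝓞 F) ^ ℓ : 𝓞 F) = τ μ + (n : ℂ) ^ ℓ := by simp
  have h5 : ‖(n : ℂ) ^ ℓ‖ = |(n : ℝ)| ^ ℓ := by rw [norm_pow, Complex.norm_intCast]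
  have h6 := norm_add_le (τ μ) ((n : ℂ) ^ ℓ)
  have h7 := norm_sub_norm_le ((n : ℂ) ^ ℓ) (-τ μ)
  rw [sub_neg_eq_add, norm_neg, add_comm (_ ^ ℓ)] at h7
  rw [h4]
  rw [h5] at h6 h7
  refine ⟨?_, ?_, fun i hi => ?_⟩
  · nlinarith [norm_nonneg (τ μ + (n : ℂ) ^ ℓ)]
  · nlinarith
  · have h8 : ‖τ (u ^ i : 𝓞 F)‖ ≤ ∑ i ∈ Finset.range ℓ, ‖τ (u ^ i : 𝓞 F)‖ :=
      Finset.single_le_sum (f := fun i => ‖τ (u ^ i : 𝓞 F)‖) (fun _ _ => norm_nonneg _)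
        (Finset.mem_range.2 hi)
    have h9 : ∑ i ∈ Finset.range ℓ, ‖τ (u ^ i : 𝓞 F)‖ ≤ D :=
      Finset.single_le_sum (f := fun τ : F →+* ℂ => ∑ i ∈ Finset.range ℓ, ‖τ (u ^ i : 𝓞 F)‖)
        (fun _ _ => Finset.sum_nonneg fun _ _ => norm_nonneg _) (Finset.mem_univ τ)
    linarith

variable {Ω : Type*} [Field Ω] [Algebra F Ω]

omit hℓ [NumberField F] in
lemma IsCoprime.exists_isIntegral_algebraMap {x y : 𝓞 F} (h : IsCoprime x y) :
    ∃ a b : Ω, IsIntegral ℤ a ∧ IsIntegral ℤ b ∧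
      algebraMap F Ω x * a + algebraMap F Ω y * b = 1 := by
  obtain ⟨a, b, hab⟩ := h
  refine ⟨algebraMap F Ω a, algebraMap F Ω b, isIntegral_algebraMap_coe a,
    isIntegral_algebraMap_coe b, ?_⟩
  have h1 : (x : F) * a + y * b = 1 := by
    have : ((a * x + b * y : 𝓞 F) : F) = 1 := by rw [hab]; rfl
    rw [← this]
    simp [mul_comm]
  rw [← map_mul (algebraMap F Ω), ← map_mul (algebraMap F Ω), ← map_add, h1, map_one]

omit hℓ [NumberField F] in
lemma exists_isIntegral_of_dvd {x y : 𝓞 F} (h : x ∣ y) :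
    ∃ a : Ω, IsIntegral ℤ a ∧ algebraMap F Ω y = algebraMap F Ω x * a := by
  obtain ⟨a, rfl⟩ := h
  exact ⟨algebraMap F Ω a, isIntegral_algebraMap_coe a, by simp⟩

variable [CharZero Ω] [IsAlgClosed Ω] (B : ValuationSubring Ω)

theorem exists_isBoundedDatum [IsCyclotomicExtension {ℓ} ℚ F] (L : IntermediateField ℚ Ω)
    [FiniteDimensional ℚ L] (hL : Module.finrank ℚ L < ℓ)
    {ψ : AddChar (ZMod ℓ) (𝓞 F)} (hψ : (extChar Ω ψ).IsPrimitive)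
    {p : ℕ} (hp : p.Prime) (hpB : B.valuation (p : Ω) < 1)
    {u μ : 𝓞 F} {s g M : ℕ} (hsl : s.Coprime ℓ) (hs0 : s ≠ 0) (hgs : g.Coprime s)
    (hu : u ∣ (s : 𝓞 F) ^ M)
    (H : ∀ r : ℕ, r.Prime → r ≠ ℓ → r ≡ g [MOD s] → ∀ (κ : Type u) [Field κ] [Fintype κ]
        (φ : 𝓞 F →+* κ), Fintype.card κ = r ^ (ℓ - 1) →
          φ u ^ ((Fintype.card κ - 1) / ℓ) ≠ 1)
    (hμ : IsCoprime μ ((p * ℓ * s : ℕ) : 𝓞 F))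
    (hres : ∀ c : 𝓞 F, B.valuation (algebraMap F Ω c - algebraMap F Ω μ) < 1 → ∀ (i : ℕ) (d : F),
        B.valuation (algebraMap F Ω d) ≤ 1 →
          1 ≤ B.valuation (algebraMap F Ω (c * u ^ i : 𝓞 F) - algebraMap F Ω d ^ ℓ)) :
    ∃ C : ℝ, 1 ≤ C ∧ ∃ n₀ : ℕ, ∀ n : ℤ, (n₀ : ℤ) ≤ |n| → ∃ i < ℓ, ∃ (γ η : Ω) (γ₀ : 𝓞 F) (r : ℕ),
      IsBoundedDatum ψ γ η γ₀ (μ + (((p * ℓ * s : ℕ) * n : ℤ) : 𝓞 F) ^ ℓ) (u ^ i) p r C ∧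
      IsLocallyDivision B (ratRange F Ω) L p (extChar Ω ψ) γ η := by
  obtain ⟨C, hC, n₀, hn₀⟩ := exists_forall_norm_le hℓ.out.ne_zero μ u
  have hQ0 : p * ℓ * s ≠ 0 := mul_ne_zero (mul_ne_zero hp.ne_zero hℓ.out.ne_zero) hs0
  refine ⟨C, hC, n₀, fun n hn => ?_⟩
  set Q := p * ℓ * s with hQ
  set N : ℤ := Q * n with hN
  obtain ⟨hN1, hNτ⟩ := hn₀ N (by
    rw [hN, abs_mul, Nat.abs_cast]
    exact hn.trans (le_mul_of_one_le_left (abs_nonneg _)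
      (by exact_mod_cast Nat.one_le_iff_ne_zero.2 hQ0)))
  set c : 𝓞 F := μ + (N : 𝓞 F) ^ ℓ with hc
  have hcμ : B.valuation (algebraMap F Ω c - algebraMap F Ω μ) < 1 := by
    have h1 : algebraMap F Ω c - algebraMap F Ω μ = ((N : ℤ) : Ω) ^ ℓ := by simp [hc]
    rw [h1, map_pow]
    refine pow_lt_one₀ zero_le ?_ hℓ.out.ne_zero
    have h2 : ((N : ℤ) : Ω) = (p : Ω) * ((ℓ * s * n : ℤ) : Ω) := by
      rw [hN, hQ]
      push_cast
      ring
    rw [h2, map_mul]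
    exact mul_lt_one_of_lt_of_le hpB (B.valuation_intCast_le_one _)
  have hc0 : c ≠ 0 := by
    intro h0
    have := hres c hcμ 0 0 (by simp)
    simp [h0, hℓ.out.ne_zero] at this
  have hcQ : IsCoprime c (Q : 𝓞 F) := by
    have h1 : (N : 𝓞 F) ^ ℓ = (Q : 𝓞 F) * ((n : 𝓞 F) * (N : 𝓞 F) ^ (ℓ - 1)) := by
      rw [← mul_pow_sub_one hℓ.out.ne_zero, hN]
      push_cast
      ring
    rw [hc, h1]
    exact hμ.add_mul_left_left _
  obtain ⟨r, hr, hpr, hcr, i, hi, γ₀, hγ₀, hco, hco'⟩ :=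
    exists_prime_parameters hp hsl hs0 hgs hc0 hcQ hu H p
  obtain ⟨γ, hγ⟩ := IsAlgClosed.exists_pow_nat_eq (algebraMap F Ω (c * u ^ i : 𝓞 F)) hℓ.out.pos
  obtain ⟨η, hη⟩ := IsAlgClosed.exists_pow_nat_eq ((p : Ω) * (r : Ω)) hℓ.out.pos
  have hu0 : u ^ i ≠ 0 := by
    refine pow_ne_zero _ ?_
    rintro rfl
    rw [zero_dvd_iff] at hu
    exact pow_ne_zero M (Nat.cast_ne_zero.2 hs0) hu
  have hdiv : IsLocallyDivision B (ratRange F Ω) L p (extChar Ω ψ) γ η :=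
    { prime := hp
      valuation_p := hpB
      finrank_K := by
        rw [finrank_ratRange, IsCyclotomicExtension.Rat.finrank ℓ F, Nat.totient_prime hℓ.out]
        exact Nat.sub_lt hℓ.out.pos one_pos
      finrank_L := hL
      apply_mem := fun a => algebraMap_mem_ratRange Ω _
      γ_pow_mem := by
        rw [hγ]
        exact algebraMap_mem_ratRange Ω _
      γ_mem := by
        rw [← B.valuation_le_one_iff]
        exact B.valuation_le_one_of_isIntegral (IsIntegral.of_pow hℓ.out.pos
          (by rw [hγ]; exact isIntegral_algebraMap_coe _))
      residue := by
        rintro _ ⟨d, rfl⟩ hd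
        rw [hγ]
        exact hres c hcμ i d ((B.valuation_le_one_iff _).2 hd)
      valuation_η := by
        rw [← map_pow, hη, map_mul,
          B.valuation_natCast_eq_one hpB ((Nat.coprime_primes hp hr).2 hpr.ne), mul_one] }
  refine ⟨i, hi, γ, η, γ₀, r, ⟨?_, hu0, fun y hy => ?_, ?_⟩, hdiv⟩
  · obtain ⟨y₁, hy₁, hy₁'⟩ := exists_isIntegral_of_dvd (Ω := Ω) hcr
    obtain ⟨y₂, hy₂, hy₂'⟩ := exists_isIntegral_of_dvd (Ω := Ω) hγ₀
    obtain ⟨a, b, ha, hb, hab⟩ := hco.exists_isIntegral_algebraMap (Ω := Ω)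
    obtain ⟨a', b', ha', hb', hab'⟩ := hco'.exists_isIntegral_algebraMap (Ω := Ω)
    refine ⟨hψ, isIntegral_algebraMap_coe c, isIntegral_algebraMap_coe (u ^ i),
      by simpa using isIntegral_algebraMap_coe (Ω := Ω) (p : 𝓞 F),
      by simpa using isIntegral_algebraMap_coe (Ω := Ω) (r : 𝓞 F),
      isIntegral_algebraMap_coe γ₀, ?_, Nat.cast_ne_zero.2 hr.ne_zero, ?_, hη,
      ⟨y₁, hy₁, ?_⟩, ⟨y₂, hy₂, ?_⟩, ⟨a, b, ha, hb, ?_⟩, ⟨a', b', ha', hb', ?_⟩⟩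
    · rw [_root_.map_ne_zero]
      exact RingOfIntegers.coe_ne_zero_iff.2 hc0
    · rw [hγ]
      simp
    · rw [hη, ← hy₁']
      simp
    · rw [hγ]
      simpa using hy₂'
    · simpa using hab
    · simpa using hab'
  · refine hdiv.det_ne_zero (fun i j => (le_sup_left : ratRange F Ω ≤ _)
      (algebraMap_mem_ratRange Ω _)) fun h => hy ?_
    ext i j
    exact (algebraMap F Ω).injective (by simpa using congrFun (congrFun h i) j)
  · have h1 : (1 : ℝ) ≤ p * r := by
      exact_mod_cast Nat.one_le_iff_ne_zero.2 (mul_ne_zero hp.ne_zero hr.ne_zero)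
    refine ⟨|(N : ℝ)|, (p * r : ℝ) ^ (ℓ⁻¹ : ℝ), hN1, Real.one_le_rpow h1 (by positivity),
      Real.rpow_inv_natCast_pow (by positivity) hℓ.out.ne_zero, fun τ => ?_⟩
    obtain ⟨h2, h3, h4⟩ := hNτ τ
    exact ⟨h2, h3, h4 i hi⟩

end datum

end

section

open NumberField IsDedekindDomain

section place

variable {k : Type*} [Field k] [NumberField k] (v : HeightOneSpectrum (𝓞 k))

lemma IsDedekindDomain.HeightOneSpectrum.exists_prime_natCast_mem :
    ∃ p : ℕ, p.Prime ∧ (p : 𝓞 k) ∈ v.asIdeal := by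
  have hmax : v.asIdeal.IsMaximal := v.isMaximal
  let : Field (𝓞 k ⧸ v.asIdeal) := Ideal.Quotient.field _
  have : Finite (𝓞 k ⧸ v.asIdeal) := Ideal.finiteQuotientOfFreeOfNeBot _ v.ne_bot
  obtain ⟨p, hp⟩ := CharP.exists (𝓞 k ⧸ v.asIdeal)
  refine ⟨p, CharP.char_is_prime (𝓞 k ⧸ v.asIdeal) p, ?_⟩
  rw [← Ideal.Quotient.eq_zero_iff_mem, map_natCast]
  exact CharP.cast_eq_zero _ p

/-- A place extends to a valuation ring of any overfield. -/
lemma IsDedekindDomain.HeightOneSpectrum.exists_valuationSubring (Ω : Type*) [Field Ω]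
    [CharZero Ω] [Algebra k Ω] : ∃ B : ValuationSubring Ω,
      (∀ x ∈ v.asIdeal, B.valuation (algebraMap k Ω x) < 1) ∧
      ∀ d : k, B.valuation (algebraMap k Ω d) ≤ 1 → v.valuation k d ≤ 1 := by
  let f : 𝓞 k →+* Ω := (algebraMap k Ω).comp (algebraMap (𝓞 k) k)
  have hf : Function.Injective f := (algebraMap k Ω).injective.comp RingOfIntegers.coe_injective
  have hbij : Function.Bijective f.rangeRestrict :=
    ⟨fun x y h => hf (congrArg Subtype.val h), f.rangeRestrict_surjective⟩
  obtain ⟨B, -, hB⟩ := Ideal.image_subset_nonunits_valuationSubring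
    (v.asIdeal.map f.rangeRestrict) (fun h => v.isPrime.ne_top (by
      rw [← Ideal.comap_map_of_bijective f.rangeRestrict hbij (I := v.asIdeal), h,
        Ideal.comap_top]))
  have h1 : ∀ x ∈ v.asIdeal, B.valuation (algebraMap k Ω x) < 1 := fun x hx =>
    (ValuationSubring.mem_nonunits_iff B).1
      (hB ⟨f.rangeRestrict x, Ideal.mem_map_of_mem _ hx, rfl⟩)
  refine ⟨B, h1, fun d hd => ?_⟩
  obtain ⟨p, hp, hpv⟩ := v.exists_prime_natCast_mem
  obtain ⟨w, hw, hwd⟩ := B.exists_heightOneSpectrum (F := k) hp.ne_zero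
    (by simpa using h1 _ hpv)
  obtain rfl : v = w := by
    refine HeightOneSpectrum.ext ?_
    exact v.isMaximal.eq_of_le w.isPrime.ne_top fun x hx => (hw x).2 (h1 x hx)
  obtain ⟨a, b, hb, hab⟩ := hwd d hd
  have hb1 : v.valuation k (b : k) = 1 :=
    le_antisymm (v.valuation_le_one b) (not_lt.1 fun h => hb ((v.valuation_lt_one_iff_mem b).1 h))
  have h2 : v.valuation k (a : k) ≤ 1 := v.valuation_le_one a
  rwa [← hab, map_mul, hb1, mul_one] at h2

end place

section integers

lemma ValuationSubring.valuation_pow_sub_pow_lt_one {Ω : Type*} [Field Ω] (B : ValuationSubring Ω)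
    {x y : Ω} (hx : B.valuation x ≤ 1) (hy : B.valuation y ≤ 1) (h : B.valuation (x - y) < 1)
    (i : ℕ) : B.valuation (x ^ i - y ^ i) < 1 := by
  obtain ⟨e, he⟩ := sub_dvd_pow_sub_pow (⟨x, (B.valuation_le_one_iff _).1 hx⟩ : B)
    ⟨y, (B.valuation_le_one_iff _).1 hy⟩ i
  have he' : x ^ i - y ^ i = (x - y) * e := congrArg Subtype.val he
  rw [he', map_mul]
  exact mul_lt_one_of_lt_of_le h ((B.valuation_le_one_iff _).2 e.2)

variable {k : Type*} [Field k] [NumberField k] (v : HeightOneSpectrum (𝓞 k))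

omit [NumberField k] in
lemma Dio₁.finset (s : Finset k) : Dio₁ (s : Set k) := by
  have h : (s : Set k) = ⋃ x ∈ s, {x} := by
    ext y
    simp
  rw [h]
  refine Dio₁.biUnion s fun x _ => ?_
  exact Dio.eq_of_mem (coord_mem_polyFun_self ()) (const_mem_polyFun x)

omit [NumberField k] in
lemma Dio₁.union {S T : Set k} (hS : Dio₁ S) (hT : Dio₁ T) : Dio₁ (S ∪ T) := Dio.union hS hT

theorem dio_valuation_le_one_of_cyclotomic {ℓ p : ℕ} [hℓ : Fact ℓ.Prime] (hp : p.Prime)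
    (hpv : (p : 𝓞 k) ∈ v.asIdeal) (hpl : p ≠ ℓ) (hk : Module.finrank ℚ k < ℓ)
    (F Ω : Type*) [Field F] [NumberField F] [IsCyclotomicExtension {ℓ} ℚ F] [Field Ω] [CharZero Ω]
    [IsAlgClosed Ω] [Algebra.IsAlgebraic ℚ Ω] [Algebra F Ω] [Algebra k Ω] :
    Dio₁ {x : k | v.valuation k x ≤ 1} := by
  classical
  obtain ⟨B, hB, hBv⟩ := v.exists_valuationSubring Ω
  have hpB : B.valuation (p : Ω) < 1 := by simpa using hB _ hpv
  have hζF := IsCyclotomicExtension.zeta_spec ℓ ℚ F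
  set ζ : 𝓞 F := hζF.toInteger with hζdef
  have hζ : IsPrimitiveRoot ζ ℓ := hζF.toInteger_isPrimitiveRoot
  have hζΩ : IsPrimitiveRoot (algebraMap F Ω (IsCyclotomicExtension.zeta ℓ ℚ F)) ℓ :=
    hζF.map_of_injective (algebraMap F Ω).injective
  set ψ : AddChar (ZMod ℓ) (𝓞 F) := AddChar.zmodChar ℓ hζ.pow_eq_one with hψdef
  have hψ : (extChar Ω ψ).IsPrimitive := by
    have : extChar Ω ψ = AddChar.zmodChar ℓ hζΩ.pow_eq_one := by
      ext a
      rw [extChar_apply, AddChar.zmodChar_apply, AddChar.zmodChar_apply, ← map_pow]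
      rfl
    rw [this]
    exact AddChar.zmodChar_primitive_of_primitive_root ℓ hζΩ
  obtain ⟨u, μ, z, s, g, hsl, hs0, hgs, ⟨M, hu⟩, H, hμ, hz1, huz, hres⟩ :=
    exists_residue_parameters B hζ hp hpl hpB
  obtain ⟨C, hC, n₀, hdat⟩ := exists_isBoundedDatum B (ratRange k Ω)
    (by rwa [finrank_ratRange]) hψ hp hpB hsl hs0 hgs hu H hμ hres
  obtain ⟨S, hSfin, hS⟩ := exists_finite_hasPattern (Ω := Ω) ψ hp.ne_zero hC
  let G : (ShortList (LatIndex ℓ F) → F) → Ω × Ω → Prop := fun t q =>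
    HasPattern (extChar Ω ψ) q.1 q.2 t ∧ IsCyclicDatum F (extChar Ω ψ) q.1 q.2 ∧
      IsLocallyDivision B (ratRange F Ω) (ratRange k Ω) p (extChar Ω ψ) q.1 q.2
  let S' := hSfin.toFinset.filter fun t => ∃ q, G t q
  have hS' : ∀ t : S', ∃ q, G t q := fun t => (Finset.mem_filter.1 t.2).2
  choose q hq using hS'
  let Q := p * ℓ * s
  have hQ : Q ≠ 0 := mul_ne_zero (mul_ne_zero hp.ne_zero hℓ.out.ne_zero) hs0
  let μΩ := algebraMap F Ω μ
  let uΩ := algebraMap F Ω u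
  let T₁ : Set k := ⋃ t ∈ S'.attach, ⋃ i ∈ Finset.range ℓ,
    cycSet k (algebraMap F Ω (IsCyclotomicExtension.zeta ℓ ℚ F)) (extChar Ω ψ) (q t).1 (q t).2
      μΩ (uΩ ^ i)
  let T₂ : Finset k := (Finset.Ioo (-n₀ : ℤ) n₀).image fun n : ℤ => ((Q : k) * n)
  refine dio_valuation_le_one_of_bounded v (T := T₁ ∪ T₂) ?_ ?_ hQ ?_
  · exact (Dio₁.biUnion _ fun t _ => Dio₁.biUnion _ fun i _ => dio₁_cycSet _ _ _ _ _ _).union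
      (Dio₁.finset T₂)
  · rintro x (hx | hx)
    · simp only [T₁, Set.mem_iUnion] at hx
      obtain ⟨t, -, i, -, y, hy0, hy⟩ := hx
      have hFK : ∀ x : F, algebraMap F Ω x ∈ ratRange F Ω ⊔ ratRange k Ω := fun x =>
        (le_sup_left : ratRange F Ω ≤ _) (algebraMap_mem_ratRange Ω x)
      have hkK : ∀ x : k, algebraMap k Ω x ∈ ratRange F Ω ⊔ ratRange k Ω := fun x =>
        (le_sup_right : ratRange k Ω ≤ _) (algebraMap_mem_ratRange Ω x)
      refine hBv x ((hq t).2.2.valuation_le_one hζΩ (algebraMap_mem_ratRange Ω _) (hkK x)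
        (B.valuation_algebraMap_coe_le_one μ) (pow_mem (algebraMap_mem_ratRange Ω (z : F)) i)
        (by rw [map_pow, hz1, one_pow]) ?_ (fun a b => ?_) hy0 hy)
      · rw [← pow_mul, mul_comm, pow_mul]
        refine B.valuation_pow_sub_pow_lt_one (B.valuation_algebraMap_coe_le_one u) ?_ huz i
        rw [map_pow]
        exact pow_le_one₀ zero_le (B.valuation_algebraMap_coe_le_one z)
      · exact sum_mem fun c _ => mul_mem (hkK _) (pow_mem (hFK _) _)
    · obtain ⟨n, -, rfl⟩ := Finset.mem_image.1 hx
      have h1 : ((Q : k) * n) = algebraMap (𝓞 k) k ((Q : 𝓞 k) * n) := by simp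
      change v.valuation k ((Q : k) * n) ≤ 1
      rw [h1]
      exact v.valuation_le_one _
  · intro n
    by_cases hn : (n₀ : ℤ) ≤ |n|
    · obtain ⟨i, hi, γ, η, γ₀, r, hbd, hloc⟩ := hdat n hn
      obtain ⟨t, htS, ht⟩ := hS γ η γ₀ _ _ r hbd
      have hcyc := hbd.isCyclicDatum hp.ne_zero
      have htS' : t ∈ S' := Finset.mem_filter.2
        ⟨hSfin.mem_toFinset.2 htS, (γ, η), ht, hcyc, hloc⟩
      left
      simp only [T₁, Set.mem_iUnion]
      refine ⟨⟨t, htS'⟩, Finset.mem_attach _ _, i, Finset.mem_range.2 hi, ?_⟩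
      refine ht.mem_cycSet hζF (hq ⟨t, htS'⟩).1 hcyc (hq ⟨t, htS'⟩).2.1 ?_
      rw [hbd.pow_γ]
      simp [μΩ, uΩ, Q]
    · right
      refine Finset.mem_coe.2 (Finset.mem_image.2 ⟨n, ?_, rfl⟩)
      rw [Finset.mem_Ioo, ← abs_lt]
      exact not_le.1 hn

/-- The valuation ring of a finite place of a number field is diophantine. -/
theorem dio_valuation_le_one : Dio₁ {x : k | v.valuation k x ≤ 1} := by
  obtain ⟨p, hp, hpv⟩ := v.exists_prime_natCast_mem
  obtain ⟨ℓ, hlt, hℓ⟩ := Nat.exists_infinite_primes (max p (Module.finrank ℚ k) + 1)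
  have := Fact.mk hℓ
  have : NeZero (ℓ : ℚ) := ⟨Nat.cast_ne_zero.2 hℓ.ne_zero⟩
  have : IsCyclotomicExtension {ℓ} ℚ (CyclotomicField ℓ ℚ) := by
    convert CyclotomicField.isCyclotomicExtension ℓ ℚ
    · rfl
    · exact Subsingleton.elim _ _
  have : NumberField (CyclotomicField ℓ ℚ) := IsCyclotomicExtension.numberField {ℓ} ℚ _
  have h1 := le_max_left p (Module.finrank ℚ k)
  have h2 := le_max_right p (Module.finrank ℚ k)
  have : Algebra.IsAlgebraic ℚ (AlgebraicClosure k) := Algebra.IsAlgebraic.trans ℚ k _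
  let : Algebra (CyclotomicField ℓ ℚ) (AlgebraicClosure k) :=
    (IsAlgClosed.lift : CyclotomicField ℓ ℚ →ₐ[ℚ] AlgebraicClosure k).toRingHom.toAlgebra
  exact dio_valuation_le_one_of_cyclotomic v (ℓ := ℓ) hp hpv (by omega) (by omega) (CyclotomicField ℓ ℚ)
    (AlgebraicClosure k)

end integers

end

/-- For a number field `k`, a nonarchimedean place `v`, and a `k`-definable subset `A` of
`k_v^n` (definable in the language of rings with parameters from `k`), the intersection
`A ∩ k^n` is diophantine over `k`. -/
theorem definable_inter_isDiophantine (k : Type*) [Field k] [NumberField k]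
    (v : HeightOneSpectrum (NumberField.RingOfIntegers k)) (n : ℕ)
    (A : Set (Fin n → v.adicCompletion k))
    (hA : @Set.Definable _ (Set.range (algebraMap k (v.adicCompletion k))) Language.ring
      (Ring.compatibleRingOfRing (v.adicCompletion k)).toStructure _ A) :
    IsDiophantine k
      ((fun (x : Fin n → k) (i : Fin n) => algebraMap k (v.adicCompletion k) (x i)) ⁻¹' A) := by
  obtain ⟨π, hπ, H⟩ := padicLike_adicCompletion v
  let := Ring.compatibleRingOfRing (v.adicCompletion k)
  exact (PowDefinable.dio hπ H (dio_valuation_le_one v)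
    (Set.Definable.powDefinable H hA)).isDiophantine
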